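/- Let g be a root-reductive Lie algebra with splitting maximal toral subalgebra h and Dynkin Borel subalgebra b ⊇ h. For λ ∈ h*, the Verma module M(λ) is a simple g-module if and only if λ is antidominant. -/

import Mathlib

noncomputable section
namespace Paper

variable (K : Type) [Field K] [IsAlgClosed K] [CharZero K]
variable (g : Type) [LieRing g] [LieAlgebra K g]

def adWeightSpace (h : LieSubalgebra K g) (α : Module.Dual K h) : Submodule K g where
  carrier := {x | ∀ H : h, ⁅(H : g), x⁆ = α H • x}
  add_mem' := by intro a b ha hb H; rw [lie_add, ha H, hb H, smul_add]
  zero_mem' := by intro H; rw [lie_zero, smul_zero]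
  smul_mem' := by intro c x hx H; rw [lie_smul, hx H, smul_comm]

def IsRootOf (h : LieSubalgebra K g) (α : Module.Dual K h) : Prop :=
  α ≠ 0 ∧ adWeightSpace K g h α ≠ ⊥

def IsToralIn (s t : LieSubalgebra K g) : Prop :=
  t ≤ s ∧ IsLieAbelian t ∧
    s.toSubmodule ≤ ⨆ α : Module.Dual K t, s.toSubmodule ⊓ adWeightSpace K g t α

def IsMaxToralIn (s t : LieSubalgebra K g) : Prop :=
  IsToralIn K g s t ∧ ∀ t' : LieSubalgebra K g, IsToralIn K g s t' → t ≤ t' → t' = t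

/-- A root-reductive Lie algebra `g` together with a splitting maximal toral subalgebra `h`
and a splitting Borel subalgebra `b ⊇ h` determined by a set `pos` of positive roots. -/
structure Setup where
  /-- the exhausting chain of finite-dimensional reductive subalgebras -/
  F : ℕ → LieSubalgebra K g
  F_mono : Monotone F
  F_exhaust : ∀ x : g, ∃ n, x ∈ F n
  F_findim : ∀ n, FiniteDimensional K (F n)
  /-- each `F n` is reductive: every abelian ideal is central -/
  F_reductive : ∀ n, ∀ I : LieIdeal K (F n), IsLieAbelian I → I ≤ LieAlgebra.center K (F n)
  /-- the nested chain of Cartan subalgebras witnessing the root inclusions -/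
  C : ℕ → LieSubalgebra K g
  C_mono : Monotone C
  C_le : ∀ n, C n ≤ F n
  C_cartan : ∀ n, (LieSubalgebra.comap (F n).incl (C n)).IsCartanSubalgebra
  /-- each inclusion `F n ↪ F (n+1)` is a root inclusion with respect to `C (n+1)`:
  every root space of `F n` relative to `C n` is a root space of `F (n+1)` -/
  C_rootIncl : ∀ n, ∀ α : Module.Dual K (C n), α ≠ 0 →
    (F n).toSubmodule ⊓ adWeightSpace K g (C n) α ≠ ⊥ →
    ∃ β : Module.Dual K (C (n + 1)),
      (F n).toSubmodule ⊓ adWeightSpace K g (C n) α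
        = (F (n + 1)).toSubmodule ⊓ adWeightSpace K g (C (n + 1)) β
  /-- the splitting maximal toral subalgebra -/
  h : LieSubalgebra K g
  h_maxToral : ∀ n, IsMaxToralIn K g (F n) (h ⊓ F n)
  /-- `g` is the direct sum of its `h`-weight spaces -/
  h_indep : iSupIndep fun α : Module.Dual K h => adWeightSpace K g h α
  h_span : (⨆ α : Module.Dual K h, adWeightSpace K g h α) = ⊤
  /-- the set `Δ⁺` of positive roots -/
  pos : Set (Module.Dual K h)
  pos_root : ∀ α ∈ pos, IsRootOf K g h α
  pos_add : ∀ α ∈ pos, ∀ β ∈ pos, IsRootOf K g h (α + β) → α + β ∈ pos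
  pos_polar : ∀ α : Module.Dual K h, IsRootOf K g h α → (α ∈ pos ↔ ¬(-α ∈ pos))
  neg_add : ∀ α β : Module.Dual K h, IsRootOf K g h α → IsRootOf K g h β →
    α ∉ pos → β ∉ pos → IsRootOf K g h (α + β) → α + β ∉ pos
  /-- the splitting Borel subalgebra -/
  b : LieSubalgebra K g
  b_eq : b.toSubmodule = h.toSubmodule ⊔ ⨆ α ∈ pos, adWeightSpace K g h α

variable {K g}

namespace Setup

variable (S : Setup K g)

/-- `h ∩ g_n`. -/
def hn (n : ℕ) : LieSubalgebra K g := S.h ⊓ S.F n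

/-- restriction of a functional on `h` to `h ∩ g_n`. -/
def resDual (n : ℕ) (lam : Module.Dual K S.h) : Module.Dual K (S.hn n) :=
  lam.comp (LieSubalgebra.inclusion (inf_le_left : S.hn n ≤ S.h)).toLinearMap

/-- the `α`-root space of `g_n` relative to `h ∩ g_n`. -/
def rootSpaceN (n : ℕ) (α : Module.Dual K (S.hn n)) : Submodule K g :=
  (S.F n).toSubmodule ⊓ adWeightSpace K g (S.hn n) α

/-- the set of `b`-positive roots of `g_n`. -/
def posRootsN (n : ℕ) : Set (Module.Dual K (S.hn n)) :=
  {α | α ≠ 0 ∧ S.rootSpaceN n α ≠ ⊥ ∧ S.rootSpaceN n α ≤ S.b.toSubmodule}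

/-- `ρ_n`, the half sum of the positive roots of `g_n` with respect to `b ∩ g_n`. -/
def rhoN (n : ℕ) : Module.Dual K (S.hn n) :=
  (2 : K)⁻¹ • ∑ᶠ α ∈ S.posRootsN n, α

/-- `α` is a simple `b`-positive root: it is positive and cannot be written as a sum of
two or more positive roots. -/
def IsSimpleRoot (α : Module.Dual K S.h) : Prop :=
  α ∈ S.pos ∧ ¬∃ s : Multiset (Module.Dual K S.h),
    2 ≤ Multiset.card s ∧ (∀ β ∈ s, β ∈ S.pos) ∧ s.sum = α

/-- `b` is a Dynkin Borel subalgebra: it is generated, as a Lie subalgebra, by `h` together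
with the simple root spaces. -/
def IsDynkin : Prop :=
  S.b = LieSubalgebra.lieSpan K g
    ((S.h : Set g) ∪ ⋃ α ∈ {α | S.IsSimpleRoot α}, (adWeightSpace K g S.h α : Set g))

/-- the partial order `≼` on `h^*`: `lam ≼ mu` iff `mu - lam` is a `ℤ≥0`-linear combination
of positive roots. -/
def wle (lam mu : Module.Dual K S.h) : Prop :=
  ∃ s : Multiset (Module.Dual K S.h), (∀ β ∈ s, β ∈ S.pos) ∧ mu - lam = s.sum

/-- `g` is locally semisimple: each `g_n` is a semisimple Lie algebra. -/
def IsLocallySemisimple : Prop := ∀ n, LieAlgebra.IsSemisimple K (S.F n)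

end Setup

/-- the universal enveloping algebra of `g`. -/
abbrev Env (K g : Type) [Field K] [LieRing g] [LieAlgebra K g] : Type :=
  UniversalEnvelopingAlgebra K g

namespace Setup

variable {K : Type} [Field K] [IsAlgClosed K] [CharZero K]
variable {g : Type} [LieRing g] [LieAlgebra K g]
variable (S : Setup K g)

/-- the nilpotent radical `n⁺ = ⨁_{α ∈ Δ⁺} g^α` of `b`, as a subspace of `g`. -/
def nplus : Submodule K g := ⨆ α ∈ S.pos, adWeightSpace K g S.h α

/-- the left ideal of `U(g)` generated by `n⁺` and the elements `H - lam(H)`, `H ∈ h`. -/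
def vermaIdeal (lam : Module.Dual K S.h) : Submodule (Env K g) (Env K g) :=
  Submodule.span (Env K g)
    ((UniversalEnvelopingAlgebra.ι K '' (S.nplus : Set g)) ∪
      Set.range fun H : S.h =>
        UniversalEnvelopingAlgebra.ι K (H : g) - algebraMap K (Env K g) (lam H))

/-- the Verma module `M(lam) = U(g)/I`. -/
abbrev Verma (lam : Module.Dual K S.h) : Type := Env K g ⧸ S.vermaIdeal lam

/-- the maximal proper submodule of the Verma module `M(lam)`,
i.e. the sum of all proper submodules. -/
def maxSub (lam : Module.Dual K S.h) : Submodule (Env K g) (S.Verma lam) :=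
  sSup {N : Submodule (Env K g) (S.Verma lam) | N ≠ ⊤}

/-- the simple module `L(lam)`, the unique simple quotient of `M(lam)`. -/
abbrev SimpleL (lam : Module.Dual K S.h) : Type := S.Verma lam ⧸ S.maxSub lam

/-- `H` is the coroot `h_α` of the root `α`:  `α(H) = 2` and `H ∈ [g^α, g^{-α}]`. -/
def IsCoroot (α : Module.Dual K S.h) (H : S.h) : Prop :=
  α H = 2 ∧ ∃ x ∈ adWeightSpace K g S.h α, ∃ y ∈ adWeightSpace K g S.h (-α),
    (H : g) = ⁅x, y⁆

/-- the dot-reflection `s_α · mu = mu - (mu + ρ)(h_α) α` associated to a root `α`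
with coroot `Hα`, relative to the half sum `ρ` of positive roots. -/
def dotReflect (ρ α : Module.Dual K S.h) (Hα : S.h) (mu : Module.Dual K S.h) :
    Module.Dual K S.h :=
  mu - ((mu + ρ) Hα) • α

/-- `ρ` is the global half sum of positive roots: its restriction to each `h ∩ g_n`
is the half sum `ρ_n` of positive roots of `g_n`. -/
def IsGlobalRho (ρ : Module.Dual K S.h) : Prop := ∀ n : ℕ, S.resDual n ρ = S.rhoN n

/-- `lam` is strongly linked to `mu` (relative to `ρ`). -/
inductive StronglyLinked (ρ : Module.Dual K S.h) :
    Module.Dual K S.h → Module.Dual K S.h → Prop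
  | refl (mu : Module.Dual K S.h) : StronglyLinked ρ mu mu
  | step {lam mu : Module.Dual K S.h} (α : Module.Dual K S.h) (Hα : S.h) :
      α ∈ S.pos → S.IsCoroot α Hα →
      S.wle (S.dotReflect ρ α Hα mu) mu →
      StronglyLinked ρ lam (S.dotReflect ρ α Hα mu) →
      StronglyLinked ρ lam mu

/-- `lam` is antidominant: `(lam + ρ)(h_α)` is not a positive integer
for any positive root `α`. -/
def IsAntidominant (ρ lam : Module.Dual K S.h) : Prop :=
  ∀ α ∈ S.pos, ∀ Hα : S.h, S.IsCoroot α Hα → ¬∃ k : ℕ, 0 < k ∧ (lam + ρ) Hα = (k : K)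

/-- `lam` is almost antidominant: `(lam + ρ)(h_α)` is a positive integer
for only finitely many positive roots `α`. -/
def IsAlmostAntidominant (ρ lam : Module.Dual K S.h) : Prop :=
  {α | α ∈ S.pos ∧ ∃ Hα : S.h, S.IsCoroot α Hα ∧
    ∃ k : ℕ, 0 < k ∧ (lam + ρ) Hα = (k : K)}.Finite

end Setup

namespace Setup

variable {K : Type} [Field K] [IsAlgClosed K] [CharZero K]
variable {g : Type} [LieRing g] [LieAlgebra K g]
variable (S : Setup K g)

/-- the reflection `s_α : mu ↦ mu - mu(h_α) α`, as a linear map on `h^*`. -/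
def reflectionMap (α : Module.Dual K S.h) (Hα : S.h) :
    Module.Dual K S.h →ₗ[K] Module.Dual K S.h where
  toFun mu := mu - mu Hα • α
  map_add' mu ν := by
    simp only [LinearMap.add_apply, add_smul]
    abel
  map_smul' c mu := by
    simp only [LinearMap.smul_apply, RingHom.id_apply, smul_sub, smul_smul, smul_eq_mul]

/-- the reflection `s_α` associated to a root `α` with coroot `Hα`,
as a linear automorphism of `h^*`. -/
def reflection (α : Module.Dual K S.h) (Hα : S.h) (h2 : α Hα = 2) :
    Module.Dual K S.h ≃ₗ[K] Module.Dual K S.h :=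
  LinearEquiv.ofInvolutive (S.reflectionMap α Hα) (by
    intro mu
    show S.reflectionMap α Hα (mu - mu Hα • α) = mu
    show (mu - mu Hα • α) - ((mu - mu Hα • α) Hα) • α = mu
    rw [LinearMap.sub_apply, LinearMap.smul_apply, h2, smul_eq_mul]
    module)

/-- the Weyl group of `g`, realized as the group of linear automorphisms of `h^*`
generated by the reflections in the roots. -/
def weylGroup : Subgroup (Module.Dual K S.h ≃ₗ[K] Module.Dual K S.h) :=
  Subgroup.closure
    {w | ∃ (α : Module.Dual K S.h) (Hα : S.h) (hc : S.IsCoroot α Hα),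
      IsRootOf K g S.h α ∧ w = S.reflection α Hα hc.1}

/-- the dot action `w · mu = w(mu + ρ) - ρ`. -/
def dotAct (ρ : Module.Dual K S.h) (w : Module.Dual K S.h ≃ₗ[K] Module.Dual K S.h)
    (mu : Module.Dual K S.h) : Module.Dual K S.h :=
  w (mu + ρ) - ρ

/-- the root lattice `Λ`, the `ℤ`-span of the roots in `h^*`. -/
def rootLattice : Submodule ℤ (Module.Dual K S.h) :=
  Submodule.span ℤ {α : Module.Dual K S.h | IsRootOf K g S.h α}

end Setup

end Paper

set_option linter.unusedSectionVars false

namespace PBW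

open Module

@[elab_as_elim]
lemma basis_induction {R M ι : Type*} [Semiring R] [AddCommMonoid M] [Module R M]
    (b : Basis ι R M) {P : M → Prop} (x : M) (zero : P 0) (add : ∀ x y, P x → P y → P (x + y))
    (smul : ∀ (c : R) x, P x → P (c • x)) (basis : ∀ i, P (b i)) : P x := by
  have hx : x ∈ Submodule.span R (Set.range b) := b.span_eq ▸ Submodule.mem_top
  induction hx using Submodule.span_induction with
  | mem x h => obtain ⟨i, rfl⟩ := h; exact basis i
  | zero => exact zero
  | add x y _ _ hx hy => exact add x y hx hy
  | smul c x _ hx => exact smul c x hx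

lemma map_mem_of_repr {R M V ι : Type*} [Semiring R] [AddCommMonoid M] [Module R M]
    [AddCommMonoid V] [Module R V] (b : Basis ι R M) (φ : M →ₗ[R] V) (N : Submodule R V) {x : M}
    (h : ∀ k, b.repr x k ≠ 0 → φ (b k) ∈ N) : φ x ∈ N := by
  rw [← b.linearCombination_repr x, Finsupp.linearCombination_apply, Finsupp.sum, map_sum]
  refine sum_mem fun k hk => ?_
  rw [map_smul]
  exact N.smul_mem _ (h k (Finsupp.mem_support_iff.1 hk))

section Action

variable {K L J : Type*} [Field K] [LieRing L] [LieAlgebra K L] [LinearOrder J]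

/-- The monomial attached to a multiset. -/
noncomputable abbrev mono (K : Type*) {J : Type*} [Field K] (M : Multiset J) : Multiset J →₀ K :=
  Finsupp.single M 1

/-- Combinations of monomials of degree at most `n`. -/
noncomputable abbrev degLE (K J : Type*) [Field K] (n : ℕ) : Submodule K (Multiset J →₀ K) :=
  Finsupp.supported K K {M : Multiset J | Multiset.card M ≤ n}

lemma mono_mem_degLE {M : Multiset J} {n : ℕ} (h : Multiset.card M ≤ n) :
    mono K M ∈ degLE K J n :=
  Finsupp.single_mem_supported K 1 h

lemma degLE_mono {m n : ℕ} (h : m ≤ n) : degLE K J m ≤ degLE K J n :=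
  Finsupp.supported_mono fun _ hM => le_trans hM h

lemma degLE_induction {n : ℕ} {N : Submodule K (Multiset J →₀ K)}
    (h : ∀ M : Multiset J, Multiset.card M ≤ n → mono K M ∈ N) : degLE K J n ≤ N := by
  rw [degLE, Finsupp.supported_eq_span_single, Submodule.span_le]
  rintro _ ⟨M, hM, rfl⟩
  exact h M hM

lemma degLE_induction_map {n : ℕ} {V : Type*} [AddCommGroup V] [Module K V]
    {N : Submodule K V} (f : (Multiset J →₀ K) →ₗ[K] V)
    (h : ∀ M : Multiset J, Multiset.card M ≤ n → f (mono K M) ∈ N) {p : Multiset J →₀ K}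
    (hp : p ∈ degLE K J n) : f p ∈ N :=
  degLE_induction (N := N.comap f) h hp

lemma exists_min_cons {M : Multiset J} (hM : M ≠ 0) :
    ∃ j N, M = j ::ₘ N ∧ ∀ k ∈ N, j ≤ k := by
  classical
  obtain ⟨j, hj, hmin⟩ := M.toFinset.exists_min_image id
    ⟨_, Multiset.mem_toFinset.2 (Multiset.exists_mem_of_ne_zero hM).choose_spec⟩
  refine ⟨j, M.erase j, (Multiset.cons_erase (Multiset.mem_toFinset.1 hj)).symm, fun k hk => ?_⟩
  exact hmin k (Multiset.mem_toFinset.2 (Multiset.mem_of_mem_erase hk))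

variable (b : Basis J K L)

/-- The bilinear map with prescribed values on basis elements and monomials. -/
noncomputable def ofTable (T : J → Multiset J → Multiset J →₀ K) :
    L →ₗ[K] (Multiset J →₀ K) →ₗ[K] (Multiset J →₀ K) :=
  b.constr K fun i => Finsupp.linearCombination K (T i)

@[simp] lemma ofTable_apply (T : J → Multiset J → Multiset J →₀ K) (i : J) (M : Multiset J) :
    ofTable b T (b i) (mono K M) = T i M := by
  simp [ofTable, mono]

/-- Approximations to the action of the basis elements on monomials. -/
noncomputable def table : ℕ → J → Multiset J → Multiset J →₀ K
  | 0, i, M => mono K (i ::ₘ M)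
  | n + 1, i, M =>
    match M.sort (· ≤ ·) with
    | [] => mono K (i ::ₘ M)
    | j :: l =>
      if i ≤ j then mono K (i ::ₘ M)
      else mono K (i ::ₘ M) +
        ofTable b (table n) (b j) (ofTable b (table n) (b i) (mono K (l : Multiset J))
          - mono K (i ::ₘ (l : Multiset J))) +
        ofTable b (table n) ⁅b i, b j⁆ (mono K (l : Multiset J))

lemma table_of_le (n : ℕ) {i : J} {M : Multiset J} (h : ∀ j ∈ M, i ≤ j) :
    table b n i M = mono K (i ::ₘ M) := by
  cases n with
  | zero => rfl
  | succ n =>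
    rcases eq_or_ne M 0 with rfl | hM
    · simp [table]
    · obtain ⟨j, N, rfl, hj⟩ := exists_min_cons hM
      simp [table, Multiset.sort_cons (r := (· ≤ ·)) j N hj, h j (Multiset.mem_cons_self _ _)]

lemma table_cons_of_lt (n : ℕ) {i j : J} {N : Multiset J} (hj : ∀ k ∈ N, j ≤ k) (h : j < i) :
    table b (n + 1) i (j ::ₘ N) = mono K (i ::ₘ j ::ₘ N) +
        ofTable b (table b n) (b j) (ofTable b (table b n) (b i) (mono K N)
          - mono K (i ::ₘ N)) +
        ofTable b (table b n) ⁅b i, b j⁆ (mono K N) := by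
  simp [table, Multiset.sort_cons (r := (· ≤ ·)) j N hj, not_le.2 h]

lemma ofTable_mem {T : J → Multiset J → Multiset J →₀ K}
    (hT : ∀ i M, T i M - mono K (i ::ₘ M) ∈ degLE K J (Multiset.card M)) (x : L) {n : ℕ}
    {p : Multiset J →₀ K} (hp : p ∈ degLE K J n) : ofTable b T x p ∈ degLE K J (n + 1) := by
  refine degLE_induction_map (ofTable b T x) (fun M hM => ?_) hp
  induction x using basis_induction b with
  | zero => simp
  | add x y hx hy => rw [map_add]; exact add_mem hx hy
  | smul c x hx => rw [map_smul]; exact Submodule.smul_mem _ _ hx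
  | basis i =>
    rw [ofTable_apply, ← sub_add_cancel (T i M) (mono K (i ::ₘ M))]
    exact add_mem (degLE_mono (by omega) (hT i M)) (mono_mem_degLE (by simpa using hM))

lemma table_sub_mem (n : ℕ) (i : J) (M : Multiset J) :
    table b n i M - mono K (i ::ₘ M) ∈ degLE K J (Multiset.card M) := by
  induction n generalizing i M with
  | zero => simp [table]
  | succ n ih =>
    by_cases h : ∀ j ∈ M, i ≤ j
    · simp [table_of_le b _ h]
    · have hM : M ≠ 0 := by rintro rfl; simp at h
      obtain ⟨j, N, rfl, hj⟩ := exists_min_cons hM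
      have hji : j < i := by
        by_contra hij
        refine h fun k hk => ?_
        rcases Multiset.mem_cons.1 hk with rfl | hk
        · exact not_lt.1 hij
        · exact (not_lt.1 hij).trans (hj k hk)
      rw [table_cons_of_lt b n hj hji, add_assoc, add_sub_cancel_left, Multiset.card_cons]
      refine add_mem (ofTable_mem b ih _ ?_) (ofTable_mem b ih _ (mono_mem_degLE le_rfl))
      rw [ofTable_apply]
      exact ih i N

lemma ofTable_congr {T T' : J → Multiset J → Multiset J →₀ K} {n : ℕ}
    (h : ∀ i M, Multiset.card M ≤ n → T i M = T' i M) (x : L)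
    {p : Multiset J →₀ K} (hp : p ∈ degLE K J n) : ofTable b T x p = ofTable b T' x p := by
  rw [← sub_eq_zero, ← LinearMap.sub_apply, ← Submodule.mem_bot K]
  refine degLE_induction_map _ (fun M hM => ?_) hp
  rw [Submodule.mem_bot, LinearMap.sub_apply, sub_eq_zero]
  induction x using basis_induction b with
  | zero => simp
  | add x y hx hy => simp only [map_add, LinearMap.add_apply, hx, hy]
  | smul c x hx => simp only [map_smul, LinearMap.smul_apply, hx]
  | basis i => simp only [ofTable_apply, h i M hM]

lemma table_succ (n : ℕ) (i : J) (M : Multiset J) (hn : Multiset.card M ≤ n) :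
    table b (n + 1) i M = table b n i M := by
  induction n generalizing i M with
  | zero => 
    obtain rfl : M = 0 := by simpa using hn
    simp [table]
  | succ n ih =>
    by_cases h : ∀ j ∈ M, i ≤ j
    · simp only [table_of_le b _ h]
    · have hM : M ≠ 0 := by rintro rfl; simp at h
      obtain ⟨j, N, rfl, hj⟩ := exists_min_cons hM
      have hji : j < i := by
        by_contra hij
        refine h fun k hk => ?_
        rcases Multiset.mem_cons.1 hk with rfl | hk
        · exact not_lt.1 hij
        · exact (not_lt.1 hij).trans (hj k hk)
      have hN : Multiset.card N ≤ n := by simpa using hn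
      have key : ∀ x : L, ∀ p ∈ degLE K J n,
          ofTable b (table b (n + 1)) x p = ofTable b (table b n) x p :=
        fun x p hp => ofTable_congr b ih x hp
      rw [table_cons_of_lt b n hj hji, table_cons_of_lt b (n + 1) hj hji,
        key _ (mono K N) (mono_mem_degLE hN), key _ (mono K N) (mono_mem_degLE hN), key]
      rw [ofTable_apply]
      exact degLE_mono hN (table_sub_mem b n i N)

lemma table_eq (n : ℕ) (i : J) (M : Multiset J) (hn : Multiset.card M ≤ n) :
    table b n i M = table b (Multiset.card M) i M := by
  induction n, hn using Nat.le_induction with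
  | base => rfl
  | succ n hn ih => rw [table_succ b n i M hn, ih]

/-- The action of `L` on polynomials underlying the Poincaré–Birkhoff–Witt theorem. -/
noncomputable def act : L →ₗ[K] (Multiset J →₀ K) →ₗ[K] (Multiset J →₀ K) :=
  ofTable b fun i M => table b (Multiset.card M) i M

lemma act_eq (n : ℕ) (x : L) {p : Multiset J →₀ K} (hp : p ∈ degLE K J n) :
    act b x p = ofTable b (table b n) x p :=
  ofTable_congr b (fun i M hM => (table_eq b n i M hM).symm) x hp

lemma act_of_le {i : J} {M : Multiset J} (h : ∀ j ∈ M, i ≤ j) :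
    act b (b i) (mono K M) = mono K (i ::ₘ M) := by
  rw [act, ofTable_apply, table_of_le b _ h]

lemma act_sub_mem (i : J) (M : Multiset J) :
    act b (b i) (mono K M) - mono K (i ::ₘ M) ∈ degLE K J (Multiset.card M) := by
  rw [act, ofTable_apply]
  exact table_sub_mem b _ i M

lemma act_mem (x : L) {n : ℕ} {p : Multiset J →₀ K} (hp : p ∈ degLE K J n) :
    act b x p ∈ degLE K J (n + 1) :=
  ofTable_mem b (fun i M => table_sub_mem b _ i M) x hp

lemma act_comm_of_lt {i j : J} {N : Multiset J} (hj : ∀ k ∈ N, j ≤ k) (h : j < i) :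
    act b (b i) (act b (b j) (mono K N)) =
      act b (b j) (act b (b i) (mono K N)) + act b ⁅b i, b j⁆ (mono K N) := by
  have hN := mono_mem_degLE (K := K) (le_refl (Multiset.card N))
  have h1 : act b (b j) (mono K (i ::ₘ N)) = mono K (i ::ₘ j ::ₘ N) := by
    rw [act_of_le b, Multiset.cons_swap]
    intro k hk
    rcases Multiset.mem_cons.1 hk with rfl | hk
    exacts [h.le, hj k hk]
  rw [act_of_le b hj]
  conv_lhs => rw [act, ofTable_apply, Multiset.card_cons, table_cons_of_lt b _ hj h]
  rw [← act_eq b _ _ hN, ← act_eq b _ _ hN, ← act_eq b _ _ (act_sub_mem b i N), map_sub, h1]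
  abel

lemma act_comm_basis (N : Multiset J) (i j : J) :
    act b (b i) (act b (b j) (mono K N)) =
      act b (b j) (act b (b i) (mono K N)) + act b ⁅b i, b j⁆ (mono K N) := by
  induction hn : Multiset.card N using Nat.strong_induction_on generalizing N i j with
  | _ n ih =>
  have key : ∀ {m : ℕ}, m < n → ∀ x y : L, ∀ p ∈ degLE K J m,
      act b x (act b y p) = act b y (act b x p) + act b ⁅x, y⁆ p := by
    intro m hm x y p hp
    have := degLE_induction_map (N := ⊥)
      (act b x ∘ₗ act b y - act b y ∘ₗ act b x - act b ⁅x, y⁆) (n := m) (fun M hM => ?_) hp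
    · rw [Submodule.mem_bot, LinearMap.sub_apply, LinearMap.sub_apply, sub_sub, sub_eq_zero] at this
      exact this
    · rw [Submodule.mem_bot, LinearMap.sub_apply, LinearMap.sub_apply, sub_sub, sub_eq_zero]
      simp only [LinearMap.comp_apply]
      induction x using basis_induction b with
      | zero => simp
      | add x x' hx hx' =>
        simp only [map_add, LinearMap.add_apply, hx, hx', add_lie]; abel
      | smul c x hx => simp only [map_smul, LinearMap.smul_apply, hx, smul_lie, smul_add]
      | basis i =>
        induction y using basis_induction b with
        | zero => simp
        | add x x' hx hx' =>
          simp only [map_add, LinearMap.add_apply, hx, hx', lie_add]; abel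
        | smul c x hx => simp only [map_smul, LinearMap.smul_apply, hx, lie_smul, smul_add]
        | basis j => exact ih _ (lt_of_le_of_lt hM hm) M i j rfl
  wlog hij : j < i generalizing i j
  · rcases (not_lt.1 hij).lt_or_eq with h | rfl
    · have := this j i h
      rw [this, ← lie_skew, map_neg, LinearMap.neg_apply]; abel
    · simp
  by_cases hj : ∀ k ∈ N, j ≤ k
  · exact act_comm_of_lt b hj hij
  have hN : N ≠ 0 := by rintro rfl; simp at hj
  obtain ⟨k, P, rfl, hk⟩ := exists_min_cons hN
  have hkj : k < j := by
    by_contra hjk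
    refine hj fun l hl => ?_
    rcases Multiset.mem_cons.1 hl with rfl | hl
    exacts [not_lt.1 hjk, (not_lt.1 hjk).trans (hk l hl)]
  rw [Multiset.card_cons] at hn
  have hlt : Multiset.card P < n := by omega
  have hP := mono_mem_degLE (K := K) (le_refl (Multiset.card P))
  -- moving the minimal letter past two others
  have move : ∀ i j : J, k < i → k < j → act b (b i) (act b (b k) (act b (b j) (mono K P))) =
      act b (b k) (act b (b i) (act b (b j) (mono K P))) +
        act b ⁅b i, b k⁆ (act b (b j) (mono K P)) := by
    intro i j hi hj
    obtain ⟨w, hw, hw'⟩ : ∃ w ∈ degLE K J (Multiset.card P),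
        act b (b j) (mono K P) = mono K (j ::ₘ P) + w :=
      ⟨_, act_sub_mem b j P, by abel⟩
    rw [hw']
    have h1 := act_comm_of_lt b (i := i) (j := k) (N := j ::ₘ P) (by
      intro l hl
      rcases Multiset.mem_cons.1 hl with rfl | hl
      exacts [hj.le, hk l hl]) hi
    have h2 := key hlt (b i) (b k) w hw
    simp only [map_add, h1, h2]
    abel
  have e1 : ∀ i j : J, k < i → k < j → act b (b i) (act b (b j) (act b (b k) (mono K P))) =
      act b (b k) (act b (b i) (act b (b j) (mono K P))) +
        act b ⁅b i, b k⁆ (act b (b j) (mono K P)) +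
        act b ⁅b j, b k⁆ (act b (b i) (mono K P)) + act b ⁅b i, ⁅b j, b k⁆⁆ (mono K P) := by
    intro i j hi hj
    rw [act_comm_of_lt b hk hj, map_add, move i j hi hj, key hlt (b i) ⁅b j, b k⁆ _ hP]
    abel
  rw [← act_of_le b hk, e1 i j (hkj.trans hij) hkj, e1 j i hkj (hkj.trans hij),
    ih _ hlt P i j rfl, map_add, key hlt ⁅b i, b j⁆ (b k) _ hP, leibniz_lie (b i) (b j) (b k)]
  simp only [map_add, LinearMap.add_apply]
  abel

lemma act_lie (x y : L) (p : Multiset J →₀ K) :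
    act b ⁅x, y⁆ p = act b x (act b y p) - act b y (act b x p) := by
  rw [eq_sub_iff_add_eq']
  symm
  induction x using basis_induction b with
  | zero => simp
  | add x x' hx hx' => simp only [map_add, LinearMap.add_apply, hx, hx', add_lie]; abel
  | smul c x hx => simp only [map_smul, LinearMap.smul_apply, hx, smul_lie, smul_add]
  | basis i =>
    induction y using basis_induction b with
    | zero => simp
    | add x x' hx hx' => simp only [map_add, LinearMap.add_apply, hx, hx', lie_add]; abel
    | smul c x hx => simp only [map_smul, LinearMap.smul_apply, hx, lie_smul, smul_add]
    | basis j =>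
      induction p using Finsupp.induction_linear with
      | zero => simp
      | add p q hp hq => simp only [map_add, hp, hq]; abel
      | single M c =>
        rw [← mul_one c, ← smul_eq_mul, ← Finsupp.smul_single]
        rw [map_smul, map_smul, map_smul, map_smul, map_smul, act_comm_basis, smul_add]

end Action

section Enveloping

attribute [local instance] LieRing.ofAssociativeRing

open UniversalEnvelopingAlgebra

lemma enveloping_induction {K L : Type*} [Field K] [LieRing L] [LieAlgebra K L]
    {P : UniversalEnvelopingAlgebra K L → Prop} (u : UniversalEnvelopingAlgebra K L)
    (algebraMap : ∀ c, P (algebraMap K _ c)) (gen : ∀ x, P (ι K x))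
    (mul : ∀ u v, P u → P v → P (u * v)) (add : ∀ u v, P u → P v → P (u + v)) : P u := by
  have hs : Function.Surjective (mkAlgHom K L) := RingCon.mk'_surjective _
  obtain ⟨t, rfl⟩ := hs u
  induction t using TensorAlgebra.induction with
  | algebraMap r => simpa using algebraMap r
  | ι x => exact gen x
  | mul a b ha hb => simpa using mul _ _ ha hb
  | add a b ha hb => simpa using add _ _ ha hb

variable {K L J : Type*} [Field K] [LieRing L] [LieAlgebra K L] [LinearOrder J]
variable (b : Basis J K L)

/-- The action of the enveloping algebra on polynomials. -/
noncomputable def actHom : UniversalEnvelopingAlgebra K L →ₐ[K] Module.End K (Multiset J →₀ K) :=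
  lift K { act b with
    map_lie' := by
      intro x y
      refine LinearMap.ext fun p => ?_
      simp only [AddHom.toFun_eq_coe, LinearMap.coe_toAddHom, LieRing.of_associative_ring_bracket]
      exact act_lie b x y p }

@[simp] lemma actHom_ι (x : L) : actHom b (ι K x) = act b x :=
  lift_ι_apply K _ x

/-- The product of the generators along a list. -/
noncomputable def listProd (l : List J) : UniversalEnvelopingAlgebra K L :=
  (l.map fun j => ι K (b j)).prod

@[simp] lemma listProd_nil : listProd b [] = 1 := rfl

@[simp] lemma listProd_cons (j : J) (l : List J) :
    listProd b (j :: l) = ι K (b j) * listProd b l := by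
  simp [listProd]

@[simp] lemma listProd_append (l m : List J) :
    listProd b (l ++ m) = listProd b l * listProd b m := by
  simp [listProd]

/-- The ordered monomial attached to a multiset. -/
noncomputable def ordMono (M : Multiset J) : UniversalEnvelopingAlgebra K L :=
  listProd b (M.sort (· ≤ ·))

@[simp] lemma ordMono_zero : ordMono b 0 = 1 := by simp [ordMono]

lemma ordMono_cons {j : J} {M : Multiset J} (h : ∀ k ∈ M, j ≤ k) :
    ordMono b (j ::ₘ M) = ι K (b j) * ordMono b M := by
  rw [ordMono, Multiset.sort_cons (r := (· ≤ ·)) j M h, listProd_cons, ordMono]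

lemma ordMono_singleton (j : J) : ordMono b {j} = ι K (b j) := by
  simp [ordMono]

lemma listProd_of_sorted {l : List J} (h : l.Pairwise (· ≤ ·)) :
    listProd b l = ordMono b (l : Multiset J) := by
  induction l with
  | nil => simp
  | cons j l ih =>
    rw [List.pairwise_cons] at h
    rw [listProd_cons, ih h.2, ← Multiset.cons_coe, ordMono_cons b (by simpa using h.1)]

lemma ordMono_add {M N : Multiset J} (h : ∀ i ∈ M, ∀ j ∈ N, i ≤ j) :
    ordMono b (M + N) = ordMono b M * ordMono b N := by
  induction hn : Multiset.card M generalizing M with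
  | zero => 
    obtain rfl : M = 0 := by simpa using hn
    simp
  | succ n ih =>
    obtain ⟨j, P, rfl, hj⟩ := exists_min_cons (M := M) (by rintro rfl; simp at hn)
    rw [Multiset.cons_add, ordMono_cons, ordMono_cons b hj, ih, mul_assoc]
    · exact fun i hi k hk => h i (Multiset.mem_cons_of_mem hi) k hk
    · simpa using hn
    · intro k hk
      rcases Multiset.mem_add.1 hk with hk | hk
      exacts [hj k hk, h j (Multiset.mem_cons_self _ _) k hk]

lemma actHom_ordMono (M : Multiset J) : actHom b (ordMono b M) (mono K 0) = mono K M := by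
  induction hn : Multiset.card M generalizing M with
  | zero => 
    obtain rfl : M = 0 := by simpa using hn
    simp
  | succ n ih =>
    obtain ⟨j, P, rfl, hj⟩ := exists_min_cons (M := M) (by rintro rfl; simp at hn)
    rw [ordMono_cons b hj, map_mul, Module.End.mul_apply, ih P (by simpa using hn), actHom_ι,
      act_of_le b hj]

section Straightening

variable {P : Set (Multiset J)}
  (hP : ∀ i j M, i ::ₘ j ::ₘ M ∈ P → ∀ k, b.repr ⁅b i, b j⁆ k ≠ 0 → k ::ₘ M ∈ P)

include hP in
lemma listProd_perm {l m : List J} (h : l.Perm m) (p : List J)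
    (hl : ((p ++ l : List J) : Multiset J) ∈ P) :
    listProd b (p ++ l) - listProd b (p ++ m) ∈
      Submodule.span K (listProd b '' {q | (q : Multiset J) ∈ P ∧ q.length < (p ++ l).length}) := by
  induction h generalizing p with
  | nil => simp
  | cons a h ih =>
    have := ih (p ++ [a]) (by simpa using hl)
    simpa using this
  | swap i j l =>
    have e : listProd b (p ++ j :: i :: l) - listProd b (p ++ i :: j :: l) =
        listProd b p * ι K ⁅b j, b i⁆ * listProd b l := by
      simp only [listProd_append, listProd_cons, LieHom.map_lie,
        LieRing.of_associative_ring_bracket]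
      noncomm_ring
    rw [e]
    refine map_mem_of_repr b ((LinearMap.mulRight K (listProd b l)) ∘ₗ
      (LinearMap.mulLeft K (listProd b p)) ∘ₗ (ι K : L →ₗ⁅K⁆ _).toLinearMap) _ fun k hk => ?_
    refine Submodule.subset_span ⟨p ++ k :: l, ⟨?_, by simp⟩, by simp [mul_assoc]⟩
    have := hP j i ((p ++ l : List J) : Multiset J) (by
      convert hl using 1
      rw [Multiset.cons_coe, Multiset.cons_coe, Multiset.coe_eq_coe]
      exact ((List.perm_middle.trans (List.Perm.cons _ List.perm_middle))).symm) k hk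
    rwa [Multiset.cons_coe, ← Multiset.coe_eq_coe.2 List.perm_middle] at this
  | trans h₁ h₂ ih₁ ih₂ =>
    have h2 := ih₂ p (by
      rwa [← Multiset.coe_eq_coe.2 (List.Perm.append_left p h₁)])
    have := add_mem (ih₁ p hl) (by
      rwa [← (List.Perm.append_left p h₁).length_eq] at h2)
    simpa using this

include hP in
/-- Straightening: a product whose letters form a multiset in a set `P` stable under replacing
two letters by a letter of their bracket is a combination of ordered monomials in `P`. -/
theorem listProd_mem (l : List J) (hl : (l : Multiset J) ∈ P) :
    listProd b l ∈ Submodule.span K (ordMono b '' P) := by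
  induction hn : l.length using Nat.strong_induction_on generalizing l with
  | _ n ih =>
  have h1 := listProd_perm b hP (p := []) (List.mergeSort_perm l (· ≤ ·)).symm hl
  have h2 : listProd b (l.mergeSort (· ≤ ·)) ∈ Submodule.span K (ordMono b '' P) := by
    rw [listProd_of_sorted b (by simpa using List.pairwise_mergeSort' (· ≤ ·) l)]
    exact Submodule.subset_span ⟨_, by
      rwa [Multiset.coe_eq_coe.2 (List.mergeSort_perm l (· ≤ ·))], rfl⟩
  have h3 : listProd b l - listProd b (l.mergeSort (· ≤ ·)) ∈
      Submodule.span K (ordMono b '' P) := by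
    refine Submodule.span_le.2 ?_ h1
    rintro _ ⟨q, ⟨hq, hq'⟩, rfl⟩
    exact ih _ (by simpa [hn] using hq') q hq rfl
  simpa using add_mem h3 h2

end Straightening

lemma span_listProd : Submodule.span K (Set.range (listProd b)) = ⊤ := by
  rw [eq_top_iff]
  rintro u -
  suffices H : ∀ w ∈ Submodule.span K (Set.range (listProd b)),
      u * w ∈ Submodule.span K (Set.range (listProd b)) by
    simpa using H 1 (Submodule.subset_span ⟨[], rfl⟩)
  induction u using enveloping_induction with
  | algebraMap c =>
    intro w hw
    rw [← Algebra.smul_def]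
    exact Submodule.smul_mem _ _ hw
  | gen x =>
    intro w hw
    refine map_mem_of_repr b (LinearMap.mulRight K w ∘ₗ (ι K : L →ₗ⁅K⁆ _).toLinearMap) _
      fun k _ => ?_
    change ι K (b k) * w ∈ _
    induction hw using Submodule.span_induction with
    | mem w h => obtain ⟨l, rfl⟩ := h; exact Submodule.subset_span ⟨k :: l, by simp⟩
    | zero => simp
    | add x y _ _ hx hy => rw [mul_add]; exact add_mem hx hy
    | smul c x _ hx => rw [mul_smul_comm]; exact Submodule.smul_mem _ _ hx
  | mul u v hu hv => intro w hw; rw [mul_assoc]; exact hu _ (hv _ hw)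
  | add u v hu hv => intro w hw; rw [add_mul]; exact add_mem (hu _ hw) (hv _ hw)

/-- The Poincaré–Birkhoff–Witt basis of ordered monomials. -/
noncomputable def pbw : Basis (Multiset J) K (UniversalEnvelopingAlgebra K L) :=
  Basis.mk (v := ordMono b)
    (by
      refine LinearIndependent.of_comp ((actHom b).toLinearMap.flip (mono K 0)) ?_
      convert (Finsupp.basisSingleOne (R := K) (ι := Multiset J)).linearIndependent using 1
      ext1 M
      simpa using actHom_ordMono b M)
    (by
      rw [← span_listProd b, Submodule.span_le]
      rintro _ ⟨l, rfl⟩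
      have := listProd_mem b (P := Set.univ) (by simp) l (by trivial)
      rwa [Set.image_univ] at this)

@[simp] lemma pbw_apply (M : Multiset J) : pbw b M = ordMono b M := by
  simp [pbw]

lemma pbw_repr_ordMono (M : Multiset J) : (pbw b).repr (ordMono b M) = mono K M := by
  rw [← pbw_apply, Basis.repr_self]

lemma pbw_repr (u : UniversalEnvelopingAlgebra K L) :
    (pbw b).repr u = actHom b u (mono K 0) := by
  have : ((pbw b).repr : _ →ₗ[K] _) = (actHom b).toLinearMap.flip (mono K 0) := by
    refine (pbw b).ext fun M => ?_
    have := actHom_ordMono b M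
    simpa [pbw_repr_ordMono] using this.symm
  exact LinearMap.congr_fun this u

lemma pbw_repr_mul (u v : UniversalEnvelopingAlgebra K L) :
    (pbw b).repr (u * v) = actHom b u ((pbw b).repr v) := by
  simp [pbw_repr]

lemma listProd_sub_mem (l : List J) (N : Multiset J) :
    actHom b (listProd b l) (mono K N) - mono K ((l : Multiset J) + N) ∈
      Finsupp.supported K K {Q | Multiset.card Q < l.length + Multiset.card N} := by
  induction l with
  | nil => simp
  | cons i l ih =>
    rw [listProd_cons, map_mul, Module.End.mul_apply, actHom_ι,
      ← sub_add_cancel (actHom b (listProd b l) (mono K N)) (mono K ((l : Multiset J) + N)),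
      map_add, add_sub_assoc]
    have e : {Q : Multiset J | Multiset.card Q < (i :: l).length + Multiset.card N} =
        {Q | Multiset.card Q ≤ l.length + Multiset.card N} := by
      ext Q; simp only [Set.mem_ofPred_eq, List.length_cons]; omega
    rw [e, ← Multiset.cons_coe, Multiset.cons_add]
    refine add_mem ?_ ?_
    · rcases Nat.eq_zero_or_pos (l.length + Multiset.card N) with h0 | h0
      · have : actHom b (listProd b l) (mono K N) - mono K ((l : Multiset J) + N) = 0 := by
          simpa [h0] using ih
        rw [this, map_zero]
        exact zero_mem _
      · obtain ⟨d, hd⟩ := Nat.exists_eq_succ_of_ne_zero h0.ne'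
        rw [hd] at ih ⊢
        refine act_mem b _ (n := d) ?_
        simpa [Nat.lt_succ_iff] using ih
    · simpa using act_sub_mem b i ((l : Multiset J) + N)

lemma actHom_ordMono_apply (M N Q : Multiset J)
    (h : Multiset.card M + Multiset.card N ≤ Multiset.card Q) :
    actHom b (ordMono b M) (mono K N) Q = mono K (M + N) Q := by
  rw [← sub_eq_zero, ← Finsupp.sub_apply]
  by_contra hne
  have := (Finsupp.mem_supported K _).1 (listProd_sub_mem b (M.sort (· ≤ ·)) N)
  simp only [Multiset.sort_eq] at this
  have := this (Finset.mem_coe.2 (Finsupp.mem_support_iff.2 hne))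
  simp only [Set.mem_ofPred_eq, Multiset.length_sort] at this
  omega

instance uniqueSums_multiset : UniqueSums (Multiset J) :=
  UniqueSums.of_injective_addHom (Multiset.toFinsupp : Multiset J ≃+ (J →₀ ℕ)).toAddMonoidHom.toAddHom
    (Multiset.toFinsupp : Multiset J ≃+ (J →₀ ℕ)).injective inferInstance

include b in
theorem pbw_mul_ne_zero {u v : UniversalEnvelopingAlgebra K L} (hu : u ≠ 0) (hv : v ≠ 0) :
    u * v ≠ 0 := by
  classical
  obtain ⟨q, rfl⟩ : ∃ q, (pbw b).repr.symm q = u := ⟨_, (pbw b).repr.symm_apply_apply u⟩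
  obtain ⟨p, rfl⟩ : ∃ p, (pbw b).repr.symm p = v := ⟨_, (pbw b).repr.symm_apply_apply v⟩
  replace hu : q.support.Nonempty := by
    rw [Finsupp.support_nonempty_iff]; rintro rfl; simp at hu
  replace hv : p.support.Nonempty := by
    rw [Finsupp.support_nonempty_iff]; rintro rfl; simp at hv
  obtain ⟨M₁, hM₁, hM₁'⟩ := q.support.exists_max_image Multiset.card hu
  obtain ⟨N₁, hN₁, hN₁'⟩ := p.support.exists_max_image Multiset.card hv
  obtain ⟨M₀, hM₀, N₀, hN₀, huniq⟩ := UniqueSums.uniqueAdd_of_nonempty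
    (A := q.support.filter fun M => Multiset.card M = Multiset.card M₁)
    (B := p.support.filter fun N => Multiset.card N = Multiset.card N₁)
    ⟨M₁, by simpa using hM₁⟩ ⟨N₁, by simpa using hN₁⟩
  rw [Finset.mem_filter] at hM₀ hN₀
  have key : (pbw b).repr ((pbw b).repr.symm q * (pbw b).repr.symm p) (M₀ + N₀) =
      q M₀ * p N₀ := by
    rw [pbw_repr_mul, LinearEquiv.apply_symm_apply]
    simp only [Basis.repr_symm_apply, Finsupp.linearCombination_apply, Finsupp.sum, map_sum,
      map_smul, pbw_apply, LinearMap.sum_apply, LinearMap.smul_apply, Finsupp.finsetSum_apply,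
      Finsupp.smul_apply]
    conv_lhs =>
      enter [2, M]
      rw [← p.sum_single, Finsupp.sum, map_sum, Finsupp.finsetSum_apply]
    have h1 : ∀ M ∈ q.support, ∀ N ∈ p.support,
        actHom b (ordMono b M) (Finsupp.single N (p N)) (M₀ + N₀) =
          if M = M₀ ∧ N = N₀ then p N₀ else 0 := by
      intro M hM N hN
      have hMc := hM₁' M hM
      have hNc := hN₁' N hN
      rw [← mul_one (p N), ← smul_eq_mul, ← Finsupp.smul_single, map_smul, Finsupp.smul_apply,
        actHom_ordMono_apply b M N _ (by rw [Multiset.card_add]; omega), Finsupp.single_apply]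
      by_cases h : M + N = M₀ + N₀
      · have hc := congrArg Multiset.card h
        simp only [Multiset.card_add] at hc
        obtain ⟨rfl, rfl⟩ := huniq (Finset.mem_filter.2 ⟨hM, by omega⟩)
          (Finset.mem_filter.2 ⟨hN, by omega⟩) h
        simp
      · rw [if_neg h, if_neg (fun ⟨h₁, h₂⟩ => h (by rw [h₁, h₂])), smul_zero]
    rw [Finset.sum_congr rfl fun M hM => by
      rw [Finset.sum_congr rfl fun N hN => h1 M hM N hN]]
    rw [Finset.sum_eq_single_of_mem M₀ hM₀.1, Finset.sum_eq_single_of_mem N₀ hN₀.1]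
    · simp
    · intro N _ hN
      simp [hN]
    · intro M _ hM
      simp [hM]
  intro h0
  rw [h0, map_zero, Finsupp.zero_apply] at key
  exact mul_ne_zero (Finsupp.mem_support_iff.1 hM₀.1) (Finsupp.mem_support_iff.1 hN₀.1) key.symm

end Enveloping

end PBW

namespace VermaTheory

open Module PBW UniversalEnvelopingAlgebra

/-- Letters: negative root vectors, toral elements, positive root vectors. -/
inductive Letter (I κ : Type*)
  | f : I → Letter I κ
  | H : κ → Letter I κ
  | e : I → Letter I κ

namespace Letter

variable {I κ : Type*}

/-- The embedding of letters in a lexicographic sum. -/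
def toSum : Letter I κ → I ⊕ₗ (κ ⊕ₗ I)
  | f i => toLex (Sum.inl i)
  | H k => toLex (Sum.inr (toLex (Sum.inl k)))
  | e i => toLex (Sum.inr (toLex (Sum.inr i)))

lemma toSum_injective : Function.Injective (toSum : Letter I κ → _) := by
  rintro (i | i | i) (j | j | j) h <;> simp_all [toSum]

noncomputable instance [LinearOrder I] [LinearOrder κ] : LinearOrder (Letter I κ) :=
  LinearOrder.lift' toSum toSum_injective

variable [LinearOrder I] [LinearOrder κ]

lemma f_le_H (i : I) (k : κ) : (f i : Letter I κ) ≤ H k := Sum.Lex.inl_le_inr _ _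

lemma f_le_e (i j : I) : (f i : Letter I κ) ≤ e j := Sum.Lex.inl_le_inr _ _

lemma H_le_e (k : κ) (i : I) : (H k : Letter I κ) ≤ e i :=
  Sum.Lex.inr_le_inr_iff.2 (Sum.Lex.inl_le_inr _ _)

lemma f_le_f {i j : I} : (f i : Letter I κ) ≤ f j ↔ i ≤ j := Sum.Lex.inl_le_inl_iff

/-- The index of a negative root vector. -/
def fIdx : Letter I κ → Option I
  | f i => some i
  | _ => none

/-- The index of a toral letter. -/
def HIdx : Letter I κ → Option κ
  | H i => some i
  | _ => none

/-- The index of a positive root vector. -/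
def eIdx : Letter I κ → Option I
  | e i => some i
  | _ => none

lemma split (M : Multiset (Letter I κ)) :
    M = (M.filterMap fIdx).map f + ((M.filterMap HIdx).map H + (M.filterMap eIdx).map e) := by
  induction M using Multiset.induction_on with
  | empty => simp
  | cons a M ih =>
    conv_lhs => rw [ih]
    rcases a with i | i | i
    · rw [Multiset.filterMap_cons_some (f := fIdx) (f i) M rfl,
        Multiset.filterMap_cons_none (f := HIdx) (f i) M rfl,
        Multiset.filterMap_cons_none (f := eIdx) (f i) M rfl]
      simp
    · rw [Multiset.filterMap_cons_none (f := fIdx) (H i) M rfl,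
        Multiset.filterMap_cons_some (f := HIdx) (H i) M rfl,
        Multiset.filterMap_cons_none (f := eIdx) (H i) M rfl]
      simp
    · rw [Multiset.filterMap_cons_none (f := fIdx) (e i) M rfl,
        Multiset.filterMap_cons_none (f := HIdx) (e i) M rfl,
        Multiset.filterMap_cons_some (f := eIdx) (e i) M rfl]
      simp

lemma filterMap_none {α β : Type*} (M : Multiset α) :
    M.filterMap (fun _ => (none : Option β)) = 0 := by
  induction M using Multiset.induction_on with
  | empty => rfl
  | cons a M ih => rw [Multiset.filterMap_cons_none _ _ rfl, ih]

lemma exists_split (M : Multiset (Letter I κ)) :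
    ∃ (F : Multiset I) (C : Multiset κ) (E : Multiset I), M = F.map f + (C.map H + E.map e) :=
  ⟨_, _, _, split M⟩

@[simp] lemma filterMap_fIdx (F : Multiset I) (C : Multiset κ) (E : Multiset I) :
    (F.map f + (C.map H + E.map e)).filterMap fIdx = F := by
  rw [Multiset.filterMap_add, Multiset.filterMap_add, Multiset.filterMap_map,
    Multiset.filterMap_map, Multiset.filterMap_map]
  simp [Function.comp_def, fIdx, filterMap_none]

@[simp] lemma filterMap_HIdx (F : Multiset I) (C : Multiset κ) (E : Multiset I) :
    (F.map f + (C.map H + E.map e)).filterMap HIdx = C := by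
  rw [Multiset.filterMap_add, Multiset.filterMap_add, Multiset.filterMap_map,
    Multiset.filterMap_map, Multiset.filterMap_map]
  simp [Function.comp_def, HIdx, filterMap_none]

@[simp] lemma filterMap_eIdx (F : Multiset I) (C : Multiset κ) (E : Multiset I) :
    (F.map f + (C.map H + E.map e)).filterMap eIdx = E := by
  rw [Multiset.filterMap_add, Multiset.filterMap_add, Multiset.filterMap_map,
    Multiset.filterMap_map, Multiset.filterMap_map]
  simp [Function.comp_def, eIdx, filterMap_none]

end Letter

open Letter

/-- The weight of a letter. -/
def lwt {K I κ V : Type*} [Field K] [AddCommGroup V] [Module K V] (wt : I → Dual K V) :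
    Letter I κ → Dual K V
  | f i => -wt i
  | H _ => 0
  | e i => wt i

/-- A Lie algebra with a triangular basis: toral subalgebra `h`, root vectors `e i`, `f i`
indexed by the positive roots `wt i`. -/
structure Tri (K g I κ : Type*) [Field K] [LieRing g] [LieAlgebra K g] where
  /-- the toral subalgebra -/
  h : LieSubalgebra K g
  /-- a basis of `h` -/
  hb : Basis κ K h
  /-- a basis of `g` -/
  b : Basis (Letter I κ) K g
  b_H : ∀ k, b (.H k) = hb k
  /-- the positive roots -/
  wt : I → Dual K h
  lie_b : ∀ (x : h) (l : Letter I κ), ⁅(x : g), b l⁆ = lwt wt l x • b l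
  wt_inj : Function.Injective wt
  wt_sum_ne : ∀ s : Multiset I, s ≠ 0 → (s.map wt).sum ≠ 0
  /-- the coroots -/
  t : I → h
  lie_ef : ∀ i, ⁅b (.e i), b (.f i)⁆ = t i
  wt_t : ∀ i, wt i (t i) = 2

namespace Tri

variable {K g I κ : Type*} [Field K] [LieRing g] [LieAlgebra K g] (T : Tri K g I κ)

lemma repr_lie (x : T.h) (y : g) (l : Letter I κ) :
    T.b.repr ⁅(x : g), y⁆ l = lwt T.wt l x * T.b.repr y l := by
  induction y using basis_induction T.b with
  | zero => simp
  | add y z hy hz => simp [lie_add, hy, hz, mul_add]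
  | smul c y hy => simp [lie_smul, hy, mul_left_comm]
  | basis m =>
    rw [T.lie_b]
    by_cases h : m = l
    · subst h; simp
    · simp [h]

lemma lwt_of_repr_ne_zero {μ : Dual K T.h} {y : g} (hy : ∀ x : T.h, ⁅(x : g), y⁆ = μ x • y)
    {l : Letter I κ} (hl : T.b.repr y l ≠ 0) : lwt T.wt l = μ := by
  ext x
  have := T.repr_lie x y l
  rw [hy, map_smul, Finsupp.smul_apply, smul_eq_mul] at this
  exact (mul_right_cancel₀ hl this).symm

lemma lwt_of_repr_lie {i j l : Letter I κ} (hl : T.b.repr ⁅T.b i, T.b j⁆ l ≠ 0) :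
    lwt T.wt l = lwt T.wt i + lwt T.wt j := by
  refine T.lwt_of_repr_ne_zero (fun x => ?_) hl
  rw [leibniz_lie, T.lie_b, T.lie_b, smul_lie, lie_smul, LinearMap.add_apply, add_smul]

lemma wt_add_ne (i j : I) : T.wt i + T.wt j ≠ 0 := by
  simpa using T.wt_sum_ne {i, j} (by simp)

lemma wt_ne (i : I) : T.wt i ≠ 0 := by
  simpa using T.wt_sum_ne {i} (by simp)

lemma wt_add_add_ne (i j k : I) : T.wt i + T.wt j + T.wt k ≠ 0 := by
  simpa [add_assoc] using T.wt_sum_ne {i, j, k} (by simp)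

lemma eq_e_of_lwt {l : Letter I κ} {i : I} (h : lwt T.wt l = T.wt i) : l = .e i := by
  rcases l with j | j | j
  · exact absurd (by simp [← h, lwt]) (T.wt_add_ne i j)
  · exact absurd h.symm (T.wt_ne i)
  · rw [T.wt_inj h]

lemma exists_e_of_lwt_add {l : Letter I κ} {i j : I} (h : lwt T.wt l = T.wt i + T.wt j) :
    ∃ k, l = .e k := by
  rcases l with k | k | k
  · exact absurd (by simp [← h, lwt]) (T.wt_add_add_ne i j k)
  · exact absurd h.symm (T.wt_add_ne i j)
  · exact ⟨k, rfl⟩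

lemma exists_f_of_lwt_add {l : Letter I κ} {i j : I} (h : lwt T.wt l = -T.wt i + -T.wt j) :
    ∃ k, l = .f k := by
  rcases l with k | k | k
  · exact ⟨k, rfl⟩
  · exact absurd (by rw [← neg_eq_zero, neg_add, ← h]; rfl) (T.wt_add_ne i j)
  · exact absurd (by simp [lwt] at h; rw [h]; abel) (T.wt_add_add_ne i j k)

lemma lie_H_H (k l : κ) : ⁅T.b (.H k), T.b (.H l)⁆ = 0 := by
  rw [T.b_H k, T.lie_b]; simp [lwt]

variable [LinearOrder I] [LinearOrder κ]

/-- Multisets without negative letters but with some positive letter. -/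
def raising (I κ : Type*) : Set (Multiset (Letter I κ)) :=
  {N | (∀ l ∈ N, ∀ i, l ≠ .f i) ∧ ∃ i, .e i ∈ N}

lemma raising_closed (i j : Letter I κ) (M : Multiset (Letter I κ))
    (h : i ::ₘ j ::ₘ M ∈ raising I κ) (k : Letter I κ) (hk : T.b.repr ⁅T.b i, T.b j⁆ k ≠ 0) :
    k ::ₘ M ∈ raising I κ := by
  obtain ⟨h1, a, ha⟩ := h
  have hw := T.lwt_of_repr_lie hk
  have hM : ∀ l ∈ M, ∀ i, l ≠ .f i := fun l hl => h1 l (by simp [hl])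
  have mem : ∀ k', .e k' ∈ k ::ₘ M → (∀ n, k ≠ .f n) → k ::ₘ M ∈ raising I κ := fun k' hk' hk =>
    ⟨fun l hl => by rcases Multiset.mem_cons.1 hl with rfl | hl; exacts [hk, hM l hl], k', hk'⟩
  rcases i with i | i | i
  · exact absurd rfl (h1 (.f i) (by simp) i)
  · rcases j with j | j | j
    · exact absurd rfl (h1 (.f j) (by simp) j)
    · rw [T.lie_H_H] at hk; simp at hk
    · obtain rfl := T.eq_e_of_lwt (i := j) (by simpa [lwt] using hw)
      exact mem j (by simp) (by simp)
  · rcases j with j | j | j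
    · exact absurd rfl (h1 (.f j) (by simp) j)
    · obtain rfl := T.eq_e_of_lwt (i := i) (by simpa [lwt] using hw)
      exact mem i (by simp) (by simp)
    · obtain ⟨n, rfl⟩ := T.exists_e_of_lwt_add hw
      exact mem n (by simp) (by simp)

section Proj

variable {R : Type*} [CommRing R] [Algebra K R] (a : T.h →ₗ[K] R)

open Classical in
/-- The image of a monomial in the Verma module with highest weight `a`. -/
noncomputable def projMono (M : Multiset (Letter I κ)) : Multiset I →₀ R :=
  if M.filterMap eIdx = 0 then
    Finsupp.single (M.filterMap fIdx) (((M.filterMap HIdx).map fun k => a (T.hb k)).prod)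
  else 0

/-- Coordinates of `u v`, where `v` is a highest weight vector of weight `a`. -/
noncomputable def proj : UniversalEnvelopingAlgebra K g →ₗ[K] (Multiset I →₀ R) :=
  (pbw T.b).constr K (T.projMono a)

lemma proj_ordMono (M : Multiset (Letter I κ)) :
    T.proj a (ordMono T.b M) = T.projMono a M := by
  rw [← pbw_apply, proj, Basis.constr_basis]

lemma projMono_zero (F : Multiset I) (C : Multiset κ) :
    T.projMono a (F.map f + C.map .H) =
      Finsupp.single F ((C.map fun k => a (T.hb k)).prod) := by
  have h1 := filterMap_fIdx F C (0 : Multiset I)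
  have h2 := filterMap_HIdx F C (0 : Multiset I)
  have h3 := filterMap_eIdx F C (0 : Multiset I)
  rw [Multiset.map_zero, add_zero] at h1 h2 h3
  rw [projMono, if_pos h3, h1, h2]

lemma projMono_of_mem_e {M : Multiset (Letter I κ)} {i : I} (h : .e i ∈ M) :
    T.projMono a M = 0 := by
  rw [projMono, if_neg]
  intro h0
  have : i ∈ M.filterMap eIdx := (Multiset.mem_filterMap _ _).2 ⟨_, h, rfl⟩
  simp [h0] at this

lemma f_le_of_raising (F : Multiset I) {N : Multiset (Letter I κ)}
    (hN : ∀ l ∈ N, ∀ i, l ≠ .f i) : ∀ i ∈ F.map f, ∀ j ∈ N, i ≤ j := by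
  intro i hi j hj
  obtain ⟨i, -, rfl⟩ := Multiset.mem_map.1 hi
  rcases j with j | j | j
  · exact absurd rfl (hN _ hj j)
  · exact f_le_H _ _
  · exact f_le_e _ _

lemma not_f_mem (C : Multiset κ) (E : Multiset I) :
    ∀ l ∈ (C.map .H + E.map .e : Multiset (Letter I κ)), ∀ i, l ≠ .f i := by
  intro l hl i
  rcases Multiset.mem_add.1 hl with hl | hl
  all_goals obtain ⟨k, -, rfl⟩ := Multiset.mem_map.1 hl; simp

lemma ordMono_split (F : Multiset I) (C : Multiset κ) (E : Multiset I) :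
    ordMono T.b (F.map f + (C.map .H + E.map .e)) =
      ordMono T.b (F.map f) * ordMono T.b (C.map .H + E.map .e) :=
  ordMono_add T.b (f_le_of_raising F (not_f_mem C E))

lemma proj_mul_raising (F : Multiset I) {w : UniversalEnvelopingAlgebra K g}
    (hw : w ∈ Submodule.span K (ordMono T.b '' raising I κ)) :
    T.proj a (ordMono T.b (F.map f) * w) = 0 := by
  induction hw using Submodule.span_induction with
  | mem w h =>
    obtain ⟨N, ⟨hN, i, hi⟩, rfl⟩ := h
    rw [← ordMono_add T.b (f_le_of_raising F hN), proj_ordMono,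
      T.projMono_of_mem_e a (i := i) (Multiset.mem_add.2 (.inr hi))]
  | zero => simp
  | add x y _ _ hx hy => rw [mul_add, map_add, hx, hy, add_zero]
  | smul c x _ hx => rw [mul_smul_comm, map_smul, hx, smul_zero]

lemma ordMono_mul_ι_mem {M : Multiset (Letter I κ)} {l : Letter I κ}
    (h : l ::ₘ M ∈ raising I κ) :
    ordMono T.b M * ι K (T.b l) ∈ Submodule.span K (ordMono T.b '' raising I κ) := by
  have := listProd_mem T.b T.raising_closed (M.sort (· ≤ ·) ++ [l]) (by
    rw [← Multiset.coe_add, Multiset.sort_eq, Multiset.coe_singleton, add_comm,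
      Multiset.singleton_add]
    exact h)
  simpa [ordMono] using this

lemma proj_mul_e (u : UniversalEnvelopingAlgebra K g) (i : I) :
    T.proj a (u * ι K (T.b (.e i))) = 0 := by
  induction u using basis_induction (pbw T.b) with
  | zero => simp
  | add x y hx hy => rw [add_mul, map_add, hx, hy, add_zero]
  | smul c x hx => rw [smul_mul_assoc, map_smul, hx, smul_zero]
  | basis M =>
    obtain ⟨F, C, E, rfl⟩ := exists_split M
    rw [pbw_apply, ordMono_split, mul_assoc]
    refine T.proj_mul_raising a F (T.ordMono_mul_ι_mem ⟨?_, i, by simp⟩)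
    intro l hl j
    rcases Multiset.mem_cons.1 hl with rfl | hl
    exacts [by simp, not_f_mem C E l hl j]

lemma ordMono_H_mul (C : Multiset κ) (k : κ) :
    ordMono T.b (C.map .H) * ι K (T.b (.H k)) = ordMono T.b ((k ::ₘ C).map .H) := by
  have h := listProd_perm T.b (P := {((k ::ₘ C).map .H : Multiset (Letter I κ))})
    (l := (C.map .H).sort (· ≤ ·) ++ [.H k]) (m := ((k ::ₘ C).map .H).sort (· ≤ ·)) ?_ ?_ []  ?_
  · have e : {q : List (Letter I κ) | (q : Multiset (Letter I κ)) ∈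
        ({((k ::ₘ C).map .H : Multiset (Letter I κ))} : Set _) ∧
        q.length < ([] ++ ((C.map .H).sort (· ≤ ·) ++ [.H k]) : List (Letter I κ)).length} = ∅ := by
      ext q
      simp only [Set.mem_singleton_iff, Set.mem_ofPred_eq, Set.mem_empty_iff_false, iff_false]
      rintro ⟨h1, h2⟩
      have := congrArg Multiset.card h1
      simp at this h2
      omega
    rw [e] at h
    simp only [Set.image_empty, Submodule.span_empty, Submodule.mem_bot, sub_eq_zero] at h
    simpa [ordMono] using h
  · intro i j M hM n hn
    have hmem : ∀ l ∈ i ::ₘ j ::ₘ M, ∃ k, l = .H k := by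
      rw [Set.mem_singleton_iff.1 hM]
      intro l hl
      obtain ⟨k, -, rfl⟩ := Multiset.mem_map.1 hl
      exact ⟨k, rfl⟩
    obtain ⟨x, rfl⟩ := hmem i (by simp)
    obtain ⟨y, rfl⟩ := hmem j (by simp)
    rw [T.lie_H_H] at hn
    simp at hn
  · rw [← Multiset.coe_eq_coe, ← Multiset.coe_add, Multiset.sort_eq, Multiset.sort_eq,
      Multiset.coe_singleton, add_comm, Multiset.singleton_add, Multiset.map_cons]
  · rw [List.nil_append, Set.mem_singleton_iff, ← Multiset.coe_add, Multiset.sort_eq,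
      Multiset.coe_singleton, add_comm, Multiset.singleton_add, Multiset.map_cons]

lemma proj_mul_H (u : UniversalEnvelopingAlgebra K g) (x : T.h) :
    T.proj a (u * ι K (x : g)) = a x • T.proj a u := by
  induction x using basis_induction T.hb with
  | zero => simp
  | add x y hx hy =>
    rw [AddMemClass.coe_add, map_add, mul_add, map_add, hx, hy, map_add, add_smul]
  | smul c x hx =>
    rw [SetLike.val_smul, map_smul, mul_smul_comm, map_smul, hx, map_smul, smul_assoc]
  | basis k =>
  induction u using basis_induction (pbw T.b) with
  | zero => simp
  | add x y hx hy => rw [add_mul, map_add, hx, hy, map_add, smul_add]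
  | smul c x hx => rw [smul_mul_assoc, map_smul, hx, map_smul, smul_comm]
  | basis M =>
    obtain ⟨F, C, E, rfl⟩ := exists_split M
    rw [pbw_apply, ← T.b_H]
    rcases eq_or_ne E 0 with rfl | hE
    · rw [ordMono_split, mul_assoc, Multiset.map_zero, add_zero, ordMono_H_mul,
        ← ordMono_add, ← ordMono_add, proj_ordMono, proj_ordMono, projMono_zero, projMono_zero,
        Finsupp.smul_single, Multiset.map_cons, Multiset.prod_cons, smul_eq_mul]
      · exact f_le_of_raising F (by simpa only [Multiset.map_zero, add_zero] using not_f_mem C (0 : Multiset I))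
      · exact f_le_of_raising F (by simpa only [Multiset.map_zero, add_zero] using not_f_mem (k ::ₘ C) (0 : Multiset I))
    · obtain ⟨i, hi⟩ := Multiset.exists_mem_of_ne_zero hE
      have hi' : (.e i : Letter I κ) ∈ F.map f + (C.map .H + E.map .e) := by
        simp only [Multiset.mem_add]
        exact .inr (.inr (Multiset.mem_map_of_mem _ hi))
      rw [proj_ordMono, T.projMono_of_mem_e a hi', smul_zero, ordMono_split, mul_assoc]
      refine T.proj_mul_raising a F (T.ordMono_mul_ι_mem ⟨?_, i, ?_⟩)
      · intro l hl j
        rcases Multiset.mem_cons.1 hl with rfl | hl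
        exacts [by simp, not_f_mem C E l hl j]
      · rw [Multiset.mem_cons, Multiset.mem_add]
        exact .inr (.inr (Multiset.mem_map_of_mem _ hi))

end Proj

end Tri

end VermaTheory

namespace VermaTheory

open Module PBW UniversalEnvelopingAlgebra Letter

attribute [local instance] LieRing.ofAssociativeRing

namespace Tri

variable {K g I κ : Type*} [Field K] [LieRing g] [LieAlgebra K g] (T : Tri K g I κ)
variable [LinearOrder I] [LinearOrder κ]

/-- The ordered monomial in the negative root vectors. -/
noncomputable def neg (π : Multiset I) : UniversalEnvelopingAlgebra K g :=
  ordMono T.b (π.map .f)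

@[simp] lemma neg_zero : T.neg 0 = 1 := by simp [neg]

lemma neg_cons {i : I} {π : Multiset I} (h : ∀ j ∈ π, i ≤ j) :
    T.neg (i ::ₘ π) = ι K (T.b (.f i)) * T.neg π := by
  rw [neg, Multiset.map_cons, ordMono_cons, neg]
  intro k hk
  obtain ⟨j, hj, rfl⟩ := Multiset.mem_map.1 hk
  exact f_le_f.2 (h j hj)

/-- The sum of the roots of a multiset. -/
def mwt (π : Multiset I) : Dual K T.h := (π.map T.wt).sum

@[simp] lemma mwt_zero : T.mwt 0 = 0 := rfl

@[simp] lemma mwt_cons (i : I) (π : Multiset I) : T.mwt (i ::ₘ π) = T.wt i + T.mwt π := by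
  simp [mwt]

@[simp] lemma mwt_add (π σ : Multiset I) : T.mwt (π + σ) = T.mwt π + T.mwt σ := by
  simp [mwt]

@[simp] lemma mwt_nsmul (n : ℕ) (π : Multiset I) : T.mwt (n • π) = n • T.mwt π := by
  simp [mwt, Multiset.map_nsmul, Multiset.sum_nsmul]

@[simp] lemma mwt_singleton (i : I) : T.mwt {i} = T.wt i := by
  simp [mwt]

lemma mwt_ne_zero {π : Multiset I} (h : π ≠ 0) : T.mwt π ≠ 0 := T.wt_sum_ne π h

/-- The subspace of the enveloping algebra of weight `μ`. -/
noncomputable def wtU (μ : Dual K T.h) : Submodule K (UniversalEnvelopingAlgebra K g) :=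
  Submodule.span K (ordMono T.b '' {M | (M.map (lwt T.wt)).sum = μ})

lemma listProd_mem_wtU (l : List (Letter I κ)) {μ : Dual K T.h}
    (h : (l.map (lwt T.wt)).sum = μ) : listProd T.b l ∈ T.wtU μ := by
  refine listProd_mem T.b (fun i j M hM k hk => ?_) l (by simpa using h)
  have := T.lwt_of_repr_lie hk
  simp only [Set.mem_ofPred_eq, Multiset.map_cons, Multiset.sum_cons] at hM ⊢
  rw [this, add_assoc, hM]

lemma ordMono_mem_wtU (M : Multiset (Letter I κ)) {μ : Dual K T.h}
    (h : (M.map (lwt T.wt)).sum = μ) : ordMono T.b M ∈ T.wtU μ :=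
  Submodule.subset_span ⟨M, h, rfl⟩

lemma ι_mem_wtU (l : Letter I κ) : ι K (T.b l) ∈ T.wtU (lwt T.wt l) := by
  rw [← ordMono_singleton]
  exact T.ordMono_mem_wtU _ (by simp)

lemma mul_mem_wtU {μ ν : Dual K T.h} {u v : UniversalEnvelopingAlgebra K g}
    (hu : u ∈ T.wtU μ) (hv : v ∈ T.wtU ν) : u * v ∈ T.wtU (μ + ν) := by
  induction hu using Submodule.span_induction with
  | mem u h =>
    obtain ⟨M, hM, rfl⟩ := h
    induction hv using Submodule.span_induction with
    | mem v h =>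
      obtain ⟨N, hN, rfl⟩ := h
      have := T.listProd_mem_wtU (M.sort (· ≤ ·) ++ N.sort (· ≤ ·)) (μ := μ + ν) (by
        rw [← hM, ← hN, List.map_append, List.sum_append, ← Multiset.sum_coe, ← Multiset.map_coe,
          Multiset.sort_eq, ← Multiset.sum_coe, ← Multiset.map_coe, Multiset.sort_eq])
      simpa [ordMono] using this
    | zero => simp
    | add x y _ _ hx hy => rw [mul_add]; exact add_mem hx hy
    | smul c x _ hx => rw [mul_smul_comm]; exact Submodule.smul_mem _ _ hx
  | zero => simp
  | add x y _ _ hx hy => rw [add_mul]; exact add_mem hx hy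
  | smul c x _ hx => rw [smul_mul_assoc]; exact Submodule.smul_mem _ _ hx

lemma pow_mem_wtU {μ : Dual K T.h} {u : UniversalEnvelopingAlgebra K g}
    (hu : u ∈ T.wtU μ) (n : ℕ) : u ^ n ∈ T.wtU (n • μ) := by
  induction n with
  | zero => simpa using T.ordMono_mem_wtU 0 (by simp)
  | succ n ih => rw [pow_succ, succ_nsmul]; exact T.mul_mem_wtU ih hu

lemma neg_mem_wtU (π : Multiset I) : T.neg π ∈ T.wtU (-T.mwt π) := by
  refine T.ordMono_mem_wtU _ ?_
  induction π using Multiset.induction_on with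
  | empty => simp
  | cons i π ih => 
    rw [Multiset.map_cons, Multiset.map_cons, Multiset.sum_cons, ih, mwt_cons, neg_add]
    rfl

lemma ι_mul_listProd (x : T.h) (l : List (Letter I κ)) :
    ι K (x : g) * listProd T.b l =
      listProd T.b l * ι K (x : g) + ((l.map (lwt T.wt)).sum x) • listProd T.b l := by
  induction l with
  | nil => simp
  | cons i l ih =>
    have h : ι K (x : g) * ι K (T.b i) =
        ι K (T.b i) * ι K (x : g) + lwt T.wt i x • ι K (T.b i) := by
      rw [← map_smul, ← T.lie_b, LieHom.map_lie, LieRing.of_associative_ring_bracket]; abel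
    rw [listProd_cons, ← mul_assoc, h, add_mul, mul_assoc, ih, List.map_cons, List.sum_cons,
      LinearMap.add_apply, add_smul, mul_add, mul_smul_comm, smul_mul_assoc, mul_assoc]
    abel

lemma ι_mul_of_mem_wtU (x : T.h) {μ : Dual K T.h} {u : UniversalEnvelopingAlgebra K g}
    (hu : u ∈ T.wtU μ) : ι K (x : g) * u = u * ι K (x : g) + μ x • u := by
  induction hu using Submodule.span_induction with
  | mem u h =>
    obtain ⟨M, hM, rfl⟩ := h
    have := T.ι_mul_listProd x (M.sort (· ≤ ·))
    rwa [← Multiset.sum_coe, ← Multiset.map_coe, Multiset.sort_eq, hM] at this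
  | zero => simp
  | add x y _ _ hx hy => rw [mul_add, hx, hy, add_mul, smul_add]; abel
  | smul c x _ hx => rw [mul_smul_comm, hx, smul_mul_assoc, smul_add, smul_comm]

lemma exists_max_cons {J : Type*} [LinearOrder J] {M : Multiset J} (hM : M ≠ 0) :
    ∃ j N, M = j ::ₘ N ∧ ∀ k ∈ N, k ≤ j :=
  exists_min_cons (J := Jᵒᵈ) hM

section Action

variable {R : Type*} [CommRing R] [Algebra K R] (a : T.h →ₗ[K] R)

lemma proj_neg (π : Multiset I) : T.proj a (T.neg π) = Finsupp.single π 1 := by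
  have := T.projMono_zero a π 0
  rw [neg, proj_ordMono]
  simpa using this

lemma proj_mul_ordMono_H (u : UniversalEnvelopingAlgebra K g) (C : Multiset κ) :
    T.proj a (u * ordMono T.b (C.map .H)) = ((C.map fun k => a (T.hb k)).prod) • T.proj a u := by
  induction C using Multiset.induction_on with
  | empty => simp
  | cons k C ih =>
    rw [← ordMono_H_mul, ← mul_assoc, T.b_H, proj_mul_H, ih, Multiset.map_cons,
      Multiset.prod_cons, mul_smul]

lemma proj_mul_ordMono_of_e (u : UniversalEnvelopingAlgebra K g) (F : Multiset I)
    (C : Multiset κ) {E : Multiset I} (hE : E ≠ 0) :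
    T.proj a (u * ordMono T.b (F.map f + (C.map .H + E.map .e))) = 0 := by
  obtain ⟨i, E, rfl, hi⟩ := exists_max_cons hE
  have : (F.map f + (C.map .H + (i ::ₘ E).map .e) : Multiset (Letter I κ)) =
      (F.map f + (C.map .H + E.map .e)) + {.e i} := by
    rw [Multiset.map_cons, ← Multiset.singleton_add, add_comm {_}, add_assoc, add_assoc]
  rw [this, ordMono_add, ordMono_singleton, ← mul_assoc, proj_mul_e]
  intro l hl j hj
  obtain rfl := Multiset.mem_singleton.1 hj
  rcases Multiset.mem_add.1 hl with hl | hl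
  · obtain ⟨k, -, rfl⟩ := Multiset.mem_map.1 hl; exact f_le_e _ _
  rcases Multiset.mem_add.1 hl with hl | hl
  · obtain ⟨k, -, rfl⟩ := Multiset.mem_map.1 hl; exact H_le_e _ _
  · obtain ⟨k, hk, rfl⟩ := Multiset.mem_map.1 hl
    exact Sum.Lex.inr_le_inr_iff.2 (Sum.Lex.inr_le_inr_iff.2 (hi k hk))

/-- The action of the enveloping algebra on the Verma module in coordinates. -/
noncomputable def vact (u : UniversalEnvelopingAlgebra K g) :
    (Multiset I →₀ R) →ₗ[R] (Multiset I →₀ R) :=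
  Finsupp.linearCombination R fun π => T.proj a (u * T.neg π)

@[simp] lemma vact_single (u : UniversalEnvelopingAlgebra K g) (π : Multiset I) (r : R) :
    T.vact a u (Finsupp.single π r) = r • T.proj a (u * T.neg π) := by
  simp [vact]

lemma proj_mul (u w : UniversalEnvelopingAlgebra K g) :
    T.proj a (u * w) = T.vact a u (T.proj a w) := by
  induction w using basis_induction (pbw T.b) with
  | zero => simp
  | add x y hx hy => rw [mul_add, map_add, hx, hy, map_add, map_add]
  | smul c x hx =>
    rw [mul_smul_comm, map_smul, map_smul, hx, LinearMap.map_smul_of_tower]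
  | basis M =>
    obtain ⟨F, C, E, rfl⟩ := exists_split M
    rw [pbw_apply]
    rcases eq_or_ne E 0 with rfl | hE
    · rw [ordMono_split, ← mul_assoc, Multiset.map_zero, add_zero, proj_mul_ordMono_H,
        proj_mul_ordMono_H, map_smul]
      change _ • T.proj a (u * T.neg F) = _ • T.vact a u (T.proj a (T.neg F))
      rw [proj_neg, vact_single, one_smul]
    · have := T.proj_mul_ordMono_of_e a 1 F C hE
      rw [one_mul] at this
      rw [this, map_zero, T.proj_mul_ordMono_of_e a u F C hE]

lemma vact_mul (u w : UniversalEnvelopingAlgebra K g) (p : Multiset I →₀ R) :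
    T.vact a (u * w) p = T.vact a u (T.vact a w p) := by
  induction p using Finsupp.induction_linear with
  | zero => simp
  | add p q hp hq => simp only [map_add, hp, hq]
  | single π r => rw [vact_single, vact_single, map_smul, mul_assoc, proj_mul]

lemma vact_add (u w : UniversalEnvelopingAlgebra K g) (p : Multiset I →₀ R) :
    T.vact a (u + w) p = T.vact a u p + T.vact a w p := by
  induction p using Finsupp.induction_linear with
  | zero => simp
  | add p q hp hq => simp only [map_add, hp, hq]; abel
  | single π r => simp only [vact_single, add_mul, map_add, smul_add]

lemma vact_smul (c : K) (w : UniversalEnvelopingAlgebra K g) (p : Multiset I →₀ R) :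
    T.vact a (c • w) p = c • T.vact a w p := by
  induction p using Finsupp.induction_linear with
  | zero => simp
  | add p q hp hq => simp only [map_add, hp, hq, smul_add]
  | single π r => simp only [vact_single, smul_mul_assoc, map_smul, smul_comm r c]

lemma vact_zero (p : Multiset I →₀ R) : T.vact a 0 p = 0 := by
  simpa using T.vact_smul a 0 0 p

lemma vact_sub (u w : UniversalEnvelopingAlgebra K g) (p : Multiset I →₀ R) :
    T.vact a (u - w) p = T.vact a u p - T.vact a w p := by
  have := T.vact_add a (u - w) w p
  rw [sub_add_cancel] at this
  rw [this, add_sub_cancel_right]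

lemma vact_one (p : Multiset I →₀ R) : T.vact a 1 p = p := by
  induction p using Finsupp.induction_linear with
  | zero => simp
  | add p q hp hq => simp only [map_add, hp, hq]
  | single π r => simp [proj_neg]

lemma vact_lie (x y : g) (p : Multiset I →₀ R) :
    T.vact a (ι K ⁅x, y⁆) p =
      T.vact a (ι K x) (T.vact a (ι K y) p) - T.vact a (ι K y) (T.vact a (ι K x) p) := by
  rw [LieHom.map_lie, LieRing.of_associative_ring_bracket, vact_sub, vact_mul, vact_mul]

/-- The action as a linear map in the element of the Lie algebra. -/
noncomputable def lact (p : Multiset I →₀ R) : g →ₗ[K] (Multiset I →₀ R) where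
  toFun x := T.vact a (ι K x) p
  map_add' x y := by rw [map_add, vact_add]
  map_smul' c x := by rw [map_smul, vact_smul, RingHom.id_apply]

lemma lact_apply (p : Multiset I →₀ R) (x : g) : T.lact a p x = T.vact a (ι K x) p := rfl

lemma proj_eq_vact (u : UniversalEnvelopingAlgebra K g) :
    T.proj a u = T.vact a u (Finsupp.single 0 1) := by
  simp

lemma mwt_of_proj_ne_zero {μ : Dual K T.h} {u : UniversalEnvelopingAlgebra K g}
    (hu : u ∈ T.wtU μ) {π : Multiset I} (h : T.proj a u π ≠ 0) : T.mwt π = -μ := by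
  suffices H : T.proj a u ∈ Finsupp.supported R R {π | T.mwt π = -μ} from
    (Finsupp.mem_supported R _).1 H (Finset.mem_coe.2 (Finsupp.mem_support_iff.2 h))
  clear h
  induction hu using Submodule.span_induction with
  | mem u h =>
    obtain ⟨M, hM, rfl⟩ := h
    obtain ⟨F, C, E, rfl⟩ := exists_split M
    rcases eq_or_ne E 0 with rfl | hE
    · rw [Multiset.map_zero, add_zero, proj_ordMono, projMono_zero]
      refine Finsupp.single_mem_supported _ _ ?_
      rw [Set.mem_ofPred_eq, ← Set.mem_ofPred.1 hM]
      simp [lwt, mwt, Function.comp_def]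
    · have := T.proj_mul_ordMono_of_e a 1 F C hE
      rw [one_mul] at this
      rw [this]
      exact zero_mem _
  | zero => simp
  | add x y _ _ hx hy => rw [map_add]; exact add_mem hx hy
  | smul c x _ hx => rw [map_smul]; exact Submodule.smul_of_tower_mem _ c hx

/-- The vectors of weight `-η` relative to the highest weight. -/
noncomputable abbrev wtS (R : Type*) [CommRing R] (η : Dual K T.h) :
    Submodule R (Multiset I →₀ R) :=
  Finsupp.supported R R {π | T.mwt π = η}

lemma vact_mem_wtS {μ η : Dual K T.h} {u : UniversalEnvelopingAlgebra K g}
    (hu : u ∈ T.wtU μ) {p : Multiset I →₀ R} (hp : p ∈ T.wtS R η) :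
    T.vact a u p ∈ T.wtS R (η - μ) := by
  rw [wtS, Finsupp.supported_eq_span_single] at hp
  induction hp using Submodule.span_induction with
  | mem p h =>
    obtain ⟨π, hπ, rfl⟩ := h
    rw [vact_single, one_smul, Finsupp.mem_supported]
    intro σ hσ
    have := T.mwt_of_proj_ne_zero a (T.mul_mem_wtU hu (T.neg_mem_wtU π))
      (Finsupp.mem_support_iff.1 (Finset.mem_coe.1 hσ))
    rw [Set.mem_ofPred_eq, this, ← Set.mem_ofPred.1 hπ]
    abel
  | zero => simp
  | add x y _ _ hx hy => rw [map_add]; exact add_mem hx hy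
  | smul c x _ hx => rw [map_smul]; exact Submodule.smul_mem _ _ hx

lemma vact_H (x : T.h) {η : Dual K T.h} {p : Multiset I →₀ R} (hp : p ∈ T.wtS R η) :
    T.vact a (ι K (x : g)) p = (a x - algebraMap K R (η x)) • p := by
  rw [wtS, Finsupp.supported_eq_span_single] at hp
  induction hp using Submodule.span_induction with
  | mem p h =>
    obtain ⟨π, hπ, rfl⟩ := h
    rw [vact_single, one_smul, T.ι_mul_of_mem_wtU x (T.neg_mem_wtU π), map_add, map_smul,
      proj_mul_H, proj_neg, sub_smul, algebraMap_smul, ← Set.mem_ofPred.1 hπ,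
      LinearMap.neg_apply, neg_smul, sub_eq_add_neg]
  | zero => simp
  | add x y _ _ hx hy => rw [map_add, hx, hy, smul_add]
  | smul c x _ hx => rw [map_smul, hx, smul_comm]

lemma vact_e_zero (i : I) (r : R) :
    T.vact a (ι K (T.b (.e i))) (Finsupp.single 0 r) = 0 := by
  have := T.proj_mul_e a 1 i
  rw [one_mul] at this
  rw [vact_single, neg_zero, mul_one, this, smul_zero]

lemma vact_f_single {i : I} {π : Multiset I} (h : ∀ j ∈ π, i ≤ j) (r : R) :
    T.vact a (ι K (T.b (.f i))) (Finsupp.single π r) = Finsupp.single (i ::ₘ π) r := by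
  rw [vact_single, ← T.neg_cons h, proj_neg, Finsupp.smul_single, smul_eq_mul, mul_one]

end Action

/-- The negative part of the enveloping algebra, in coordinates. -/
noncomputable def emb : (Multiset I →₀ K) →ₗ[K] UniversalEnvelopingAlgebra K g :=
  Finsupp.linearCombination K T.neg

@[simp] lemma emb_single (π : Multiset I) (c : K) : T.emb (Finsupp.single π c) = c • T.neg π := by
  simp [emb]

@[simp] lemma proj_emb (a : T.h →ₗ[K] K) (p : Multiset I →₀ K) : T.proj a (T.emb p) = p := by
  induction p using Finsupp.induction_linear with
  | zero => simp
  | add p q hp hq => simp only [map_add, hp, hq]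
  | single π r => simp [proj_neg]

lemma emb_injective : Function.Injective T.emb := fun p q h => by
  rw [← T.proj_emb 0 p, h, T.proj_emb]

lemma vact_emb_single (a : T.h →ₗ[K] K) (p : Multiset I →₀ K) :
    T.vact a (T.emb p) (Finsupp.single 0 1) = p := by
  rw [← proj_eq_vact, proj_emb]

lemma listProd_f_mem (l : List I) :
    listProd T.b (l.map .f) ∈ LinearMap.range T.emb := by
  have := listProd_mem T.b (P := Set.range fun π : Multiset I => (π.map .f : Multiset (Letter I κ)))
    (fun i j M hM k hk => ?_) (l.map .f) ⟨l, by simp⟩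
  · refine Submodule.span_le.2 ?_ this
    rintro _ ⟨_, ⟨π, rfl⟩, rfl⟩
    exact ⟨Finsupp.single π 1, by simp [neg]⟩
  · obtain ⟨π, hπ⟩ := hM
    dsimp only at hπ
    have hmem : ∀ l ∈ i ::ₘ j ::ₘ M, ∃ k, l = .f k := by
      rw [← hπ]
      intro l hl
      obtain ⟨k, -, rfl⟩ := Multiset.mem_map.1 hl
      exact ⟨k, rfl⟩
    obtain ⟨x, rfl⟩ := hmem i (by simp)
    obtain ⟨y, rfl⟩ := hmem j (by simp)
    obtain ⟨z, rfl⟩ := T.exists_f_of_lwt_add (T.lwt_of_repr_lie hk)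
    refine ⟨(Letter.f z ::ₘ M).filterMap fIdx, ?_⟩
    have : ∀ N : Multiset (Letter I κ), (∀ l ∈ N, ∃ k, l = .f k) →
        (N.filterMap fIdx).map .f = N := by
      intro N hN
      induction N using Multiset.induction_on with
      | empty => simp
      | cons a N ih =>
        obtain ⟨k, rfl⟩ := hN a (by simp)
        rw [Multiset.filterMap_cons_some (f := fIdx) _ _ rfl, Multiset.map_cons,
          ih fun l hl => hN l (by simp [hl])]
    refine this _ fun l hl => ?_
    rcases Multiset.mem_cons.1 hl with rfl | hl
    exacts [⟨z, rfl⟩, hmem l (by simp [hl])]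

/-- The negative part of the enveloping algebra is closed under multiplication. -/
lemma mul_mem_range_emb {u v : UniversalEnvelopingAlgebra K g} (hu : u ∈ LinearMap.range T.emb)
    (hv : v ∈ LinearMap.range T.emb) : u * v ∈ LinearMap.range T.emb := by
  obtain ⟨p, rfl⟩ := hu
  obtain ⟨q, rfl⟩ := hv
  induction p using Finsupp.induction_linear with
  | zero => simp
  | add p q hp hq => rw [map_add, add_mul]; exact add_mem hp hq
  | single π r =>
    induction q using Finsupp.induction_linear with
    | zero => simp
    | add p q hp hq => rw [map_add, mul_add]; exact add_mem hp hq
    | single σ s =>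
      rw [emb_single, emb_single, smul_mul_smul_comm]
      refine Submodule.smul_mem _ _ ?_
      have h : ∀ π : Multiset I, T.neg π = listProd T.b ((π.sort (· ≤ ·)).map .f) := by
        intro π
        rw [listProd_of_sorted, neg, ← Multiset.map_coe, Multiset.sort_eq]
        rw [List.pairwise_map]
        exact (Multiset.pairwise_sort π (· ≤ ·)).imp fun h => f_le_f.2 h
      rw [h, h, ← listProd_append, ← List.map_append]
      exact T.listProd_f_mem _

lemma ι_f_mem_range_emb (i : I) : ι K (T.b (.f i)) ∈ LinearMap.range T.emb := by
  simpa using T.listProd_f_mem [i]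

lemma ι_f_pow_mem_range_emb (i : I) (n : ℕ) : ι K (T.b (.f i)) ^ n ∈ LinearMap.range T.emb := by
  induction n with
  | zero => exact ⟨Finsupp.single 0 1, by simp⟩
  | succ n ih => rw [pow_succ]; exact T.mul_mem_range_emb ih (T.ι_f_mem_range_emb i)

lemma eq_zero_of_mem_range_emb (a : T.h →ₗ[K] K) {u : UniversalEnvelopingAlgebra K g}
    (hu : u ∈ LinearMap.range T.emb) (h : T.proj a u = 0) : u = 0 := by
  obtain ⟨p, rfl⟩ := hu
  rw [proj_emb] at h
  rw [h, map_zero]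

end Tri

end VermaTheory

namespace VermaTheory

open Module PBW UniversalEnvelopingAlgebra Letter

attribute [local instance] LieRing.ofAssociativeRing

namespace Tri

variable {K g I κ : Type*} [Field K] [LieRing g] [LieAlgebra K g] (T : Tri K g I κ)
variable [LinearOrder I] [LinearOrder κ]

section Functorial

variable {R R' : Type*} [CommRing R] [Algebra K R] [CommRing R'] [Algebra K R']

lemma proj_map (a : T.h →ₗ[K] R) (φ : R →ₐ[K] R') (u : UniversalEnvelopingAlgebra K g)
    (π : Multiset I) : T.proj (φ.toLinearMap ∘ₗ a) u π = φ (T.proj a u π) := by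
  induction u using basis_induction (pbw T.b) with
  | zero => simp
  | add x y hx hy => simp [hx, hy]
  | smul c x hx => simp [hx]
  | basis M =>
    obtain ⟨F, C, E, rfl⟩ := exists_split M
    rw [pbw_apply]
    rcases eq_or_ne E 0 with rfl | hE
    · rw [Multiset.map_zero, add_zero, proj_ordMono, projMono_zero, proj_ordMono, projMono_zero,
        Finsupp.single_apply, Finsupp.single_apply]
      split_ifs
      · rw [map_multiset_prod, Multiset.map_map]
        rfl
      · simp
    · have := T.proj_mul_ordMono_of_e a 1 F C hE
      rw [one_mul] at this
      have h := T.proj_mul_ordMono_of_e (φ.toLinearMap ∘ₗ a) 1 F C hE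
      rw [one_mul] at h
      rw [this, h]
      simp

lemma vact_map (a : T.h →ₗ[K] R) (φ : R →ₐ[K] R') (u : UniversalEnvelopingAlgebra K g)
    (p : Multiset I →₀ R) (π : Multiset I) :
    T.vact (φ.toLinearMap ∘ₗ a) u (p.mapRange φ (map_zero φ)) π = φ (T.vact a u p π) := by
  induction p using Finsupp.induction_linear with
  | zero => simp
  | add p q hp hq => 
    rw [Finsupp.mapRange_add (map_add φ), map_add, Finsupp.add_apply, hp, hq, map_add,
      Finsupp.add_apply, map_add]
  | single σ r => 
    rw [Finsupp.mapRange_single, vact_single, vact_single, Finsupp.smul_apply, Finsupp.smul_apply,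
      proj_map, smul_eq_mul, smul_eq_mul, map_mul φ]

lemma vact_H_apply (a : T.h →ₗ[K] R) (x : T.h) (p : Multiset I →₀ R) (π : Multiset I) :
    T.vact a (ι K (x : g)) p π = (a x - algebraMap K R (T.mwt π x)) * p π := by
  induction p using Finsupp.induction_linear with
  | zero => simp
  | add p q hp hq => rw [map_add, Finsupp.add_apply, hp, hq, Finsupp.add_apply, mul_add]
  | single σ r =>
    rw [T.vact_H a x (η := T.mwt σ) (Finsupp.single_mem_supported _ _ rfl), Finsupp.smul_apply,
      smul_eq_mul, Finsupp.single_apply]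
    split_ifs with h
    · rw [h]
    · simp

/-- A vector annihilated by all positive root vectors. -/
def IsSingular (a : T.h →ₗ[K] R) (q : Multiset I →₀ R) : Prop :=
  ∀ i, T.vact a (ι K (T.b (.e i))) q = 0

/-- A singular weight vector generates a quotient of a Verma module. -/
lemma vact_eq_of_isSingular {a : T.h →ₗ[K] R} {l : Dual K T.h} {q : Multiset I →₀ R}
    (hq : T.IsSingular a q) (hH : ∀ x : T.h, T.vact a (ι K (x : g)) q = l x • q)
    (u : UniversalEnvelopingAlgebra K g) :
    T.vact a u q = T.vact a (T.emb (T.proj l u)) q := by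
  induction u using basis_induction (pbw T.b) with
  | zero => simp
  | add x y hx hy => simp only [map_add, vact_add, hx, hy]
  | smul c x hx => simp only [map_smul, vact_smul, hx]
  | basis M =>
    obtain ⟨F, C, E, rfl⟩ := exists_split M
    rw [pbw_apply]
    rcases eq_or_ne E 0 with rfl | hE
    · rw [ordMono_split, Multiset.map_zero, add_zero, vact_mul]
      have h1 : ∀ C : Multiset κ, T.vact a (ordMono T.b (C.map .H)) q =
          (C.map fun k => l (T.hb k)).prod • q := by
        intro C
        induction C using Multiset.induction_on with
        | empty => simp [vact_one]
        | cons k C ih =>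
          rw [← ordMono_H_mul, vact_mul, T.b_H, hH, LinearMap.map_smul_of_tower, ih,
            Multiset.map_cons, Multiset.prod_cons, mul_smul]
      rw [h1, proj_mul_ordMono_H]
      change _ = T.vact a (T.emb (_ • T.proj l (T.neg F))) q
      rw [T.emb.map_smul, vact_smul, proj_neg, emb_single, one_smul,
        LinearMap.map_smul_of_tower]
      rfl
    · have h := T.proj_mul_ordMono_of_e l 1 F C hE
      rw [one_mul] at h
      rw [h, map_zero, vact_zero]
      obtain ⟨i, E, rfl, hi⟩ := exists_max_cons hE
      have : (F.map f + (C.map .H + (i ::ₘ E).map .e) : Multiset (Letter I κ)) =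
          (F.map f + (C.map .H + E.map .e)) + {.e i} := by
        rw [Multiset.map_cons, ← Multiset.singleton_add, add_comm {_}, add_assoc, add_assoc]
      rw [this, ordMono_add, ordMono_singleton, vact_mul, hq i, map_zero]
      intro l hl j hj
      obtain rfl := Multiset.mem_singleton.1 hj
      rcases Multiset.mem_add.1 hl with hl | hl
      · obtain ⟨k, -, rfl⟩ := Multiset.mem_map.1 hl; exact f_le_e _ _
      rcases Multiset.mem_add.1 hl with hl | hl
      · obtain ⟨k, -, rfl⟩ := Multiset.mem_map.1 hl; exact H_le_e _ _
      · obtain ⟨k, hk, rfl⟩ := Multiset.mem_map.1 hl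
        exact Sum.Lex.inr_le_inr_iff.2 (Sum.Lex.inr_le_inr_iff.2 (hi k hk))

lemma isSingular_of_gen {a : T.h →ₗ[K] R} {simple : Set I}
    (gen : ∀ i, T.b (.e i) ∈ LieSubalgebra.lieSpan K g ((fun i => T.b (.e i)) '' simple))
    {q : Multiset I →₀ R} (hq : ∀ i ∈ simple, T.vact a (ι K (T.b (.e i))) q = 0) :
    T.IsSingular a q := by
  let N : LieSubalgebra K g :=
    { LinearMap.ker (T.lact a q) with
      lie_mem' := by
        intro x y hx hy
        change T.vact a (ι K ⁅x, y⁆) q = 0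
        rw [vact_lie, show T.vact a (ι K y) q = 0 from hy, show T.vact a (ι K x) q = 0 from hx,
          map_zero, map_zero, sub_zero] }
  intro i
  have : LieSubalgebra.lieSpan K g ((fun i => T.b (.e i)) '' simple) ≤ N :=
    LieSubalgebra.lieSpan_le.2 (by rintro _ ⟨i, hi, rfl⟩; exact hq i hi)
  exact this (gen i)

end Functorial

end Tri

end VermaTheory

namespace VermaTheory

open Module PBW UniversalEnvelopingAlgebra Letter

attribute [local instance] LieRing.ofAssociativeRing

/-- If `x` acts locally nilpotently, high powers of `x` can be moved to the right. -/
lemma exists_pow_mul_eq {K g : Type*} [Field K] [LieRing g] [LieAlgebra K g] (x : g)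
    (hx : ∀ y, ∃ n, ((LieAlgebra.ad K g x) ^ n) y = 0) (u : UniversalEnvelopingAlgebra K g)
    (p : ℕ) : ∃ n, ∀ l, n ≤ l → ∃ w, ι K x ^ l * u = w * ι K x ^ p := by
  induction u using enveloping_induction generalizing p with
  | algebraMap c =>
    refine ⟨p, fun l hl => ⟨algebraMap K _ c * ι K x ^ (l - p), ?_⟩⟩
    rw [mul_assoc, ← pow_add, Nat.sub_add_cancel hl, Algebra.commutes]
  | add u v hu hv =>
    obtain ⟨n, hn⟩ := hu p
    obtain ⟨m, hm⟩ := hv p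
    refine ⟨max n m, fun l hl => ?_⟩
    obtain ⟨w, hw⟩ := hn l ((le_max_left _ _).trans hl)
    obtain ⟨w', hw'⟩ := hm l ((le_max_right _ _).trans hl)
    exact ⟨w + w', by rw [mul_add, hw, hw', add_mul]⟩
  | mul u v hu hv =>
    obtain ⟨m, hm⟩ := hv p
    obtain ⟨n, hn⟩ := hu m
    refine ⟨n, fun l hl => ?_⟩
    obtain ⟨w, hw⟩ := hn l hl
    obtain ⟨w', hw'⟩ := hm m le_rfl
    exact ⟨w * w', by rw [← mul_assoc, hw, mul_assoc, hw', mul_assoc]⟩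
  | gen y =>
    obtain ⟨n, hn⟩ := hx y
    induction n generalizing y p with
    | zero => exact ⟨0, fun l _ => ⟨0, by simp at hn; simp [hn]⟩⟩
    | succ n ih =>
      induction p with
      | zero => exact ⟨0, fun l _ => ⟨ι K x ^ l * ι K y, by simp⟩⟩
      | succ p ihp =>
        obtain ⟨N, hN⟩ := ihp
        obtain ⟨M, hM⟩ := ih ⁅x, y⁆ (p + 1) (by rwa [pow_succ] at hn)
        refine ⟨max N M + 1, fun l hl => ?_⟩
        obtain ⟨l, rfl⟩ : ∃ l', l = l' + 1 := ⟨l - 1, by omega⟩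
        obtain ⟨w, hw⟩ := hN l (by omega)
        obtain ⟨w', hw'⟩ := hM l (by omega)
        refine ⟨w + w', ?_⟩
        have : ι K x * ι K y = ι K y * ι K x + ι K ⁅x, y⁆ := by
          rw [LieHom.map_lie, LieRing.of_associative_ring_bracket]; abel
        rw [pow_succ, mul_assoc, this, mul_add, ← mul_assoc, hw, hw', add_mul, mul_assoc,
          ← pow_succ]

/-- A polynomial family of linear forms with trivial common kernel at `0` has trivial common
kernel outside a finite set. -/
lemma finite_nontrivial_kernel {K S ι : Type*} [Field K] [Fintype S]
    (A : ι → S → Polynomial K)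
    (h0 : ∀ v : S → K, (∀ r, ∑ s, (A r s).eval 0 * v s = 0) → v = 0) :
    {c : K | ∃ v : S → K, v ≠ 0 ∧ ∀ r, ∑ s, (A r s).eval c * v s = 0}.Finite := by
  classical
  let row : ι → S → K := fun r s => (A r s).eval 0
  have htop : Submodule.span K (Set.range row) = ⊤ := by
    by_contra hne
    obtain ⟨f, hf, hle⟩ := Submodule.exists_le_ker_of_lt_top _ (lt_top_iff_ne_top.2 hne)
    refine hf ?_
    have hv : (fun s => f (Pi.single s 1)) = 0 := by
      refine h0 _ fun r => ?_
      have h1 : f (row r) = 0 := hle (Submodule.subset_span ⟨r, rfl⟩)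
      rw [LinearMap.pi_apply_eq_sum_univ f (row r)] at h1
      rw [← h1]
      refine Finset.sum_congr rfl fun s _ => ?_
      rw [smul_eq_mul]
      congr 2
      ext j
      simp [Pi.single_apply, eq_comm]
    ext s
    simpa using congrFun hv s
  obtain ⟨B, hB, hspan, hli⟩ := exists_linearIndependent K (Set.range row)
  rw [htop] at hspan
  let bas : Basis B K (S → K) := Basis.mk hli (by rw [Subtype.range_coe, hspan])
  let e : S ≃ B := (Pi.basisFun K S).indexEquiv bas
  choose r hr using fun b : B => hB b.2
  let M : Matrix S S (Polynomial K) := Matrix.of fun s' s => A (r (e s')) s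
  have hdet : ∀ c, M.det.eval c = (Matrix.of fun s' s => (A (r (e s')) s).eval c).det := by
    intro c
    rw [← Polynomial.coe_evalRingHom, RingHom.map_det]
    rfl
  have hM : M.det ≠ 0 := by
    intro h
    have h1 := hdet 0
    rw [h, Polynomial.eval_zero] at h1
    have hli' : LinearIndependent K
        (Matrix.of fun s' s => (A (r (e s')) s).eval 0 : Matrix S S K).row := by
      have : (Matrix.of fun s' s => (A (r (e s')) s).eval 0 : Matrix S S K).row =
          (fun b : B => (b : S → K)) ∘ e := by
        funext s'
        exact hr (e s')
      rw [this]
      exact hli.comp _ e.injective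
    have hu := Matrix.linearIndependent_rows_iff_isUnit.1 hli'
    rw [Matrix.isUnit_iff_isUnit_det, ← h1] at hu
    exact not_isUnit_zero hu
  refine (Polynomial.finite_setOfPred_isRoot hM).subset ?_
  rintro c ⟨v, hv, hvr⟩
  change M.det.eval c = 0
  rw [hdet]
  exact Matrix.exists_mulVec_eq_zero_iff.1 ⟨v, hv, funext fun s' => hvr (r (e s'))⟩

/-- An affine line of weights, as a weight with polynomial values. -/
noncomputable def line {K V : Type*} [Field K] [AddCommGroup V] [Module K V]
    (l ξ : Dual K V) : V →ₗ[K] Polynomial K :=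
  (Algebra.linearMap K (Polynomial K)) ∘ₗ l +
    (LinearMap.toSpanSingleton K (Polynomial K) Polynomial.X) ∘ₗ ξ

lemma line_apply {K V : Type*} [Field K] [AddCommGroup V] [Module K V]
    (l ξ : Dual K V) (x : V) : line l ξ x = Polynomial.C (l x) + ξ x • Polynomial.X := rfl

lemma aeval_comp_line {K V : Type*} [Field K] [AddCommGroup V] [Module K V]
    (l ξ : Dual K V) (c : K) :
    (Polynomial.aeval (R := K) c).toLinearMap ∘ₗ line l ξ = l + c • ξ := by
  ext x
  simp [line_apply, mul_comm]

namespace Tri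

variable {K g I κ : Type*} [Field K] [LieRing g] [LieAlgebra K g] (T : Tri K g I κ)

/-- The further structure coming from a Dynkin Borel subalgebra. -/
structure IsDynkin (simple : Set I) (ht : I → ℕ) (ρ : Dual K T.h) : Prop where
  finite : ∀ η, {s : Multiset I | (s.map T.wt).sum = η}.Finite
  gen : ∀ i, T.b (.e i) ∈ LieSubalgebra.lieSpan K g ((fun i => T.b (.e i)) '' simple)
  lie_eq_zero : ∀ i ∈ simple, ∀ j ∈ simple, i ≠ j → ⁅T.b (.e i), T.b (.f j)⁆ = 0
  nilpotent : ∀ i ∈ simple, ∀ x, ∃ n, ((LieAlgebra.ad K g (T.b (.f i))) ^ n) x = 0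
  reduce : ∀ i ∉ simple, ∃ j ∈ simple, ∃ i', ∃ m : ℕ, 0 < m ∧ T.wt i = T.wt i' + m • T.wt j ∧
    T.wt i (T.t j) = m ∧ T.t i' = T.t i - T.wt j (T.t i) • T.t j ∧ ht i' < ht i
  indep : ∀ i j, i ≠ j → LinearIndependent K ![T.t i, T.t j]
  rho : ∀ i ∈ simple, ρ (T.t i) = 1

variable [LinearOrder I] [LinearOrder κ]

section

variable {R : Type*} [CommRing R] [Algebra K R] (a : T.h →ₗ[K] R)

lemma ι_f_pow_mem_wtU (i : I) (n : ℕ) : ι K (T.b (.f i)) ^ n ∈ T.wtU (-(n • T.wt i)) := by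
  have := T.pow_mem_wtU (T.ι_mem_wtU (.f i)) n
  rwa [lwt, smul_neg] at this

lemma vact_f_pow_mem_wtS {η : Dual K T.h} {q : Multiset I →₀ R} (hq : q ∈ T.wtS R η) (i : I)
    (n : ℕ) : T.vact a (ι K (T.b (.f i)) ^ n) q ∈ T.wtS R (η + n • T.wt i) := by
  simpa using T.vact_mem_wtS a (T.ι_f_pow_mem_wtU i n) hq

lemma vact_e_f (i : I) {η : Dual K T.h} {q : Multiset I →₀ R} (hq : q ∈ T.wtS R η) :
    T.vact a (ι K (T.b (.e i))) (T.vact a (ι K (T.b (.f i))) q) =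
      (a (T.t i) - algebraMap K R (η (T.t i))) • q +
        T.vact a (ι K (T.b (.f i))) (T.vact a (ι K (T.b (.e i))) q) := by
  have := T.vact_lie a (T.b (.e i)) (T.b (.f i)) q
  rw [T.lie_ef, T.vact_H a _ hq] at this
  rw [this, sub_add_cancel]

lemma vact_e_f_pow {i : I} {η : Dual K T.h} {q : Multiset I →₀ R} (hq : q ∈ T.wtS R η)
    (he : T.vact a (ι K (T.b (.e i))) q = 0) (n : ℕ) :
    T.vact a (ι K (T.b (.e i))) (T.vact a (ι K (T.b (.f i)) ^ (n + 1)) q) =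
      ((n + 1 : R) * (a (T.t i) - algebraMap K R (η (T.t i)) - n)) •
        T.vact a (ι K (T.b (.f i)) ^ n) q := by
  induction n with
  | zero =>
    rw [zero_add, pow_one, pow_zero, vact_one, T.vact_e_f a i hq, he, map_zero, add_zero,
      Nat.cast_zero, zero_add, one_mul, sub_zero]
  | succ n ih =>
    rw [pow_succ', vact_mul, T.vact_e_f a i (T.vact_f_pow_mem_wtS a hq i (n + 1)), ih, map_smul,
      ← vact_mul, ← pow_succ', ← add_smul]
    congr 1
    rw [LinearMap.add_apply, LinearMap.smul_apply, T.wt_t]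
    simp only [map_add, nsmul_eq_mul, map_mul, map_natCast, map_ofNat, Nat.cast_add, Nat.cast_one,
      map_one]
    ring

lemma vact_e_f_pow_of_lie_eq_zero {i j : I} (h : ⁅T.b (.e i), T.b (.f j)⁆ = 0)
    {q : Multiset I →₀ R} (he : T.vact a (ι K (T.b (.e i))) q = 0) (n : ℕ) :
    T.vact a (ι K (T.b (.e i))) (T.vact a (ι K (T.b (.f j)) ^ n) q) = 0 := by
  induction n with
  | zero => simpa [vact_one] using he
  | succ n ih =>
    have := T.vact_lie a (T.b (.e i)) (T.b (.f j)) (T.vact a (ι K (T.b (.f j)) ^ n) q)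
    rw [h, map_zero, vact_zero, ih, map_zero, sub_zero] at this
    rw [pow_succ', vact_mul, ← this]

end

end Tri

end VermaTheory

namespace VermaTheory

open Module PBW UniversalEnvelopingAlgebra Letter

attribute [local instance] LieRing.ofAssociativeRing

namespace Tri

variable {K g I κ : Type*} [Field K] [CharZero K] [LieRing g] [LieAlgebra K g] (T : Tri K g I κ)
variable [LinearOrder I] [LinearOrder κ]

lemma single_mem_wtS (R : Type*) [CommRing R] (r : R) :
    (Finsupp.single 0 r : Multiset I →₀ R) ∈ T.wtS R 0 :=
  Finsupp.single_mem_supported _ _ T.mwt_zero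

/-- Existence of a nonzero singular vector of relative weight `-k wt i`. -/
def HasSingular (l : Dual K T.h) (i : I) (k : ℕ) : Prop :=
  ∃ q : Multiset I →₀ K, q ≠ 0 ∧ q ∈ T.wtS K (k • T.wt i) ∧ T.IsSingular l q

lemma ι_f_pow_ne_zero (i : I) (n : ℕ) : ι K (T.b (.f i)) ^ n ≠ 0 := by
  induction n with
  | zero =>
    intro h
    have := T.proj_neg (R := K) 0 0
    rw [neg_zero, ← pow_zero (ι K (T.b (.f i))), h, map_zero] at this
    exact Finsupp.single_ne_zero.2 one_ne_zero this.symm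
  | succ n ih =>
    rw [pow_succ]
    refine pbw_mul_ne_zero T.b ih fun h => ?_
    rw [← ordMono_singleton, ← pbw_apply] at h
    exact (pbw T.b).ne_zero _ h

variable {T} {simple : Set I} {ht : I → ℕ} {ρ : Dual K T.h} (D : T.IsDynkin simple ht ρ)
include D

lemma IsDynkin.isSingular_f_pow {l : Dual K T.h} {i : I} (hi : i ∈ simple) {k : ℕ} (hk : 0 < k)
    (h : (l + ρ) (T.t i) = k) :
    T.IsSingular l (T.vact l (ι K (T.b (.f i)) ^ k) (Finsupp.single 0 1)) := by
  refine T.isSingular_of_gen D.gen fun j hj => ?_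
  by_cases hij : j = i
  · subst hij
    obtain ⟨k, rfl⟩ : ∃ n, k = n + 1 := ⟨k - 1, by omega⟩
    rw [T.vact_e_f_pow l (T.single_mem_wtS K 1) (T.vact_e_zero l _ _)]
    have : l (T.t j) = k := by
      rw [LinearMap.add_apply, D.rho j hj] at h
      push_cast at h
      exact add_right_cancel h
    simp [this]
  · exact T.vact_e_f_pow_of_lie_eq_zero l (D.lie_eq_zero j hj i hi hij) (T.vact_e_zero l _ _) k

lemma IsDynkin.hasSingular_simple {l : Dual K T.h} {i : I} (hi : i ∈ simple) {k : ℕ} (hk : 0 < k)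
    (h : (l + ρ) (T.t i) = k) : T.HasSingular l i k := by
  refine ⟨_, fun h0 => ?_, ?_, D.isSingular_f_pow hi hk h⟩
  · rw [← proj_eq_vact] at h0
    exact T.ι_f_pow_ne_zero i k (T.eq_zero_of_mem_range_emb l (T.ι_f_pow_mem_range_emb i k) h0)
  · simpa using T.vact_f_pow_mem_wtS l (T.single_mem_wtS K 1) i k

/-- The embedding step along a simple reflection. -/
lemma IsDynkin.hasSingular_of_reflect {l : Dual K T.h} {i i' j : I} (hj : j ∈ simple) {m k p : ℕ}
    (hwt : T.wt i = T.wt i' + m • T.wt j) (hij : T.wt i (T.t j) = m) (hp : 0 < p)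
    (hl : (l + ρ) (T.t j) = -p)
    (h : T.HasSingular (l + (p : K) • T.wt j) i' k) : T.HasSingular l i k := by
  set μ : Dual K T.h := l + (p : K) • T.wt j with hμ
  obtain ⟨q, hq0, hq, hqs⟩ := h
  set f := ι K (T.b (.f j)) with hf
  set s : Multiset I →₀ K := T.vact μ (f ^ p) (Finsupp.single 0 1) with hs
  have hμt : μ (T.t j) = p - 1 := by
    rw [LinearMap.add_apply, D.rho j hj] at hl
    rw [hμ, LinearMap.add_apply, LinearMap.smul_apply, T.wt_t, smul_eq_mul]
    linear_combination hl
  have hi' : T.wt i' (T.t j) = -m := by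
    have := hij
    rw [hwt, LinearMap.add_apply, LinearMap.smul_apply, T.wt_t, nsmul_eq_mul] at this
    linear_combination this
  have hss : T.IsSingular μ s :=
    D.isSingular_f_pow hj hp (by rw [LinearMap.add_apply, hμt, D.rho j hj]; ring)
  have hswt : s ∈ T.wtS K (p • T.wt j) := by
    have := T.vact_f_pow_mem_wtS μ (T.single_mem_wtS K 1) j p
    rwa [zero_add] at this
  have hsH : ∀ x : T.h, T.vact μ (ι K (x : g)) s = l x • s := by
    intro x
    rw [T.vact_H μ x hswt, hμ]
    congr 1
    simp
  -- the embedding of `M(l)` in `M(μ)`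
  let φ : (Multiset I →₀ K) →ₗ[K] (Multiset I →₀ K) :=
    { toFun := fun r => T.vact μ (T.emb r) s
      map_add' := fun x y => by rw [map_add, vact_add]
      map_smul' := fun c x => by rw [map_smul, vact_smul, RingHom.id_apply] }
  have hφ : ∀ r, φ r = T.proj μ (T.emb r * f ^ p) := fun r => by
    rw [proj_eq_vact, vact_mul]; rfl
  have hφinj : ∀ r, φ r = 0 → r = 0 := by
    intro r hr
    by_contra hne
    rw [hφ] at hr
    have := T.eq_zero_of_mem_range_emb μ
      (T.mul_mem_range_emb ⟨r, rfl⟩ (T.ι_f_pow_mem_range_emb j p)) hr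
    refine pbw_mul_ne_zero T.b (fun h0 => hne ?_) (T.ι_f_pow_ne_zero j p) this
    exact T.emb_injective (by rw [h0, map_zero])
  have hInt : ∀ u r, T.vact μ u (φ r) = φ (T.vact l u r) := by
    intro u r
    change T.vact μ u (T.vact μ (T.emb r) s) = T.vact μ (T.emb (T.vact l u r)) s
    rw [← vact_mul, T.vact_eq_of_isSingular hss hsH, T.proj_mul, T.proj_emb]
  -- high powers of `f` applied to `q`
  let w : ℕ → (Multiset I →₀ K) := fun n => T.vact μ (f ^ n) q
  have hw : ∀ n, w n = T.proj μ (f ^ n * T.emb q) := fun n => by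
    rw [proj_eq_vact, vact_mul, T.vact_emb_single]
  have hwne : ∀ n, w n ≠ 0 := by
    intro n h0
    rw [hw] at h0
    have := T.eq_zero_of_mem_range_emb μ
      (T.mul_mem_range_emb (T.ι_f_pow_mem_range_emb j n) ⟨q, rfl⟩) h0
    refine pbw_mul_ne_zero T.b (T.ι_f_pow_ne_zero j n) (fun h0 => hq0 ?_) this
    exact T.emb_injective (by rw [h0, map_zero])
  have hwsucc : ∀ n, T.vact μ (ι K (T.b (.e j))) (w (n + 1)) =
      ((n + 1 : K) * (p + k * m - (n + 1))) • w n := by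
    intro n
    change T.vact μ _ (T.vact μ _ q) = _
    rw [T.vact_e_f_pow μ hq (hqs j), hμt]
    congr 1
    simp only [LinearMap.smul_apply, hi', Algebra.algebraMap_self, RingHom.id_apply, nsmul_eq_mul]
    ring
  have hmem : ∃ n, p + k * m ≤ n ∧ w n ∈ LinearMap.range φ := by
    obtain ⟨n, hn⟩ := exists_pow_mul_eq (T.b (.f j)) (D.nilpotent j hj) (T.emb q) p
    refine ⟨max n (p + k * m), le_max_right _ _, ?_⟩
    obtain ⟨u, hu⟩ := hn _ (le_max_left n (p + k * m))
    refine ⟨T.proj l u, ?_⟩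
    change φ (T.proj l u) = w _
    rw [hw, hu, T.proj_eq_vact μ, vact_mul]
    exact (T.vact_eq_of_isSingular hss hsH u).symm
  have hdesc : ∀ d, w (p + k * m + d) ∈ LinearMap.range φ → w (p + k * m) ∈ LinearMap.range φ := by
    intro d
    induction d with
    | zero => exact id
    | succ d ih =>
      rintro ⟨r, hr⟩
      refine ih ?_
      have h1 := hwsucc (p + k * m + d)
      rw [add_assoc (p + k * m) d 1, ← hr, hInt] at h1
      refine (Submodule.smul_mem_iff _ ?_).1 (h1 ▸ LinearMap.mem_range_self φ _)
      refine mul_ne_zero (Nat.cast_add_one_ne_zero _) ?_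
      push_cast
      have : (p + k * m - (p + k * m + d + 1) : K) = -((d + 1 : ℕ) : K) := by push_cast; ring
      rw [this]
      exact neg_ne_zero.2 (by exact_mod_cast Nat.succ_ne_zero d)
  obtain ⟨n, hn, hwn⟩ := hmem
  obtain ⟨d, rfl⟩ := Nat.exists_eq_add_of_le hn
  obtain ⟨r, hr⟩ := hdesc d hwn
  have hwwt : w (p + k * m) ∈ T.wtS K (k • T.wt i + p • T.wt j) := by
    have := T.vact_f_pow_mem_wtS μ hq j (p + k * m)
    convert this using 2
    rw [hwt]
    simp only [smul_add, add_smul, mul_smul]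
    abel
  refine ⟨r, fun h0 => hwne (p + k * m) (by rw [← hr, h0, map_zero]), ?_, ?_⟩
  · rw [Finsupp.mem_supported]
    intro σ hσ
    have hσ0 : r σ ≠ 0 := Finsupp.mem_support_iff.1 (Finset.mem_coe.1 hσ)
    rw [Set.mem_ofPred_eq]
    ext x
    have h1 : T.vact l (ι K (x : g)) r = (l x - (k • T.wt i) x) • r := by
      rw [← sub_eq_zero]
      refine hφinj _ ?_
      rw [map_sub, ← hInt, map_smul, hr, T.vact_H μ x hwwt, ← sub_smul]
      convert zero_smul K _
      simp [hμ]
    have h2 := congrArg (fun p => p σ) h1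
    simp only [vact_H_apply, Finsupp.smul_apply, smul_eq_mul] at h2
    have h3 := mul_right_cancel₀ hσ0 h2
    simpa using h3
  · refine T.isSingular_of_gen D.gen fun c hc => hφinj _ ?_
    rw [← hInt, hr]
    by_cases hcj : c = j
    · subst hcj
      obtain ⟨n, hn⟩ : ∃ n, p + k * m = n + 1 := ⟨p + k * m - 1, by omega⟩
      have hz : (p + k * m : K) - (n + 1) = 0 := by
        have := congrArg (Nat.cast : ℕ → K) hn
        push_cast at this
        rw [this, sub_self]
      rw [hn, hwsucc, hz, mul_zero, zero_smul]
    · exact T.vact_e_f_pow_of_lie_eq_zero μ (D.lie_eq_zero c hc j hj hcj) (hqs c) _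

/-- Existence of singular vectors is a closed condition along lines. -/
lemma IsDynkin.hasSingular_of_infinite {l ξ : Dual K T.h} {i : I} {k : ℕ}
    (h : {c : K | T.HasSingular (l + c • ξ) i k}.Infinite) : T.HasSingular l i k := by
  classical
  by_contra hno
  refine h ?_
  let P : Set (Multiset I) := {π | T.mwt π = k • T.wt i}
  have : Fintype P := (D.finite (k • T.wt i)).fintype
  let A : I × Multiset I → P → Polynomial K := fun r s =>
    T.vact (line l ξ) (ι K (T.b (.e r.1))) (Finsupp.single (s : Multiset I) 1) r.2
  have hA : ∀ (c : K) (v : P → K) (r : I × Multiset I),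
      ∑ s, (A r s).eval c * v s = T.vact (l + c • ξ) (ι K (T.b (.e r.1)))
        (∑ s : P, Finsupp.single (s : Multiset I) (v s)) r.2 := by
    intro c v r
    rw [map_sum, Finsupp.finsetSum_apply]
    refine Finset.sum_congr rfl fun s _ => ?_
    have h1 := T.vact_map (line l ξ) (Polynomial.aeval c) (ι K (T.b (.e r.1)))
      (Finsupp.single (s : Multiset I) 1) r.2
    rw [aeval_comp_line, Finsupp.mapRange_single, map_one] at h1
    rw [← mul_one (v s), ← smul_eq_mul (v s) 1, ← Finsupp.smul_single, map_smul,
      Finsupp.smul_apply, h1, smul_eq_mul, smul_eq_mul, mul_one, mul_comm]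
    rfl
  have happ : ∀ (v : P → K) (s : P),
      (∑ s : P, Finsupp.single (s : Multiset I) (v s)) (s : Multiset I) = v s := by
    intro v s
    rw [Finsupp.finsetSum_apply, Finset.sum_eq_single s]
    · simp
    · intro b _ hb
      rw [Finsupp.single_apply, if_neg (fun h => hb (Subtype.ext h))]
    · simp
  refine (finite_nontrivial_kernel A fun v hv => ?_).subset ?_
  · by_contra hne
    refine hno ⟨∑ s : P, Finsupp.single (s : Multiset I) (v s), fun h0 => hne ?_, ?_, fun j => ?_⟩
    · funext s
      rw [← happ v, h0]; rfl
    · exact sum_mem fun s _ => Finsupp.single_mem_supported _ _ s.2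
    · ext σ
      have := hv (j, σ)
      rwa [hA, zero_smul, add_zero] at this
  · rintro c ⟨q, hq0, hq, hqs⟩
    have hq' : q = ∑ s : P, Finsupp.single (s : Multiset I) (q s) := by
      ext π
      by_cases hπ : T.mwt π = k • T.wt i
      · exact (happ (fun s => q s) ⟨π, hπ⟩).symm
      · rw [Finsupp.notMem_support_iff.1 fun h => hπ (hq (Finset.mem_coe.2 h)),
          Finsupp.finsetSum_apply, Finset.sum_eq_zero]
        intro s _
        rw [Finsupp.single_apply, if_neg]
        rintro rfl
        exact hπ s.2
    refine ⟨fun s => q s, fun h0 => hq0 ?_, fun r => ?_⟩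
    · rw [hq']
      exact Finset.sum_eq_zero fun s _ => by rw [show q s = 0 from congrFun h0 s]; simp
    · rw [hA, ← hq', hqs]; rfl

theorem IsDynkin.hasSingular {l : Dual K T.h} {i : I} {k : ℕ} (hk : 0 < k)
    (h : (l + ρ) (T.t i) = k) : T.HasSingular l i k := by
  induction hn : ht i using Nat.strong_induction_on generalizing i l with
  | _ n ih =>
    by_cases hi : i ∈ simple
    · exact D.hasSingular_simple hi hk h
    obtain ⟨j, hj, i', m, -, hwt, hij, ht', hlt⟩ := D.reduce i hi
    obtain ⟨ξ, hξ⟩ : ∃ ξ : Dual K T.h, ξ (T.t i) = 0 ∧ ξ (T.t j) = 1 := by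
      have hne : i ≠ j := by rintro rfl; exact hi hj
      have hli := D.indep i j hne
      obtain ⟨ξ, hξ⟩ := LinearMap.exists_extend ((Basis.span hli).constr K ![(0 : K), 1])
      have hb : ∀ a : Fin 2, ξ (![T.t i, T.t j] a) = ![(0 : K), 1] a := by
        intro a
        have := LinearMap.congr_fun hξ (Basis.span hli a)
        rwa [Basis.constr_basis, LinearMap.comp_apply, Submodule.subtype_apply,
          Basis.span_apply] at this
      exact ⟨ξ, by simpa using hb 0, by simpa using hb 1⟩
    refine D.hasSingular_of_infinite (ξ := ξ) ?_
    refine (Set.infinite_range_of_injective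
      (f := fun p : ℕ => -((p + 1 : ℕ) : K) - (l + ρ) (T.t j)) ?_).mono ?_
    · intro p p' hpp
      simpa using hpp
    · rintro _ ⟨p, rfl⟩
      obtain ⟨c, hc⟩ : ∃ c, c = -((p + 1 : ℕ) : K) - (l + ρ) (T.t j) := ⟨_, rfl⟩
      change T.HasSingular (l + (-((p + 1 : ℕ) : K) - (l + ρ) (T.t j)) • ξ) i k
      rw [← hc]
      have h1 : (l + c • ξ + ρ) (T.t j) = -((p + 1 : ℕ) : K) := by
        have : (l + c • ξ + ρ) (T.t j) = (l + ρ) (T.t j) + c * ξ (T.t j) := by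
          simp only [LinearMap.add_apply, LinearMap.smul_apply, smul_eq_mul]; ring
        rw [this, hξ.2, hc]; ring
      refine D.hasSingular_of_reflect hj hwt hij (Nat.succ_pos p) h1 ?_
      refine ih _ (hn ▸ hlt) ?_ rfl
      have h2 : (l + c • ξ + ρ) (T.t i) = k := by
        rw [← h]
        simp [hξ.1]
      rw [ht']
      have h3 := T.wt_t j
      simp only [LinearMap.add_apply, LinearMap.smul_apply, smul_eq_mul, map_sub, map_smul] at *
      rw [h3]
      linear_combination h2 - (T.wt j) (T.t i) * h1

end Tri

end VermaTheory

namespace VermaTheory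

open Module PBW UniversalEnvelopingAlgebra Letter

attribute [local instance] LieRing.ofAssociativeRing

namespace Tri

variable {K g I κ : Type*} [Field K] [CharZero K] [LieRing g] [LieAlgebra K g] (T : Tri K g I κ)
variable [LinearOrder I] [LinearOrder κ]

/-- The left ideal annihilating the highest weight vector. -/
noncomputable def vIdeal (l : Dual K T.h) :
    Submodule (UniversalEnvelopingAlgebra K g) (UniversalEnvelopingAlgebra K g) :=
  Submodule.span (UniversalEnvelopingAlgebra K g)
    ((Set.range fun i => ι K (T.b (.e i))) ∪
      Set.range fun x : T.h =>
        ι K (x : g) - algebraMap K (UniversalEnvelopingAlgebra K g) (l x))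

lemma proj_one {R : Type*} [CommRing R] [Algebra K R] (a : T.h →ₗ[K] R) :
    T.proj a 1 = Finsupp.single 0 1 := by
  simpa using T.proj_neg a 0

lemma proj_algebraMap (l : Dual K T.h) (c : K) :
    T.proj l (algebraMap K _ c) = Finsupp.single 0 c := by
  rw [Algebra.algebraMap_eq_smul_one, map_smul, proj_one, Finsupp.smul_single, smul_eq_mul,
    mul_one]

lemma proj_eq_zero_of_mem {l : Dual K T.h} {u : UniversalEnvelopingAlgebra K g}
    (hu : u ∈ T.vIdeal l) : T.proj l u = 0 := by
  induction hu using Submodule.span_induction with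
  | mem u h =>
    rcases h with ⟨i, rfl⟩ | ⟨x, rfl⟩
    · have := T.proj_mul_e l 1 i
      rwa [one_mul] at this
    · have := T.proj_mul_H l 1 x
      rw [one_mul, proj_one, Finsupp.smul_single, smul_eq_mul, mul_one] at this
      simp only [map_sub, this, proj_algebraMap, sub_self]
  | zero => simp
  | add x y _ _ hx hy => rw [map_add, hx, hy, add_zero]
  | smul c x _ hx => rw [smul_eq_mul, proj_mul, hx, map_zero]

lemma sub_emb_mem (l : Dual K T.h) (u : UniversalEnvelopingAlgebra K g) :
    u - T.emb (T.proj l u) ∈ T.vIdeal l := by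
  have hK : ∀ (c : K) (w : UniversalEnvelopingAlgebra K g), w ∈ T.vIdeal l →
      c • w ∈ T.vIdeal l := by
    intro c w hw
    rw [Algebra.smul_def]
    exact Submodule.smul_mem _ (algebraMap K _ c) hw
  induction u using basis_induction (pbw T.b) with
  | zero => simp
  | add x y hx hy =>
    rw [map_add, map_add, add_sub_add_comm]
    exact add_mem hx hy
  | smul c x hx =>
    rw [map_smul, map_smul, ← smul_sub]
    exact hK c _ hx
  | basis M =>
    obtain ⟨F, C, E, rfl⟩ := exists_split M
    rw [pbw_apply]
    rcases eq_or_ne E 0 with rfl | hE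
    · rw [ordMono_split, Multiset.map_zero, add_zero, proj_mul_ordMono_H]
      change T.neg F * _ - T.emb (_ • T.proj l (T.neg F)) ∈ _
      rw [proj_neg, map_smul, emb_single, one_smul]
      induction C using Multiset.induction_on with
      | empty => simp
      | cons k C ih =>
        rw [← ordMono_H_mul, ← mul_assoc, Multiset.map_cons, Multiset.prod_cons, T.b_H]
        have h1 : T.neg F * ordMono T.b (C.map .H) * ι K (T.hb k : g) -
            (l (T.hb k) * (C.map fun k => l (T.hb k)).prod) • T.neg F =
            (T.neg F * ordMono T.b (C.map .H)) *
              (ι K (T.hb k : g) - algebraMap K _ (l (T.hb k))) +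
            l (T.hb k) • (T.neg F * ordMono T.b (C.map .H) -
              (C.map fun k => l (T.hb k)).prod • T.neg F) := by
          rw [mul_sub, ← Algebra.commutes, ← Algebra.smul_def, smul_sub, mul_smul]
          abel
        rw [h1]
        exact add_mem (Submodule.smul_mem _ _ (Submodule.subset_span (Or.inr ⟨_, rfl⟩)))
          (hK _ _ ih)
    · have h := T.proj_mul_ordMono_of_e l 1 F C hE
      rw [one_mul] at h
      rw [h, map_zero, sub_zero]
      obtain ⟨i, E, rfl, hi⟩ := exists_max_cons hE
      have : (F.map f + (C.map .H + (i ::ₘ E).map .e) : Multiset (Letter I κ)) =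
          (F.map f + (C.map .H + E.map .e)) + {.e i} := by
        rw [Multiset.map_cons, ← Multiset.singleton_add, add_comm {_}, add_assoc, add_assoc]
      rw [this, ordMono_add, ordMono_singleton]
      · exact Submodule.smul_mem _ _ (Submodule.subset_span (Or.inl ⟨_, rfl⟩))
      intro l hl j hj
      obtain rfl := Multiset.mem_singleton.1 hj
      rcases Multiset.mem_add.1 hl with hl | hl
      · obtain ⟨k, -, rfl⟩ := Multiset.mem_map.1 hl; exact f_le_e _ _
      rcases Multiset.mem_add.1 hl with hl | hl
      · obtain ⟨k, -, rfl⟩ := Multiset.mem_map.1 hl; exact H_le_e _ _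
      · obtain ⟨k, hk, rfl⟩ := Multiset.mem_map.1 hl
        exact Sum.Lex.inr_le_inr_iff.2 (Sum.Lex.inr_le_inr_iff.2 (hi k hk))

lemma mem_vIdeal {l : Dual K T.h} {u : UniversalEnvelopingAlgebra K g} :
    u ∈ T.vIdeal l ↔ T.proj l u = 0 := by
  refine ⟨T.proj_eq_zero_of_mem, fun h => ?_⟩
  simpa [h] using T.sub_emb_mem l u

lemma vIdeal_ne_top (l : Dual K T.h) : T.vIdeal l ≠ ⊤ := by
  intro h
  have : (1 : UniversalEnvelopingAlgebra K g) ∈ T.vIdeal l := h ▸ Submodule.mem_top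
  rw [mem_vIdeal, proj_one, Finsupp.single_eq_zero] at this
  exact one_ne_zero this

lemma exists_vact_eq_single {l : Dual K T.h} {q : Multiset I →₀ K} (hq : q 0 ≠ 0) :
    ∃ u, T.vact l u q = Finsupp.single 0 1 := by
  induction hn : q.support.card using Nat.strong_induction_on generalizing q with
  | _ n ih =>
    by_cases h : ∃ τ ∈ q.support, τ ≠ 0
    · obtain ⟨τ, hτ, hτ0⟩ := h
      obtain ⟨x, hx⟩ : ∃ x, T.mwt τ x ≠ 0 := by
        by_contra! hall
        exact T.mwt_ne_zero hτ0 (LinearMap.ext hall)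
      let u := ι K (x : g) - (l x - T.mwt τ x) • (1 : UniversalEnvelopingAlgebra K g)
      have hu : ∀ π, T.vact l u q π = (T.mwt τ x - T.mwt π x) * q π := by
        intro π
        rw [vact_sub, vact_smul, vact_one, Finsupp.sub_apply, vact_H_apply, Finsupp.smul_apply,
          smul_eq_mul]
        simp only [Algebra.algebraMap_self, RingHom.id_apply]
        ring
      have hlt : (T.vact l u q).support.card < n := by
        rw [← hn]
        refine Finset.card_lt_card ⟨fun π hπ => ?_, fun hle => ?_⟩
        · rw [Finsupp.mem_support_iff, hu] at hπ
          exact Finsupp.mem_support_iff.2 (right_ne_zero_of_mul hπ)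
        · have := hle hτ
          rw [Finsupp.mem_support_iff, hu, sub_self, zero_mul] at this
          exact this rfl
      obtain ⟨w, hw⟩ := ih _ hlt (by rw [hu]; simpa using ⟨hx, hq⟩) rfl
      exact ⟨w * u, by rw [vact_mul, hw]⟩
    · push Not at h
      refine ⟨(q 0)⁻¹ • 1, ?_⟩
      rw [vact_smul, vact_one]
      ext π
      rw [Finsupp.smul_apply, Finsupp.single_apply, smul_eq_mul]
      split_ifs with h0
      · rw [← h0, inv_mul_cancel₀ hq]
      · rw [Finsupp.notMem_support_iff.1 fun hπ => h0 (h π hπ).symm, mul_zero]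

lemma isCoatom_of_forall {l : Dual K T.h}
    (h : ∀ q : Multiset I →₀ K, q ≠ 0 → ∃ u, T.vact l u q 0 ≠ 0) : IsCoatom (T.vIdeal l) := by
  refine ⟨T.vIdeal_ne_top l, fun N hN => ?_⟩
  obtain ⟨u, huN, hu⟩ := SetLike.exists_of_lt hN
  obtain ⟨w, hw⟩ := h (T.proj l u) fun h0 => hu (T.mem_vIdeal.2 h0)
  obtain ⟨w', hw'⟩ := T.exists_vact_eq_single hw
  have h1 : w' * w * u - 1 ∈ T.vIdeal l := by
    rw [mem_vIdeal, map_sub, proj_mul, vact_mul, hw', proj_one, sub_self]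
  have h2 : w' * w * u ∈ N := N.smul_mem (w' * w) huN
  have h3 : (1 : UniversalEnvelopingAlgebra K g) ∈ N := by
    have := N.sub_mem h2 (hN.le h1)
    rwa [sub_sub_cancel] at this
  refine (Submodule.eq_top_iff').2 fun x => ?_
  simpa using N.smul_mem x h3

/-- The submodule generated by a singular vector misses the highest weight space. -/
lemma IsSingular.vact_apply_zero {l : Dual K T.h} {i : I} {k : ℕ} (hk : 0 < k)
    {q : Multiset I →₀ K} (hqs : T.IsSingular l q) (hq : q ∈ T.wtS K (k • T.wt i))
    (w : UniversalEnvelopingAlgebra K g) : T.vact l w q 0 = 0 := by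
  rw [T.vact_eq_of_isSingular (l := l - k • T.wt i) hqs]
  · generalize T.proj (l - k • T.wt i) w = r
    induction r using Finsupp.induction_linear with
    | zero => simp [vact_zero]
    | add p q hp hq => rw [map_add, vact_add, Finsupp.add_apply, hp, hq, add_zero]
    | single π c =>
      rw [emb_single, vact_smul, Finsupp.smul_apply]
      have h4 := T.vact_mem_wtS l (T.neg_mem_wtU π) hq
      rw [Finsupp.notMem_support_iff.1, smul_zero]
      intro h5
      have h6 : T.mwt 0 = k • T.wt i - -T.mwt π := h4 (Finset.mem_coe.2 h5)
      rw [mwt_zero, sub_neg_eq_add, ← mwt_singleton, ← mwt_nsmul, ← mwt_add] at h6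
      refine T.mwt_ne_zero ?_ h6.symm
      intro h7
      have := congrArg Multiset.card h7
      simp only [Multiset.card_add, Multiset.card_nsmul, Multiset.card_singleton,
        Multiset.card_zero] at this
      omega
  · intro x
    rw [T.vact_H l x hq]
    rfl

lemma not_isCoatom_of_hasSingular {l : Dual K T.h} {i : I} {k : ℕ} (hk : 0 < k)
    (h : T.HasSingular l i k) : ¬ IsCoatom (T.vIdeal l) := by
  obtain ⟨q, hq0, hq, hqs⟩ := h
  intro hco
  have hu : T.emb q ∉ T.vIdeal l := by rwa [mem_vIdeal, proj_emb]
  have htop : T.vIdeal l ⊔ Submodule.span _ {T.emb q} = ⊤ :=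
    hco.2 _ (lt_of_le_of_ne le_sup_left fun h => hu (h ▸ Submodule.mem_sup_right
      (Submodule.mem_span_singleton_self _)))
  have h1 : (1 : UniversalEnvelopingAlgebra K g) ∈
      T.vIdeal l ⊔ Submodule.span _ {T.emb q} := htop ▸ Submodule.mem_top
  obtain ⟨x, hx, y, hy, hxy⟩ := Submodule.mem_sup.1 h1
  obtain ⟨w, rfl⟩ := Submodule.mem_span_singleton.1 hy
  have h2 : T.vact l w q = Finsupp.single 0 1 := by
    rw [← T.proj_one l, ← hxy, map_add, T.mem_vIdeal.1 hx, zero_add, smul_eq_mul, proj_mul,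
      proj_emb]
  have h3 := IsSingular.vact_apply_zero T hk hqs hq w
  rw [h2, Finsupp.single_eq_same] at h3
  exact one_ne_zero h3

end Tri

end VermaTheory

namespace VermaTheory

open Module Polynomial

lemma det_ne_zero_of_degree {K S : Type*} [Field K] [Fintype S] [DecidableEq S]
    (A : Matrix S S K[X]) (n : S → ℕ)
    (h : ∀ i j, i ≠ j → A i j = 0 ∨ 2 * (A i j).natDegree < n i + n j)
    (hd : ∀ i, A i i ≠ 0 ∧ (A i i).natDegree = n i) :
    A.det ≠ 0 ∧ A.det.natDegree ≤ ∑ i, n i := by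
  have hle : ∀ i j, 2 * (A i j).natDegree ≤ n i + n j := by
    intro i j
    by_cases hij : i = j
    · subst hij; rw [(hd i).2]; omega
    · rcases h i j hij with h | h
      · simp [h]
      · exact h.le
  have hprod : ∀ σ : Equiv.Perm S, σ ≠ 1 → (∏ i, A (σ i) i = 0) ∨
      (∏ i, A (σ i) i).natDegree < ∑ i, n i := by
    intro σ hσ
    by_cases h0 : ∃ i, A (σ i) i = 0
    · obtain ⟨i, hi⟩ := h0
      exact Or.inl (Finset.prod_eq_zero (Finset.mem_univ i) hi)
    push Not at h0
    refine Or.inr ?_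
    obtain ⟨i, hi⟩ : ∃ i, σ i ≠ i := by
      by_contra! hall
      exact hσ (Equiv.ext hall)
    have h1 : ∑ i, 2 * (A (σ i) i).natDegree < ∑ i, (n (σ i) + n i) :=
      Finset.sum_lt_sum (fun i _ => hle _ _)
        ⟨i, Finset.mem_univ i, (h _ _ hi).resolve_left (h0 i)⟩
    rw [Finset.sum_add_distrib, Equiv.sum_comp σ n, ← Finset.mul_sum] at h1
    have h2 := Polynomial.natDegree_prod_le Finset.univ fun i => A (σ i) i
    have h3 : (∏ i, A (σ i) i).natDegree ≤ ∑ i, (A (σ i) i).natDegree := h2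
    omega
  have hone : (∏ i, A i i).natDegree = ∑ i, n i := by
    rw [Polynomial.natDegree_prod _ _ fun i _ => (hd i).1]
    exact Finset.sum_congr rfl fun i _ => (hd i).2
  have hdet : A.det.coeff (∑ i, n i) ≠ 0 := by
    rw [Matrix.det_apply, Polynomial.finsetSum_coeff, Finset.sum_eq_single 1]
    · rw [Equiv.Perm.sign_one, one_smul, ← hone]
      simp only [Equiv.Perm.one_apply]
      rw [Polynomial.coeff_natDegree, Ne, Polynomial.leadingCoeff_eq_zero, Finset.prod_eq_zero_iff]
      rintro ⟨i, -, hi⟩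
      exact (hd i).1 hi
    · intro σ _ hσ
      rw [Polynomial.coeff_smul]
      rcases hprod σ hσ with h | h
      · simp [h]
      · rw [Polynomial.coeff_eq_zero_of_natDegree_lt h, smul_zero]
    · simp
  refine ⟨fun h0 => hdet (by rw [h0, Polynomial.coeff_zero]), ?_⟩
  rw [Matrix.det_apply]
  refine Polynomial.natDegree_sum_le_of_forall_le _ _ fun σ _ => ?_
  refine (Polynomial.natDegree_smul_le _ _).trans ?_
  by_cases hσ : σ = 1
  · subst hσ; exact hone.le
  · rcases hprod σ hσ with h | h
    · simp [h]
    · exact h.le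

lemma pow_dvd_det {K S ι : Type*} [Field K] [Fintype S] [DecidableEq S] [Fintype ι]
    (A : Matrix S S K[X]) (c : K) (v : ι → S → K) (hv : LinearIndependent K v)
    (h : ∀ j r, ∑ s, (A r s).eval c * v j s = 0) : (X - C c) ^ Fintype.card ι ∣ A.det := by
  classical
  let B := Basis.sumExtend hv
  let e : S ≃ _ := (Pi.basisFun K S).indexEquiv B
  let P : Matrix S S K := Matrix.of fun s s' => B (e s') s
  have hP : IsUnit P.det := by
    rw [← Matrix.isUnit_iff_isUnit_det, ← Matrix.linearIndependent_cols_iff_isUnit]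
    exact B.linearIndependent.comp e e.injective
  let M : Matrix S S K[X] := A * P.map C
  have hM : M.det = A.det * C P.det := by
    rw [Matrix.det_mul, RingHom.map_det]; rfl
  let d : S → K[X] := fun s => if (e s).isLeft then X - C c else 1
  have hdvd : ∀ s r, d s ∣ M r s := by
    intro s r
    simp only [d]
    split_ifs with hs
    · obtain ⟨j, hj⟩ := Sum.isLeft_iff.1 hs
      rw [Polynomial.dvd_iff_isRoot, Polynomial.IsRoot, ← h j r,
        show M r s = ∑ x, A r x * C (P x s) from rfl, Polynomial.eval_finsetSum]
      refine Finset.sum_congr rfl fun x _ => ?_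
      rw [Polynomial.eval_mul, Polynomial.eval_C]
      simp only [P, Matrix.of_apply, hj]
      rw [show B (Sum.inl j) = v j from by
        simp only [B, Basis.sumExtend, Basis.reindex_apply, Basis.coe_extend]; rfl]
    · exact one_dvd _
  choose Q hQ using hdvd
  have hdet : M.det = (∏ s, d s) * (Matrix.of fun r s => Q s r).det := by
    rw [← Matrix.det_mul_row]
    congr 1
    ext1 r s
    rw [Matrix.of_apply, Matrix.of_apply, hQ]
  have hprod : ∏ s, d s = (X - C c) ^ Fintype.card ι := by
    have : Fintype (Basis.sumExtendIndex hv) :=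
      @Fintype.ofInjective _ _ (Fintype.ofEquiv S e) (Sum.inr (α := ι)) Sum.inr_injective
    have h1 : ∏ s, d s = ∏ x : ι ⊕ Basis.sumExtendIndex hv,
        if x.isLeft then X - C c else 1 :=
      Fintype.prod_equiv e _ _ fun _ => rfl
    rw [h1, Fintype.prod_sum_type]
    simp
  rw [← hprod]
  have : A.det * C P.det = (∏ s, d s) * (Matrix.of fun r s => Q s r).det := by rw [← hM, hdet]
  have hu : IsUnit (C P.det) := hP.map C
  rw [← hu.dvd_mul_right, this]
  exact dvd_mul_right _ _

end VermaTheory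

namespace VermaTheory

open Module PBW UniversalEnvelopingAlgebra Letter Polynomial

attribute [local instance] LieRing.ofAssociativeRing

section Filtration

variable (K : Type*) {I : Type*} [Field K]

/-- The filtration of the polynomial space in which the variable has degree two. -/
noncomputable def filt (q : ℕ) : Submodule K (Multiset I →₀ K[X]) :=
  Submodule.span K {p | ∃ π d, 2 * d + Multiset.card π ≤ q ∧ p = Finsupp.single π (X ^ d)}

variable {K}

lemma single_mem_filt {q d : ℕ} {π : Multiset I} (h : 2 * d + Multiset.card π ≤ q) (c : K) :
    Finsupp.single π (C c * X ^ d) ∈ filt K q := by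
  rw [← Polynomial.smul_eq_C_mul, ← Finsupp.smul_single]
  exact Submodule.smul_mem _ _ (Submodule.subset_span ⟨π, d, h, rfl⟩)

lemma single_one_mem_filt {q : ℕ} {π : Multiset I} (h : Multiset.card π ≤ q) :
    (Finsupp.single π 1 : Multiset I →₀ K[X]) ∈ filt K q := by
  simpa using single_mem_filt (K := K) (d := 0) (π := π) (q := q) (by simpa using h) 1

lemma filt_mono {q q' : ℕ} (h : q ≤ q') :
    (filt K q : Submodule K (Multiset I →₀ K[X])) ≤ filt K q' :=
  Submodule.span_mono fun _ ⟨π, d, hd, hp⟩ => ⟨π, d, hd.trans h, hp⟩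

lemma coeff_of_mem_filt {q : ℕ} {p : Multiset I →₀ K[X]} (hp : p ∈ filt K q) (π : Multiset I)
    (d : ℕ) (h : q < 2 * d + Multiset.card π) : (p π).coeff d = 0 := by
  classical
  induction hp using Submodule.span_induction with
  | mem p hp =>
    obtain ⟨σ, e, he, rfl⟩ := hp
    rw [Finsupp.single_apply]
    split_ifs with hσ
    · subst hσ
      rw [coeff_X_pow, if_neg]
      rintro rfl
      omega
    · simp
  | zero => simp
  | add p p' _ _ hp hp' => rw [Finsupp.add_apply, coeff_add, hp, hp', add_zero]
  | smul c p _ hp => rw [Finsupp.smul_apply, coeff_smul, hp, smul_zero]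

lemma natDegree_of_mem_filt {q : ℕ} {p : Multiset I →₀ K[X]} (hp : p ∈ filt K q) (π : Multiset I) :
    2 * (p π).natDegree ≤ q := by
  by_contra! h
  have := coeff_of_mem_filt hp π (p π).natDegree (by omega)
  rw [coeff_natDegree, leadingCoeff_eq_zero] at this
  simp [this] at h

lemma map_mem_filt (φ : (Multiset I →₀ K[X]) →ₗ[K[X]] (Multiset I →₀ K[X])) {q s : ℕ}
    (h : ∀ π : Multiset I, Multiset.card π ≤ q →
      φ (Finsupp.single π 1) ∈ filt K (Multiset.card π + s))
    {p : Multiset I →₀ K[X]} (hp : p ∈ filt K q) : φ p ∈ filt K (q + s) := by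
  induction hp using Submodule.span_induction with
  | mem p hp =>
    obtain ⟨σ, e, he, rfl⟩ := hp
    rw [← mul_one (X ^ e), ← smul_eq_mul, ← Finsupp.smul_single, map_smul]
    have hX : ∀ p ∈ filt K (Multiset.card σ + s),
        (X ^ e : K[X]) • p ∈ (filt K (q + s) : Submodule K (Multiset I →₀ K[X])) := by
      intro p hp
      induction hp using Submodule.span_induction with
      | mem p hp =>
        obtain ⟨τ, d, hd, rfl⟩ := hp
        rw [Finsupp.smul_single, smul_eq_mul, ← pow_add]
        exact Submodule.subset_span ⟨τ, e + d, by omega, rfl⟩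
      | zero => rw [smul_zero]; exact zero_mem _
      | add p p' _ _ hp hp' => rw [smul_add]; exact add_mem hp hp'
      | smul c p _ hp => rw [smul_comm]; exact Submodule.smul_mem _ _ hp
    exact hX _ (h σ (by omega))
  | zero => rw [map_zero]; exact zero_mem _
  | add p p' _ _ hp hp' => rw [map_add]; exact add_mem hp hp'
  | smul c p _ hp => rw [LinearMap.map_smul_of_tower]; exact Submodule.smul_mem _ _ hp

lemma C_mul_X_pow_smul_mem_filt {q d : ℕ} {p : Multiset I →₀ K[X]} (hp : p ∈ filt K q) (c : K) :
    (C c * X ^ d) • p ∈ filt K (q + 2 * d) :=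
  map_mem_filt (((C c * X ^ d : K[X])) • LinearMap.id) (fun π _ => by
    rw [LinearMap.smul_apply, LinearMap.id_apply, Finsupp.smul_single, smul_eq_mul, mul_one]
    exact single_mem_filt (by omega) c) hp

lemma single_erase_mem_filt [DecidableEq I] {q : ℕ} {σ : Multiset I} (h : Multiset.card σ + 1 ≤ q)
    (x : K) (γ : I) : (Finsupp.single (σ.erase γ) (C (x * σ.count γ) * X) : Multiset I →₀ K[X]) ∈
      filt K q := by
  by_cases hδ : γ ∈ σ
  · rw [← pow_one (X : K[X])]
    refine single_mem_filt ?_ _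
    have := Multiset.card_erase_add_one hδ
    omega
  · rw [Multiset.count_eq_zero_of_notMem hδ]
    simp

end Filtration

namespace Tri

variable {K g I κ : Type*} [Field K] [CharZero K] [LieRing g] [LieAlgebra K g] (T : Tri K g I κ)
variable [LinearOrder I] [LinearOrder κ]

variable (l ξ : Dual K T.h)

lemma vact_f_sub_mem_filt (β : I) (π : Multiset I) :
    T.vact (line l ξ) (ι K (T.b (.f β))) (Finsupp.single π 1) - Finsupp.single (β ::ₘ π) 1 ∈
      filt K (Multiset.card π) := by
  induction hn : Multiset.card π using Nat.strong_induction_on generalizing β π with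
  | _ n ih =>
  subst hn
  have hmem : ∀ (γ : I) (σ : Multiset I), Multiset.card σ < Multiset.card π →
      T.vact (line l ξ) (ι K (T.b (.f γ))) (Finsupp.single σ 1) ∈ filt K (Multiset.card σ + 1) := by
    intro γ σ hσ
    rw [← sub_add_cancel (T.vact _ _ _) (Finsupp.single (γ ::ₘ σ) 1)]
    exact add_mem (filt_mono (by omega) (ih _ hσ γ σ rfl)) (single_one_mem_filt (by simp))
  by_cases hmin : ∀ j ∈ π, β ≤ j
  · rw [T.vact_f_single _ hmin, sub_self]
    exact zero_mem _
  have h0 : π ≠ 0 := by rintro rfl; simp at hmin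
  obtain ⟨j, σ, rfl, hj⟩ := exists_min_cons h0
  have hjβ : j ≤ β := by
    push Not at hmin
    obtain ⟨k, hk, hkβ⟩ := hmin
    rcases Multiset.mem_cons.1 hk with rfl | hk
    · exact hkβ.le
    · exact (hj k hk).trans hkβ.le
  rw [Multiset.card_cons] at hmem ⊢
  have e1 : T.vact (line l ξ) (ι K (T.b (.f β))) (Finsupp.single (j ::ₘ σ) 1) =
      T.vact (line l ξ) (ι K (T.b (.f j))) (T.vact (line l ξ) (ι K (T.b (.f β)))
        (Finsupp.single σ 1)) + T.lact (line l ξ) (Finsupp.single σ 1) ⁅T.b (.f β), T.b (.f j)⁆ := by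
    rw [lact_apply, vact_lie, ← T.vact_f_single _ hj]
    abel
  have e2 : (Finsupp.single (β ::ₘ j ::ₘ σ) 1 : Multiset I →₀ K[X]) =
      T.vact (line l ξ) (ι K (T.b (.f j))) (Finsupp.single (β ::ₘ σ) 1) := by
    rw [T.vact_f_single, Multiset.cons_swap]
    intro k hk
    rcases Multiset.mem_cons.1 hk with rfl | hk
    · exact hjβ
    · exact hj k hk
  rw [e1, e2, add_sub_right_comm, ← map_sub]
  refine add_mem (map_mem_filt _ (fun τ hτ => hmem j τ (by omega)) (ih _ (by simp) β σ rfl)) ?_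
  refine map_mem_of_repr T.b _ _ fun k hk => ?_
  obtain ⟨i, rfl⟩ := T.exists_f_of_lwt_add (T.lwt_of_repr_lie hk)
  exact hmem i σ (by omega)

lemma vact_f_mem_filt (β : I) (π : Multiset I) :
    T.vact (line l ξ) (ι K (T.b (.f β))) (Finsupp.single π 1) ∈ filt K (Multiset.card π + 1) := by
  rw [← sub_add_cancel (T.vact _ _ _) (Finsupp.single (β ::ₘ π) 1)]
  exact add_mem (filt_mono (by omega) (T.vact_f_sub_mem_filt l ξ β π))
    (single_one_mem_filt (by simp))

lemma vact_H_sub_mem_filt (x : T.h) (π : Multiset I) :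
    T.vact (line l ξ) (ι K (x : g)) (Finsupp.single π 1) - Finsupp.single π (C (ξ x) * X) ∈
      filt K (Multiset.card π) := by
  rw [T.vact_H (η := T.mwt π) _ x (Finsupp.single_mem_supported _ _ rfl), line_apply,
    Finsupp.smul_single, ← Finsupp.single_sub]
  have e : (C (l x) + ξ x • X - algebraMap K K[X] (T.mwt π x)) • (1 : K[X]) - C (ξ x) * X =
      C (l x - T.mwt π x) * X ^ 0 := by
    rw [smul_eq_C_mul, Polynomial.algebraMap_eq, smul_eq_mul, C_sub]
    ring
  rw [e]
  exact single_mem_filt (by simp) _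

lemma vact_e_sub_mem_filt (γ : I) (σ : Multiset I) :
    T.vact (line l ξ) (ι K (T.b (.e γ))) (Finsupp.single σ 1) -
      Finsupp.single (σ.erase γ) (C (ξ (T.t γ) * σ.count γ) * X) ∈ filt K (Multiset.card σ) := by
  induction hn : Multiset.card σ generalizing γ σ with
  | zero =>
    obtain rfl := Multiset.card_eq_zero.1 hn
    simp [-ι_apply, -vact_single, vact_e_zero]
  | succ n ih =>
    obtain ⟨β, σ, rfl, hβ⟩ := exists_min_cons (M := σ) (by rintro rfl; simp at hn)
    rw [Multiset.card_cons, add_left_inj] at hn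
    have hmem : ∀ δ, T.vact (line l ξ) (ι K (T.b (.e δ))) (Finsupp.single σ 1) ∈ filt K (n + 1) := by
      intro δ
      rw [← sub_add_cancel (T.vact _ _ _) (Finsupp.single (σ.erase δ) (C (ξ (T.t δ) * σ.count δ) * X))]
      exact add_mem (filt_mono (by omega) (ih δ σ hn)) (single_erase_mem_filt (by omega) _ _)
    have hf : T.vact (line l ξ) (ι K (T.b (.f β))) (T.vact (line l ξ) (ι K (T.b (.e γ)))
        (Finsupp.single σ 1)) - Finsupp.single (β ::ₘ σ.erase γ) (C (ξ (T.t γ) * σ.count γ) * X) ∈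
        filt K (n + 1) := by
      have h1 := map_mem_filt _ (fun τ _ => T.vact_f_mem_filt l ξ β τ) (ih γ σ hn)
      rw [map_sub] at h1
      rw [← sub_add_sub_cancel]
      refine add_mem h1 ?_
      by_cases hγ : γ ∈ σ
      · have h2 := C_mul_X_pow_smul_mem_filt (d := 1) (T.vact_f_sub_mem_filt l ξ β (σ.erase γ))
          (ξ (T.t γ) * σ.count γ)
        have h3 := Multiset.card_erase_add_one hγ
        rw [pow_one, smul_sub, ← map_smul, Finsupp.smul_single, Finsupp.smul_single] at h2
        simp only [smul_eq_mul, mul_one] at h2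
        exact filt_mono (by omega) h2
      · rw [Multiset.count_eq_zero_of_notMem hγ]
        simp
    have e1 : T.vact (line l ξ) (ι K (T.b (.e γ))) (Finsupp.single (β ::ₘ σ) 1) =
        T.vact (line l ξ) (ι K (T.b (.f β))) (T.vact (line l ξ) (ι K (T.b (.e γ)))
        (Finsupp.single σ 1)) + T.lact (line l ξ) (Finsupp.single σ 1) ⁅T.b (.e γ), T.b (.f β)⁆ := by
      rw [lact_apply, vact_lie, ← T.vact_f_single _ hβ]
      abel
    rw [e1]
    by_cases hγβ : γ = β
    · subst hγβ
      have h2 := T.vact_H_sub_mem_filt l ξ (T.t γ) σ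
      rw [← T.lie_ef, ← lact_apply] at h2
      have h3 : (Finsupp.single ((γ ::ₘ σ).erase γ) (C (ξ (T.t γ) * (γ ::ₘ σ).count γ) * X) :
          Multiset I →₀ K[X]) = Finsupp.single (γ ::ₘ σ.erase γ) (C (ξ (T.t γ) * σ.count γ) * X) +
          Finsupp.single σ (C (ξ (T.t γ)) * X) := by
        rw [Multiset.erase_cons_head, Multiset.count_cons_self]
        by_cases hγ : γ ∈ σ
        · rw [Multiset.cons_erase hγ, ← Finsupp.single_add]
          congr 1
          push_cast
          rw [mul_add, C_add]
          simp [mul_one, add_mul]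
        · rw [Multiset.count_eq_zero_of_notMem hγ]
          simp
      rw [h3, add_sub_add_comm]
      exact add_mem hf (filt_mono (by omega) h2)
    · rw [Multiset.erase_cons_tail _ (Ne.symm hγβ), Multiset.count_cons_of_ne hγβ, add_sub_right_comm]
      refine add_mem hf (map_mem_of_repr T.b _ _ fun k hk => ?_)
      have hw := T.lwt_of_repr_lie hk
      rw [lact_apply]
      match k, hw with
      | .f i, _ => exact hn ▸ T.vact_f_mem_filt l ξ i σ
      | .e i, _ => exact hmem i
      | .H i, hw =>
        simp only [lwt] at hw
        exact absurd (T.wt_inj (eq_of_sub_eq_zero (by rw [sub_eq_add_neg]; exact hw.symm))) hγβ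

lemma vact_e_mem_filt (γ : I) (σ : Multiset I) :
    T.vact (line l ξ) (ι K (T.b (.e γ))) (Finsupp.single σ 1) ∈ filt K (Multiset.card σ + 1) := by
  rw [← sub_add_cancel (T.vact _ _ _) (Finsupp.single (σ.erase γ) (C (ξ (T.t γ) * σ.count γ) * X))]
  exact add_mem (filt_mono (by omega) (T.vact_e_sub_mem_filt l ξ γ σ))
    (single_erase_mem_filt le_rfl _ _)

lemma vact_listProd_e (L : List I) (hL : ∀ γ ∈ L, ξ (T.t γ) ≠ 0) (σ : Multiset I) :
    ∃ c : K, (L = [] → c = 1) ∧ (c ≠ 0 ↔ (L : Multiset I) ≤ σ) ∧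
      T.vact (line l ξ) (listProd T.b (L.map .e)) (Finsupp.single σ 1) -
        Finsupp.single (σ - L) (C c * X ^ L.length) ∈
      (filt K (Multiset.card σ + L.length - 1) : Submodule K (Multiset I →₀ K[X])) := by
  induction L with
  | nil => exact ⟨1, fun _ => rfl, by simp, by simp [-vact_single, vact_one]⟩
  | cons γ L ih =>
    obtain ⟨c, hc1, hc, hmem⟩ := ih fun δ hδ => hL δ (List.mem_cons_of_mem _ hδ)
    refine ⟨c * (ξ (T.t γ) * (σ - (L : Multiset I)).count γ), by simp, ?_, ?_⟩
    · have h1 := hL γ List.mem_cons_self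
      rw [mul_ne_zero_iff, mul_ne_zero_iff, hc, Nat.cast_ne_zero, Multiset.count_ne_zero,
        ← Multiset.cons_coe]
      constructor
      · rintro ⟨h2, -, h3⟩
        rw [← tsub_add_cancel_of_le h2, ← Multiset.singleton_add]
        exact add_le_add_left (Multiset.singleton_le.2 h3) _
      · intro h2
        have h3 := (Multiset.le_cons_self (L : Multiset I) γ).trans h2
        refine ⟨h3, h1, ?_⟩
        rw [← Multiset.singleton_le, le_tsub_iff_right h3, Multiset.singleton_add]
        exact h2
    · rw [List.map_cons, listProd_cons, vact_mul, List.length_cons]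
      have h1 : T.vact (line l ξ) (ι K (T.b (.e γ))) (T.vact (line l ξ) (listProd T.b (L.map .e))
          (Finsupp.single σ 1) - Finsupp.single (σ - L) (C c * X ^ L.length)) ∈
          (filt K (Multiset.card σ + (L.length + 1) - 1) : Submodule K (Multiset I →₀ K[X])) := by
        rcases eq_or_ne L [] with rfl | h0
        · simp [-ι_apply, -vact_single, vact_one, hc1]
        · have := List.length_pos_iff.2 h0
          exact filt_mono (by omega) (map_mem_filt _ (fun τ _ => T.vact_e_mem_filt l ξ γ τ) hmem)
      rw [map_sub] at h1
      rw [← sub_add_sub_cancel]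
      refine add_mem h1 ?_
      by_cases h0 : c = 0
      · simp [h0]
      have h2 := C_mul_X_pow_smul_mem_filt (d := L.length) (T.vact_e_sub_mem_filt l ξ γ (σ - L)) c
      have h3 := Multiset.card_sub (hc.1 h0)
      have h4 := Multiset.card_le_card (hc.1 h0)
      rw [smul_sub, ← map_smul, Finsupp.smul_single, Finsupp.smul_single, smul_eq_mul,
          mul_one] at h2
      have h5 : (σ - (L : Multiset I)).erase γ = σ - ((γ :: L : List I) : Multiset I) := by
        rw [← Multiset.cons_coe, ← Multiset.singleton_add, add_comm, ← tsub_tsub, Multiset.sub_singleton]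
      rw [h5, smul_eq_mul] at h2
      rw [C_mul, pow_succ, mul_mul_mul_comm]
      rw [Multiset.coe_card] at h3 h4
      exact filt_mono (by omega) h2

/-- The matrix pairing raising monomials with lowering monomials. -/
noncomputable def pairing {R : Type*} [CommRing R] [Algebra K R] (a : T.h →ₗ[K] R)
    (π σ : Multiset I) : R :=
  T.vact a (listProd T.b (π.toList.map .e)) (Finsupp.single σ 1) 0

lemma natDegree_pairing_of_ne {π σ : Multiset I} (hπ : ∀ γ ∈ π, ξ (T.t γ) ≠ 0) (h : π ≠ σ) :
    2 * (T.pairing (line l ξ) π σ).natDegree < Multiset.card π + Multiset.card σ := by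
  obtain ⟨c, -, hc, hmem⟩ := T.vact_listProd_e l ξ π.toList (by simpa using hπ) σ
  rw [Multiset.coe_toList] at hc hmem
  have h1 := natDegree_of_mem_filt hmem 0
  have h2 : (Finsupp.single (σ - π) (C c * X ^ π.toList.length) : Multiset I →₀ K[X]) 0 = 0 := by
    rw [Finsupp.single_apply]
    split_ifs with h0
    · by_cases hc0 : c = 0
      · simp [hc0]
      · exact absurd (le_antisymm (hc.1 hc0) (tsub_eq_zero_iff_le.1 h0)) h
    · rfl
  rw [Finsupp.sub_apply, h2, sub_zero, Multiset.length_toList] at h1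
  have h3 : 0 < Multiset.card π + Multiset.card σ := by
    by_contra! h0
    rw [Nat.le_zero, Nat.add_eq_zero_iff, Multiset.card_eq_zero, Multiset.card_eq_zero] at h0
    exact h (h0.1.trans h0.2.symm)
  change 2 * (T.pairing (line l ξ) π σ).natDegree ≤ _ at h1
  omega

lemma pairing_self {π : Multiset I} (hπ : ∀ γ ∈ π, ξ (T.t γ) ≠ 0) :
    T.pairing (line l ξ) π π ≠ 0 ∧ (T.pairing (line l ξ) π π).natDegree = Multiset.card π := by
  rcases eq_or_ne π 0 with rfl | h0
  · simp [pairing, -vact_single, vact_one]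
  obtain ⟨c, -, hc, hmem⟩ := T.vact_listProd_e l ξ π.toList (by simpa using hπ) π
  rw [Multiset.coe_toList] at hc hmem
  have h1 := natDegree_of_mem_filt hmem 0
  rw [Finsupp.sub_apply, tsub_self, Finsupp.single_eq_same, Multiset.length_toList] at h1
  have hpos := Multiset.card_pos.2 h0
  have hc0 : c ≠ 0 := hc.2 le_rfl
  have e1 : T.pairing (line l ξ) π π = (T.pairing (line l ξ) π π - C c * X ^ Multiset.card π) +
      C c * X ^ Multiset.card π := by ring
  change 2 * (T.pairing (line l ξ) π π - C c * X ^ Multiset.card π).natDegree ≤ _ at h1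
  have e2 : (T.pairing (line l ξ) π π).natDegree = Multiset.card π := by
    rw [e1, natDegree_add_eq_right_of_natDegree_lt, natDegree_C_mul_X_pow _ _ hc0]
    rw [natDegree_C_mul_X_pow _ _ hc0]
    omega
  refine ⟨fun h => ?_, e2⟩
  rw [h, natDegree_zero] at e2
  omega

end Tri

end VermaTheory

namespace VermaTheory

open Module PBW UniversalEnvelopingAlgebra Letter Polynomial

attribute [local instance] LieRing.ofAssociativeRing

namespace Tri

variable {K g I κ : Type*} [Field K] [CharZero K] [LieRing g] [LieAlgebra K g] (T : Tri K g I κ)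
variable [LinearOrder I] [LinearOrder κ]

lemma listProd_e_mem_wtU (π : Multiset I) : listProd T.b (π.toList.map .e) ∈ T.wtU (T.mwt π) := by
  refine T.listProd_mem_wtU _ ?_
  rw [List.map_map, mwt, ← Multiset.coe_toList (π.map T.wt), ← Multiset.sum_coe]
  rw [Multiset.coe_toList]
  conv_rhs => rw [← Multiset.coe_toList π, Multiset.map_coe]
  rfl

lemma pairing_map {R R' : Type*} [CommRing R] [Algebra K R] [CommRing R'] [Algebra K R']
    (a : T.h →ₗ[K] R) (φ : R →ₐ[K] R') (π σ : Multiset I) :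
    φ (T.pairing a π σ) = T.pairing (φ.toLinearMap ∘ₗ a) π σ := by
  rw [pairing, ← vact_map, pairing, Finsupp.mapRange_single, map_one]

lemma pairing_line_eval (l ξ : Dual K T.h) (c : K) (π σ : Multiset I) :
    (T.pairing (line l ξ) π σ).eval c = T.pairing (l + c • ξ) π σ := by
  rw [← aeval_comp_line, ← pairing_map, Polynomial.coe_aeval_eq_eval]

/-- The lowering operators acting on a fixed vector. -/
noncomputable def lower (a : Dual K T.h) (q : Multiset I →₀ K) :
    (Multiset I →₀ K) →ₗ[K] (Multiset I →₀ K) where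
  toFun s := T.vact a (T.emb s) q
  map_add' s s' := by rw [map_add, vact_add]
  map_smul' r s := by rw [map_smul, vact_smul, RingHom.id_apply]

lemma ker_lower (a : Dual K T.h) {q : Multiset I →₀ K} (hq : q ≠ 0) :
    LinearMap.ker (T.lower a q) = ⊥ := by
  refine LinearMap.ker_eq_bot'.2 fun s hs => ?_
  change T.vact a (T.emb s) q = 0 at hs
  rw [← T.vact_emb_single a q, ← vact_mul, ← proj_eq_vact] at hs
  have h1 := T.eq_zero_of_mem_range_emb _ (T.mul_mem_range_emb ⟨s, rfl⟩ ⟨q, rfl⟩) hs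
  by_contra hs0
  exact pbw_mul_ne_zero T.b (fun h => hs0 (T.emb_injective (h.trans (map_zero _).symm)))
    (fun h => hq (T.emb_injective (h.trans (map_zero _).symm))) h1

lemma linearIndependent_vact_neg {A : Type*} {τ : A → Multiset I} (a : Dual K T.h)
    {q : Multiset I →₀ K} (hq : q ≠ 0) (hτ : Function.Injective τ) :
    LinearIndependent K fun x => T.vact a (T.neg (τ x)) q := by
  have h1 := ((Finsupp.basisSingleOne (R := K) (ι := Multiset I)).linearIndependent.comp
    τ hτ).map' _ (T.ker_lower a hq)
  have h2 : (T.lower a q ∘ Finsupp.basisSingleOne ∘ τ) = fun x => T.vact a (T.neg (τ x)) q := by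
    funext x
    simp [lower]
  exact h2 ▸ h1

section Weight

variable (η : Dual K T.h) [Fintype {π : Multiset I // T.mwt π = η}]

lemma vact_listProd_e_eq_sum (a : Dual K T.h) {π : Multiset I} (hπ : T.mwt π = η)
    (q : Multiset I →₀ K) :
    T.vact a (listProd T.b (π.toList.map .e)) q 0 =
      ∑ σ : {π : Multiset I // T.mwt π = η}, T.pairing a π σ * q σ := by
  classical
  induction q using Finsupp.induction_linear with
  | zero => simp
  | add p q hp hq =>
    rw [map_add, Finsupp.add_apply, hp, hq, ← Finset.sum_add_distrib]
    exact Finset.sum_congr rfl fun σ _ => by rw [Finsupp.add_apply, mul_add]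
  | single τ r =>
    have e1 : (Finsupp.single τ r : Multiset I →₀ K) = r • Finsupp.single τ 1 := by simp
    by_cases hτ : T.mwt τ = η
    · rw [Finset.sum_eq_single ⟨τ, hτ⟩, Finsupp.single_eq_same, e1, map_smul, Finsupp.smul_apply,
        smul_eq_mul, mul_comm]
      · rfl
      · intro σ _ hσ
        rw [Finsupp.single_eq_of_ne, mul_zero]
        exact fun h => hσ (Subtype.ext h)
      · simp
    · rw [Finset.sum_eq_zero]
      · by_contra h
        have h1 := T.vact_mem_wtS a (T.listProd_e_mem_wtU π)
          (Finsupp.single_mem_supported K r (show τ ∈ {σ | T.mwt σ = T.mwt τ} from rfl))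
        have h2 : T.mwt 0 = T.mwt τ - T.mwt π :=
          (Finsupp.mem_supported _ _).1 h1 (Finset.mem_coe.2 (Finsupp.mem_support_iff.2 h))
        rw [mwt_zero, hπ] at h2
        exact hτ (eq_of_sub_eq_zero h2.symm)
      · rintro ⟨σ, hσ⟩ -
        rw [Finsupp.single_eq_of_ne, mul_zero]
        rintro rfl
        exact hτ hσ

lemma pow_dvd_det_pairing [DecidableEq {π : Multiset I // T.mwt π = η}] (l ξ : Dual K T.h) (c : K)
    {i : I} {k : ℕ} (hk : 0 < k) (h : T.HasSingular (l + c • ξ) i k) :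
    (X - C c) ^ (Finset.univ.filter fun π : {π : Multiset I // T.mwt π = η} => k ≤ π.1.count i).card ∣
      (Matrix.of fun π σ : {π : Multiset I // T.mwt π = η} => T.pairing (line l ξ) π σ).det := by
  classical
  obtain ⟨q, hq0, hq, hqs⟩ := h
  rw [← Fintype.card_subtype]
  let p (π : {π : {π : Multiset I // T.mwt π = η} // k ≤ π.1.count i}) : Multiset I →₀ K :=
    T.vact (l + c • ξ) (T.neg (π.1.1 - k • {i})) q
  have hp : ∀ π, p π ∈ T.wtS K η := by
    intro π
    have h1 := T.vact_mem_wtS (l + c • ξ) (T.neg_mem_wtU (π.1.1 - k • {i})) hq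
    have h2 : k • {i} ≤ π.1.1 := by
      rw [Multiset.nsmul_singleton, ← Multiset.le_count_iff_replicate_le]
      exact π.2
    have h3 : k • T.wt i - -T.mwt (π.1.1 - k • {i}) = η := by
      rw [sub_neg_eq_add, ← mwt_singleton, ← mwt_nsmul, ← mwt_add, add_tsub_cancel_of_le h2]
      exact π.1.2
    rwa [h3] at h1
  refine pow_dvd_det _ c (fun π σ => p π σ) ?_ ?_
  · let f : ({π : Multiset I // T.mwt π = η} → K) →ₗ[K] (Multiset I →₀ K) :=
      ∑ σ, Finsupp.lsingle σ.1 ∘ₗ LinearMap.proj σ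
    refine LinearIndependent.of_comp f ?_
    have hf : (f ∘ fun π σ => p π σ) = p := by
      funext π
      ext τ
      simp only [f, Function.comp_apply, LinearMap.sum_apply, LinearMap.comp_apply,
        LinearMap.proj_apply, Finsupp.lsingle_apply, Finsupp.finsetSum_apply]
      by_cases hτ : T.mwt τ = η
      · rw [Finset.sum_eq_single ⟨τ, hτ⟩, Finsupp.single_eq_same]
        · intro σ _ hσ
          rw [Finsupp.single_eq_of_ne]
          exact fun h => hσ (Subtype.ext h.symm)
        · simp
      · rw [Finset.sum_eq_zero]
        · by_contra h
          exact hτ ((Finsupp.mem_supported _ _).1 (hp π)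
            (Finset.mem_coe.2 (Finsupp.mem_support_iff.2 (Ne.symm h))))
        · rintro ⟨σ, hσ⟩ -
          rw [Finsupp.single_eq_of_ne]
          rintro rfl
          exact hτ hσ
    rw [hf]
    refine T.linearIndependent_vact_neg _ hq0 fun π π' h => ?_
    have h2 : ∀ π : {π : {π : Multiset I // T.mwt π = η} // k ≤ π.1.count i},
        k • {i} ≤ π.1.1 := by
      intro π
      rw [Multiset.nsmul_singleton, ← Multiset.le_count_iff_replicate_le]
      exact π.2
    exact Subtype.ext (Subtype.ext ((tsub_left_inj (h2 π) (h2 π')).1 h))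
  · intro π r
    simp only [Matrix.of_apply, pairing_line_eval]
    rw [← T.vact_listProd_e_eq_sum η _ r.2, ← vact_mul]
    exact IsSingular.vact_apply_zero T hk hqs hq _

variable {T} {simple : Set I} {ht : I → ℕ} {ρ : Dual K T.h} (D : T.IsDynkin simple ht ρ)
include D

lemma IsDynkin.det_pairing_ne_zero [DecidableEq {π : Multiset I // T.mwt π = η}] {l : Dual K T.h}
    (hl : ∀ i, ∀ k : ℕ, 0 < k → (l + ρ) (T.t i) ≠ k) :
    (Matrix.of fun π σ : {π : Multiset I // T.mwt π = η} => T.pairing l π.1 σ.1).det ≠ 0 := by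
  classical
  let P := {π : Multiset I // T.mwt π = η}
  let J : Finset I := Finset.univ.biUnion fun π : P => π.1.toFinset
  let N : ℕ := Finset.univ.sup fun π : P => Multiset.card π.1
  let S : Finset (I × ℕ) := J ×ˢ Finset.Icc 1 N
  let a (i : I) : K := (l + ρ) (T.t i)
  let w : S ⊕ {x : S × S // x.1.1.1 ≠ x.2.1.1} → T.h := Sum.elim (fun x => T.t x.1.1)
    fun x => ((x.1.1.1.2 : K) - a x.1.1.1.1) • T.t x.1.2.1.1 -
      ((x.1.2.1.2 : K) - a x.1.2.1.1) • T.t x.1.1.1.1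
  have hS : ∀ x ∈ S, x.1 ∈ J ∧ 0 < x.2 := fun x hx => by
    have := Finset.mem_product.1 hx
    exact ⟨this.1, (Finset.mem_Icc.1 this.2).1⟩
  have hw : ∀ x, w x ≠ 0 := by
    rintro (x | ⟨⟨x, y⟩, hxy⟩)
    · intro h
      have := T.wt_t x.1.1
      rw [show T.t x.1.1 = 0 from h, map_zero] at this
      exact two_ne_zero this.symm
    · intro h
      have h1 := LinearIndependent.pair_iff.1 (D.indep _ _ hxy) (-((y.1.2 : K) - a y.1.1))
        ((x.1.2 : K) - a x.1.1) (by rw [neg_smul, ← h]; simp only [w, Sum.elim_inr]; abel)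
      exact hl x.1.1 x.1.2 (hS _ x.2).2 (sub_eq_zero.1 h1.2).symm
  obtain ⟨ξ, hξ⟩ := Module.exists_dual_forall_apply_ne_zero (K := K) w hw
  have hξt : ∀ x ∈ S, ξ (T.t x.1) ≠ 0 := fun x hx => hξ (Sum.inl ⟨x, hx⟩)
  have hsub : ∀ x ∈ S, (x.2 : K) - a x.1 ≠ 0 := fun x hx h =>
    hl x.1 x.2 (hS x hx).2 (sub_eq_zero.1 h).symm
  let c (x : I × ℕ) : K := ((x.2 : K) - a x.1) / ξ (T.t x.1)
  have hc : ∀ x ∈ S, ∀ y ∈ S, x ≠ y → c x ≠ c y := by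
    intro x hx y hy hxy h
    rw [div_eq_div_iff (hξt x hx) (hξt y hy)] at h
    by_cases h1 : x.1 = y.1
    · rw [h1] at h
      have h2 := mul_right_cancel₀ (hξt y hy) h
      rw [sub_left_inj, Nat.cast_inj] at h2
      exact hxy (Prod.ext h1 h2)
    · refine hξ (Sum.inr ⟨⟨⟨x, hx⟩, ⟨y, hy⟩⟩, h1⟩) ?_
      simp only [w, Sum.elim_inr, map_sub, map_smul, smul_eq_mul]
      exact sub_eq_zero.2 h
  have hξP : ∀ π : P, ∀ γ ∈ π.1, ξ (T.t γ) ≠ 0 := by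
    intro π γ hγ
    refine hξt (γ, 1) (Finset.mem_product.2 ⟨Finset.mem_biUnion.2 ⟨π, Finset.mem_univ _,
      Multiset.mem_toFinset.2 hγ⟩, Finset.mem_Icc.2 ⟨le_rfl, ?_⟩⟩)
    exact (Multiset.card_pos_iff_exists_mem.2 ⟨γ, hγ⟩ : 0 < _).trans_le
      (Finset.le_sup (f := fun π : P => Multiset.card π.1) (Finset.mem_univ π))
  let A : Matrix P P K[X] := Matrix.of fun π σ => T.pairing (line l ξ) π.1 σ.1
  obtain ⟨hA0, hAdeg⟩ := det_ne_zero_of_degree A (fun π => Multiset.card π.1)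
    (fun π σ hπσ => Or.inr (T.natDegree_pairing_of_ne l ξ (hξP π) fun h => hπσ (Subtype.ext h)))
    (fun π => T.pairing_self l ξ (hξP π))
  let m (x : I × ℕ) : ℕ := (Finset.univ.filter fun π : P => x.2 ≤ π.1.count x.1).card
  have hdvd : ∀ x ∈ S, (X - C (c x)) ^ m x ∣ A.det := by
    intro x hx
    refine T.pow_dvd_det_pairing η l ξ (c x) (hS x hx).2 (D.hasSingular (hS x hx).2 ?_)
    have h1 : c x * ξ (T.t x.1) = x.2 - a x.1 := div_mul_cancel₀ _ (hξt x hx)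
    have h2 : a x.1 = l (T.t x.1) + ρ (T.t x.1) := rfl
    rw [LinearMap.add_apply, LinearMap.add_apply, LinearMap.smul_apply, smul_eq_mul, h1, h2]
    ring
  have hprod : ∏ x ∈ S, (X - C (c x)) ^ m x ∣ A.det := by
    refine Finset.prod_dvd_of_coprime (fun x hx y hy hxy => ?_) hdvd
    exact (isCoprime_X_sub_C_of_isUnit_sub
      (sub_ne_zero.2 (hc x hx y hy hxy)).isUnit).pow
  have hsum : ∑ x ∈ S, m x = ∑ π : P, Multiset.card π.1 := by
    simp only [m, Finset.card_filter]
    rw [Finset.sum_comm]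
    refine Finset.sum_congr rfl fun π _ => ?_
    rw [Finset.sum_product]
    rw [← Multiset.sum_count_eq_card (s := J) fun i hi => Finset.mem_biUnion.2
      ⟨π, Finset.mem_univ _, Multiset.mem_toFinset.2 hi⟩]
    refine Finset.sum_congr rfl fun i _ => ?_
    rw [← Finset.card_filter]
    have hle : π.1.count i ≤ N := (Multiset.count_le_card _ _).trans
      (Finset.le_sup (f := fun π : P => Multiset.card π.1) (Finset.mem_univ π))
    have : (Finset.Icc 1 N).filter (fun k => k ≤ π.1.count i) = Finset.Icc 1 (π.1.count i) := by
      ext k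
      simp only [Finset.mem_filter, Finset.mem_Icc]
      omega
    rw [this, Nat.card_Icc, Nat.add_sub_cancel]
  have heval : (Matrix.of fun π σ : P => T.pairing l π.1 σ.1).det = A.det.eval 0 := by
    rw [← Polynomial.coe_evalRingHom, RingHom.map_det]
    congr 1
    ext π σ
    change _ = (T.pairing (line l ξ) π.1 σ.1).eval 0
    rw [pairing_line_eval, zero_smul, add_zero]
    rfl
  rw [heval]
  intro h0
  have hX : X ∣ A.det := by rw [Polynomial.X_dvd_iff, Polynomial.coeff_zero_eq_eval_zero, h0]
  have hcop : IsCoprime (X : K[X]) (∏ x ∈ S, (X - C (c x)) ^ m x) := by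
    refine IsCoprime.prod_right fun x hx => IsCoprime.pow_right ?_
    have := isCoprime_X_sub_C_of_isUnit_sub (a := (0 : K)) (b := c x)
      (by rw [zero_sub]; exact (neg_ne_zero.2 (div_ne_zero (hsub x hx) (hξt x hx))).isUnit)
    simpa using this
  have hdeg := Polynomial.natDegree_le_of_dvd (hcop.mul_dvd hX hprod) hA0
  have hmonic : (∏ x ∈ S, (X - C (c x)) ^ m x).Monic :=
    monic_prod_of_monic _ _ fun x _ => (monic_X_sub_C _).pow _
  rw [natDegree_mul X_ne_zero hmonic.ne_zero, natDegree_X,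
    natDegree_prod_of_monic _ _ fun x _ => (monic_X_sub_C _).pow _] at hdeg
  simp only [natDegree_pow, natDegree_X_sub_C, mul_one] at hdeg
  rw [hsum] at hdeg
  omega

end Weight

variable {T} {simple : Set I} {ht : I → ℕ} {ρ : Dual K T.h} (D : T.IsDynkin simple ht ρ)
include D

/-- A Verma module is simple exactly when its highest weight is antidominant. -/
theorem IsDynkin.isCoatom_vIdeal_iff (l : Dual K T.h) :
    IsCoatom (T.vIdeal l) ↔ ∀ i, ∀ k : ℕ, 0 < k → (l + ρ) (T.t i) ≠ k := by
  classical
  refine ⟨fun h i k hk hik => T.not_isCoatom_of_hasSingular hk (D.hasSingular hk hik) h,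
    fun hl => T.isCoatom_of_forall fun q hq => ?_⟩
  obtain ⟨σ, hσ⟩ := Finsupp.ne_iff.1 hq
  have : Fintype {π : Multiset I // T.mwt π = T.mwt σ} := (D.finite (T.mwt σ)).fintype
  have hdet := D.det_pairing_ne_zero (T.mwt σ) hl
  by_contra! h
  have h1 := Matrix.eq_zero_of_mulVec_eq_zero hdet
    (v := fun σ' : {π : Multiset I // T.mwt π = T.mwt σ} => q σ') (by
      funext π
      rw [Matrix.mulVec, dotProduct]
      exact (T.vact_listProd_e_eq_sum _ l π.2 q).symm.trans (h _))
  exact hσ (congrFun h1 ⟨σ, rfl⟩)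

end Tri

end VermaTheory

namespace LieAux

open Module

section Sl2

variable {K V : Type*} [Field K] [CharZero K] [AddCommGroup V] [Module K V]

/-- `h`, `e`, `f` satisfy the relations of the standard basis of `sl₂`. -/
structure Sl2 (h e f : End K V) : Prop where
  he : ∀ v, h (e v) = e (h v) + (2 : K) • e v
  hf : ∀ v, h (f v) = f (h v) - (2 : K) • f v
  ef : ∀ v, e (f v) = f (e v) + h v

lemma mem_maxGen_of_shift {h a : End K V} {c : K} (ha : ∀ v, h (a v) = a (h v) + c • a v)
    {μ : K} {v : V} (hv : v ∈ h.maxGenEigenspace μ) : a v ∈ h.maxGenEigenspace (μ + c) := by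
  rw [End.mem_maxGenEigenspace] at hv ⊢
  obtain ⟨k, hk⟩ := hv
  refine ⟨k, ?_⟩
  have : ∀ (k : ℕ) (w : V), ((h - (μ + c) • 1) ^ k) (a w) = a (((h - μ • 1) ^ k) w) := by
    intro k
    induction k with
    | zero => simp
    | succ k ih =>
      intro w
      rw [pow_succ, pow_succ, Module.End.mul_apply, Module.End.mul_apply, ← ih]
      congr 1
      simp [ha, add_smul]
  rw [this, hk, map_zero]

lemma pow_mem_maxGen_of_shift {h a : End K V} {c : K} (ha : ∀ v, h (a v) = a (h v) + c • a v)
    {μ : K} {v : V} (hv : v ∈ h.maxGenEigenspace μ) (n : ℕ) :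
    (a ^ n) v ∈ h.maxGenEigenspace (μ + n * c) := by
  induction n with
  | zero => simpa using hv
  | succ n ih =>
    rw [pow_succ', Module.End.mul_apply]
    convert mem_maxGen_of_shift ha ih using 2
    push_cast; ring

variable [FiniteDimensional K V]

lemma exists_pow_eq_zero_of_shift {h a : End K V} {c : K} (hc : c ≠ 0)
    (ha : ∀ v, h (a v) = a (h v) + c • a v) {μ : K} {v : V} (hv : v ∈ h.maxGenEigenspace μ) :
    ∃ n, (a ^ n) v = 0 := by
  by_contra! H
  have hfin := WellFoundedGT.finite_ne_bot_of_iSupIndep h.independent_maxGenEigenspace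
  have hinj : Function.Injective fun n : ℕ => μ + n * c := by
    intro m n hmn
    have := mul_right_cancel₀ hc (add_left_cancel hmn)
    exact_mod_cast this
  refine Set.infinite_range_of_injective hinj (hfin.subset ?_)
  rintro _ ⟨n, rfl⟩
  intro h0
  have := pow_mem_maxGen_of_shift ha hv n
  rw [h0] at this
  exact H n (by simpa using this)

lemma mem_maxGen_of_sq {h : End K V} {μ : K} {v u : V} (h1 : h v = μ • v + u) (h2 : h u = μ • u) :
    v ∈ h.maxGenEigenspace μ := by
  rw [End.mem_maxGenEigenspace]
  refine ⟨2, ?_⟩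
  simp [pow_two, h1, h2]

lemma mem_maxGen_of_eig {h : End K V} {μ : K} {u : V} (h2 : h u = μ • u) :
    u ∈ h.maxGenEigenspace μ :=
  mem_maxGen_of_sq (u := 0) (by simpa using h2) (by simp)

namespace Sl2

variable {h e f : End K V} (S : Sl2 h e f)
include S

omit [FiniteDimensional K V] [CharZero K] in
lemma h_f_pow (n : ℕ) (v : V) : h ((f ^ n) v) = (f ^ n) (h v) - (2 * n : K) • (f ^ n) v := by
  induction n with
  | zero => simp
  | succ n ih =>
    rw [pow_succ', Module.End.mul_apply, S.hf, ih, Module.End.mul_apply]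
    simp only [map_sub, map_smul]
    push_cast
    module

omit [FiniteDimensional K V] [CharZero K] in
lemma h_e_pow (n : ℕ) (v : V) : h ((e ^ n) v) = (e ^ n) (h v) + (2 * n : K) • (e ^ n) v := by
  induction n with
  | zero => simp
  | succ n ih =>
    rw [pow_succ', Module.End.mul_apply, S.he, ih, Module.End.mul_apply]
    simp only [map_add, map_smul]
    push_cast
    module

omit [FiniteDimensional K V] [CharZero K] in
lemma e_f_pow {w : V} (hw : e w = 0) (n : ℕ) :
    e ((f ^ (n + 1)) w) = (n + 1 : K) • (f ^ n) (h w - (n : K) • w) := by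
  induction n with
  | zero => simp [S.ef, hw]
  | succ n ih =>
    rw [pow_succ', Module.End.mul_apply, S.ef, ih, S.h_f_pow, map_smul, ← Module.End.mul_apply,
      ← pow_succ']
    simp only [map_sub, map_smul]
    push_cast
    module

lemma exists_e_pow {μ : K} {v : V} (hv : v ∈ h.maxGenEigenspace μ) (h0 : v ≠ 0) :
    ∃ n, (e ^ n) v ≠ 0 ∧ e ((e ^ n) v) = 0 := by
  have hex := exists_pow_eq_zero_of_shift two_ne_zero S.he hv
  classical
  have hpos : Nat.find hex ≠ 0 := fun h => h0 (by simpa [h] using Nat.find_spec hex)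
  obtain ⟨n, hn⟩ := Nat.exists_eq_succ_of_ne_zero hpos
  refine ⟨n, Nat.find_min hex (by omega), ?_⟩
  have := Nat.find_spec hex
  rwa [hn, Nat.succ_eq_add_one, pow_succ', Module.End.mul_apply] at this

lemma exists_f_pow {μ : K} {v : V} (hv : v ∈ h.maxGenEigenspace μ) (h0 : v ≠ 0) :
    ∃ n, (f ^ n) v ≠ 0 ∧ f ((f ^ n) v) = 0 := by
  have hex := exists_pow_eq_zero_of_shift (c := (-2 : K)) (by simp)
    (fun v => by rw [S.hf]; module) hv
  classical
  have hpos : Nat.find hex ≠ 0 := fun h => h0 (by simpa [h] using Nat.find_spec hex)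
  obtain ⟨n, hn⟩ := Nat.exists_eq_succ_of_ne_zero hpos
  refine ⟨n, Nat.find_min hex (by omega), ?_⟩
  have := Nat.find_spec hex
  rwa [hn, Nat.succ_eq_add_one, pow_succ', Module.End.mul_apply] at this

lemma primitive_nat {μ : K} {w : V} (he : e w = 0) (hw : h w = μ • w) (h0 : w ≠ 0) :
    ∃ n : ℕ, μ = n ∧ (f ^ n) w ≠ 0 ∧ f ((f ^ n) w) = 0 := by
  obtain ⟨n, hn, hn'⟩ := S.exists_f_pow (mem_maxGen_of_eig hw) h0
  refine ⟨n, ?_, hn, hn'⟩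
  have := S.e_f_pow he n
  rw [pow_succ', Module.End.mul_apply, hn', map_zero, hw, ← sub_smul, map_smul, smul_smul] at this
  have h1 := (smul_eq_zero.1 this.symm).resolve_right hn
  exact sub_eq_zero.1 ((mul_eq_zero.1 h1).resolve_left (by exact_mod_cast n.succ_ne_zero))

lemma primitive_eig {μ : K} {w u : V} (he : e w = 0) (hw : h w = μ • w + u) (hu : h u = μ • u) :
    u = 0 := by
  by_contra h0
  have heu : e u = 0 := by
    have := S.he w
    rw [hw, he] at this
    simpa [he] using this.symm
  obtain ⟨n, rfl, hn, hn'⟩ := S.primitive_nat heu hu h0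
  have hfu : ∀ k, n + 1 ≤ k → (f ^ k) u = 0 := by
    intro k hk
    obtain ⟨j, rfl⟩ := Nat.exists_eq_add_of_le hk
    rw [add_comm, pow_add, Module.End.mul_apply, pow_succ', Module.End.mul_apply, hn', map_zero]
  have key : ∀ j, (f ^ (n + 1 + j)) w ≠ 0 := by
    intro j
    induction j with
    | zero =>
      intro h1
      have := S.e_f_pow he n
      rw [show n + 1 = n + 1 + 0 from rfl, h1, map_zero, hw, add_sub_cancel_left] at this
      exact hn ((smul_eq_zero.1 this.symm).resolve_left (by exact_mod_cast n.succ_ne_zero))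
    | succ j ih =>
      intro h1
      have := S.e_f_pow he (n + 1 + j)
      rw [show n + 1 + j + 1 = n + 1 + (j + 1) from rfl, h1, map_zero, hw, map_sub, map_add,
        hfu _ (by omega), add_zero, map_smul, map_smul, ← sub_smul, smul_smul] at this
      refine ih ((smul_eq_zero.1 this.symm).resolve_left ?_)
      push_cast
      refine mul_ne_zero (by exact_mod_cast (n + 1 + j).succ_ne_zero) ?_
      rw [sub_ne_zero]
      exact_mod_cast (by omega : n ≠ n + 1 + j)
  obtain ⟨m, hm⟩ := exists_pow_eq_zero_of_shift (c := (-2 : K)) (by simp)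
    (fun v => by rw [S.hf]; module) (mem_maxGen_of_sq hw hu)
  refine key m ?_
  rw [pow_add, Module.End.mul_apply, hm, map_zero]

end Sl2

/-- The Casimir operator (up to normalisation). -/
def cas (h e f : End K V) : End K V := (2 : K) • (f * e) + (2⁻¹ : K) • (h * h) + h

namespace Sl2

variable {h e f : End K V} (S : Sl2 h e f)
include S

omit [FiniteDimensional K V] in
lemma cas_comm_e (v : V) : cas h e f (e v) = e (cas h e f v) := by
  simp only [cas, LinearMap.add_apply, LinearMap.smul_apply, Module.End.mul_apply, map_add,
    map_smul, S.ef, S.he, smul_add, smul_smul]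
  have : (2⁻¹ : K) * 2 = 1 := by norm_num
  simp only [this]
  match_scalars <;> norm_num

omit [FiniteDimensional K V] in
lemma cas_comm_h (v : V) : cas h e f (h v) = h (cas h e f v) := by
  simp only [cas, LinearMap.add_apply, LinearMap.smul_apply, Module.End.mul_apply, map_add,
    map_smul, S.hf, S.he]
  match_scalars <;> norm_num

omit [CharZero K] [FiniteDimensional K V] S in
lemma eig_eq_of_mem_maxGen {g : End K V} {c ω : K} {w : V} (h0 : w ≠ 0) (hw : g w = c • w)
    (hω : w ∈ g.maxGenEigenspace ω) : c = ω := by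
  by_contra hne
  have h1 : w ∈ g.maxGenEigenspace c := by
    rw [End.mem_maxGenEigenspace]; exact ⟨1, by simp [hw]⟩
  exact h0 ((Submodule.disjoint_def.1 (End.disjoint_genEigenspace g hne ⊤ ⊤)) w h1 hω)

omit [FiniteDimensional K V] [CharZero K] in
lemma cas_primitive {μ : K} {w : V} (he : e w = 0) (hw : h w = μ • w) :
    cas h e f w = (2⁻¹ * (μ * μ) + μ) • w := by
  simp only [cas, LinearMap.add_apply, LinearMap.smul_apply, Module.End.mul_apply, he, hw,
    map_smul, map_zero]
  module

lemma cas_eig {μ ω : K} {v u : V} (hv : v ∈ (cas h e f).maxGenEigenspace ω)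
    (h1 : h v = μ • v + u) (h2 : h u = μ • u) : u = 0 := by
  by_contra h0
  have hv0 : v ≠ 0 := by
    rintro rfl
    exact h0 (by simpa using h1.symm)
  have key : ∀ {x y : V}, x ∈ (cas h e f).maxGenEigenspace ω → h x = μ • x + y → h y = μ • y →
      x ≠ 0 → ∃ j m : ℕ, (e ^ j) x ≠ 0 ∧ (e ^ j) y = 0 ∧ μ + 2 * j = m ∧
        2⁻¹ * ((m : K) * m) + m = ω := by
    intro x y hx h1 h2 h0
    obtain ⟨j, hj, hj'⟩ := S.exists_e_pow (mem_maxGen_of_sq h1 h2) h0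
    have h3 : h ((e ^ j) x) = (μ + 2 * j) • (e ^ j) x + (e ^ j) y := by
      rw [S.h_e_pow, h1]; simp only [map_add, map_smul]; module
    have h4 : h ((e ^ j) y) = (μ + 2 * j) • (e ^ j) y := by
      rw [S.h_e_pow, h2]; simp only [map_smul]; module
    have h5 := S.primitive_eig hj' h3 h4
    rw [h5, add_zero] at h3
    obtain ⟨m, hm, -, -⟩ := S.primitive_nat hj' h3 hj
    refine ⟨j, m, hj, h5, hm, ?_⟩
    rw [hm] at h3
    refine eig_eq_of_mem_maxGen hj (S.cas_primitive hj' h3) ?_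
    refine End.mapsTo_maxGenEigenspace_of_comm (Commute.pow_right ?_ j) ω hx
    exact LinearMap.ext S.cas_comm_e
  have hu : u ∈ (cas h e f).maxGenEigenspace ω := by
    have : u = h v - μ • v := by rw [h1]; abel
    rw [this]
    refine Submodule.sub_mem _ ?_ (Submodule.smul_mem _ _ hv)
    exact End.mapsTo_maxGenEigenspace_of_comm
      (show Commute (cas h e f) h from LinearMap.ext S.cas_comm_h) ω hv
  obtain ⟨j, m, hj, hju, hm, hω⟩ := key hv h1 h2 hv0
  obtain ⟨i, m', hi, -, hm', hω'⟩ := key (y := 0) hu (by simpa using h2) (by simp) h0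
  have hmm : m = m' := by
    have h3 : (m : K) * m + 2 * m = m' * m' + 2 * m' := by linear_combination 2 * hω - 2 * hω'
    have h3 : m * m + 2 * m = m' * m' + 2 * m' := by exact_mod_cast h3
    nlinarith
  have hij : j = i := by
    rw [hmm, ← hm', add_right_inj, mul_right_inj' two_ne_zero] at hm
    exact_mod_cast hm
  exact hi (hij ▸ hju)

/-- In a finite-dimensional representation of `sl₂`, `h` acts diagonalizably. -/
theorem iSup_eigenspace [IsAlgClosed K] : ⨆ μ, h.eigenspace μ = ⊤ := by
  have hc : Commute h (cas h e f) := (LinearMap.ext fun v => (S.cas_comm_h v).symm)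
  have := End.iSup_iInf_maxGenEigenspace_eq_top_of_iSup_maxGenEigenspace_eq_top_of_commute
    (fun b : Bool => if b then h else cas h e f)
    (fun i j hij => by cases i <;> cases j <;> simp [hc, hc.symm] at hij ⊢)
    (fun i => End.iSup_maxGenEigenspace_eq_top _)
  rw [eq_top_iff, ← this]
  refine iSup_le fun χ => le_iSup_of_le (χ true) fun v hv => ?_
  rw [Submodule.mem_iInf] at hv
  have h1 : v ∈ h.maxGenEigenspace (χ true) := by simpa using hv true
  have h2 : v ∈ (cas h e f).maxGenEigenspace (χ false) := by simpa using hv false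
  generalize χ true = μ at h1
  rw [End.mem_maxGenEigenspace] at h1
  obtain ⟨k, hk⟩ := h1
  rw [End.mem_eigenspace_iff, ← sub_eq_zero]
  have hd : ∀ x, (h - μ • 1) x = h x - μ • x := fun x => by simp
  rw [← hd]
  induction k with
  | zero => simp at hk; simp [hk]
  | succ k ih =>
    rcases k with - | k
    · simpa using hk
    · refine ih ?_
      have hmem : ((h - μ • 1) ^ k) v ∈ (cas h e f).maxGenEigenspace (χ false) := by
        refine End.mapsTo_maxGenEigenspace_of_comm (Commute.pow_right ?_ k) _ h2
        exact Commute.sub_right hc.symm ((Commute.one_right _).smul_right _)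
      refine S.cas_eig (μ := μ) hmem ?_ ?_
      · rw [pow_succ', Module.End.mul_apply, hd]; abel
      · rw [← sub_eq_zero, ← hd, ← Module.End.mul_apply, ← pow_succ', hk]

end Sl2
end Sl2
end LieAux

namespace LieAux

open Module LieAlgebra LieModule

section Radical

variable {K F : Type*} [Field K] [LieRing F] [LieAlgebra K F]

lemma mem_center_iff' {x : F} : x ∈ center K F ↔ ∀ y : F, ⁅y, x⁆ = 0 := by
  rw [LieModule.mem_maxTrivSubmodule]

lemma center_lie {x : F} (hx : x ∈ center K F) (y : F) : ⁅x, y⁆ = 0 := by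
  rw [← lie_skew, mem_center_iff'.1 hx, neg_zero]

lemma isLieAbelian_iff (I : LieIdeal K F) : IsLieAbelian I ↔ ∀ x ∈ I, ∀ y ∈ I, ⁅x, y⁆ = 0 := by
  constructor
  · intro h x hx y hy
    have := h.trivial ⟨x, hx⟩ ⟨y, hy⟩
    exact congrArg Subtype.val this
  · intro h
    exact ⟨fun x y => Subtype.ext (h x x.2 y y.2)⟩

/-- The centre of an ideal, as an ideal. -/
def idealCenter (A : LieIdeal K F) : LieIdeal K F where
  carrier := {a | a ∈ A ∧ ∀ b ∈ A, ⁅a, b⁆ = 0}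
  add_mem' := by
    rintro a b ⟨ha, ha'⟩ ⟨hb, hb'⟩
    exact ⟨A.add_mem ha hb, fun c hc => by rw [add_lie, ha' c hc, hb' c hc, add_zero]⟩
  zero_mem' := ⟨A.zero_mem, by simp⟩
  smul_mem' := by
    rintro t a ⟨ha, ha'⟩
    exact ⟨A.smul_mem t ha, fun c hc => by rw [smul_lie, ha' c hc, smul_zero]⟩
  lie_mem := by
    rintro x a ⟨ha, ha'⟩
    refine ⟨A.lie_mem ha, fun c hc => ?_⟩
    rw [lie_lie, ha' c hc, lie_zero, zero_sub, ha' _ (A.lie_mem hc), neg_zero]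

variable [IsAlgClosed K] [CharZero K] [FiniteDimensional K F]

lemma le_center_of_lie_le_center
    (hred : ∀ I : LieIdeal K F, IsLieAbelian I → I ≤ center K F)
    (M : LieIdeal K F) [IsSolvable M] (hM : ⁅⁅M, M⁆, ⁅M, M⁆⁆ ≤ center K F) :
    ⁅M, M⁆ ≤ center K F := by
  set A := ⁅M, M⁆ with hA
  by_contra hnot
  let N : LieSubmodule K F A := LieSubmodule.comap (LieSubmodule.incl A) (center K F)
  have hmem : ∀ a : A, (LieSubmodule.Quotient.mk a : A ⧸ N) = 0 ↔ (a : F) ∈ center K F := by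
    intro a
    rw [LieSubmodule.Quotient.mk_eq_zero']
    rfl
  have hnt : Nontrivial (A ⧸ N) := by
    obtain ⟨a, ha, ha'⟩ := SetLike.not_le_iff_exists.1 hnot
    exact ⟨⟨LieSubmodule.Quotient.mk ⟨a, ha⟩, 0, fun h => ha' ((hmem _).1 h)⟩⟩
  have hfin : FiniteDimensional K (A ⧸ N) :=
    inferInstanceAs (FiniteDimensional K (A ⧸ N.toSubmodule))
  obtain ⟨χ, hχ⟩ := exists_nontrivial_weightSpace_of_isSolvable K M (A ⧸ N)
  let W : LieSubmodule K F (A ⧸ N) := weightSpaceOfIsLieTower K (A ⧸ N) (χ : M → K)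
  have hW : ∀ v : A ⧸ N, v ∈ W ↔ ∀ m : M, ⁅m, v⁆ = χ m • v := fun v => mem_weightSpace _ _
  let U : LieIdeal K F := LieSubmodule.map (LieSubmodule.incl A)
    (LieSubmodule.comap (LieSubmodule.Quotient.mk' N) W)
  have hU : ∀ u ∈ U, ∃ hu : u ∈ A, ∀ m : M, ⁅(m : F), u⁆ - χ m • u ∈ center K F := by
    intro u hu
    obtain ⟨a, ha, rfl⟩ := (LieSubmodule.mem_map u).1 hu
    refine ⟨a.2, fun m => ?_⟩
    have := (hW _).1 ha m
    rw [← sub_eq_zero] at this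
    exact (hmem (⁅(m : F), a⁆ - χ m • a)).1 this
  obtain ⟨⟨v, hv⟩, hv0⟩ := exists_ne (0 : weightSpace (A ⧸ N) (χ : M → K))
  obtain ⟨a, rfl⟩ := LieSubmodule.Quotient.surjective_mk' N v
  have haU : (a : F) ∈ U := (LieSubmodule.mem_map _).2 ⟨a, hv, rfl⟩
  have haZ : (a : F) ∉ center K F := by
    intro h
    exact hv0 (Subtype.ext ((hmem a).2 h))
  by_cases h0 : χ = 0
  · refine haZ (hred (idealCenter A) ?_ ⟨a.2, ?_⟩)
    · rw [isLieAbelian_iff]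
      exact fun x hx y hy => hx.2 y hy.1
    · have hma : ∀ m ∈ M, ⁅m, (a : F)⁆ ∈ center K F := by
        intro m hm
        obtain ⟨-, h⟩ := hU a haU
        simpa [h0] using h ⟨m, hm⟩
      intro b hb
      rw [hA, ← LieSubmodule.mem_toSubmodule, LieSubmodule.lieIdeal_oper_eq_linear_span'] at hb
      induction hb using Submodule.span_induction with
      | mem x hx =>
        obtain ⟨m, hm, m', hm', rfl⟩ := hx
        have h1 : ∀ m ∈ M, ⁅(a : F), m⁆ ∈ center K F := fun m hm => by
          rw [← lie_skew]; exact neg_mem (hma m hm)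
        rw [leibniz_lie, center_lie (h1 m hm), mem_center_iff'.1 (h1 m' hm'), add_zero]
      | zero => simp
      | add x y _ _ hx hy => rw [lie_add, hx, hy, add_zero]
      | smul c x _ hx => rw [lie_smul, hx, smul_zero]
  · obtain ⟨m, hm⟩ : ∃ m, χ m ≠ 0 := by
      by_contra! h
      exact h0 (LinearMap.ext h)
    refine haZ (hred U ?_ haU)
    rw [isLieAbelian_iff]
    intro x hx y hy
    obtain ⟨hxA, hx⟩ := hU x hx
    obtain ⟨hyA, hy⟩ := hU y hy
    have hxy : ⁅x, y⁆ ∈ center K F := hM (LieSubmodule.lie_mem_lie hxA hyA)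
    have h1 : ⁅(m : F), x⁆ = χ m • x + (⁅(m : F), x⁆ - χ m • x) := by abel
    have h2 : ⁅(m : F), y⁆ = χ m • y + (⁅(m : F), y⁆ - χ m • y) := by abel
    have := mem_center_iff'.1 hxy m
    rw [leibniz_lie, h1, h2, add_lie, lie_add, center_lie (hx m), mem_center_iff'.1 (hy m),
      add_zero, add_zero, smul_lie, lie_smul, ← two_smul K, smul_smul] at this
    exact (smul_eq_zero.1 this).resolve_left (mul_ne_zero two_ne_zero hm)

/-- If every abelian ideal is central, the radical is nilpotent of class at most two. -/
theorem lie_radical_le_center (hred : ∀ I : LieIdeal K F, IsLieAbelian I → I ≤ center K F) :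
    ⁅radical K F, radical K F⁆ ≤ center K F := by
  obtain ⟨k, hk⟩ := IsSolvable.solvable (R := K) (L := radical K F)
  rw [LieIdeal.derivedSeries_eq_bot_iff] at hk
  have hD : ∀ j, derivedSeriesOfIdeal K F (k - j + 1) (radical K F) ≤ center K F := by
    intro j
    induction j with
    | zero =>
      rw [Nat.sub_zero]
      exact (derivedSeriesOfIdeal_succ_le _ _).trans (hk.le.trans bot_le)
    | succ j ih =>
      by_cases hj : k ≤ j
      · rw [show k - (j + 1) = k - j by omega]; exact ih
      · rw [show k - j = k - (j + 1) + 1 by omega] at ih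
        rw [derivedSeriesOfIdeal_succ, derivedSeriesOfIdeal_succ] at ih
        rw [derivedSeriesOfIdeal_succ]
        have : IsSolvable (derivedSeriesOfIdeal K F (k - (j + 1)) (radical K F)) :=
          le_solvable_ideal_solvable (derivedSeriesOfIdeal_le_self _ _) inferInstance
        exact le_center_of_lie_le_center hred _ ih
  have := hD k
  simpa [derivedSeriesOfIdeal_succ] using this

end Radical

section Quotient

variable {K F : Type*} [Field K] [LieRing F] [LieAlgebra K F] [FiniteDimensional K F]

/-- The quotient map by an ideal. -/
def quotHom (I : LieIdeal K F) : F →ₗ⁅K⁆ F ⧸ I :=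
  { (LieSubmodule.Quotient.mk' I : F →ₗ[K] F ⧸ I) with
    map_lie' := fun {_ _} => rfl }

omit [FiniteDimensional K F] in
lemma quotHom_surjective (I : LieIdeal K F) : Function.Surjective (quotHom I) :=
  LieSubmodule.Quotient.surjective_mk' I

omit [FiniteDimensional K F] in
lemma quotHom_eq_zero {I : LieIdeal K F} {x : F} : quotHom I x = 0 ↔ x ∈ I :=
  LieSubmodule.Quotient.mk_eq_zero'

/-- The quotient by the radical has trivial radical. -/
theorem hasTrivialRadical_quotient : HasTrivialRadical K (F ⧸ radical K F) := by
  refine ⟨?_⟩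
  have hfin : FiniteDimensional K (F ⧸ radical K F) :=
    inferInstanceAs (FiniteDimensional K (F ⧸ (radical K F).toSubmodule))
  have hker : ∀ x, quotHom (radical K F) x = 0 ↔ x ∈ radical K F := fun x => quotHom_eq_zero
  set J := radical K (F ⧸ radical K F)
  let I := LieIdeal.comap (quotHom (radical K F)) J
  have hle : ∀ k, derivedSeriesOfIdeal K F k I ≤
      LieIdeal.comap (quotHom (radical K F)) (derivedSeriesOfIdeal K _ k J) := by
    intro k
    induction k with
    | zero => exact le_rfl
    | succ k ih =>
      rw [derivedSeriesOfIdeal_succ, derivedSeriesOfIdeal_succ]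
      exact (LieSubmodule.mono_lie ih ih).trans (LieIdeal.comap_bracket_le _)
  obtain ⟨k, hk⟩ := IsSolvable.solvable (R := K) (L := J)
  obtain ⟨l, hl⟩ := IsSolvable.solvable (R := K) (L := radical K F)
  rw [LieIdeal.derivedSeries_eq_bot_iff] at hk hl
  have h1 : derivedSeriesOfIdeal K F k I ≤ radical K F := by
    intro x hx
    have := hle k hx
    rw [hk, LieIdeal.mem_comap, LieSubmodule.mem_bot, hker] at this
    exact this
  have h2 : derivedSeriesOfIdeal K F (l + k) I = ⊥ := by
    rw [derivedSeriesOfIdeal_add, ← le_bot_iff, ← hl]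
    exact derivedSeriesOfIdeal_mono h1 l
  rw [← LieIdeal.derivedSeries_eq_bot_iff] at h2
  have h3 : I ≤ radical K F := (LieIdeal.solvable_iff_le_radical K F I).1 (IsSolvable.mk h2)
  rw [LieSubmodule.eq_bot_iff]
  intro y hy
  obtain ⟨x, rfl⟩ := quotHom_surjective (radical K F) y
  exact (hker x).2 (h3 hy)

end Quotient
end LieAux

namespace LieAux

open Module LieAlgebra LieModule

lemma exists_common_eigenvector {K V : Type*} [Field K] [IsAlgClosed K] [AddCommGroup V]
    [Module K V] [FiniteDimensional K V] (P : Set (End K V)) (hP : ∀ f ∈ P, ∀ g ∈ P, Commute f g)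
    (V₀ : Submodule K V) (h0 : V₀ ≠ ⊥) (hst : ∀ f ∈ P, ∀ v ∈ V₀, f v ∈ V₀) :
    ∃ v ∈ V₀, v ≠ 0 ∧ ∀ f ∈ P, ∃ c : K, f v = c • v := by
  obtain ⟨W, ⟨hW0, hWV, hWst⟩, hmin⟩ := (wellFounded_lt (α := Submodule K V)).has_min
    {W | W ≠ ⊥ ∧ W ≤ V₀ ∧ ∀ f ∈ P, ∀ v ∈ W, f v ∈ W} ⟨V₀, h0, le_rfl, hst⟩
  obtain ⟨v, hv, hv0⟩ := W.ne_bot_iff.1 hW0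
  refine ⟨v, hWV hv, hv0, fun f hf => ?_⟩
  have : Nontrivial W := ⟨⟨⟨v, hv⟩, 0, fun h => hv0 (congrArg Subtype.val h)⟩⟩
  obtain ⟨c, hc⟩ := End.exists_eigenvalue (f.restrict (hWst f hf))
  obtain ⟨⟨w, hwW⟩, hw⟩ := hc.exists_hasEigenvector
  have hw1 : f w = c • w := congrArg Subtype.val hw.apply_eq_smul
  have hw0 : w ≠ 0 := fun h => hw.2 (Subtype.ext h)
  refine ⟨c, ?_⟩
  by_contra hne
  refine hmin (W ⊓ f.eigenspace c) ⟨?_, inf_le_left.trans hWV, ?_⟩ ?_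
  · exact (Submodule.ne_bot_iff _).2 ⟨w, ⟨hwW, End.mem_eigenspace_iff.2 hw1⟩, hw0⟩
  · rintro g hg u ⟨hu, hu'⟩
    refine ⟨hWst g hg u hu, ?_⟩
    rw [SetLike.mem_coe, End.mem_eigenspace_iff] at hu' ⊢
    rw [← Module.End.mul_apply, (hP f hf g hg).eq, Module.End.mul_apply, hu', map_smul]
  · exact lt_of_le_of_ne inf_le_left fun h => hne (by
      rw [← End.mem_eigenspace_iff]
      exact (inf_eq_left.1 h) hv)

section Isotropic

variable {K F V Z : Type*} [Field K] [CharZero K] [LieRing F] [LieAlgebra K F]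
  [AddCommGroup V] [Module K V] [LieRingModule F V] [LieModule K F V]
  [AddCommGroup Z] [Module K Z]

/-- The elements of `F` acting on `V` with degree `2 k` with respect to `H`. -/
def degree (K : Type*) [Field K] {F : Type*} (V : Type*) [LieRing F] [LieAlgebra K F]
    [AddCommGroup V] [Module K V] [LieRingModule F V] [LieModule K F V]
    (H : F) (k : ℤ) : Submodule K F where
  carrier := {x | ∀ v : V, ⁅H, ⁅x, v⁆⁆ = ⁅x, ⁅H, v⁆⁆ + (2 * k : K) • ⁅x, v⁆}
  add_mem' := by
    intro x y hx hy v
    simp only [add_lie, lie_add, hx v, hy v, smul_add]; abel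
  zero_mem' := by intro v; simp
  smul_mem' := by
    intro c x hx v
    simp only [smul_lie, lie_smul, hx v, smul_add, smul_comm c]

lemma invariant_pow (ω : V →ₗ[K] V →ₗ[K] Z) {x : F}
    (hω : ∀ v w, ω ⁅x, v⁆ w + ω v ⁅x, w⁆ = 0) (n : ℕ) (v w : V) :
    ω ((toEnd K F V x ^ n) v) w = (-1 : K) ^ n • ω v ((toEnd K F V x ^ n) w) := by
  induction n generalizing v w with
  | zero => simp
  | succ n ih =>
    rw [pow_succ, Module.End.mul_apply, ih, toEnd_apply_apply, eq_neg_of_add_eq_zero_left (hω _ _),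
      ← toEnd_apply_apply K, smul_neg,
      pow_succ (-1 : K) n, mul_neg, mul_one, neg_smul, ← Module.End.mul_apply, ← pow_succ', pow_succ]

lemma Sl2.e_pow_f_pow {h e f : End K V} (S : Sl2 h e f) {n : ℕ} {v : V} (he : e v = 0)
    (hv : h v = (n : K) • v) (k : ℕ) (hk : k ≤ n) :
    ∃ a : K, a ≠ 0 ∧ (e ^ k) ((f ^ k) v) = a • v := by
  induction k with
  | zero => exact ⟨1, one_ne_zero, by simp⟩
  | succ k ih =>
    obtain ⟨a, ha, h⟩ := ih (by omega)
    refine ⟨(k + 1) * (n - k) * a, mul_ne_zero (mul_ne_zero (by exact_mod_cast k.succ_ne_zero)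
      (sub_ne_zero.2 (by exact_mod_cast (by omega : n ≠ k)))) ha, ?_⟩
    rw [pow_succ, Module.End.mul_apply, S.e_f_pow he, hv, ← sub_smul, map_smul, map_smul, map_smul,
      h]
    module

variable [FiniteDimensional K V] [IsAlgClosed K]

/-- An invariant alternating form on a module with an even weight for a principal `sl₂` has a
nonzero isotropic submodule. -/
theorem exists_isotropic (ω : V →ₗ[K] V →ₗ[K] Z) (hω1 : ∀ v w, ω v w = -ω w v)
    (hω2 : ∀ (x : F) (v w : V), ω ⁅x, v⁆ w + ω v ⁅x, w⁆ = 0)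
    {H E F' : F} (S : Sl2 (toEnd K F V H) (toEnd K F V E) (toEnd K F V F'))
    (A : ℤ → Submodule K F) (hAd : ∀ k, A k ≤ degree K V H k) (hA : ⨆ k, A k = ⊤)
    (hcomm : ∀ x ∈ A 0, ∀ y ∈ A 0, ∀ v : V, ⁅x, ⁅y, v⁆⁆ = ⁅y, ⁅x, v⁆⁆)
    {k₀ : ℤ} {v₀ : V} (hv₀ : v₀ ≠ 0) (hk₀ : ⁅H, v₀⁆ = (2 * k₀ : K) • v₀) :
    ∃ Y : LieSubmodule K F V, Y ≠ ⊥ ∧ ∀ y ∈ Y, ∀ y' ∈ Y, ω y y' = 0 := by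
  have hind : ∀ {p : F → Prop}, (∀ k, ∀ x ∈ A k, p x) → p 0 →
      (∀ x y, p x → p y → p (x + y)) → ∀ x, p x := by
    intro p h1 h2 h3 x
    exact Submodule.iSup_induction _ (motive := p) (hA ▸ Submodule.mem_top : x ∈ _) h1 h2 h3
  obtain ⟨d, ⟨v₁, hv₁, hd⟩, hmax⟩ : ∃ d : ℤ, (∃ v : V, v ≠ 0 ∧ ⁅H, v⁆ = (2 * d : K) • v) ∧
      ∀ k : ℤ, d < k → ∀ v : V, ⁅H, v⁆ = (2 * k : K) • v → v = 0 := by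
    have hfin : {k : ℤ | ∃ v : V, v ≠ 0 ∧ ⁅H, v⁆ = (2 * k : K) • v}.Finite := by
      refine Set.Finite.subset (Set.Finite.preimage (f := fun k : ℤ => (2 * k : K)) ?_
        (End.finite_hasEigenvalue (toEnd K F V H))) ?_
      · intro a _ b _ h
        exact_mod_cast mul_left_cancel₀ two_ne_zero h
      · rintro k ⟨v, h0, h⟩
        exact End.hasEigenvalue_of_hasEigenvector ⟨End.mem_eigenspace_iff.2 h, h0⟩
    obtain ⟨d, hd, hmax⟩ := Set.exists_max_image _ id hfin ⟨k₀, v₀, hv₀, hk₀⟩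
    refine ⟨d, hd, fun k hk v hv => ?_⟩
    by_contra h0
    exact absurd (hmax k ⟨v, h0, hv⟩) (not_le.2 hk)
  have hshift : ∀ (k : ℤ) (x : F), x ∈ degree K V H k → ∀ (c : ℤ) (v : V),
      ⁅H, v⁆ = (2 * c : K) • v → ⁅H, ⁅x, v⁆⁆ = (2 * (c + k : ℤ) : K) • ⁅x, v⁆ := by
    intro k x hx c v hv
    rw [hx v, hv, lie_smul]; push_cast; module
  obtain ⟨v, hvd, hv0, hv⟩ := exists_common_eigenvector
    ((toEnd K F V) '' (A 0 : Set F))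
    (by
      rintro _ ⟨x, hx, rfl⟩ _ ⟨y, hy, rfl⟩
      exact LinearMap.ext fun v => hcomm x hx y hy v)
    ((toEnd K F V H).eigenspace (2 * d : K))
    ((Submodule.ne_bot_iff _).2 ⟨v₁, End.mem_eigenspace_iff.2 hd, hv₁⟩)
    (by
      rintro _ ⟨x, hx, rfl⟩ v hv
      rw [End.mem_eigenspace_iff] at hv ⊢
      simpa using hshift 0 x (hAd 0 hx) d v hv)
  rw [End.mem_eigenspace_iff, toEnd_apply_apply] at hvd
  have hup : ∀ k : ℤ, 0 < k → ∀ x ∈ A k, ⁅x, v⁆ = 0 := fun k hk x hx =>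
    hmax (d + k) (by omega) _ (hshift k x (hAd k hx) d v hvd)
  have hEv : ⁅E, v⁆ = 0 := hmax (d + 1) (by omega) _ <| (fun h => hshift 1 E h d v hvd) fun w => by
    have := S.he w
    simp only [toEnd_apply_apply] at this
    rw [this]; simp
  obtain ⟨n, hn, -, -⟩ := S.primitive_nat hEv hvd hv0
  have hnd : (n : ℤ) = 2 * d := by exact_mod_cast hn.symm
  let W : Submodule K V := K ∙ v ⊔ ⨆ j : ℕ, (toEnd K F V H).eigenspace (2 * (d - 1 - j : ℤ) : K)
  let Y₀ : Submodule K V := sInf {N | v ∈ N ∧ ∀ k < 0, ∀ x ∈ A k, ∀ w ∈ N, ⁅x, w⁆ ∈ N}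
  have hY₀v : v ∈ Y₀ := Submodule.mem_sInf.2 fun N hN => hN.1
  have hY₀n : ∀ k < 0, ∀ x ∈ A k, ∀ w ∈ Y₀, ⁅x, w⁆ ∈ Y₀ := fun k hk x hx w hw =>
    Submodule.mem_sInf.2 fun N hN => hN.2 k hk x hx w (Submodule.mem_sInf.1 hw N hN)
  have hY₀le : ∀ N : Submodule K V, v ∈ N →
      (∀ k < 0, ∀ x ∈ A k, ∀ w ∈ N, ⁅x, w⁆ ∈ N) → Y₀ ≤ N := fun N h1 h2 =>
    sInf_le ⟨h1, h2⟩
  have hY₀W : Y₀ ≤ W := by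
    refine hY₀le W (Submodule.mem_sup_left (Submodule.mem_span_singleton_self v)) ?_
    intro k hk x hx w hw
    obtain ⟨m, rfl⟩ : ∃ m : ℕ, k = -(m + 1 : ℤ) := ⟨(-k - 1).toNat, by omega⟩
    refine Submodule.mem_sup_right ?_
    have : W ≤ (⨆ j : ℕ, (toEnd K F V H).eigenspace (2 * (d - 1 - j : ℤ) : K)).comap
        (toEnd K F V x) := by
      refine sup_le ?_ (iSup_le fun j => ?_)
      · rw [Submodule.span_singleton_le_iff_mem, Submodule.mem_comap]
        refine Submodule.mem_iSup_of_mem m (End.mem_eigenspace_iff.2 ?_)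
        have := hshift _ x (hAd _ hx) d v hvd
        rw [show d + -(m + 1 : ℤ) = d - 1 - m by ring] at this
        exact this
      · intro u hu
        rw [Submodule.mem_comap]
        refine Submodule.mem_iSup_of_mem (j + m + 1) (End.mem_eigenspace_iff.2 ?_)
        have := hshift _ x (hAd _ hx) _ u (End.mem_eigenspace_iff.1 hu)
        rw [show (d - 1 - j : ℤ) + -(m + 1 : ℤ) = d - 1 - (j + m + 1 : ℕ) by push_cast; ring]
          at this
        exact this
    exact this hw
  have hY₀F : ∀ (x : F), ∀ y ∈ Y₀, ⁅x, y⁆ ∈ Y₀ := by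
    let N : Submodule K V :=
      { carrier := {y | y ∈ Y₀ ∧ ∀ x : F, ⁅x, y⁆ ∈ Y₀}
        add_mem' := fun ha hb => ⟨Y₀.add_mem ha.1 hb.1, fun x => by
          rw [lie_add]; exact Y₀.add_mem (ha.2 x) (hb.2 x)⟩
        zero_mem' := ⟨Y₀.zero_mem, fun x => by rw [lie_zero]; exact Y₀.zero_mem⟩
        smul_mem' := fun c y hy => ⟨Y₀.smul_mem c hy.1, fun x => by
          rw [lie_smul]; exact Y₀.smul_mem c (hy.2 x)⟩ }
    have : Y₀ ≤ N := by
      refine hY₀le N ⟨hY₀v, hind ?_ ?_ ?_⟩ ?_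
      · intro k x hx
        rcases lt_trichotomy k 0 with hk | rfl | hk
        · exact hY₀n k hk x hx v hY₀v
        · obtain ⟨c, hc⟩ := hv _ ⟨x, hx, rfl⟩
          rw [toEnd_apply_apply] at hc
          rw [hc]; exact Y₀.smul_mem c hY₀v
        · rw [hup k hk x hx]; exact Y₀.zero_mem
      · rw [zero_lie]; exact Y₀.zero_mem
      · intro x y hx hy; rw [add_lie]; exact Y₀.add_mem hx hy
      · rintro k hk x' hx' y ⟨hy, hy'⟩
        refine ⟨hY₀n k hk x' hx' y hy, fun x => ?_⟩
        rw [leibniz_lie]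
        exact Y₀.add_mem (hy' _) (hY₀n k hk x' hx' _ (hy' x))
    exact fun x y hy => (this hy).2 x
  have hωW : ∀ w ∈ W, ω ((toEnd K F V F' ^ n) v) w = 0 := by
    have : W ≤ LinearMap.ker (ω ((toEnd K F V F' ^ n) v)) := by
      refine sup_le ?_ (iSup_le fun j => ?_)
      · rw [Submodule.span_singleton_le_iff_mem, LinearMap.mem_ker]
        have h1 := invariant_pow ω (hω2 F') n v v
        have h2 : Even n := by
          rw [← Int.even_coe_nat, hnd]; exact even_two_mul d
        rw [h2.neg_one_pow, one_smul, hω1 v] at h1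
        refine (smul_eq_zero.1 (?_ : (2 : K) • ω ((toEnd K F V F' ^ n) v) v = 0)).resolve_left
          two_ne_zero
        rw [two_smul]
        exact add_eq_zero_iff_eq_neg.2 h1
      · intro u hu
        rw [LinearMap.mem_ker]
        have hu := End.mem_eigenspace_iff.1 hu
        rw [toEnd_apply_apply] at hu
        have h1 := S.h_f_pow n v
        simp only [toEnd_apply_apply] at h1
        rw [hvd, map_smul, ← sub_smul] at h1
        have h2 := hω2 H ((toEnd K F V F' ^ n) v) u
        rw [h1, hu, map_smul, map_smul, LinearMap.smul_apply, ← add_smul] at h2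
        refine (smul_eq_zero.1 h2).resolve_left ?_
        rw [← hn]
        intro h3
        have h4 : ((2 * d - 2 * (2 * d) + 2 * (d - 1 - j) : ℤ) : K) = 0 := by
          push_cast; push_cast at h3; exact h3
        have h5 : (2 * d - 2 * (2 * d) + 2 * (d - 1 - j) : ℤ) = 0 := by exact_mod_cast h4
        omega
    exact fun w hw => this hw
  have hEY : ∀ (m : ℕ), ∀ y ∈ Y₀, (toEnd K F V E ^ m) y ∈ Y₀ := by
    intro m
    induction m with
    | zero => intro y hy; simpa using hy
    | succ m ih =>
      intro y hy
      rw [pow_succ', Module.End.mul_apply]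
      exact hY₀F E _ (ih y hy)
  have hωv : ∀ y ∈ Y₀, ω v y = 0 := by
    intro y hy
    obtain ⟨a, ha, hav⟩ := S.e_pow_f_pow hEv (hn ▸ hvd) n le_rfl
    have := invariant_pow ω (hω2 E) n ((toEnd K F V F' ^ n) v) y
    rw [hav, hωW _ (hY₀W (hEY n y hy)), smul_zero, map_smul, LinearMap.smul_apply] at this
    exact (smul_eq_zero.1 this).resolve_left ha
  refine ⟨{ Y₀ with lie_mem := fun {x y} hy => hY₀F x y hy }, ?_, ?_⟩
  · intro h
    have : v ∈ (⊥ : LieSubmodule K F V) := h ▸ hY₀v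
    exact hv0 (by simpa using this)
  · let N : Submodule K V :=
      { carrier := {y | ∀ y' ∈ Y₀, ω y y' = 0}
        add_mem' := fun ha hb y' hy' => by
          rw [map_add, LinearMap.add_apply, ha y' hy', hb y' hy', add_zero]
        zero_mem' := fun y' _ => by simp
        smul_mem' := fun c y hy y' hy' => by
          rw [map_smul, LinearMap.smul_apply, hy y' hy', smul_zero] }
    have : Y₀ ≤ N := by
      refine hY₀le N hωv ?_
      intro k _ x _ w hw y' hy'
      rw [eq_neg_of_add_eq_zero_left (hω2 x w y'), hw _ (hY₀F x y' hy'), neg_zero]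
    exact fun y hy y' hy' => this hy y' hy'

end Isotropic
end LieAux

namespace LieAux

open Module LieAlgebra LieModule

lemma exists_lift_of_iSupIndep {K V W ι : Type*} [Field K] [AddCommGroup V] [Module K V]
    [AddCommGroup W] [Module K W] {f : V →ₗ[K] W} (hf : Function.Surjective f)
    {A : ι → Submodule K V} (hA : ⨆ i, A i = ⊤) {B : ι → Submodule K W} (hB : iSupIndep B)
    (hAB : ∀ i, ∀ v ∈ A i, f v ∈ B i) (i : ι) {w : W} (hw : w ∈ B i) : ∃ v ∈ A i, f v = w := by
  obtain ⟨v, rfl⟩ := hf w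
  have hv : v ∈ A i ⊔ ⨆ (j) (_ : j ≠ i), A j := by
    rw [← iSup_split_single A i, hA]; trivial
  obtain ⟨a, ha, c, hc, rfl⟩ := Submodule.mem_sup.1 hv
  have hc' : f c ∈ ⨆ (j) (_ : j ≠ i), B j := by
    have : ⨆ (j) (_ : j ≠ i), A j ≤ (⨆ (j) (_ : j ≠ i), B j).comap f :=
      iSup₂_le fun j hj u hu => (le_iSup₂_of_le (f := fun j (_ : j ≠ i) => B j) j hj le_rfl)
        (hAB j u hu)
    exact this hc
  have hc'' : f c ∈ B i := by
    rw [map_add] at hw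
    simpa using (B i).sub_mem hw (hAB i a ha)
  refine ⟨a, ha, ?_⟩
  rw [map_add, Submodule.disjoint_def.1 (hB i) _ hc'' hc', add_zero]

lemma mem_eigenspace_of_mem_maxGenEigenspace {K V : Type*} [Field K] [AddCommGroup V] [Module K V]
    {a : End K V} (ha : ⨆ μ, a.eigenspace μ = ⊤) {μ : K} {v : V}
    (hv : v ∈ a.maxGenEigenspace μ) : v ∈ a.eigenspace μ := by
  obtain ⟨w, hw, rfl⟩ := exists_lift_of_iSupIndep (f := LinearMap.id) Function.surjective_id ha
    a.independent_maxGenEigenspace (fun i v hv => by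
      rw [End.mem_maxGenEigenspace]
      exact ⟨1, by simp [End.mem_eigenspace_iff.1 hv]⟩)
    μ hv
  exact hw

/-- The joint eigenspaces of a subspace of a Lie algebra acting on a Lie module. -/
def wsp {K F : Type*} [Field K] [LieRing F] [LieAlgebra K F] (T : Submodule K F)
    (V : Type*) [AddCommGroup V] [Module K V] [LieRingModule F V] [LieModule K F V]
    (α : Dual K T) : Submodule K V where
  carrier := {x | ∀ H : T, ⁅(H : F), x⁆ = α H • x}
  add_mem' := by intro a b ha hb H; rw [lie_add, ha H, hb H, smul_add]
  zero_mem' := by intro H; rw [lie_zero, smul_zero]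
  smul_mem' := by intro c x hx H; rw [lie_smul, hx H, smul_comm]

section

variable {K F : Type*} [Field K] [LieRing F] [LieAlgebra K F] {T : Submodule K F}
  {V : Type*} [AddCommGroup V] [Module K V] [LieRingModule F V] [LieModule K F V]

lemma mem_wsp {α : Dual K T} {v : V} : v ∈ wsp T V α ↔ ∀ H : T, ⁅(H : F), v⁆ = α H • v := Iff.rfl

lemma iSupIndep_wsp : iSupIndep (wsp T V) := by
  classical
  rw [iSupIndep_iff_finsetSum_eq_zero_imp_eq_zero]
  intro s
  induction s using Finset.induction_on with
  | empty => intro x _ _ i hi; simp at hi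
  | insert β s hβ ih =>
    intro x hx hs
    have key : ∀ i ∈ s, x i = 0 := by
      intro i hi
      have hne : i ≠ β := fun h => hβ (h ▸ hi)
      obtain ⟨H, hH⟩ : ∃ H : T, i H - β H ≠ 0 := by
        by_contra! h
        exact hne (LinearMap.ext fun H => sub_eq_zero.1 (h H))
      have := ih (fun j => (j H - β H) • x j)
        (fun j hj => Submodule.smul_mem _ _ (hx j (Finset.mem_insert_of_mem hj))) ?_ i hi
      · exact (smul_eq_zero.1 this).resolve_left hH
      · have h1 := congrArg (fun v => ⁅(H : F), v⁆ - β H • v) hs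
        simp only [lie_zero, smul_zero, sub_zero, lie_sum, Finset.smul_sum,
          ← Finset.sum_sub_distrib] at h1
        rw [Finset.sum_insert hβ, mem_wsp.1 (hx β (Finset.mem_insert_self _ _)), sub_self,
          zero_add] at h1
        rw [← h1]
        refine Finset.sum_congr rfl fun j hj => ?_
        rw [mem_wsp.1 (hx j (Finset.mem_insert_of_mem hj)), sub_smul]
    intro i hi
    rcases Finset.mem_insert.1 hi with rfl | hi
    · rw [Finset.sum_insert hβ, Finset.sum_eq_zero key, add_zero] at hs
      exact hs
    · exact key i hi

lemma lie_mem_wsp {α β : Dual K T} {x : F} {v : V} (hx : x ∈ wsp T F α) (hv : v ∈ wsp T V β) :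
    ⁅x, v⁆ ∈ wsp T V (α + β) := by
  intro H
  rw [leibniz_lie, mem_wsp.1 hx, mem_wsp.1 hv, smul_lie, lie_smul, LinearMap.add_apply, add_smul]

end

section Killing

variable {K L : Type*} [Field K] [IsAlgClosed K] [CharZero K] [LieRing L] [LieAlgebra K L]
  [FiniteDimensional K L]

lemma exists_cartan_ge (T : LieSubalgebra K L) (hT : ∀ x ∈ T, ∀ y ∈ T, ⁅x, y⁆ = 0)
    (hd : ∀ t ∈ T, ⨆ μ, (ad K L t).eigenspace μ = ⊤) :
    ∃ H : LieSubalgebra K L, H.IsCartanSubalgebra ∧ T ≤ H := by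
  let C : LieSubalgebra K L :=
    { carrier := {x | ∀ t ∈ T, ⁅t, x⁆ = 0}
      add_mem' := fun ha hb t ht => by rw [lie_add, ha t ht, hb t ht, add_zero]
      zero_mem' := fun t _ => lie_zero t
      smul_mem' := fun c x hx t ht => by rw [lie_smul, hx t ht, smul_zero]
      lie_mem' := fun {x y} hx hy t ht => by
        rw [leibniz_lie, hx t ht, hy t ht, zero_lie, lie_zero, add_zero] }
  have : Infinite K := inferInstance
  obtain ⟨x, hx⟩ := exists_isCartanSubalgebra_engel (K := K) (L := C)
  set H₀ := LieSubalgebra.engel K x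
  have hTH₀ : ∀ t (ht : t ∈ T), (⟨t, fun s hs => hT s hs t ht⟩ : C) ∈ H₀ := by
    intro t ht
    rw [← hx.self_normalizing, LieSubalgebra.mem_normalizer_iff]
    intro y hy
    have : ⁅(⟨t, fun s hs => hT s hs t ht⟩ : C), y⁆ = 0 := Subtype.ext (y.2 t ht)
    rw [this]; exact zero_mem _
  let H : LieSubalgebra K L := H₀.map C.incl
  have hmem : ∀ {y : C}, y ∈ H₀ → (y : L) ∈ H := fun {y} hy => ⟨y, hy, rfl⟩
  refine ⟨H, ⟨?_, ?_⟩, fun t ht => hmem (hTH₀ t ht)⟩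
  · have := hx.nilpotent
    exact (LieEquiv.nilpotent_iff_equiv_nilpotent
      (LieSubalgebra.equivMapOfInjective C.incl H₀ Subtype.val_injective)).1 this
  · refine le_antisymm (fun y hy => ?_) H.le_normalizer
    rw [LieSubalgebra.mem_normalizer_iff] at hy
    have hyC : ∀ t ∈ T, ⁅t, y⁆ = 0 := by
      intro t ht
      have h1 : ⁅t, ⁅t, y⁆⁆ = 0 := by
        obtain ⟨z, hz, h2⟩ := hy t (hmem (hTH₀ t ht))
        have h3 := z.2 t ht
        rw [← lie_skew t y, lie_neg, ← h2]
        exact neg_eq_zero.2 h3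
      have h2 : y ∈ (ad K L t).maxGenEigenspace 0 := by
        rw [End.mem_maxGenEigenspace]
        exact ⟨2, by simp [pow_two, h1]⟩
      have h3 := End.mem_eigenspace_iff.1 (mem_eigenspace_of_mem_maxGenEigenspace (hd t ht) h2)
      simpa using h3
    have : (⟨y, hyC⟩ : C) ∈ H₀ := by
      rw [← hx.self_normalizing, LieSubalgebra.mem_normalizer_iff]
      intro z hz
      obtain ⟨w, hw, h2⟩ := hy z (hmem hz)
      have : ⁅(⟨y, hyC⟩ : C), z⁆ = w := Subtype.ext h2.symm
      rw [this]; exact hw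
    exact hmem this

open LieAlgebra.IsKilling in
lemma exists_principal [IsKilling K L] (H : LieSubalgebra K L) [H.IsCartanSubalgebra] :
    ∃ (h : H) (e f : L), ⁅(h : L), e⁆ = (2 : K) • e ∧ ⁅(h : L), f⁆ = -((2 : K) • f) ∧
      ⁅e, f⁆ = h ∧ ∀ α : Weight K H L, α.IsNonZero → ∃ k : ℤ, k ≠ 0 ∧ α h = 2 * k := by
  classical
  let P := rootSystem H
  obtain ⟨b⟩ := P.nonempty_base
  have hw : ∀ i : H.root, (i : Weight K H L).IsNonZero := fun i => by
    have := i.2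
    simpa only [LieSubalgebra.root, Finset.mem_filter, Finset.mem_univ, true_and] using this
  obtain ⟨h, hh⟩ : ∃ h : H, ∀ i ∈ b.support, (i : Weight K H L) h = 2 := by
    let B := b.toWeightBasis
    let φ : Dual K (Dual K H) := B.constr K fun _ => (2 : K)
    refine ⟨(evalEquiv K H).symm φ, fun i hi => ?_⟩
    have h1 : φ (B ⟨i, hi⟩) = 2 := by simp [φ]
    have h2 := apply_evalEquiv_symm_apply K H (B ⟨i, hi⟩) φ
    rw [h1] at h2
    rw [← h2, b.toWeightBasis_apply]
    rfl
  have hval : ∀ α : Weight K H L, α.IsNonZero → ∃ k : ℤ, k ≠ 0 ∧ α h = 2 * k := by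
    intro α hα
    let i : H.root := ⟨α, by simpa using hα⟩
    refine ⟨b.height i, b.height_ne_zero i, ?_⟩
    obtain ⟨f, hf⟩ := b.exists_root_eq_sum_int i
    rw [b.height_eq_sum (f := f) hf.2.2]
    have h3 := congrArg (fun γ : Dual K H => γ h) hf.2.2
    simp only [LinearMap.sum_apply, LinearMap.smul_apply] at h3
    have h4 : P.root i h = α h := rfl
    rw [← h4, h3, Int.cast_sum, Finset.mul_sum]
    refine Finset.sum_congr rfl fun j hj => ?_
    have h5 : P.root j h = 2 := hh j hj
    rw [h5, zsmul_eq_mul, mul_comm]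
  choose h' e' f' ht he hf using fun i : H.root => exists_isSl2Triple_of_weight_isNonZero (hw i)
  have hc : ∀ i, h' i = coroot (i : Weight K H L) := fun i =>
    (ht i).h_eq_coroot (hw i) (he i) (hf i)
  obtain ⟨c, hc'⟩ : ∃ c : H.root → K, h = ∑ i ∈ b.support, c i • coroot (i : Weight K H L) := by
    have h1 : h ∈ Submodule.span K (P.coroot '' b.support) := by
      rw [b.span_coroot_support, RootPairing.corootSpan,
        RootPairing.IsRootSystem.span_coroot_eq_top]
      trivial
    rw [Submodule.mem_span_image_finset_iff_exists_fun] at h1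
    obtain ⟨c, h1⟩ := h1
    refine ⟨fun i => if hi : i ∈ b.support then c ⟨i, hi⟩ else 0, h1.symm.trans ?_⟩
    rw [← Finset.sum_coe_sort b.support]
    refine Finset.sum_congr rfl fun i _ => ?_
    have : c i = if hi : (i : H.root) ∈ b.support then c ⟨i, hi⟩ else 0 := by rw [dif_pos i.2]
    rw [this]
    rfl
  have hef : ∀ i ∈ b.support, ∀ j ∈ b.support, i ≠ j → ⁅e' i, f' j⁆ = 0 := by
    intro i hi j hj hij
    by_contra hne
    have h1 : ⁅e' i, f' j⁆ ∈ rootSpace H ((i : Weight K H L) + -(j : Weight K H L) : H → K) :=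
      lie_mem_genWeightSpace_of_mem_genWeightSpace (he i) (hf j)
    let γ : Weight K H L := ⟨(i : Weight K H L) + -(j : Weight K H L), fun h2 => hne (by
      have h3 := h1
      rw [rootSpace, h2] at h3; simpa using h3)⟩
    have hγ : γ.IsNonZero := by
      intro h2
      have h3 : ((i : Weight K H L) + -(j : Weight K H L) : H → K) = 0 := h2
      exact hij (Subtype.ext (DFunLike.coe_injective (add_neg_eq_zero.1 h3)))
    refine b.sub_notMem_range_root hi hj ⟨⟨γ, by simpa using hγ⟩, ?_⟩
    refine LinearMap.ext fun x => ?_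
    change (i : Weight K H L) x + -(j : Weight K H L) x =
      (i : Weight K H L) x - (j : Weight K H L) x
    rw [sub_eq_add_neg]
  refine ⟨h, ∑ i ∈ b.support, e' i, ∑ i ∈ b.support, c i • f' i, ?_, ?_, ?_, hval⟩
  · rw [lie_sum, Finset.smul_sum]
    refine Finset.sum_congr rfl fun i hi => ?_
    have := lie_eq_smul_of_mem_rootSpace (he i) h
    rw [hh i hi] at this
    exact this
  · rw [lie_sum, Finset.smul_sum, ← Finset.sum_neg_distrib]
    refine Finset.sum_congr rfl fun i hi => ?_
    have := lie_eq_smul_of_mem_rootSpace (hf i) h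
    rw [Pi.neg_apply, hh i hi, neg_smul] at this
    rw [lie_smul]
    refine (congrArg (c i • ·) this).trans ?_
    module
  · have h1 : (h : L) = ∑ i ∈ b.support, c i • h' i := by
      conv_lhs => rw [hc']
      simp only [hc]
      push_cast
      rfl
    rw [h1, lie_sum]
    refine Finset.sum_congr rfl fun j hj => ?_
    rw [sum_lie, Finset.sum_eq_single j, lie_smul, (ht j).lie_e_f]
    · intro i hi hij
      rw [lie_smul, hef i hi j hj hij, smul_zero]
    · exact fun h => absurd hj h

open LieAlgebra.IsKilling in
lemma exists_principal' [IsKilling K L] (H : LieSubalgebra K L) [H.IsCartanSubalgebra] :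
    ∃ (h : H) (e f : L), ⁅(h : L), e⁆ = (2 : K) • e ∧ ⁅(h : L), f⁆ = -((2 : K) • f) ∧
      ⁅e, f⁆ = h ∧ ⨆ k : ℤ, (ad K L (h : L)).eigenspace (2 * k : K) = ⊤ ∧
      (∀ x, ⁅(h : L), x⁆ = 0 → x ∈ H) ∧
      ∀ α : Weight K H L, ∃ k : ℤ, α h = 2 * k := by
  classical
  obtain ⟨h, e, f, h1, h2, h3, h4⟩ := exists_principal H
  have h0 : ∀ α : Weight K H L, ∃ k : ℤ, α h = 2 * k := by
    intro α
    by_cases hα : α.IsNonZero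
    · obtain ⟨k, -, hk⟩ := h4 α hα
      exact ⟨k, hk⟩
    · rw [Weight.IsNonZero, not_not] at hα
      exact ⟨0, by rw [hα.eq]; simp⟩
  refine ⟨h, e, f, h1, h2, h3, ?_, ?_, h0⟩
  · refine top_unique ?_
    have := congrArg LieSubmodule.toSubmodule (iSup_genWeightSpace_eq_top' K H L)
    rw [LieSubmodule.iSup_toSubmodule, LieSubmodule.top_toSubmodule] at this
    rw [← this]
    refine iSup_le fun α => ?_
    obtain ⟨k, hk⟩ := h0 α
    refine le_iSup_of_le k fun x hx => ?_
    rw [End.mem_eigenspace_iff, ← hk]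
    exact lie_eq_smul_of_mem_rootSpace hx h
  · intro x hx
    let A : K → Submodule K L := fun c => if c = 0 then H.toSubmodule else
      (ad K L (h : L)).eigenspace c
    have hA0 : A 0 = H.toSubmodule := if_pos rfl
    have hA1 : ∀ c, c ≠ 0 → A c = (ad K L (h : L)).eigenspace c := fun c hc => if_neg hc
    have hA : ⨆ c, A c = ⊤ := by
      refine top_unique ?_
      have := congrArg LieSubmodule.toSubmodule (iSup_genWeightSpace_eq_top' K H L)
      rw [LieSubmodule.iSup_toSubmodule, LieSubmodule.top_toSubmodule] at this
      rw [← this]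
      refine iSup_le fun α => ?_
      by_cases hα : α.IsNonZero
      · obtain ⟨k, hk0, hk⟩ := h4 α hα
        refine le_iSup_of_le (α h) fun x hx => ?_
        have : α h ≠ 0 := by rw [hk]; simpa using hk0
        rw [hA1 _ this, End.mem_eigenspace_iff]
        exact lie_eq_smul_of_mem_rootSpace hx h
      · rw [Weight.IsNonZero, not_not] at hα
        refine le_iSup_of_le 0 fun x hx => ?_
        rw [hA0]
        rw [hα.eq] at hx
        have hx' : x ∈ rootSpace H (0 : H → K) := hx
        rwa [rootSpace_zero_eq K L H, LieSubalgebra.mem_toLieSubmodule] at hx'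
    obtain ⟨y, hy, rfl⟩ := exists_lift_of_iSupIndep (f := LinearMap.id) Function.surjective_id hA
      (ad K L (h : L)).eigenspaces_iSupIndep (fun c v hv => by
        by_cases hc : c = 0
        · subst hc
          rw [hA0] at hv
          rw [End.mem_eigenspace_iff]
          have := congrArg Subtype.val (trivial_lie_zero H H h ⟨v, hv⟩)
          simpa using this
        · rwa [hA1 c hc] at hv) 0 (End.mem_eigenspace_iff.2 (by simpa using hx) :
          x ∈ (ad K L (h : L)).eigenspace 0)
    rwa [hA0] at hy

end Killing

end LieAux

namespace LieAux

open Module LieAlgebra LieModule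

section

variable {K F : Type*} [Field K] [LieRing F] [LieAlgebra K F]

lemma exists_radForm (R : LieIdeal K F) :
    ∃ ω : (R ⧸ (LieSubmodule.comap (LieSubmodule.incl R) (center K F))) →ₗ[K]
      (R ⧸ (LieSubmodule.comap (LieSubmodule.incl R) (center K F))) →ₗ[K] F,
      ∀ a b : R, ω (LieSubmodule.Quotient.mk a) (LieSubmodule.Quotient.mk b) =
        ⁅(a : F), (b : F)⁆ := by
  set N := LieSubmodule.comap (LieSubmodule.incl R) (center K F)
  let f : R →ₗ[K] R →ₗ[K] F := LinearMap.mk₂ K (fun a b => ⁅(a : F), (b : F)⁆)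
    (fun a b c => by simp) (fun c a b => by simp) (fun a b c => by simp) (fun c a b => by simp)
  have h1 : N.toSubmodule ≤ LinearMap.ker f := fun a ha => by
    rw [LinearMap.mem_ker]
    exact LinearMap.ext fun b => center_lie (K := K) (x := (a : F)) ha b
  have h2 : N.toSubmodule ≤ LinearMap.ker (Submodule.liftQ N.toSubmodule f h1).flip := fun a ha => by
    rw [LinearMap.mem_ker]
    refine LinearMap.ext fun b => ?_
    obtain ⟨b, rfl⟩ := Submodule.mkQ_surjective _ b
    exact mem_center_iff'.1 (show (a : F) ∈ center K F from ha) b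
  exact ⟨(Submodule.liftQ N.toSubmodule _ h2).flip, fun a b => rfl⟩

variable [IsAlgClosed K] [CharZero K] [FiniteDimensional K F]

theorem mem_center_of_even
    (hred : ∀ I : LieIdeal K F, IsLieAbelian I → I ≤ center K F) {H E F' : F}
    (hHE : ⁅H, E⁆ - (2 : K) • E ∈ radical K F) (hHF : ⁅H, F'⁆ + (2 : K) • F' ∈ radical K F)
    (hEF : ⁅E, F'⁆ - H ∈ radical K F)
    (hsup : ⨆ k : ℤ, (ad K (F ⧸ radical K F) (quotHom (radical K F) H)).eigenspace (2 * k : K) = ⊤)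
    (hab : ∀ x y : F, ⁅H, x⁆ ∈ radical K F → ⁅H, y⁆ ∈ radical K F → ⁅x, y⁆ ∈ radical K F)
    {r : F} (hr : r ∈ radical K F) {k : ℤ} (hk : r ∈ (ad K F H).maxGenEigenspace (2 * k : K)) :
    r ∈ center K F := by
  have hRR : ∀ a ∈ radical K F, ∀ b ∈ radical K F, ⁅a, b⁆ ∈ center K F := fun a ha b hb =>
    lie_radical_le_center hred (LieSubmodule.lie_mem_lie ha hb)
  set R := radical K F
  set N := LieSubmodule.comap (LieSubmodule.incl R) (center K F)
  obtain ⟨ω, hω⟩ := exists_radForm R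
  have hmkS : ∀ v : R ⧸ N, ∃ a : R, LieSubmodule.Quotient.mk a = v := fun v =>
    Submodule.mkQ_surjective _ v
  have hmk0 : ∀ a : R, (LieSubmodule.Quotient.mk a : R ⧸ N) = 0 ↔ (a : F) ∈ center K F := fun a =>
    LieSubmodule.Quotient.mk_eq_zero'
  have hlie : ∀ (x : F) (a : R), ⁅x, (LieSubmodule.Quotient.mk a : R ⧸ N)⁆ =
    LieSubmodule.Quotient.mk ⁅x, a⁆ := fun x a => rfl
  have hR0 : ∀ x ∈ R, ∀ v : R ⧸ N, ⁅x, v⁆ = 0 := by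
    intro x hx v
    obtain ⟨a, rfl⟩ := hmkS v
    rw [hlie, hmk0]
    exact hRR x hx a a.2
  have : FiniteDimensional K (R ⧸ N) := inferInstanceAs (FiniteDimensional K (R ⧸ N.toSubmodule))
  have S : Sl2 (toEnd K F (R ⧸ N) H) (toEnd K F (R ⧸ N) E) (toEnd K F (R ⧸ N) F') := by
    refine ⟨fun v => ?_, fun v => ?_, fun v => ?_⟩
    · have := hR0 _ hHE v
      rw [sub_lie, lie_lie, smul_lie] at this
      simp only [toEnd_apply_apply]
      rw [← sub_eq_zero, ← this]; abel
    · have := hR0 _ hHF v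
      rw [add_lie, lie_lie, smul_lie] at this
      simp only [toEnd_apply_apply]
      rw [← sub_eq_zero, ← this]; abel
    · have := hR0 _ hEF v
      rw [sub_lie, lie_lie] at this
      simp only [toEnd_apply_apply]
      rw [← sub_eq_zero, ← this]; abel
  have hev : (LieSubmodule.Quotient.mk ⟨r, hr⟩ : R ⧸ N) ∈
      (toEnd K F (R ⧸ N) H).eigenspace (2 * k : K) := by
    refine mem_eigenspace_of_mem_maxGenEigenspace S.iSup_eigenspace ?_
    rw [End.mem_maxGenEigenspace] at hk ⊢
    obtain ⟨n, hn⟩ := hk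
    refine ⟨n, ?_⟩
    have key : ∀ (n : ℕ) (a : R), ∃ b : R, (b : F) = ((ad K F H - (2 * k : K) • 1) ^ n) a ∧
        ((toEnd K F (R ⧸ N) H - (2 * k : K) • 1) ^ n) (LieSubmodule.Quotient.mk a) =
          LieSubmodule.Quotient.mk b := by
      intro n
      induction n with
      | zero => intro a; exact ⟨a, rfl, rfl⟩
      | succ n ih =>
        intro a
        obtain ⟨b, hb, hb'⟩ := ih (⁅H, a⁆ - (2 * k : K) • a)
        refine ⟨b, ?_, ?_⟩
        · rw [hb, pow_succ, Module.End.mul_apply]; rfl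
        · rw [← hb', pow_succ, Module.End.mul_apply]; rfl
    obtain ⟨b, hb, hb'⟩ := key n ⟨r, hr⟩
    rw [hb', hmk0, hb]
    rw [hn]
    exact zero_mem _
  rw [End.mem_eigenspace_iff, toEnd_apply_apply] at hev
  by_contra hrc
  have hinv : ∀ (x : F) (v w : R ⧸ N), ω ⁅x, v⁆ w + ω v ⁅x, w⁆ = 0 := by
    intro x v w
    obtain ⟨a, rfl⟩ := hmkS v
    obtain ⟨b, rfl⟩ := hmkS w
    rw [hlie, hlie, hω, hω, LieSubmodule.coe_bracket, LieSubmodule.coe_bracket, ← leibniz_lie]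
    exact mem_center_iff'.1 (hRR a a.2 b b.2) x
  have hdeg : ∀ k : ℤ, ∀ x : F, ⁅H, x⁆ - (2 * k : K) • x ∈ R → x ∈ degree K (R ⧸ N) H k := by
    intro k x hx v
    have := hR0 _ hx v
    rw [sub_lie, lie_lie, smul_lie] at this
    rw [← sub_eq_zero, ← this]; abel
  let A : ℤ → Submodule K F := fun k =>
    ((ad K (F ⧸ R) (quotHom R H)).eigenspace (2 * k : K)).comap (quotHom R : F →ₗ[K] F ⧸ R)
  have hAR : ∀ k : ℤ, ∀ x ∈ A k, ⁅H, x⁆ - (2 * k : K) • x ∈ R := by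
    intro k x hx
    have hx := End.mem_eigenspace_iff.1 (Submodule.mem_comap.1 hx)
    rw [ad_apply] at hx
    rw [← quotHom_eq_zero, map_sub, map_smul, LieHom.map_lie]
    exact sub_eq_zero.2 hx
  have hA : ⨆ k, A k = ⊤ := by
    refine top_unique fun x _ => ?_
    have hx : quotHom R x ∈ ⨆ k : ℤ, (ad K (F ⧸ R) (quotHom R H)).eigenspace (2 * k : K) := by
      rw [hsup]; trivial
    have : ∀ z ∈ ⨆ k : ℤ, (ad K (F ⧸ R) (quotHom R H)).eigenspace (2 * k : K), ∀ x,
        quotHom R x = z → x ∈ ⨆ k, A k := by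
      intro z hz
      induction hz using Submodule.iSup_induction' with
      | mem k z hz =>
        rintro x rfl
        exact Submodule.mem_iSup_of_mem k hz
      | zero =>
        intro x hx
        refine Submodule.mem_iSup_of_mem 0 (Submodule.mem_comap.2 ?_)
        rw [show (quotHom R : F →ₗ[K] F ⧸ R) x = 0 from hx]; exact zero_mem _
      | add y z _ _ ihy ihz =>
        intro x hx
        obtain ⟨u, rfl⟩ := quotHom_surjective R y
        have := ihz (x - u) (by rw [map_sub, hx]; abel)
        simpa using add_mem this (ihy u rfl)
    exact this _ hx x rfl
  have hcomm : ∀ x ∈ A 0, ∀ y ∈ A 0, ∀ v : R ⧸ N, ⁅x, ⁅y, v⁆⁆ = ⁅y, ⁅x, v⁆⁆ := by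
    intro x hx y hy v
    have h0 : ∀ x ∈ A 0, ⁅H, x⁆ ∈ R := fun x hx => by simpa using hAR 0 x hx
    have := hR0 _ (hab x y (h0 x hx) (h0 y hy)) v
    rwa [lie_lie, sub_eq_zero] at this
  obtain ⟨Y, hY, hY'⟩ := exists_isotropic ω (fun v w => by
    obtain ⟨a, rfl⟩ := hmkS v
    obtain ⟨b, rfl⟩ := hmkS w
    rw [hω, hω, lie_skew]) hinv S A (fun k x hx => hdeg k x (hAR k x hx))
    hA hcomm (fun h => hrc ((hmk0 _).1 h)) hev
  let I : LieIdeal K F :=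
    { carrier := {x | ∃ a : R, (a : F) = x ∧ (LieSubmodule.Quotient.mk a : R ⧸ N) ∈ Y}
      add_mem' := by
        rintro _ _ ⟨a, rfl, ha⟩ ⟨b, rfl, hb⟩
        exact ⟨a + b, rfl, Y.add_mem ha hb⟩
      zero_mem' := ⟨0, rfl, Y.zero_mem⟩
      smul_mem' := by
        rintro c _ ⟨a, rfl, ha⟩
        exact ⟨c • a, rfl, Y.smul_mem c ha⟩
      lie_mem := by
        rintro x _ ⟨a, rfl, ha⟩
        exact ⟨⁅x, a⁆, rfl, Y.lie_mem ha⟩ }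
  have hI : I ≤ center K F := hred I ((isLieAbelian_iff I).2 (by
    rintro _ ⟨a, rfl, ha⟩ _ ⟨b, rfl, hb⟩
    rw [← hω]
    exact hY' _ ha _ hb))
  refine hY ((LieSubmodule.eq_bot_iff _).2 fun y hy => ?_)
  obtain ⟨a, rfl⟩ := hmkS y
  exact (hmk0 a).2 (hI ⟨a, rfl, hy⟩)

end

end LieAux

namespace LieAux

open Module LieAlgebra LieModule

/-- A maximal toral subalgebra, characterized by its self-centralizing property among
diagonalizable elements. -/
structure MaxToral {K F : Type*} [Field K] [LieRing F] [LieAlgebra K F]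
    (T : LieSubalgebra K F) : Prop where
  comm : ∀ x ∈ T, ∀ y ∈ T, ⁅x, y⁆ = 0
  iSup_wsp : ⨆ α, wsp T.toSubmodule F α = ⊤
  max : ∀ t : F, (∀ τ ∈ T, ⁅τ, t⁆ = 0) → ⨆ c, (ad K F t).eigenspace c = ⊤ → t ∈ T

section Lift

variable {K F L : Type*} [Field K] [LieRing F] [LieAlgebra K F] [LieRing L] [LieAlgebra K L]
  {π : F →ₗ⁅K⁆ L}

lemma exists_lift_wsp (hπ : Function.Surjective π) {T : LieSubalgebra K F} (hT : MaxToral T)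
    {α : Dual K T} {y : L} (hy : ∀ τ : T, ⁅π τ, y⁆ = α τ • y) :
    ∃ x ∈ wsp T.toSubmodule F α, π x = y := by
  let _ : LieRingModule F L := LieRingModule.compLieHom L π
  have : LieModule K F L := LieModule.compLieHom L π
  refine exists_lift_of_iSupIndep (f := (π : F →ₗ[K] L)) hπ hT.iSup_wsp
    (iSupIndep_wsp (T := T.toSubmodule) (V := L)) ?_ α (w := y) hy
  intro α v hv τ
  change ⁅π τ, π v⁆ = α τ • π v
  rw [← LieHom.map_lie, hv τ, map_smul]

lemma map_mem_maxGenEigenspace {H : F} {c : K} {x : F} (hx : x ∈ (ad K F H).maxGenEigenspace c) :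
    π x ∈ (ad K L (π H)).maxGenEigenspace c := by
  rw [End.mem_maxGenEigenspace] at hx ⊢
  obtain ⟨n, hn⟩ := hx
  refine ⟨n, ?_⟩
  have key : ∀ (n : ℕ) (x : F), ((ad K L (π H) - c • 1) ^ n) (π x) =
      π (((ad K F H - c • 1) ^ n) x) := by
    intro n
    induction n with
    | zero => intro x; rfl
    | succ n ih =>
      intro x
      rw [pow_succ, pow_succ, Module.End.mul_apply, Module.End.mul_apply, ← ih]
      simp
  rw [key, hn, map_zero]

lemma mem_maxGen_ad {H x : F} {c : K} (hx : ⁅H, x⁆ = c • x) :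
    x ∈ (ad K F H).maxGenEigenspace c := by
  rw [End.mem_maxGenEigenspace]
  exact ⟨1, by simp [hx]⟩

variable [IsAlgClosed K] [FiniteDimensional K F]

lemma exists_lift_maxGen (hπ : Function.Surjective π) {H : F} {c : K} {y : L}
    (hy : ⁅π H, y⁆ = c • y) : ∃ x ∈ (ad K F H).maxGenEigenspace c, π x = y :=
  exists_lift_of_iSupIndep (f := (π : F →ₗ[K] L)) hπ (End.iSup_maxGenEigenspace_eq_top (ad K F H))
    (ad K L (π H)).independent_maxGenEigenspace
    (fun _ _ hv => map_mem_maxGenEigenspace hv) c (mem_maxGen_ad hy)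

variable [CharZero K]

lemma MaxToral.mem_of_triple {T : LieSubalgebra K F} (hT : MaxToral T) {t e f : F}
    (h1 : ⁅t, e⁆ = (2 : K) • e) (h2 : ⁅t, f⁆ = -((2 : K) • f)) (h3 : ⁅e, f⁆ = t)
    (h4 : ∀ τ ∈ T, ⁅τ, t⁆ = 0) : t ∈ T := by
  have S : Sl2 (ad K F t) (ad K F e) (ad K F f) := by
    refine ⟨fun v => ?_, fun v => ?_, fun v => ?_⟩
    · simp only [ad_apply]
      rw [leibniz_lie, h1, smul_lie, add_comm]
    · simp only [ad_apply]
      rw [leibniz_lie, h2, neg_lie, smul_lie]; abel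
    · simp only [ad_apply]
      rw [leibniz_lie, h3, add_comm]
  exact hT.max t h4 S.iSup_eigenspace

variable [FiniteDimensional K L] [IsKilling K L] (HL : LieSubalgebra K L)
  [HL.IsCartanSubalgebra] {T : LieSubalgebra K F} {h : HL}

open LieAlgebra.IsKilling

lemma exists_coroot_lift (hπ : Function.Surjective π) (hT : MaxToral T)
    (hTH : ∀ t ∈ T, π t ∈ HL)
    (hInt : ∀ α : Weight K HL L, ∃ k : ℤ, α h = 2 * k)
    (noEven : ∀ H, π H = h → ∀ (k : ℤ) (r : F), π r = 0 →
      r ∈ (ad K F H).maxGenEigenspace (2 * k : K) → r ∈ center K F)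
    {H : F} (hH : π H = h) (hTc : ∀ τ ∈ T, ⁅τ, H⁆ = 0)
    {γ : Weight K HL L} (hγ : γ.IsNonZero) : ∃ t ∈ T, π t = coroot γ := by
  obtain ⟨h0, e0, f0, hs, he0, hf0⟩ := exists_isSl2Triple_of_weight_isNonZero hγ
  have hc := hs.h_eq_coroot hγ he0 hf0
  obtain ⟨k, hk⟩ := hInt γ
  have he' : ∀ x : HL, ⁅(x : L), e0⁆ = γ x • e0 := fun x => lie_eq_smul_of_mem_rootSpace he0 x
  have hf' : ∀ x : HL, ⁅(x : L), f0⁆ = -(γ x • f0) := fun x => by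
    have := lie_eq_smul_of_mem_rootSpace hf0 x
    rw [Pi.neg_apply, neg_smul] at this
    exact this
  obtain ⟨e1, he1, rfl⟩ := exists_lift_maxGen hπ (H := H) (c := 2 * k) (y := e0)
    (by rw [hH, he', hk])
  obtain ⟨f1, hf1, rfl⟩ := exists_lift_maxGen hπ (H := H) (c := -(2 * k)) (y := f0)
    (by rw [hH, hf', hk, neg_smul])
  have h2e : ⁅h0, π e1⁆ = (2 : K) • π e1 := by
    rw [hs.lie_h_e_nsmul, ← Nat.cast_smul_eq_nsmul K, Nat.cast_ofNat]
  have h2f : ⁅h0, π f1⁆ = -((2 : K) • π f1) := by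
    rw [hs.lie_h_f_nsmul, ← Nat.cast_smul_eq_nsmul K, Nat.cast_ofNat]
  have ht1 : π ⁅e1, f1⁆ = h0 := by rw [LieHom.map_lie, hs.lie_e_f]
  have ht0 : ⁅e1, f1⁆ ∈ (ad K F H).maxGenEigenspace 0 := by
    have := lie_mem_maxGenEigenspace_toEnd (M := F) he1 hf1
    rwa [add_neg_cancel] at this
  have hτ0 : ∀ τ ∈ T, τ ∈ (ad K F H).maxGenEigenspace 0 := fun τ hτ =>
    mem_maxGen_ad (by rw [zero_smul, ← lie_skew, hTc τ hτ, neg_zero])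
  have hm : ∀ x ∈ (ad K F H).maxGenEigenspace 0, ∀ c : K, ∀ y ∈ (ad K F H).maxGenEigenspace c,
      ∀ a : K, ⁅x, y⁆ - a • y ∈ (ad K F H).maxGenEigenspace c := by
    intro x hx c y hy a
    refine Submodule.sub_mem _ ?_ (Submodule.smul_mem _ _ hy)
    have := lie_mem_maxGenEigenspace_toEnd (M := F) hx hy
    rwa [zero_add] at this
  have hZe : ∀ x ∈ (ad K F H).maxGenEigenspace 0, ∀ a : K, ⁅π x, π e1⁆ = a • π e1 →
      ⁅x, e1⁆ - a • e1 ∈ center K F := fun x hx a hxa =>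
    noEven H hH k _ (by rw [map_sub, map_smul, LieHom.map_lie, hxa, sub_self])
      (hm x hx _ _ he1 a)
  have hZf : ∀ x ∈ (ad K F H).maxGenEigenspace 0, ∀ a : K, ⁅π x, π f1⁆ = a • π f1 →
      ⁅x, f1⁆ - a • f1 ∈ center K F := fun x hx a hxa =>
    noEven H hH (-k) _ (by rw [map_sub, map_smul, LieHom.map_lie, hxa, sub_self])
      (by push_cast; rw [mul_neg]; exact hm x hx _ _ hf1 a)
  have hre := hZe _ ht0 2 (by rw [ht1, h2e])
  have hrf := hZf _ ht0 (-2) (by rw [ht1, h2f, neg_smul])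
  generalize hr : ⁅⁅e1, f1⁆, e1⁆ - (2 : K) • e1 = r at hre
  generalize hs' : ⁅⁅e1, f1⁆, f1⁆ - (-2 : K) • f1 = s at hrf
  have hr' : ⁅⁅e1, f1⁆, e1⁆ = (2 : K) • e1 + r := by rw [← hr]; abel
  have hs'' : ⁅⁅e1, f1⁆, f1⁆ = (-2 : K) • f1 + s := by rw [← hs']; abel
  refine ⟨⁅e1, f1⁆, hT.mem_of_triple (e := e1 + (2⁻¹ : K) • r) (f := f1 - (2⁻¹ : K) • s)
    ?_ ?_ ?_ ?_, by rw [ht1, hc]⟩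
  · rw [lie_add, lie_smul, mem_center_iff'.1 hre, smul_zero, add_zero, hr', smul_add, smul_smul,
      mul_inv_cancel₀ two_ne_zero, one_smul]
  · rw [lie_sub, lie_smul, mem_center_iff'.1 hrf, smul_zero, sub_zero, hs'', smul_sub, smul_smul,
      mul_inv_cancel₀ two_ne_zero, one_smul, neg_smul]
    abel
  · rw [lie_sub, add_lie, lie_smul, mem_center_iff'.1 hrf, smul_lie, center_lie hre, smul_zero,
      sub_zero, add_zero]
  · intro τ hτ
    have h1 := hZe τ (hτ0 τ hτ) _ (he' ⟨π τ, hTH τ hτ⟩)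
    have h2 := hZf τ (hτ0 τ hτ) (-γ ⟨π τ, hTH τ hτ⟩)
      (by rw [neg_smul]; exact hf' ⟨π τ, hTH τ hτ⟩)
    have h3 := center_lie h1 f1
    have h4 := mem_center_iff'.1 h2 e1
    rw [sub_lie, smul_lie, sub_eq_zero] at h3
    rw [lie_sub, lie_smul, sub_eq_zero] at h4
    rw [leibniz_lie, h3, h4]
    module

lemma exists_lift_mem (hπ : Function.Surjective π) (hT : MaxToral T)
    (hTH : ∀ t ∈ T, π t ∈ HL)
    (hInt : ∀ α : Weight K HL L, ∃ k : ℤ, α h = 2 * k)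
    (noEven : ∀ H, π H = h → ∀ (k : ℤ) (r : F), π r = 0 →
      r ∈ (ad K F H).maxGenEigenspace (2 * k : K) → r ∈ center K F) (y : HL) :
    ∃ t ∈ T, π t = y := by
  have hw : ∀ i : HL.root, (i : Weight K HL L).IsNonZero := fun i => by
    have := i.2
    simpa only [LieSubalgebra.root, Finset.mem_filter, Finset.mem_univ, true_and] using this
  have hHab : ∀ x ∈ HL, ∀ y ∈ HL, ⁅x, y⁆ = 0 := fun x hx y hy =>
    congrArg Subtype.val (trivial_lie_zero HL HL ⟨x, hx⟩ ⟨y, hy⟩)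
  obtain ⟨H, hH, hHh⟩ := exists_lift_wsp hπ hT (α := 0) (y := (h : L))
    (fun τ => by rw [hHab _ (hTH τ τ.2) _ h.2]; simp)
  have hTc : ∀ τ ∈ T, ⁅τ, H⁆ = 0 := fun τ hτ => by
    have := hH ⟨τ, hτ⟩
    rwa [LinearMap.zero_apply, zero_smul] at this
  have h1 : y ∈ Submodule.span K (Set.range (rootSystem HL).coroot) := by
    rw [RootPairing.IsRootSystem.span_coroot_eq_top]; trivial
  induction h1 using Submodule.span_induction with
  | mem x hx =>
    obtain ⟨i, rfl⟩ := hx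
    rw [rootSystem_coroot_apply]
    exact exists_coroot_lift HL hπ hT hTH hInt noEven hHh hTc (hw i)
  | zero => exact ⟨0, T.zero_mem, by simp⟩
  | add x y _ _ hx hy =>
    obtain ⟨t, ht, hx⟩ := hx
    obtain ⟨u, hu, hy⟩ := hy
    exact ⟨t + u, T.add_mem ht hu, by rw [map_add, hx, hy]; rfl⟩
  | smul c x _ hx =>
    obtain ⟨t, ht, hx⟩ := hx
    exact ⟨c • t, T.smul_mem c ht, by rw [map_smul, hx]; rfl⟩

end Lift

section Structure

variable {K F : Type*} [Field K] [LieRing F] [LieAlgebra K F]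
  [IsAlgClosed K] [CharZero K] [FiniteDimensional K F]

instance : IsKilling K (F ⧸ radical K F) :=
  have := hasTrivialRadical_quotient (K := K) (F := F)
  inferInstance

instance : FiniteDimensional K (F ⧸ radical K F) :=
  inferInstanceAs (FiniteDimensional K (F ⧸ (radical K F).toSubmodule))

theorem MaxToral.exists_cartan
    (hred : ∀ I : LieIdeal K F, IsLieAbelian I → I ≤ center K F)
    {T : LieSubalgebra K F} (hT : MaxToral T) :
    ∃ HL : LieSubalgebra K (F ⧸ radical K F), ∃ _ : HL.IsCartanSubalgebra,
      (∀ y, y ∈ HL ↔ ∃ t ∈ T, quotHom (radical K F) t = y) ∧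
      ∃ H ∈ T, ∃ h : HL, quotHom (radical K F) H = h ∧
        (∀ x, ⁅(h : F ⧸ radical K F), x⁆ = 0 → x ∈ HL) ∧
        (∀ α : Weight K HL (F ⧸ radical K F), ∃ k : ℤ, α h = 2 * k) ∧
        ∀ (k : ℤ), ∀ r ∈ radical K F, r ∈ (ad K F H).maxGenEigenspace (2 * k : K) →
          r ∈ center K F := by
  set R := radical K F
  set π := quotHom R
  have hπ : Function.Surjective π := quotHom_surjective R
  obtain ⟨HL, hHL, hTH⟩ := exists_cartan_ge (T.map π)
    (by
      rintro _ ⟨x, hx, rfl⟩ _ ⟨y, hy, rfl⟩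
      change ⁅π x, π y⁆ = 0
      rw [← LieHom.map_lie, hT.comm x hx y hy, map_zero])
    (by
      rintro _ ⟨t, ht, rfl⟩
      refine top_unique fun y _ => ?_
      obtain ⟨x, rfl⟩ := hπ y
      have hx : x ∈ ⨆ α, wsp T.toSubmodule F α := by rw [hT.iSup_wsp]; trivial
      have hle : ⨆ α, wsp T.toSubmodule F α ≤
          (⨆ μ, (ad K (F ⧸ R) (π t)).eigenspace μ).comap (π : F →ₗ[K] F ⧸ R) := by
        refine iSup_le fun α x hx => Submodule.mem_comap.2 ?_
        refine Submodule.mem_iSup_of_mem (α ⟨t, ht⟩) (End.mem_eigenspace_iff.2 ?_)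
        change ⁅π t, π x⁆ = _ • π x
        rw [← LieHom.map_lie, ← map_smul, ← hx ⟨t, ht⟩]
      exact hle hx)
  have hTH' : ∀ t ∈ T, π t ∈ HL := fun t ht => hTH ⟨t, ht, rfl⟩
  obtain ⟨h, e, f, h1, h2, h3, hsup, hcen, hInt⟩ := exists_principal' HL
  have hHab : ∀ x ∈ HL, ∀ y ∈ HL, ⁅x, y⁆ = 0 := fun x hx y hy =>
    congrArg Subtype.val (trivial_lie_zero HL HL ⟨x, hx⟩ ⟨y, hy⟩)
  obtain ⟨e', rfl⟩ := hπ e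
  obtain ⟨f', rfl⟩ := hπ f
  have noEven : ∀ H, π H = h → ∀ (k : ℤ) (r : F), π r = 0 →
      r ∈ (ad K F H).maxGenEigenspace (2 * k : K) → r ∈ center K F := by
    intro H hH k r hr hrk
    refine mem_center_of_even hred (H := H) (E := e') (F' := f') ?_ ?_ ?_ ?_ ?_
      (quotHom_eq_zero.1 hr) hrk
    · rw [← quotHom_eq_zero, map_sub, map_smul, LieHom.map_lie]
      change ⁅π H, π e'⁆ - (2 : K) • π e' = 0
      rw [hH, h1, sub_self]
    · rw [← quotHom_eq_zero, map_add, map_smul, LieHom.map_lie]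
      change ⁅π H, π f'⁆ + (2 : K) • π f' = 0
      rw [hH, h2, neg_add_cancel]
    · rw [← quotHom_eq_zero, map_sub, LieHom.map_lie]
      change ⁅π e', π f'⁆ - π H = 0
      rw [hH, h3, sub_self]
    · change ⨆ k : ℤ, (ad K (F ⧸ R) (π H)).eigenspace (2 * k : K) = ⊤
      rw [hH, hsup]
    · have key : ∀ x, ⁅H, x⁆ ∈ radical K F → π x ∈ HL := fun x hx => hcen _ (by
        rw [← hH, ← LieHom.map_lie]; exact quotHom_eq_zero.2 hx)
      intro x y hx hy
      rw [← quotHom_eq_zero, LieHom.map_lie]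
      exact hHab _ (key x hx) _ (key y hy)
  have hsurj : ∀ y : HL, ∃ t ∈ T, π t = y := exists_lift_mem HL hπ hT hTH' hInt noEven
  obtain ⟨H, hH, hHh⟩ := hsurj h
  refine ⟨HL, hHL, fun y => ⟨fun hy => hsurj ⟨y, hy⟩, ?_⟩, H, hH, h, hHh, hcen, hInt,
    fun k r hr => noEven H hHh k r (quotHom_eq_zero.2 hr)⟩
  rintro ⟨t, ht, rfl⟩
  exact hTH' t ht

end Structure

end LieAux

namespace LieAux

open Module LieAlgebra LieModule

section

variable {K F : Type*} [Field K] [LieRing F] [LieAlgebra K F]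
  [IsAlgClosed K] [CharZero K] [FiniteDimensional K F]

/-- An `sl₂`-triple of weight vectors for `T`, not contained in the radical. -/
structure RootTriple (T : LieSubalgebra K F) (α : Dual K T) (x y : F) (t : T) : Prop where
  hx : x ∈ wsp T.toSubmodule F α
  hy : y ∈ wsp T.toSubmodule F (-α)
  notMem : x ∉ radical K F
  lie : ⁅x, y⁆ = t
  two : α t = 2

variable {T : LieSubalgebra K F}

lemma RootTriple.ne_zero {α : Dual K T} {x y : F} {t : T} (h : RootTriple T α x y t) : α ≠ 0 := by
  rintro rfl
  simpa using h.two

namespace MaxToral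

theorem mem_of_comm (hred : ∀ I : LieIdeal K F, IsLieAbelian I → I ≤ center K F)
    (hT : MaxToral T) {x : F} (hx : ∀ τ ∈ T, ⁅τ, x⁆ = 0) : x ∈ T := by
  obtain ⟨HL, _, hHL, H, hH, h, hHh, hcen, -, hev⟩ := hT.exists_cartan hred
  obtain ⟨t, ht, htx⟩ := (hHL (quotHom (radical K F) x)).1 (hcen _ (by
    rw [← hHh, ← LieHom.map_lie, hx H hH, map_zero]))
  have hr : x - t ∈ radical K F := by
    rw [← quotHom_eq_zero, map_sub, htx, sub_self]
  have hz : x - t ∈ center K F := hev 0 _ hr (mem_maxGen_ad (by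
    rw [lie_sub, hx H hH, hT.comm H hH t ht]; simp))
  have hzT : x - t ∈ T := hT.max _ (fun τ _ => mem_center_iff'.1 hz τ) <| top_unique fun y _ =>
    Submodule.mem_iSup_of_mem 0 (End.mem_eigenspace_iff.2 (by
      rw [ad_apply, center_lie hz, zero_smul]))
  have := T.add_mem hzT ht
  rwa [sub_add_cancel] at this

theorem mem_center (hred : ∀ I : LieIdeal K F, IsLieAbelian I → I ≤ center K F)
    (hT : MaxToral T) {x : F} (hx : x ∈ T) (hr : x ∈ radical K F) : x ∈ center K F := by
  obtain ⟨HL, _, hHL, H, hH, h, hHh, hcen, -, hev⟩ := hT.exists_cartan hred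
  exact hev 0 x hr (mem_maxGen_ad (by rw [hT.comm H hH x hx]; simp))

open LieAlgebra.IsKilling

/-- The classical root system of the semisimple quotient, and its relation to the weights of a
maximal toral subalgebra. -/
theorem exists_projection (hred : ∀ I : LieIdeal K F, IsLieAbelian I → I ≤ center K F)
    (hT : MaxToral T) :
    ∃ HL : LieSubalgebra K (F ⧸ radical K F), ∃ _ : HL.IsCartanSubalgebra, ∃ p : T →ₗ[K] HL,
      Function.Surjective p ∧ (∀ τ : T, (p τ : F ⧸ radical K F) = quotHom (radical K F) (τ : F)) ∧
      (∀ (α : Dual K T), α ≠ 0 → ∀ x ∈ wsp T.toSubmodule F α, x ∉ radical K F →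
        (∀ x' ∈ wsp T.toSubmodule F α, x' ∈ radical K F → x' = 0) ∧
        ∃ γ : Weight K HL (F ⧸ radical K F), γ.IsNonZero ∧ (∀ τ, α τ = γ (p τ))) := by
  set R := radical K F
  set π := quotHom R
  obtain ⟨HL, hC, hHL, H, hH, h, hHh, hcen, hInt, hev⟩ := hT.exists_cartan hred
  let p : T →ₗ[K] HL := ((π : F →ₗ[K] F ⧸ R).domRestrict T.toSubmodule).codRestrict
    HL.toSubmodule (fun τ => (hHL _).2 ⟨τ, τ.2, rfl⟩)
  have hp : Function.Surjective p := fun y => by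
    obtain ⟨t, ht, hty⟩ := (hHL y).1 y.2
    exact ⟨⟨t, ht⟩, Subtype.ext hty⟩
  have hpπ : ∀ τ : T, (p τ : F ⧸ R) = π (τ : F) := fun τ => rfl
  refine ⟨HL, hC, p, hp, hpπ, ?_⟩
  intro α hα x hx hxR
  have hx0 : π x ≠ 0 := fun h0 => hxR (quotHom_eq_zero.1 h0)
  have hlie : ∀ τ : T, ⁅(p τ : F ⧸ R), π x⁆ = α τ • π x := fun τ => by
    rw [hpπ]
    change ⁅π τ, π x⁆ = _
    rw [← LieHom.map_lie, ← map_smul, ← hx τ]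
  obtain ⟨s, hs⟩ := p.exists_rightInverse_of_surjective (LinearMap.range_eq_top.2 hp)
  have hs' : ∀ y, p (s y) = y := fun y => LinearMap.congr_fun hs y
  have hαs : ∀ τ, α τ = α (s (p τ)) := by
    intro τ
    have h1 := hlie τ
    have h2 := hlie (s (p τ))
    rw [hs', h1] at h2
    exact smul_left_injective K hx0 h2
  have hmem : π x ∈ rootSpace HL (α ∘ s : HL → K) := by
    refine weightSpace_le_genWeightSpace _ _ ?_
    rw [mem_weightSpace]
    intro y
    have := hlie (s y)
    rw [hs'] at this
    exact this
  let γ : Weight K HL (F ⧸ R) := ⟨α ∘ s, fun h0 => hx0 (by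
    rw [rootSpace, h0] at hmem; simpa using hmem)⟩
  have hγα : ∀ τ, α τ = γ (p τ) := hαs
  refine ⟨?_, γ, fun h0 => hα (LinearMap.ext fun τ => ?_), hγα⟩
  · intro x' hx' hxR'
    obtain ⟨k, hk⟩ := hInt γ
    have hph : p ⟨H, hH⟩ = h := Subtype.ext hHh
    have hz := hev k x' hxR' (mem_maxGen_ad (by
      have := hx' ⟨H, hH⟩
      rw [← hk, ← hph, ← hγα]
      exact this))
    by_contra h0
    refine hα (LinearMap.ext fun τ => ?_)
    have := hx' τ
    rw [mem_center_iff'.1 hz] at this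
    exact (smul_eq_zero.1 this.symm).resolve_right h0
  · rw [hγα]
    exact congrFun h0 (p τ)

theorem exists_partner (hred : ∀ I : LieIdeal K F, IsLieAbelian I → I ≤ center K F)
    (hT : MaxToral T) {α : Dual K T} (hα : α ≠ 0) {x : F} (hx : x ∈ wsp T.toSubmodule F α)
    (hxR : x ∉ radical K F) :
    (∀ x' ∈ wsp T.toSubmodule F α, ∃ c : K, x' = c • x) ∧ ∃ y t, RootTriple T α x y t := by
  set R := radical K F
  set π := quotHom R
  obtain ⟨HL, hC, p, hp, hpπ, hw⟩ := hT.exists_projection hred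
  obtain ⟨h0, γ, hγ, hγα⟩ := hw α hα x hx hxR
  have hx0 : π x ≠ 0 := fun h0 => hxR (quotHom_eq_zero.1 h0)
  have hmem : ∀ x' ∈ wsp T.toSubmodule F α, π x' ∈ rootSpace HL γ := by
    intro x' hx'
    refine weightSpace_le_genWeightSpace _ _ ?_
    rw [mem_weightSpace]
    intro y
    obtain ⟨τ, rfl⟩ := hp y
    change ⁅(p τ : F ⧸ R), π x'⁆ = _
    rw [hpπ]
    change ⁅π τ, π x'⁆ = _
    rw [← LieHom.map_lie, ← hγα, ← map_smul, ← hx' τ]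
  have h1 : ∀ w ∈ rootSpace HL γ, ∃ c : K, w = c • π x := by
    intro w hw
    obtain ⟨c, hc⟩ := (finrank_eq_one_iff_of_nonzero' (⟨π x, hmem x hx⟩ : rootSpace HL γ)
      (fun h => hx0 (congrArg Subtype.val h))).1 (finrank_rootSpace_eq_one γ hγ) ⟨w, hw⟩
    exact ⟨c, (congrArg Subtype.val hc).symm⟩
  refine ⟨fun x' hx' => ?_, ?_⟩
  · obtain ⟨c, hc⟩ := h1 _ (hmem x' hx')
    refine ⟨c, sub_eq_zero.1 (h0 _ (Submodule.sub_mem _ hx' (Submodule.smul_mem _ c hx)) ?_)⟩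
    rw [← quotHom_eq_zero, map_sub, map_smul]
    exact sub_eq_zero.2 hc
  · obtain ⟨h', e', f', hs, he', hf'⟩ := exists_isSl2Triple_of_weight_isNonZero hγ
    obtain ⟨c, rfl⟩ := h1 _ he'
    obtain ⟨y, hy, hyf⟩ := exists_lift_wsp (quotHom_surjective R) hT (α := -α) (y := c • f') (by
      intro τ
      have := lie_eq_smul_of_mem_rootSpace hf' (p τ)
      rw [lie_smul, LinearMap.neg_apply, hγα, smul_comm]
      rw [Pi.neg_apply] at this
      rw [← this, LieSubalgebra.coe_bracket_of_module, hpπ])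
    have hxy : ⁅x, y⁆ ∈ T := hT.mem_of_comm hred fun τ hτ => by
      have := lie_mem_wsp hx hy ⟨τ, hτ⟩
      rwa [add_neg_cancel, LinearMap.zero_apply, zero_smul] at this
    have hpt : p ⟨⁅x, y⁆, hxy⟩ = coroot γ := by
      refine Subtype.ext ?_
      rw [← hs.h_eq_coroot hγ he' hf', ← hs.lie_e_f, hpπ]
      change π ⁅x, y⁆ = _
      rw [LieHom.map_lie, smul_lie, ← lie_smul, ← hyf]
    exact ⟨y, ⟨_, hxy⟩, hx, hy, hxR, rfl, by rw [hγα, hpt, root_apply_coroot hγ]⟩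

theorem exists_rootSystem (hred : ∀ I : LieIdeal K F, IsLieAbelian I → I ≤ center K F)
    (hT : MaxToral T) :
    ∃ HL : LieSubalgebra K (F ⧸ radical K F), ∃ _ : HL.IsCartanSubalgebra, ∃ p : T →ₗ[K] HL,
      Function.Surjective p ∧ ∀ α x y t, RootTriple T α x y t →
        ∃ i : HL.root, (∀ τ, α τ = (rootSystem HL).root i (p τ)) ∧
          p t = (rootSystem HL).coroot i := by
  set R := radical K F
  set π := quotHom R
  obtain ⟨HL, hC, p, hp, hpπ, hw⟩ := hT.exists_projection hred
  refine ⟨HL, hC, p, hp, fun α x y t h => ?_⟩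
  obtain ⟨h0, γ, hγ, hγα⟩ := hw α h.ne_zero x h.hx h.notMem
  have hpπ' : ∀ τ : T, (p τ : F ⧸ R) = π τ := hpπ
  refine ⟨⟨γ, by simpa using hγ⟩, hγα, ?_⟩
  rw [rootSystem_coroot_apply]
  have hlie : ∀ (β : Dual K T) (z : F), z ∈ wsp T.toSubmodule F β → ∀ τ : T,
      ⁅(p τ : F ⧸ R), π z⁆ = β τ • π z := by
    intro β z hz τ
    rw [hpπ', ← LieHom.map_lie, ← map_smul, ← hz τ]
  have hpt : (p t : F ⧸ R) = ⁅π x, π y⁆ := by rw [hpπ', ← LieHom.map_lie, h.lie]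
  refine Subtype.ext (IsSl2Triple.h_eq_coroot hγ (h := (p t : F ⧸ R)) (e := π x) (f := π y)
    ⟨?_, hpt.symm, ?_, ?_⟩ ?_ ?_)
  · intro h1
    have h2 := h.two
    rw [hγα, show p t = 0 from Subtype.ext h1] at h2
    have h3 : γ (0 : HL) = 0 := map_zero (Weight.toLinear K HL (F ⧸ R) γ)
    rw [h3] at h2
    exact two_ne_zero h2.symm
  · rw [hlie α x h.hx, h.two, ← Nat.cast_smul_eq_nsmul K, Nat.cast_ofNat]
  · rw [hlie _ y h.hy, LinearMap.neg_apply, h.two, ← Nat.cast_smul_eq_nsmul K, Nat.cast_ofNat,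
      neg_smul]
  · refine weightSpace_le_genWeightSpace _ _ ?_
    rw [mem_weightSpace]
    intro w
    obtain ⟨τ, rfl⟩ := hp w
    rw [← hγα]
    exact hlie α x h.hx τ
  · refine weightSpace_le_genWeightSpace _ _ ?_
    rw [mem_weightSpace]
    intro w
    obtain ⟨τ, rfl⟩ := hp w
    rw [Pi.neg_apply, ← hγα]
    exact hlie _ y h.hy τ

end MaxToral

end

end LieAux

namespace LieAux

open Module LieAlgebra LieModule

section RootPairing

variable {ι R M N : Type*} [Field R] [CharZero R] [AddCommGroup M] [Module R M]
  [AddCommGroup N] [Module R N] [Finite ι] (P : RootPairing ι R M N) [P.IsCrystallographic]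

/-- A sum of roots which is nonpositive on the coroots of all its summands vanishes on all
coroots. -/
theorem toLinearMap_sum_root_eq_zero (s : Multiset ι)
    (hs : ∀ i ∈ s, ∃ k : ℤ, k ≤ 0 ∧ P.toLinearMap (s.map P.root).sum (P.coroot i) = k) (j : ι) :
    P.toLinearMap (s.map P.root).sum (P.coroot j) = 0 := by
  have := Fintype.ofFinite ι
  set v := (s.map P.root).sum with hv
  have hsum : ∀ (f : M →ₗ[R] R), f v = (s.map fun i => f (P.root i)).sum := fun f => by
    rw [hv, map_multiset_sum, Multiset.map_map]
    rfl
  have hInt : ∀ j, ∃ c : ℤ, P.toLinearMap v (P.coroot j) = c := by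
    intro j
    refine ⟨(s.map fun i => P.pairingIn ℤ i j).sum, ?_⟩
    have := hsum (P.coroot' j)
    rw [← eq_intCast (Int.castRingHom R), map_multiset_sum (Int.castRingHom R), Multiset.map_map]
    refine this.trans (congrArg _ (Multiset.map_congr rfl fun i _ => ?_))
    exact (P.algebraMap_pairingIn ℤ i j).symm
  choose c hc using hInt
  have hnorm : P.RootForm v v = ((∑ j, c j * c j : ℤ) : R) := by
    rw [P.rootForm_apply_apply]
    push_cast
    exact Finset.sum_congr rfl fun j _ => by rw [← hc]; rfl
  have hle : ∃ k : ℤ, k ≤ 0 ∧ 2 * P.RootForm v v = k := by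
    have h1 : 2 * P.RootForm v v = (s.map fun i => 2 * P.RootForm v (P.root i)).sum := by
      rw [hsum (P.RootForm v), Multiset.sum_map_mul_left]
    have h2 : ∀ i ∈ s, ∃ k : ℤ, k ≤ 0 ∧ 2 * P.RootForm v (P.root i) = k := by
      intro i hi
      obtain ⟨k, hk, hvk⟩ := hs i hi
      have h3 := congrArg (P.toLinearMap v) (P.rootForm_self_smul_coroot i)
      rw [map_smul, hvk, map_nsmul, P.toLinearMap_apply_apply_Polarization,
        P.rootForm_root_self] at h3
      refine ⟨(∑ j, P.pairingIn ℤ i j * P.pairingIn ℤ i j) * k,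
        mul_nonpos_of_nonneg_of_nonpos (Finset.sum_nonneg fun j _ => mul_self_nonneg _) hk, ?_⟩
      have h4 : P.RootForm v (P.root i) = P.RootForm (P.root i) v := by
        simp only [P.rootForm_apply_apply, mul_comm]
      rw [smul_eq_mul, nsmul_eq_mul, Nat.cast_ofNat] at h3
      rw [h4, ← h3]
      push_cast
      congr 1
      exact Finset.sum_congr rfl fun j _ => by rw [← P.algebraMap_pairingIn ℤ i j]; rfl
    rw [h1]
    clear h1
    clear_value v
    clear hsum hs hv
    induction s using Multiset.induction_on with
    | empty => exact ⟨0, le_rfl, by simp⟩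
    | cons a s ih =>
      obtain ⟨k, hk, hk'⟩ := h2 a (Multiset.mem_cons_self a s)
      obtain ⟨l, hl, hl'⟩ := ih fun i hi => h2 i (Multiset.mem_cons_of_mem hi)
      refine ⟨k + l, by omega, ?_⟩
      rw [Multiset.map_cons, Multiset.sum_cons, hk', hl', Int.cast_add]
  obtain ⟨k, hk, hk'⟩ := hle
  rw [hnorm] at hk'
  have hz : 2 * ∑ j, c j * c j = k := by exact_mod_cast hk'
  have h0 : ∑ j, c j * c j = 0 := le_antisymm (by omega)
    (Finset.sum_nonneg fun j _ => mul_self_nonneg _)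
  have := (Finset.sum_eq_zero_iff_of_nonneg fun j _ => mul_self_nonneg (c j)).1 h0 j
    (Finset.mem_univ _)
  rw [hc, mul_self_eq_zero.1 this, Int.cast_zero]

theorem linearIndependent_pair_coroot [P.IsReduced] [IsTorsionFree R N] {i j : ι} (hij : i ≠ j)
    (hij' : P.root i ≠ -P.root j) : LinearIndependent R ![P.coroot i, P.coroot j] := by
  refine RootPairing.IsReduced.linearIndependent (P := P.flip) hij fun h => hij' ?_
  have h1 : P.coroot i = P.coroot (P.reflectionPerm j j) := by
    rw [P.coroot_reflectionPerm, P.coreflection_apply_self]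
    exact h
  rw [P.coroot.injective h1, P.root_reflectionPerm, P.reflection_apply_self]

end RootPairing

section

variable {K F : Type*} [Field K] [LieRing F] [LieAlgebra K F]
  [IsAlgClosed K] [CharZero K] [FiniteDimensional K F] {T : LieSubalgebra K F}

namespace MaxToral

open LieAlgebra.IsKilling

variable (hred : ∀ I : LieIdeal K F, IsLieAbelian I → I ≤ center K F) (hT : MaxToral T)
include hred hT

theorem exists_int {α β : Dual K T} {x y x' y' : F} {t t' : T} (h : RootTriple T α x y t)
    (h' : RootTriple T β x' y' t') : ∃ k : ℤ, α t' = k := by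
  obtain ⟨HL, _, p, hp, H⟩ := hT.exists_rootSystem hred
  obtain ⟨i, hi, -⟩ := H _ _ _ _ h
  obtain ⟨j, -, hj⟩ := H _ _ _ _ h'
  refine ⟨(rootSystem HL).pairingIn ℤ i j, ?_⟩
  rw [hi, hj]
  exact ((rootSystem HL).algebraMap_pairingIn ℤ i j).symm

theorem pos_symm {α β : Dual K T} {x y x' y' : F} {t t' : T} (h : RootTriple T α x y t)
    (h' : RootTriple T β x' y' t') {k : ℤ} (hk : 0 < k) (hα : α t' = k) :
    ∃ l : ℤ, 0 < l ∧ β t = l := by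
  obtain ⟨HL, _, p, hp, H⟩ := hT.exists_rootSystem hred
  obtain ⟨i, hi, hi'⟩ := H _ _ _ _ h
  obtain ⟨j, hj, hj'⟩ := H _ _ _ _ h'
  have e1 : α t' = ((rootSystem HL).pairingIn ℤ i j : ℤ) := by
    rw [hi, hj']
    exact ((rootSystem HL).algebraMap_pairingIn ℤ i j).symm
  have e2 : β t = ((rootSystem HL).pairingIn ℤ j i : ℤ) := by
    rw [hj, hi']
    exact ((rootSystem HL).algebraMap_pairingIn ℤ j i).symm
  refine ⟨_, (rootSystem HL).zero_lt_pairingIn_iff' ℤ |>.1 ?_, e2⟩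
  rw [e1] at hα
  have : (rootSystem HL).pairingIn ℤ i j = k := by exact_mod_cast hα
  omega

theorem eq_or_eq_neg_of_smul {α β : Dual K T} {x y x' y' : F} {t t' : T} 
    (h : RootTriple T α x y t) (h' : RootTriple T β x' y' t') {c : K} (hc : β = c • α) :
    α = β ∨ α = -β := by
  obtain ⟨HL, _, p, hp, H⟩ := hT.exists_rootSystem hred
  obtain ⟨i, hi, hi'⟩ := H _ _ _ _ h
  obtain ⟨j, hj, hj'⟩ := H _ _ _ _ h'
  have := RootPairing.IsReduced.eq_or_eq_neg (P := rootSystem HL) i j (fun hli => by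
    have h1 := LinearIndependent.pair_iff.1 hli c (-1) (by
      refine LinearMap.ext fun y => ?_
      obtain ⟨τ, rfl⟩ := hp y
      have : β τ = c * α τ := by rw [hc]; rfl
      simp only [LinearMap.add_apply, LinearMap.smul_apply, LinearMap.zero_apply, ← hi, ← hj, this]
      simp)
    exact one_ne_zero (neg_eq_zero.1 h1.2))
  refine this.imp (fun e => LinearMap.ext fun τ => ?_) (fun e => LinearMap.ext fun τ => ?_)
  · rw [hi, hj, e]
  · rw [LinearMap.neg_apply, hi, hj, e]; rfl

theorem linearIndependent_coroot {α β : Dual K T} {x y x' y' : F} {t t' : T}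
    (h : RootTriple T α x y t) (h' : RootTriple T β x' y' t') (h1 : α ≠ β) (h2 : α ≠ -β) :
    LinearIndependent K ![t, t'] := by
  obtain ⟨HL, _, p, hp, H⟩ := hT.exists_rootSystem hred
  obtain ⟨i, hi, hi'⟩ := H _ _ _ _ h
  obtain ⟨j, hj, hj'⟩ := H _ _ _ _ h'
  have hli := linearIndependent_pair_coroot (rootSystem HL) (i := i) (j := j)
    (fun e => h1 (LinearMap.ext fun τ => by rw [hi, hj, e]))
    (fun e => h2 (LinearMap.ext fun τ => by rw [hi, e, LinearMap.neg_apply, LinearMap.neg_apply, hj]))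
  refine LinearIndependent.of_comp p ?_
  rw [← hi', ← hj'] at hli
  convert hli using 1
  funext i
  fin_cases i <;> rfl

theorem coroot_reflection {α β α' : Dual K T} {x y x' y' x'' y'' : F} {t t' t'' : T}
    (h : RootTriple T α x y t) (h' : RootTriple T β x' y' t') (h'' : RootTriple T α' x'' y'' t'')
    (h1 : α ≠ β) (h2 : α ≠ -β) (hα' : α' = α - α t' • β) {a b : K} (hab : t'' = a • t + b • t') :
    t'' = t - β t • t' := by
  obtain ⟨HL, _, p, hp, H⟩ := hT.exists_rootSystem hred
  obtain ⟨i, hi, hi'⟩ := H _ _ _ _ h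
  obtain ⟨j, hj, hj'⟩ := H _ _ _ _ h'
  obtain ⟨k, hk, hk'⟩ := H _ _ _ _ h''
  have hli := linearIndependent_pair_coroot (rootSystem HL) (i := i) (j := j)
    (fun e => h1 (LinearMap.ext fun τ => by rw [hi, hj, e]))
    (fun e => h2 (LinearMap.ext fun τ => by rw [hi, e, LinearMap.neg_apply, LinearMap.neg_apply, hj]))
  have e1 : (rootSystem HL).root k = (rootSystem HL).root ((rootSystem HL).reflectionPerm j i) := by
    refine LinearMap.ext fun z => ?_
    obtain ⟨τ, rfl⟩ := hp z
    rw [RootPairing.root_reflectionPerm, RootPairing.reflection_apply, LinearMap.sub_apply,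
      LinearMap.smul_apply, ← hk, ← hi, ← hj, hα', LinearMap.sub_apply, LinearMap.smul_apply, hi t',
      hj']
    rfl
  have e2 : p t'' = p t - β t • p t' := by
    rw [hk', (rootSystem HL).root.injective e1, RootPairing.coroot_reflectionPerm,
      RootPairing.coreflection_apply, hi', hj', hj, hi']
    rfl
  have e3 : (a - 1) • p t + (b + β t) • p t' = 0 := by
    rw [hab, map_add, map_smul, map_smul, ← sub_eq_zero] at e2
    rw [← e2]
    module
  rw [hi', hj'] at e3
  obtain ⟨ha, hb⟩ := LinearIndependent.pair_iff.1 hli _ _ e3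
  rw [hab, sub_eq_zero.1 ha, eq_neg_of_add_eq_zero_left hb]
  module

theorem sum_eq_zero {ι : Type*} (A : ι → Dual K T) (x y : ι → F) (t : ι → T) (s : Multiset ι)
    (hA : ∀ i ∈ s, RootTriple T (A i) (x i) (y i) (t i))
    (hs : ∀ i ∈ s, ∃ k : ℤ, k ≤ 0 ∧ (s.map A).sum (t i) = k) : (s.map A).sum = 0 := by
  obtain ⟨HL, _, p, hp, H⟩ := hT.exists_rootSystem hred
  have hj : ∀ i : {i // i ∈ s}, ∃ j : HL.root, (∀ τ, A i τ = (rootSystem HL).root j (p τ)) ∧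
      p (t i) = (rootSystem HL).coroot j := fun i => H _ _ _ _ (hA i i.2)
  choose j hj hj' using hj
  have key : ∀ τ, (s.map A).sum τ =
      (rootSystem HL).toLinearMap ((s.attach.map j).map (rootSystem HL).root).sum (p τ) := by
    intro τ
    rw [← s.attach_map_val' A]
    generalize s.attach = u
    induction u using Multiset.induction_on with
    | empty => simp
    | cons a u ih => 
      simp only [Multiset.map_cons, Multiset.sum_cons, LinearMap.add_apply, ih, map_add, hj]
      rfl
  have hz := toLinearMap_sum_root_eq_zero (rootSystem HL) (s.attach.map j) (fun i hi => by
    obtain ⟨a, -, rfl⟩ := Multiset.mem_map.1 hi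
    obtain ⟨k, hk, hk'⟩ := hs a a.2
    exact ⟨k, hk, by rw [← hk', key, hj']⟩)
  refine LinearMap.ext fun τ => ?_
  rw [key, LinearMap.zero_apply]
  have hspan : p τ ∈ Submodule.span K (Set.range (rootSystem HL).coroot) := by
    rw [RootPairing.IsRootSystem.span_coroot_eq_top]; trivial
  refine Submodule.span_induction (p := fun z _ => (rootSystem HL).toLinearMap
    ((s.attach.map j).map (rootSystem HL).root).sum z = 0) ?_ (map_zero _) ?_ ?_ hspan
  · rintro _ ⟨i, rfl⟩
    exact hz i
  · intro a b _ _ ha hb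
    rw [map_add, ha, hb, add_zero]
  · intro c a _ ha
    rw [map_smul, ha, smul_zero]

end MaxToral

end

end LieAux

namespace Paper

namespace Setup

open Module LieAlgebra LieAux

variable {K : Type} [Field K] [IsAlgClosed K] [CharZero K]
variable {g : Type} [LieRing g] [LieAlgebra K g]
variable (S : Setup K g)

/-- `h ∩ g_n` as a subalgebra of `g_n`. -/
def torus (n : ℕ) : LieSubalgebra K (S.F n) := S.h.comap (S.F n).incl

instance (n : ℕ) : FiniteDimensional K (S.F n) := S.F_findim n

lemma mem_iSup_wsp {n : ℕ} {z : g} (hz : z ∈ S.F n) :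
    (⟨z, hz⟩ : S.F n) ∈ ⨆ α, wsp (S.torus n).toSubmodule (S.F n) α := by
  have h1 := (S.h_maxToral n).1.2.2 hz
  suffices ∀ z : g, z ∈ ⨆ α : Dual K (S.h ⊓ S.F n : LieSubalgebra K g),
      (S.F n).toSubmodule ⊓ adWeightSpace K g (S.h ⊓ S.F n) α →
      ∃ hz : z ∈ S.F n, (⟨z, hz⟩ : S.F n) ∈ ⨆ α, wsp (S.torus n).toSubmodule (S.F n) α from
    (this z h1).2
  intro z hz
  refine Submodule.iSup_induction _ (motive := fun z => ∃ hz : z ∈ S.F n,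
    (⟨z, hz⟩ : S.F n) ∈ ⨆ α, wsp (S.torus n).toSubmodule (S.F n) α) hz ?_ ?_ ?_
  · intro α x hx
    refine ⟨hx.1, Submodule.mem_iSup_of_mem
      (α.comp (LinearMap.codRestrict _ ((S.F n).toSubmodule.subtype.comp
        (S.torus n).toSubmodule.subtype) fun τ => ⟨τ.2, τ.1.2⟩)) fun τ => ?_⟩
    exact Subtype.ext (hx.2 ⟨τ.1, τ.2, τ.1.2⟩)
  · exact ⟨zero_mem _, zero_mem _⟩
  · rintro x y ⟨hx, hx'⟩ ⟨hy, hy'⟩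
    exact ⟨add_mem hx hy, add_mem hx' hy'⟩

lemma torus_comm {x y : g} (hx : x ∈ S.h) (hy : y ∈ S.h) : ⁅x, y⁆ = 0 := by
  obtain ⟨n, hn⟩ := S.F_exhaust x
  obtain ⟨m, hm⟩ := S.F_exhaust y
  have hx' := S.F_mono (le_max_left n m) hn
  have hy' := S.F_mono (le_max_right n m) hm
  have := (S.h_maxToral (max n m)).1.2.1
  exact congrArg Subtype.val (trivial_lie_zero (S.h ⊓ S.F (max n m) : LieSubalgebra K g)
    (S.h ⊓ S.F (max n m) : LieSubalgebra K g) ⟨x, hx, hx'⟩ ⟨y, hy, hy'⟩)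

theorem maxToral (n : ℕ) : MaxToral (S.torus n) where
  comm x hx y hy := Subtype.ext (S.torus_comm hx hy)
  iSup_wsp := top_unique fun x _ => S.mem_iSup_wsp x.2
  max t ht htop := by
    have hcomm : ∀ τ ∈ S.h, τ ∈ S.F n → ⁅τ, (t : g)⁆ = 0 := fun τ h1 h2 =>
      congrArg Subtype.val (ht ⟨τ, h2⟩ h1)
    have hmem : ∀ {z : g}, z ∈ (S.h ⊓ S.F n).toSubmodule ⊔ Submodule.span K {(t : g)} →
        ∃ τ, τ ∈ S.h ∧ τ ∈ S.F n ∧ ∃ c : K, z = τ + c • (t : g) := by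
      intro z hz
      obtain ⟨τ, hτ, w, hw, rfl⟩ := Submodule.mem_sup.1 hz
      obtain ⟨c, rfl⟩ := Submodule.mem_span_singleton.1 hw
      exact ⟨τ, hτ.1, hτ.2, c, rfl⟩
    have hz0 : ∀ {a b : g}, a ∈ (S.h ⊓ S.F n).toSubmodule ⊔ Submodule.span K {(t : g)} →
        b ∈ (S.h ⊓ S.F n).toSubmodule ⊔ Submodule.span K {(t : g)} → ⁅a, b⁆ = 0 := by
      intro a b ha hb
      obtain ⟨τ, h1, h2, c, rfl⟩ := hmem ha
      obtain ⟨σ, h3, h4, d, rfl⟩ := hmem hb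
      have h5 : ⁅(t : g), σ⁆ = 0 := by rw [← lie_skew, hcomm σ h3 h4, neg_zero]
      simp [S.torus_comm h1 h3, hcomm τ h1 h2, h5]
    let t' : LieSubalgebra K g :=
      { (S.h ⊓ S.F n).toSubmodule ⊔ Submodule.span K {(t : g)} with
        lie_mem' := fun {a b} ha hb => by
          have := hz0 ha hb
          simp only [AddSubsemigroup.mem_carrier, AddSubmonoid.mem_toSubsemigroup,
            Submodule.mem_toAddSubmonoid] at *
          rw [this]
          exact zero_mem _ }
    have htor : IsToralIn K g (S.F n) t' := by
      refine ⟨?_, ⟨fun a b => Subtype.ext (hz0 a.2 b.2)⟩, ?_⟩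
      · intro z hz
        obtain ⟨τ, h1, h2, c, rfl⟩ := hmem hz
        exact add_mem h2 ((S.F n).smul_mem c t.2)
      · intro z hz
        have h1 := S.mem_iSup_wsp hz
        have h2 : ∀ α, wsp (S.torus n).toSubmodule (S.F n) α =
            ⨆ c, wsp (S.torus n).toSubmodule (S.F n) α ⊓ (ad K (S.F n) t).eigenspace c := fun α =>
          Submodule.eq_iSup_inf_genEigenspace 1 (fun x hx τ => by
            rw [ad_apply, leibniz_lie, ht τ τ.2, zero_lie, zero_add, hx τ, lie_smul]) htop
        rw [iSup_congr h2] at h1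
        suffices (⟨z, hz⟩ : S.F n) ∈ (⨆ α : Dual K t',
            (S.F n).toSubmodule ⊓ adWeightSpace K g t' α).comap (S.F n).toSubmodule.subtype from this
        refine SetLike.le_def.1 (iSup_le fun α => iSup_le fun c => ?_) h1
        rintro v ⟨hv, hvc⟩
        rw [SetLike.mem_coe, End.mem_eigenspace_iff, ad_apply] at hvc
        rcases eq_or_ne v 0 with rfl | hv0
        · exact zero_mem _
        have hv1 : (v : g) ≠ 0 := fun h => hv0 (Subtype.ext h)
        obtain ⟨φ, hφ⟩ := Projective.exists_dual_eq_one K hv1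
        have hsc : ∀ a : t', ∃ d : K, ⁅(a : g), (v : g)⁆ = d • (v : g) := by
          intro a
          obtain ⟨τ, h3, h4, d, hd⟩ := hmem a.2
          refine ⟨α ⟨⟨τ, h4⟩, h3⟩ + d * c, ?_⟩
          have h5 : ⁅τ, (v : g)⁆ = α ⟨⟨τ, h4⟩, h3⟩ • (v : g) :=
            congrArg Subtype.val (hv ⟨⟨τ, h4⟩, h3⟩)
          have h6 : ⁅(t : g), (v : g)⁆ = c • (v : g) := congrArg Subtype.val hvc
          rw [hd, add_lie, smul_lie, h5, h6, add_smul, mul_smul]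
        refine Submodule.mem_iSup_of_mem
          { toFun := fun a => φ ⁅(a : g), (v : g)⁆
            map_add' := fun a b => (congrArg φ (add_lie (a : g) b (v : g))).trans (map_add φ _ _)
            map_smul' := fun d a =>
              (congrArg φ (smul_lie d (a : g) (v : g))).trans (map_smul φ _ _) } ⟨v.2, fun a => ?_⟩
        obtain ⟨d, hd⟩ := hsc a
        change ⁅(a : g), (v : g)⁆ = φ ⁅(a : g), (v : g)⁆ • (v : g)
        rw [hd, map_smul, hφ, smul_eq_mul, mul_one]
    have := (S.h_maxToral n).2 t' htor (fun z hz => Submodule.mem_sup_left hz)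
    have h3 : (t : g) ∈ t' := Submodule.mem_sup_right (Submodule.mem_span_singleton_self _)
    rw [this] at h3
    exact h3.1

end Setup

end Paper

namespace LieAux

open Module LieAlgebra

theorem MaxToral.ideal_le {K F : Type*} [Field K] [LieRing F] [LieAlgebra K F]
    [IsAlgClosed K] [CharZero K] [FiniteDimensional K F] {T : LieSubalgebra K F}
    (hred : ∀ I : LieIdeal K F, IsLieAbelian I → I ≤ center K F) (hT : MaxToral T)
    {I : LieIdeal K F} (hI : I ≤ radical K F) {J : Submodule K F} (hJ : ∀ x ∈ J, x ∈ T → x = 0)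
    (hIJ : ∀ x ∈ I, ∀ y ∈ I, ⁅x, y⁆ ∈ J) {x : F} (hx : x ∈ I) : x ∈ T := by
  have hab : ∀ A : LieIdeal K F, ⁅A, A⁆ = ⊥ → ∀ x ∈ A, x ∈ T := by
    intro A hA x hx
    have hc : A ≤ center K F := hred A ((isLieAbelian_iff A).2 fun x hx y hy => by
      have := LieSubmodule.lie_mem_lie hx hy
      rwa [hA, LieSubmodule.mem_bot] at this)
    exact hT.mem_of_comm hred fun τ _ => mem_center_iff'.1 (hc hx) τ
  have hD : ∀ k, derivedSeriesOfIdeal K F (k + 1) I = ⊥ → derivedSeriesOfIdeal K F 1 I = ⊥ := by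
    intro k
    induction k with
    | zero => exact id
    | succ k ih =>
      intro h
      refine ih ((LieSubmodule.eq_bot_iff _).2 fun x hx => hJ x ?_ (hab _ ?_ x hx))
      · have h1 : derivedSeriesOfIdeal K F (k + 1) I ≤ ⁅I, I⁆ :=
          derivedSeriesOfIdeal_le le_rfl (by omega : 1 ≤ k + 1)
        have h2 : (⁅I, I⁆ : LieIdeal K F).toSubmodule ≤ J := by
          rw [LieSubmodule.lieIdeal_oper_eq_linear_span', Submodule.span_le]
          rintro _ ⟨a, ha, b, hb, rfl⟩
          exact hIJ a ha b hb
        exact h2 (h1 hx)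
      · rw [← derivedSeriesOfIdeal_succ]; exact h
  have hs : IsSolvable I := (LieIdeal.solvable_iff_le_radical K F I).2 hI
  obtain ⟨k, hk⟩ := IsSolvable.solvable K I
  rw [LieIdeal.derivedSeries_eq_bot_iff] at hk
  refine hab I ?_ x hx
  have h1 := hD k (le_bot_iff.1 ((derivedSeriesOfIdeal_succ_le I k).trans hk.le))
  exact h1

theorem mem_radical_of_comp {K F G : Type*} [Field K] [LieRing F] [LieAlgebra K F]
    [LieRing G] [LieAlgebra K G] [FiniteDimensional K F] [FiniteDimensional K G]
    (f : F →ₗ⁅K⁆ G) (hf : Function.Injective f) {x : F} (hx : f x ∈ radical K G) :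
    x ∈ radical K F := by
  let I : LieIdeal K F := (radical K G).comap f
  suffices h : I ≤ radical K F from h (LieIdeal.mem_comap.2 hx)
  rw [← LieIdeal.solvable_iff_le_radical]
  let φ : I →ₗ⁅K⁆ radical K G :=
    { ((f : F →ₗ[K] G).domRestrict I.toSubmodule).codRestrict (radical K G).toSubmodule
        (fun z => LieIdeal.mem_comap.1 z.2) with
      map_lie' := fun {a b} => Subtype.ext (f.map_lie (a : F) b) }
  have hφ : Function.Injective φ := fun a b h =>
    Subtype.ext (hf (congrArg Subtype.val h))
  exact hφ.lieAlgebra_isSolvable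

end LieAux

namespace Paper

namespace Setup

open Module LieAlgebra LieAux Filter

variable {K : Type} [Field K] [IsAlgClosed K] [CharZero K]
variable {g : Type} [LieRing g] [LieAlgebra K g]
variable (S : Setup K g)

/-- The weight space of weight `α`. -/
abbrev W (α : Dual K S.h) : Submodule K g := adWeightSpace K g S.h α

lemma lie_mem_W {α β : Dual K S.h} {x y : g} (hx : x ∈ S.W α) (hy : y ∈ S.W β) :
    ⁅x, y⁆ ∈ S.W (α + β) :=
  lie_mem_wsp (T := S.h.toSubmodule) (V := g) hx hy

lemma isRoot_of_mem {α : Dual K S.h} {x : g} (hα : α ≠ 0) (hx : x ∈ S.W α) (h0 : x ≠ 0) :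
    IsRootOf K g S.h α :=
  ⟨hα, fun h => h0 (by rw [W, h] at hx; exact hx)⟩

lemma induction_W {Q : g → Prop} (h0 : Q 0) (hadd : ∀ x y, Q x → Q y → Q (x + y))
    (hW : ∀ α, ∀ x ∈ S.W α, Q x) (x : g) : Q x := by
  have hx : x ∈ ⨆ α, S.W α := by rw [S.h_span]; trivial
  exact Submodule.iSup_induction _ (motive := Q) hx hW h0 hadd

lemma eventually_mem (x : g) : ∀ᶠ m in atTop, x ∈ S.F m := by
  obtain ⟨n, hn⟩ := S.F_exhaust x
  exact eventually_atTop.2 ⟨n, fun m hm => S.F_mono hm hn⟩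

lemma mem_W_zero {x : g} : x ∈ S.W 0 ↔ x ∈ S.h := by
  constructor
  · intro hx
    obtain ⟨n, hn⟩ := S.F_exhaust x
    have := (S.maxToral n).mem_of_comm (S.F_reductive n) (x := ⟨x, hn⟩) fun τ hτ => by
      refine Subtype.ext ((hx ⟨τ, hτ⟩).trans ?_)
      simp
    exact this
  · intro hx H
    rw [LinearMap.zero_apply, zero_smul]
    exact S.torus_comm H.2 hx

/-- Restriction of a functional on `h` to `h ∩ g_n`. -/
def res (n : ℕ) (α : Dual K S.h) : Dual K (S.torus n) :=
  α.comp (((S.F n).toSubmodule.subtype.comp (S.torus n).toSubmodule.subtype).codRestrict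
    S.h.toSubmodule fun τ => τ.2)

lemma mem_wsp_res {n : ℕ} {α : Dual K S.h} {x : g} (hx : x ∈ S.W α) (hn : x ∈ S.F n) :
    (⟨x, hn⟩ : S.F n) ∈ wsp (S.torus n).toSubmodule (S.F n) (S.res n α) :=
  fun τ => Subtype.ext (hx ⟨τ, τ.2⟩)

lemma mem_radical_of_frequently {x : g}
    (h : ∃ᶠ m in atTop, ∃ hx : x ∈ S.F m, (⟨x, hx⟩ : S.F m) ∈ radical K (S.F m)) {n : ℕ}
    (hn : x ∈ S.F n) : (⟨x, hn⟩ : S.F n) ∈ radical K (S.F n) := by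
  obtain ⟨m, hm, hx, hr⟩ := (frequently_atTop.1 h) n
  exact mem_radical_of_comp (LieSubalgebra.inclusion (S.F_mono hm))
    (LieSubalgebra.inclusion_injective _) hr

/-- The locally radical elements of `g`. -/
def locRad : LieIdeal K g where
  carrier := {x | ∀ m (hx : x ∈ S.F m), (⟨x, hx⟩ : S.F m) ∈ radical K (S.F m)}
  add_mem' := fun {x y} hx hy m hm => by
    refine S.mem_radical_of_frequently (Eventually.frequently ?_) hm
    filter_upwards [S.eventually_mem x, S.eventually_mem y] with k h1 h2
    exact ⟨add_mem h1 h2, (radical K (S.F k)).add_mem (hx k h1) (hy k h2)⟩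
  zero_mem' := fun m _ => (radical K (S.F m)).zero_mem
  smul_mem' := fun c x hx m hm => by
    refine S.mem_radical_of_frequently (Eventually.frequently ?_) hm
    filter_upwards [S.eventually_mem x] with k h1
    exact ⟨(S.F k).smul_mem c h1, (radical K (S.F k)).smul_mem c (hx k h1)⟩
  lie_mem := fun {y x} hx m hm => by
    refine S.mem_radical_of_frequently (Eventually.frequently ?_) hm
    filter_upwards [S.eventually_mem x, S.eventually_mem y] with k h1 h2
    exact ⟨(S.F k).lie_mem h2 h1, lie_mem_right K (S.F k) (radical K (S.F k)) ⟨y, h2⟩ ⟨x, h1⟩ (hx k h1)⟩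

lemma eventually_notMem_radical {x : g} (h : x ∉ S.locRad) :
    ∀ᶠ m in atTop, ∃ hx : x ∈ S.F m, (⟨x, hx⟩ : S.F m) ∉ radical K (S.F m) := by
  by_contra hn
  refine h fun m hm => S.mem_radical_of_frequently (x := x) ?_ hm
  refine (not_eventually.1 hn).and_eventually (S.eventually_mem x) |>.mono fun k hk => ?_
  by_contra h1
  exact hk.1 ⟨hk.2, fun h2 => h1 ⟨hk.2, h2⟩⟩

/-- An ideal of locally radical elements whose derived ideal meets `h` trivially lies in `h`. -/
lemma ideal_le_h {I : LieIdeal K g} (hI : I ≤ S.locRad) {J : Submodule K g}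
    (hJ : ∀ x ∈ J, x ∈ S.h → x = 0) (hIJ : ∀ x ∈ I, ∀ y ∈ I, ⁅x, y⁆ ∈ J) {x : g} (hx : x ∈ I) :
    x ∈ S.h := by
  obtain ⟨n, hn⟩ := S.F_exhaust x
  exact (S.maxToral n).ideal_le (S.F_reductive n) (I := I.comap (S.F n).incl)
    (J := J.comap (S.F n).toSubmodule.subtype) (x := ⟨x, hn⟩)
    (fun y hy => hI (LieIdeal.mem_comap.1 hy) n y.2)
    (fun y hy hyT => Subtype.ext (hJ y hy hyT))
    (fun y hy z hz => hIJ y (LieIdeal.mem_comap.1 hy) z (LieIdeal.mem_comap.1 hz))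
    (LieIdeal.mem_comap.2 hx)

lemma lie_eq_zero_of_mem_locRad {x : g} (hx : x ∈ S.locRad) (hh : x ∈ S.h) (y : g) :
    ⁅y, x⁆ = 0 := by
  obtain ⟨m, h1, h2⟩ := ((S.eventually_mem x).and (S.eventually_mem y)).exists
  have := (S.maxToral m).mem_center (S.F_reductive m) (x := ⟨x, h1⟩) hh (hx m h1)
  exact congrArg Subtype.val (mem_center_iff'.1 this ⟨y, h2⟩)

lemma eq_zero_of_mem_h {A : Set (Dual K S.h)} (hA : (0 : Dual K S.h) ∉ A) {x : g}
    (hx : x ∈ ⨆ α ∈ A, S.W α) (hh : x ∈ S.h) : x = 0 := by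
  have h1 := S.h_indep 0
  rw [disjoint_iff] at h1
  have h2 : (⨆ α ∈ A, S.W α) ≤ ⨆ (j) (_ : j ≠ 0), adWeightSpace K g S.h j :=
    iSup₂_le fun α hα => le_iSup₂_of_le α (fun h => hA (h ▸ hα)) le_rfl
  have h3 : x ∈ (⊥ : Submodule K g) := by
    rw [← h1]
    exact ⟨S.mem_W_zero.2 hh, h2 hx⟩
  exact (Submodule.mem_bot K).1 h3

lemma zero_notMem_pos : (0 : Dual K S.h) ∉ S.pos := fun h => (S.pos_root 0 h).1 rfl

/-- The sum of the locally radical parts of the weight spaces with weights in `A`. -/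
def radPart (A : Set (Dual K S.h)) : Submodule K g :=
  ⨆ α ∈ A, S.locRad.toSubmodule ⊓ S.W α

lemma mem_radPart {A : Set (Dual K S.h)} {α : Dual K S.h} (hα : α ∈ A) {x : g}
    (hx : x ∈ S.locRad) (hW : x ∈ S.W α) : x ∈ S.radPart A :=
  Submodule.mem_iSup_of_mem α (Submodule.mem_iSup_of_mem hα ⟨hx, hW⟩)

lemma radPart_le {A : Set (Dual K S.h)} {P : Submodule K g}
    (h : ∀ α ∈ A, ∀ x ∈ S.locRad, x ∈ S.W α → x ∈ P) : S.radPart A ≤ P :=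
  iSup₂_le fun α hα x hx => h α hα x hx.1 hx.2

lemma radPart_le_locRad {A : Set (Dual K S.h)} : S.radPart A ≤ S.locRad.toSubmodule :=
  S.radPart_le fun _ _ _ hx _ => hx

lemma radPart_lie {A B C : Set (Dual K S.h)} (h : ∀ α ∈ A, ∀ β ∈ B, ∀ x ∈ S.locRad, x ∈ S.W α →
    ∀ y ∈ S.locRad, y ∈ S.W β → ⁅x, y⁆ ≠ 0 → α + β ∈ C) {x y : g} (hx : x ∈ S.radPart A)
    (hy : y ∈ S.radPart B) : ⁅x, y⁆ ∈ S.radPart C := by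
  have h1 : S.radPart A ≤ (S.radPart C).comap ((ad K g y : Module.End K g)) := by
    refine S.radPart_le fun α hα a ha haW => ?_
    rw [Submodule.mem_comap, ad_apply, ← lie_skew]
    have h2 : S.radPart B ≤ (S.radPart C).comap ((ad K g a : Module.End K g)) := by
      refine S.radPart_le fun β hβ b hb hbW => ?_
      rw [Submodule.mem_comap, ad_apply]
      by_cases h0 : ⁅a, b⁆ = 0
      · rw [h0]; exact zero_mem _
      · exact S.mem_radPart (h α hα β hβ a ha haW b hb hbW h0) (S.locRad.lie_mem hb)
          (S.lie_mem_W haW hbW)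
    exact neg_mem (h2 hy)
  have := h1 hx
  rw [Submodule.mem_comap, ad_apply] at this
  rw [← lie_skew]
  exact neg_mem this

end Setup

end Paper

namespace Paper

namespace Setup

open Module LieAlgebra LieAux Filter

variable {K : Type} [Field K] [IsAlgClosed K] [CharZero K]
variable {g : Type} [LieRing g] [LieAlgebra K g]
variable (S : Setup K g)

/-- The subalgebra of elements stabilizing a subspace. -/
def stab (P : Submodule K g) : LieSubalgebra K g where
  carrier := {x | ∀ y ∈ P, ⁅x, y⁆ ∈ P}
  add_mem' := fun hx hy z hz => by rw [add_lie]; exact add_mem (hx z hz) (hy z hz)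
  zero_mem' := fun z _ => by rw [zero_lie]; exact zero_mem _
  smul_mem' := fun c x hx z hz => by rw [smul_lie]; exact P.smul_mem c (hx z hz)
  lie_mem' := fun {x y} hx hy z hz => by
    rw [lie_lie]
    exact sub_mem (hx _ (hy z hz)) (hy _ (hx z hz))

lemma mem_b_of_mem_h {x : g} (hx : x ∈ S.h) : x ∈ S.b := by
  have h1 : x ∈ S.b.toSubmodule := by
    rw [S.b_eq]; exact Submodule.mem_sup_left hx
  exact h1

lemma mem_b_of_mem_W {α : Dual K S.h} (hα : α ∈ S.pos) {x : g} (hx : x ∈ S.W α) : x ∈ S.b := by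
  have h1 : x ∈ S.b.toSubmodule := by
    rw [S.b_eq]
    exact Submodule.mem_sup_right (Submodule.mem_iSup_of_mem α (Submodule.mem_iSup_of_mem hα hx))
  exact h1

variable {S} in
lemma IsDynkin.b_le (hD : S.IsDynkin) {N : LieSubalgebra K g} (hh : ∀ x ∈ S.h, x ∈ N)
    (hs : ∀ α, S.IsSimpleRoot α → ∀ x ∈ S.W α, x ∈ N) : S.b ≤ N := by
  rw [hD, LieSubalgebra.lieSpan_le]
  rintro x (hx | hx)
  · exact hh x hx
  · simp only [Set.mem_iUnion] at hx
    obtain ⟨α, hα, hx⟩ := hx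
    exact hs α hα x hx

lemma neg_mem_pos {α : Dual K S.h} (h : IsRootOf K g S.h α) (hα : α ∉ S.pos) : -α ∈ S.pos :=
  not_not.1 fun h1 => hα ((S.pos_polar α h).2 h1)

lemma neg_notMem_pos {α : Dual K S.h} (hα : α ∈ S.pos) : -α ∉ S.pos :=
  (S.pos_polar α (S.pos_root α hα)).1 hα

/-- The sum of the locally radical parts of the weight spaces with nonpositive weights. -/
def negRad : Submodule K g := S.radPart {μ | μ ∉ S.pos}

variable {S}

lemma IsDynkin.mem_stab_negRad (hD : S.IsDynkin) (x : g) : x ∈ stab S.negRad := by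
  have key : ∀ β, (β = 0 ∨ β ∉ S.pos ∨ S.IsSimpleRoot β) → ∀ x ∈ S.W β, x ∈ stab S.negRad := by
    intro β hβ x hx
    suffices h : S.negRad ≤ S.negRad.comap (ad K g x : End K g) from fun y hy => h hy
    refine S.radPart_le fun μ hμ y hy hyW => ?_
    rw [Submodule.mem_comap, ad_apply]
    by_cases h0 : ⁅x, y⁆ = 0
    · rw [h0]; exact zero_mem _
    have hμ0 : μ ≠ 0 := by
      rintro rfl
      exact h0 (S.lie_eq_zero_of_mem_locRad hy (S.mem_W_zero.1 hyW) x)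
    have hμr := S.isRoot_of_mem hμ0 hyW fun h => h0 (by rw [h, lie_zero])
    refine S.mem_radPart (α := β + μ) ?_ (S.locRad.lie_mem hy) (S.lie_mem_W hx hyW)
    rcases eq_or_ne β 0 with rfl | hβ0
    · rwa [zero_add]
    rcases hβ with hβ | hβ | hβ
    · exact absurd hβ hβ0
    · by_cases hs : β + μ = 0
      · rw [hs]; exact S.zero_notMem_pos
      · exact S.neg_add β μ (S.isRoot_of_mem hβ0 hx fun h => h0 (by rw [h, zero_lie])) hμr hβ hμ
          (S.isRoot_of_mem hs (S.lie_mem_W hx hyW) h0)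
    · intro hs
      refine hβ.2 ⟨{β + μ, -μ}, by simp, fun γ hγ => ?_, by simp⟩
      simp only [Multiset.insert_eq_cons, Multiset.mem_cons, Multiset.mem_singleton] at hγ
      rcases hγ with rfl | rfl
      · exact hs
      · exact S.neg_mem_pos hμr hμ
  have hb : S.b ≤ stab S.negRad := hD.b_le
    (fun x hx => key 0 (Or.inl rfl) x (S.mem_W_zero.2 hx))
    (fun α hα => key α (Or.inr (Or.inr hα)))
  refine S.induction_W (zero_mem _) (fun _ _ => add_mem) (fun β x hx => ?_) x
  by_cases hβ : β ∈ S.pos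
  · exact hb (S.mem_b_of_mem_W hβ hx)
  · exact key β (Or.inr (Or.inl hβ)) x hx

lemma IsDynkin.neg_locRad_eq_zero (hD : S.IsDynkin) {μ : Dual K S.h} (hμ0 : μ ≠ 0)
    (hμ : μ ∉ S.pos) {x : g} (hx : x ∈ S.locRad) (hW : x ∈ S.W μ) : x = 0 := by
  let I : LieIdeal K g :=
    { S.negRad with lie_mem := fun {y m} hm => hD.mem_stab_negRad y m hm }
  have hxI : x ∈ I := S.mem_radPart hμ hx hW
  have hxh : x ∈ S.h := S.ideal_le_h (I := I) (J := S.radPart {μ | μ ∉ S.pos ∧ μ ≠ 0})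
    (fun y hy => S.radPart_le_locRad hy)
    (fun y hy hyh => S.eq_zero_of_mem_h (A := {μ | μ ∉ S.pos ∧ μ ≠ 0}) (fun h => h.2 rfl)
      (S.radPart_le (fun α hα z _ hz => Submodule.mem_iSup_of_mem α
        (Submodule.mem_iSup_of_mem hα hz)) hy) hyh)
    (fun y hy z hz => S.radPart_lie (A := {μ | μ ∉ S.pos}) (B := {μ | μ ∉ S.pos}) (by
      intro α hα β hβ a ha haW b hb hbW hab
      have hα0 : α ≠ 0 := by
        rintro rfl
        refine hab ?_
        rw [← lie_skew, S.lie_eq_zero_of_mem_locRad ha (S.mem_W_zero.1 haW), neg_zero]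
      have hβ0 : β ≠ 0 := by
        rintro rfl
        exact hab (S.lie_eq_zero_of_mem_locRad hb (S.mem_W_zero.1 hbW) a)
      have hαr := S.isRoot_of_mem hα0 haW fun h => hab (by rw [h, zero_lie])
      have hβr := S.isRoot_of_mem hβ0 hbW fun h => hab (by rw [h, lie_zero])
      have hs : α + β ≠ 0 := fun h => hβ (by
        rw [← neg_eq_of_add_eq_zero_right h]; exact S.neg_mem_pos hαr hα)
      exact ⟨S.neg_add α β hαr hβr hα hβ (S.isRoot_of_mem hs (S.lie_mem_W haW hbW) hab), hs⟩)
      hy hz) hxI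
  exact S.eq_zero_of_mem_h (A := {μ}) (fun h => hμ0 h.symm)
    (Submodule.mem_iSup_of_mem μ (Submodule.mem_iSup_of_mem rfl hW)) hxh

/-- Root vectors are not locally radical. -/
theorem IsDynkin.locRad_eq_zero (hD : S.IsDynkin) {μ : Dual K S.h} (hμ0 : μ ≠ 0)
    {x : g} (hx : x ∈ S.locRad) (hW : x ∈ S.W μ) : x = 0 := by
  let I : LieIdeal K g :=
    { S.radPart Set.univ with
      lie_mem := fun {y m} hm => by
        refine S.induction_W (Q := fun y => ⁅y, m⁆ ∈ S.radPart Set.univ) ?_ ?_ ?_ y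
        · rw [zero_lie]; exact zero_mem _
        · intro a b ha hb
          rw [add_lie]
          exact add_mem ha hb
        · intro α a ha
          have h : S.radPart Set.univ ≤ (S.radPart Set.univ).comap (ad K g a : End K g) :=
            S.radPart_le fun β _ z hz hzW => S.mem_radPart (α := α + β) (Set.mem_univ _)
              (S.locRad.lie_mem hz) (S.lie_mem_W ha hzW)
          exact h hm }
  have hxI : x ∈ I := S.mem_radPart (Set.mem_univ μ) hx hW
  have hxh : x ∈ S.h := S.ideal_le_h (I := I) (J := S.radPart S.pos)
    (fun y hy => S.radPart_le_locRad hy)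
    (fun y hy hyh => S.eq_zero_of_mem_h S.zero_notMem_pos
      (S.radPart_le (fun α hα z _ hz => Submodule.mem_iSup_of_mem α
        (Submodule.mem_iSup_of_mem hα hz)) hy) hyh)
    (fun y hy z hz => S.radPart_lie (A := Set.univ) (B := Set.univ) (by
      intro α _ β _ a ha haW b hb hbW hab
      have hα0 : α ≠ 0 := by
        rintro rfl
        refine hab ?_
        rw [← lie_skew, S.lie_eq_zero_of_mem_locRad ha (S.mem_W_zero.1 haW), neg_zero]
      have hβ0 : β ≠ 0 := by
        rintro rfl
        exact hab (S.lie_eq_zero_of_mem_locRad hb (S.mem_W_zero.1 hbW) a)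
      have hα : α ∈ S.pos := by
        by_contra h
        exact hab (by rw [hD.neg_locRad_eq_zero hα0 h ha haW, zero_lie])
      have hβ : β ∈ S.pos := by
        by_contra h
        exact hab (by rw [hD.neg_locRad_eq_zero hβ0 h hb hbW, lie_zero])
      have hs : α + β ≠ 0 := fun h => S.neg_notMem_pos hα (by
        rwa [neg_eq_of_add_eq_zero_right h])
      exact S.pos_add α hα β hβ (S.isRoot_of_mem hs (S.lie_mem_W haW hbW) hab)) hy hz) hxI
  exact S.eq_zero_of_mem_h (A := {μ}) (fun h => hμ0 h.symm)
    (Submodule.mem_iSup_of_mem μ (Submodule.mem_iSup_of_mem rfl hW)) hxh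

end Setup

end Paper

namespace Paper

namespace Setup

open Module LieAlgebra LieAux Filter

variable {K : Type} [Field K] [IsAlgClosed K] [CharZero K]
variable {g : Type} [LieRing g] [LieAlgebra K g]
variable (S : Setup K g)

/-- An `sl₂`-triple attached to a root. -/
structure Triple (α : Dual K S.h) (x y : g) (t : S.h) : Prop where
  hx : x ∈ S.W α
  hy : y ∈ S.W (-α)
  lie : ⁅x, y⁆ = t
  two : α t = 2

variable {S}

namespace Triple

variable {α : Dual K S.h} {x y : g} {t : S.h}

lemma ne_zero (h : S.Triple α x y t) : α ≠ 0 := by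
  rintro rfl
  exact two_ne_zero (α := K) (h.two.symm.trans rfl)

lemma x_ne_zero (h : S.Triple α x y t) : x ≠ 0 := by
  rintro rfl
  have h1 := h.lie
  rw [zero_lie] at h1
  have h2 : t = 0 := Subtype.ext h1.symm
  have := h.two
  rw [h2, map_zero] at this
  exact two_ne_zero this.symm

lemma symm (h : S.Triple α x y t) : S.Triple (-α) y x (-t) where
  hx := h.hy
  hy := by rw [neg_neg]; exact h.hx
  lie := by rw [← lie_skew, h.lie]; rfl
  two := by rw [map_neg, LinearMap.neg_apply, neg_neg, h.two]

lemma isRoot (h : S.Triple α x y t) : IsRootOf K g S.h α :=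
  S.isRoot_of_mem h.ne_zero h.hx h.x_ne_zero

lemma lie_tx (h : S.Triple α x y t) : ⁅(t : g), x⁆ = (2 : K) • x := by
  rw [h.hx t, h.two]

lemma lie_ty (h : S.Triple α x y t) : ⁅(t : g), y⁆ = -((2 : K) • y) := by
  rw [h.hy t, LinearMap.neg_apply, h.two, neg_smul]

end Triple

lemma eventually_ne_res {α β : Dual K S.h} (h : α ≠ β) :
    ∀ᶠ m in atTop, S.res m α ≠ S.res m β := by
  obtain ⟨H, hH⟩ : ∃ H, α H ≠ β H := by
    by_contra! hn
    exact h (LinearMap.ext hn)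
  filter_upwards [S.eventually_mem (H : g)] with m hm he
  exact hH (LinearMap.congr_fun he ⟨⟨H, hm⟩, H.2⟩)

namespace IsDynkin

variable (hD : S.IsDynkin)
include hD

lemma notMem_locRad {α : Dual K S.h} {x : g} (hα : α ≠ 0) (hx : x ∈ S.W α) (h0 : x ≠ 0) :
    x ∉ S.locRad := fun h => h0 (hD.locRad_eq_zero hα h hx)

lemma eventually_partner {α : Dual K S.h} {x : g} (hα : α ≠ 0) (hx : x ∈ S.W α) (h0 : x ≠ 0) :
    ∀ᶠ m in atTop, ∃ hm : x ∈ S.F m, (⟨x, hm⟩ : S.F m) ∉ radical K (S.F m) ∧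
      (∀ x' ∈ wsp (S.torus m).toSubmodule (S.F m) (S.res m α), ∃ c : K, x' = c • ⟨x, hm⟩) ∧
      ∃ y t, RootTriple (S.torus m) (S.res m α) ⟨x, hm⟩ y t := by
  filter_upwards [S.eventually_notMem_radical (hD.notMem_locRad hα hx h0),
    eventually_ne_res hα] with m h1 h2
  obtain ⟨hm, hr⟩ := h1
  obtain ⟨h3, h4⟩ := (S.maxToral m).exists_partner (S.F_reductive m) h2 (S.mem_wsp_res hx hm) hr
  exact ⟨hm, hr, h3, h4⟩

theorem exists_triple {α : Dual K S.h} {x : g} (hα : α ≠ 0) (hx : x ∈ S.W α) (h0 : x ≠ 0) :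
    ∃ y t, S.Triple α x y t := by
  obtain ⟨m, hm, -, -, y, t, hT⟩ := (hD.eventually_partner hα hx h0).exists
  have key : ∀ y : g, ∃ y' ∈ S.W (-α), ∃ z ∈ ⨆ γ ∈ ({0}ᶜ : Set (Dual K S.h)), S.W γ,
      ⁅x, y⁆ = ⁅x, y'⁆ + z := by
    refine S.induction_W ⟨0, zero_mem _, 0, zero_mem _, by simp⟩ ?_ ?_
    · rintro a b ⟨a', ha', z, hz, h1⟩ ⟨b', hb', w, hw, h2⟩
      refine ⟨a' + b', add_mem ha' hb', z + w, add_mem hz hw, ?_⟩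
      rw [lie_add, lie_add, h1, h2]
      abel
    · intro γ y hy
      by_cases hγ : α + γ = 0
      · rw [← neg_eq_of_add_eq_zero_right hγ] at hy
        exact ⟨y, hy, 0, zero_mem _, by simp⟩
      · exact ⟨0, zero_mem _, ⁅x, y⁆, Submodule.mem_iSup_of_mem (α + γ)
          (Submodule.mem_iSup_of_mem hγ (S.lie_mem_W hx hy)), by simp⟩
  obtain ⟨y', hy', z, hz, h1⟩ := key y
  have h2 : ⁅x, (y : g)⁆ = ((t : S.F m) : g) := congrArg Subtype.val hT.lie
  have h3 : ⁅x, y'⁆ ∈ S.h := by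
    have := S.lie_mem_W hx hy'
    rw [add_neg_cancel] at this
    exact S.mem_W_zero.1 this
  have h4 : z = 0 := S.eq_zero_of_mem_h (A := {0}ᶜ) (by simp) hz (by
    have : z = ((t : S.F m) : g) - ⁅x, y'⁆ := by rw [← h2, h1]; abel
    rw [this]
    exact sub_mem t.2 h3)
  refine ⟨y', ⟨((t : S.F m) : g), t.2⟩, hx, hy', ?_, hT.two⟩
  rw [← h2, h1, h4, add_zero]

theorem exists_triple_of_isRoot {α : Dual K S.h} (hα : IsRootOf K g S.h α) :
    ∃ x y t, S.Triple α x y t := by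
  obtain ⟨x, hx, h0⟩ := (Submodule.ne_bot_iff _).1 hα.2
  obtain ⟨y, t, h⟩ := hD.exists_triple hα.1 hx h0
  exact ⟨x, y, t, h⟩

lemma neg_isRoot {α : Dual K S.h} (hα : IsRootOf K g S.h α) : IsRootOf K g S.h (-α) := by
  obtain ⟨x, y, t, h⟩ := hD.exists_triple_of_isRoot hα
  exact h.symm.isRoot

lemma exists_smul {α : Dual K S.h} {x x' : g} (hα : α ≠ 0) (hx : x ∈ S.W α) (h0 : x ≠ 0)
    (hx' : x' ∈ S.W α) : ∃ c : K, x' = c • x := by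
  obtain ⟨m, ⟨hm, -, h1, -⟩, hm'⟩ :=
    ((hD.eventually_partner hα hx h0).and (S.eventually_mem x')).exists
  obtain ⟨c, hc⟩ := h1 _ (S.mem_wsp_res hx' hm')
  exact ⟨c, congrArg Subtype.val hc⟩

lemma coroot_unique {α : Dual K S.h} {x y x' y' : g} {t t' : S.h} (h : S.Triple α x y t)
    (h' : S.Triple α x' y' t') : t = t' := by
  obtain ⟨c, rfl⟩ := hD.exists_smul h.ne_zero h.hx h.x_ne_zero h'.hx
  obtain ⟨d, rfl⟩ := hD.exists_smul h.symm.ne_zero h.symm.hx h.symm.x_ne_zero h'.symm.hx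
  have h1 : t' = (c * d) • t := Subtype.ext (by
    rw [← h'.lie, smul_lie, lie_smul, smul_smul, h.lie]; rfl)
  have h2 := h'.two
  rw [h1, map_smul, h.two, smul_eq_mul] at h2
  have h3 : c * d = 1 := mul_right_cancel₀ two_ne_zero (h2.trans (one_mul 2).symm)
  rw [h1, h3, one_smul]

lemma eventually_rootTriple {α : Dual K S.h} {x y : g} {t : S.h} (h : S.Triple α x y t) :
    ∀ᶠ m in atTop, ∃ (hx : x ∈ S.F m) (hy : y ∈ S.F m) (ht : (t : g) ∈ S.F m),
      RootTriple (S.torus m) (S.res m α) ⟨x, hx⟩ ⟨y, hy⟩ ⟨⟨t, ht⟩, t.2⟩ := by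
  filter_upwards [S.eventually_notMem_radical (hD.notMem_locRad h.ne_zero h.hx h.x_ne_zero),
    S.eventually_mem y, S.eventually_mem (t : g)] with m ⟨hx, hr⟩ hy ht
  exact ⟨hx, hy, ht, S.mem_wsp_res h.hx hx, S.mem_wsp_res h.hy hy, hr, Subtype.ext h.lie, h.two⟩

lemma exists_int {α β : Dual K S.h} {x y x' y' : g} {t t' : S.h} (h : S.Triple α x y t)
    (h' : S.Triple β x' y' t') : ∃ k : ℤ, α t' = k := by
  obtain ⟨m, ⟨_, _, _, h1⟩, _, _, _, h2⟩ :=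
    ((hD.eventually_rootTriple h).and (hD.eventually_rootTriple h')).exists
  exact (S.maxToral m).exists_int (S.F_reductive m) h1 h2

lemma pos_symm {α β : Dual K S.h} {x y x' y' : g} {t t' : S.h} (h : S.Triple α x y t)
    (h' : S.Triple β x' y' t') {k : ℤ} (hk : 0 < k) (hα : α t' = k) :
    ∃ l : ℤ, 0 < l ∧ β t = l := by
  obtain ⟨m, ⟨_, _, _, h1⟩, _, _, _, h2⟩ :=
    ((hD.eventually_rootTriple h).and (hD.eventually_rootTriple h')).exists
  exact (S.maxToral m).pos_symm (S.F_reductive m) h1 h2 hk hα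

lemma eq_or_eq_neg_of_smul {α β : Dual K S.h} {x y x' y' : g} {t t' : S.h}
    (h : S.Triple α x y t) (h' : S.Triple β x' y' t') {c : K} (hc : β = c • α) :
    α = β ∨ α = -β := by
  by_contra! hn
  obtain ⟨m, ⟨_, _, _, h1⟩, ⟨_, _, _, h2⟩, h3, h4⟩ :=
    ((hD.eventually_rootTriple h).and ((hD.eventually_rootTriple h').and
      ((eventually_ne_res hn.1).and (eventually_ne_res hn.2)))).exists
  rcases (S.maxToral m).eq_or_eq_neg_of_smul (S.F_reductive m) h1 h2 (c := c)
    (by rw [hc]; rfl) with h | h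
  · exact h3 h
  · exact h4 h

lemma linearIndependent_coroot {α β : Dual K S.h} {x y x' y' : g} {t t' : S.h}
    (h : S.Triple α x y t) (h' : S.Triple β x' y' t') (h1 : α ≠ β) (h2 : α ≠ -β) :
    LinearIndependent K ![t, t'] := by
  obtain ⟨m, ⟨_, _, a1, h3⟩, ⟨_, _, a2, h4⟩, h5, h6⟩ :=
    ((hD.eventually_rootTriple h).and ((hD.eventually_rootTriple h').and
      ((eventually_ne_res h1).and (eventually_ne_res h2)))).exists
  have := (S.maxToral m).linearIndependent_coroot (S.F_reductive m) h3 h4 h5 h6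
  rw [LinearIndependent.pair_iff] at this ⊢
  intro a b hab
  refine this a b (Subtype.ext (Subtype.ext ?_))
  exact (congrArg Subtype.val hab :)

lemma coroot_reflection {α β α' : Dual K S.h} {x y x' y' x'' y'' : g} {t t' t'' : S.h}
    (h : S.Triple α x y t) (h' : S.Triple β x' y' t') (h'' : S.Triple α' x'' y'' t'')
    (h1 : α ≠ β) (h2 : α ≠ -β) (hα' : α' = α - α t' • β) {a b : K} (hab : t'' = a • t + b • t') :
    t'' = t - β t • t' := by
  obtain ⟨m, ⟨_, _, a1, h3⟩, ⟨_, _, a2, h4⟩, ⟨_, _, a3, h7⟩, h5, h6⟩ :=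
    ((hD.eventually_rootTriple h).and ((hD.eventually_rootTriple h').and
      ((hD.eventually_rootTriple h'').and
      ((eventually_ne_res h1).and (eventually_ne_res h2))))).exists
  have := (S.maxToral m).coroot_reflection (S.F_reductive m) h3 h4 h7 h5 h6
    (by rw [hα']; rfl) (a := a) (b := b) (Subtype.ext (Subtype.ext (congrArg Subtype.val hab :)))
  exact Subtype.ext (congrArg (fun z : S.torus m => ((z : S.F m) : g)) this)

end IsDynkin

end Setup

end Paper

namespace LieAux

open Module

namespace Sl2

variable {K V : Type*} [Field K] [CharZero K] [AddCommGroup V] [Module K V]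
  [FiniteDimensional K V] {h e f : End K V}

lemma symm (S : Sl2 h e f) : Sl2 (-h) f e where
  he v := by simp only [LinearMap.neg_apply, map_neg, S.hf]; module
  hf v := by simp only [LinearMap.neg_apply, map_neg, S.he]; module
  ef v := by simp only [LinearMap.neg_apply, S.ef]; abel

lemma exists_reflect_aux (S : Sl2 h e f) {μ : K} {v : V} (hv : h v = μ • v) (h0 : v ≠ 0) :
    ∃ k : ℤ, μ = k ∧ (0 ≤ k → ∃ q, (f ^ (q + k.toNat)) ((e ^ q) v) ≠ 0) := by
  obtain ⟨n, hn, hn'⟩ := S.exists_e_pow (mem_maxGen_of_eig hv) h0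
  have h1 : h ((e ^ n) v) = (μ + 2 * n) • (e ^ n) v := by
    rw [S.h_e_pow, hv, map_smul]; module
  obtain ⟨N, hN, hf, -⟩ := S.primitive_nat hn' h1 hn
  refine ⟨N - 2 * n, by push_cast; linear_combination hN, fun hk => ⟨n, fun h2 => hf ?_⟩⟩
  obtain ⟨j, rfl⟩ : ∃ j, N = 2 * n + j := ⟨N - 2 * n, by omega⟩
  have h3 : n + (((2 * n + j : ℕ) : ℤ) - 2 * n).toNat = n + j := by omega
  rw [h3] at h2
  rw [show 2 * n + j = n + (n + j) by omega, pow_add, Module.End.mul_apply, h2, map_zero]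

lemma exists_reflect (S : Sl2 h e f) {μ : K} {v : V} (hv : h v = μ • v) (h0 : v ≠ 0) :
    ∃ k : ℕ, (μ = k ∧ ∃ q, (f ^ (q + k)) ((e ^ q) v) ≠ 0) ∨
      (μ = -k ∧ ∃ q, (e ^ (q + k)) ((f ^ q) v) ≠ 0) := by
  obtain ⟨k, hk, h1⟩ := S.exists_reflect_aux hv h0
  rcases le_total 0 k with hk0 | hk0
  · lift k to ℕ using hk0
    exact ⟨k, Or.inl ⟨by simpa using hk, by simpa using h1 (by positivity)⟩⟩
  · obtain ⟨l, rfl⟩ : ∃ l : ℕ, k = -(l : ℤ) := ⟨(-k).toNat, by omega⟩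
    obtain ⟨k', hk', h2⟩ := S.symm.exists_reflect_aux (μ := -μ) (v := v)
      (by rw [LinearMap.neg_apply, hv, neg_smul]) h0
    have : k' = l := by
      rw [hk] at hk'
      push_cast at hk'
      rw [neg_neg] at hk'
      exact_mod_cast hk'.symm
    subst this
    exact ⟨l, Or.inr ⟨by simpa using hk, by simpa using h2 (by positivity)⟩⟩

end Sl2

end LieAux

namespace Paper

namespace Setup

open Module LieAlgebra LieAux Filter

variable {K : Type} [Field K] [IsAlgClosed K] [CharZero K]
variable {g : Type} [LieRing g] [LieAlgebra K g]
variable {S : Setup K g}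

lemma coe_ad_pow {m : ℕ} (x z : S.F m) (n : ℕ) :
    ((((ad K (S.F m) x) ^ n) z : S.F m) : g) = ((ad K g (x : g)) ^ n) (z : g) := by
  induction n with
  | zero => rfl
  | succ n ih =>
    rw [pow_succ', pow_succ', Module.End.mul_apply, Module.End.mul_apply, ← ih]
    rfl

lemma pow_mem_F {m : ℕ} {x z : g} (hx : x ∈ S.F m) (hz : z ∈ S.F m) (n : ℕ) :
    ((ad K g x) ^ n) z ∈ S.F m := by
  rw [← coe_ad_pow ⟨x, hx⟩ ⟨z, hz⟩]
  exact Subtype.prop _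

lemma pow_mem_W {α γ : Dual K S.h} {x z : g} (hx : x ∈ S.W α) (hz : z ∈ S.W γ) (n : ℕ) :
    ((ad K g x) ^ n) z ∈ S.W (γ + n • α) := by
  induction n with
  | zero => simpa using hz
  | succ n ih =>
    rw [pow_succ', Module.End.mul_apply, ad_apply]
    convert S.lie_mem_W hx ih using 1
    rw [succ_nsmul]
    congr 1
    abel

namespace Triple

variable {α : Dual K S.h} {x y : g} {t : S.h} (h : S.Triple α x y t)
include h

lemma sl2 {m : ℕ} (hx : x ∈ S.F m) (hy : y ∈ S.F m) (ht : (t : g) ∈ S.F m) :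
    Sl2 (ad K (S.F m) ⟨t, ht⟩) (ad K (S.F m) ⟨x, hx⟩) (ad K (S.F m) ⟨y, hy⟩) where
  he v := by
    simp only [ad_apply]
    rw [leibniz_lie, show ⁅(⟨t, ht⟩ : S.F m), (⟨x, hx⟩ : S.F m)⁆ = (2 : K) • ⟨x, hx⟩ from
      Subtype.ext h.lie_tx, smul_lie, add_comm]
  hf v := by
    simp only [ad_apply]
    rw [leibniz_lie, show ⁅(⟨t, ht⟩ : S.F m), (⟨y, hy⟩ : S.F m)⁆ = -((2 : K) • ⟨y, hy⟩) from
      Subtype.ext h.lie_ty, neg_lie, smul_lie]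
    abel
  ef v := by
    simp only [ad_apply]
    rw [leibniz_lie, show ⁅(⟨x, hx⟩ : S.F m), (⟨y, hy⟩ : S.F m)⁆ = ⟨t, ht⟩ from
      Subtype.ext h.lie, add_comm]

lemma exists_F (z : g) : ∃ m, x ∈ S.F m ∧ y ∈ S.F m ∧ (t : g) ∈ S.F m ∧ z ∈ S.F m :=
  ((S.eventually_mem x).and ((S.eventually_mem y).and ((S.eventually_mem (t : g)).and
    (S.eventually_mem z)))).exists

lemma exists_reflect {z : g} {μ : K} (hz : ⁅(t : g), z⁆ = μ • z) (h0 : z ≠ 0) :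
    ∃ k : ℕ, (μ = k ∧ ∃ q, ((ad K g y) ^ (q + k)) (((ad K g x) ^ q) z) ≠ 0) ∨
      (μ = -k ∧ ∃ q, ((ad K g x) ^ (q + k)) (((ad K g y) ^ q) z) ≠ 0) := by
  obtain ⟨m, hx, hy, ht, hm⟩ := h.exists_F z
  obtain ⟨k, hk⟩ := (h.sl2 hx hy ht).exists_reflect (μ := μ) (v := ⟨z, hm⟩) (Subtype.ext hz)
    (fun h => h0 (congrArg Subtype.val h))
  refine ⟨k, hk.imp (And.imp_right ?_) (And.imp_right ?_)⟩ <;>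
  · rintro ⟨q, hq⟩
    refine ⟨q, fun h1 => hq (Subtype.ext ?_)⟩
    rw [coe_ad_pow, coe_ad_pow, h1]
    rfl

lemma primitive {z : g} {μ : K} (hz : ⁅(t : g), z⁆ = μ • z) (h0 : z ≠ 0) (hxz : ⁅x, z⁆ = 0) :
    ∃ n : ℕ, μ = n := by
  obtain ⟨m, hx, hy, ht, hm⟩ := h.exists_F z
  obtain ⟨n, hn, -, -⟩ := (h.sl2 hx hy ht).primitive_nat (μ := μ) (w := ⟨z, hm⟩)
    (Subtype.ext hxz) (Subtype.ext hz) (fun h => h0 (congrArg Subtype.val h))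
  exact ⟨n, hn⟩

lemma lie_ne_zero {γ : Dual K S.h} {z : g} (hz : z ∈ S.W γ) (h0 : z ≠ 0) {k : ℤ} (hk : k < 0)
    (hγ : γ t = k) : ⁅x, z⁆ ≠ 0 := fun h1 => by
  obtain ⟨n, hn⟩ := h.primitive (hz t) h0 h1
  rw [hγ] at hn
  have : k = n := by exact_mod_cast hn
  omega

lemma nilpotent_y (z : g) : ∃ n, ((ad K g y) ^ n) z = 0 := by
  refine S.induction_W (Q := fun z => ∃ n, ((ad K g y) ^ n) z = 0) ⟨0, rfl⟩ ?_ ?_ z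
  · rintro a b ⟨n, hn⟩ ⟨m, hm⟩
    refine ⟨n + m, ?_⟩
    rw [map_add, pow_add, Module.End.mul_apply, Module.End.mul_apply, hm, map_zero, add_zero,
      ← Module.End.mul_apply, ← pow_add, add_comm, pow_add, Module.End.mul_apply, hn, map_zero]
  · intro γ z hz
    obtain ⟨m, hx, hy, ht, hm⟩ := h.exists_F z
    have S2 := h.sl2 hx hy ht
    have h2 : (ad K (S.F m) ⟨t, ht⟩ : End K (S.F m)) ⟨z, hm⟩ = γ t • (⟨z, hm⟩ : S.F m) :=
      Subtype.ext (hz t)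
    obtain ⟨n, hn⟩ := exists_pow_eq_zero_of_shift (c := (-2 : K)) (by simp)
      (fun v => by rw [S2.hf]; module) (mem_maxGen_of_eig h2)
    refine ⟨n, ?_⟩
    have := congrArg Subtype.val hn
    rwa [coe_ad_pow] at this

end Triple

end Setup

end Paper

namespace Paper

namespace Setup

open Module LieAlgebra LieAux Filter

variable {K : Type} [Field K] [IsAlgClosed K] [CharZero K]
variable {g : Type} [LieRing g] [LieAlgebra K g]
variable {S : Setup K g}

lemma iSup_W_lie {A B C : Set (Dual K S.h)} (h : ∀ α ∈ A, ∀ β ∈ B, ∀ x ∈ S.W α, ∀ y ∈ S.W β,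
    ⁅x, y⁆ ≠ 0 → α + β ∈ C) {x y : g} (hx : x ∈ ⨆ α ∈ A, S.W α) (hy : y ∈ ⨆ α ∈ B, S.W α) :
    ⁅x, y⁆ ∈ ⨆ α ∈ C, S.W α := by
  have h1 : (⨆ α ∈ A, S.W α) ≤ (⨆ α ∈ C, S.W α).comap (ad K g y : End K g) := by
    refine iSup₂_le fun α hα a ha => ?_
    rw [Submodule.mem_comap, ad_apply, ← lie_skew]
    have h2 : (⨆ α ∈ B, S.W α) ≤ (⨆ α ∈ C, S.W α).comap (ad K g a : End K g) := by
      refine iSup₂_le fun β hβ b hb => ?_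
      rw [Submodule.mem_comap, ad_apply]
      by_cases h0 : ⁅a, b⁆ = 0
      · rw [h0]; exact zero_mem _
      · exact Submodule.mem_iSup_of_mem (α + β) (Submodule.mem_iSup_of_mem
          (h α hα β hβ a ha b hb h0) (S.lie_mem_W ha hb))
    exact neg_mem (h2 hy)
  have := h1 hx
  rw [Submodule.mem_comap, ad_apply] at this
  rw [← lie_skew]
  exact neg_mem this

/-- The sum of the weight spaces with weights in `A`, as a subalgebra. -/
def subW (A : Set (Dual K S.h)) (h : ∀ α ∈ A, ∀ β ∈ A, ∀ x ∈ S.W α, ∀ y ∈ S.W β,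
    ⁅x, y⁆ ≠ 0 → α + β ∈ A) : LieSubalgebra K g :=
  { (⨆ α ∈ A, S.W α) with lie_mem' := fun {_ _} hx hy => iSup_W_lie h hx hy }

lemma mem_iSup_W {A : Set (Dual K S.h)} {α : Dual K S.h} (hα : α ∈ A) {x : g} (hx : x ∈ S.W α) :
    x ∈ ⨆ α ∈ A, S.W α :=
  Submodule.mem_iSup_of_mem α (Submodule.mem_iSup_of_mem hα hx)

lemma mem_of_mem_iSup_W {A : Set (Dual K S.h)} {α : Dual K S.h} {x : g} (hx : x ∈ S.W α)
    (h0 : x ≠ 0) (hA : x ∈ ⨆ α ∈ A, S.W α) : α ∈ A := by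
  by_contra hα
  have h1 := S.h_indep α
  rw [disjoint_iff] at h1
  have h2 : (⨆ γ ∈ A, S.W γ) ≤ ⨆ (j) (_ : j ≠ α), adWeightSpace K g S.h j :=
    iSup₂_le fun γ hγ => le_iSup₂_of_le γ (fun h => hα (h ▸ hγ)) le_rfl
  have h3 : x ∈ (⊥ : Submodule K g) := by
    rw [← h1]
    exact ⟨hx, h2 hA⟩
  exact h0 ((Submodule.mem_bot K).1 h3)

lemma pos_add_of_lie {α β : Dual K S.h} (hα : α ∈ S.pos) (hβ : β ∈ S.pos) {x y : g}
    (hx : x ∈ S.W α) (hy : y ∈ S.W β) (h0 : ⁅x, y⁆ ≠ 0) : α + β ∈ S.pos := by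
  have hs : α + β ≠ 0 := fun h => S.neg_notMem_pos hα (by rwa [neg_eq_of_add_eq_zero_right h])
  exact S.pos_add α hα β hβ (S.isRoot_of_mem hs (S.lie_mem_W hx hy) h0)

lemma exists_neg_of_sum {s : Multiset (Dual K S.h)} {t : S.h} (hs : ∀ γ ∈ s, ∃ k : ℤ, γ t = k)
    {N : ℤ} (hN : N < 0) (h : s.sum t = N) : ∃ γ ∈ s, ∃ k : ℤ, k < 0 ∧ γ t = k := by
  induction s using Multiset.induction_on generalizing N with
  | empty =>
    rw [Multiset.sum_zero, LinearMap.zero_apply] at h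
    have : (0 : ℤ) = N := by exact_mod_cast h
    omega
  | cons a s ih =>
    obtain ⟨k, hk⟩ := hs a (Multiset.mem_cons_self a s)
    by_cases hk0 : k < 0
    · exact ⟨a, Multiset.mem_cons_self a s, k, hk0, hk⟩
    · rw [Multiset.sum_cons, LinearMap.add_apply, hk] at h
      obtain ⟨γ, hγ, h1⟩ := ih (fun γ hγ => hs γ (Multiset.mem_cons_of_mem hγ))
        (N := N - k) (by omega) (by push_cast; rw [← h]; ring)
      exact ⟨γ, Multiset.mem_cons_of_mem hγ, h1⟩

lemma exists_pos_of_sum {s : Multiset (Dual K S.h)} {t : S.h} (hs : ∀ γ ∈ s, ∃ k : ℤ, γ t = k)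
    {N : ℤ} (hN : 0 < N) (h : s.sum t = N) : ∃ γ ∈ s, ∃ k : ℤ, 0 < k ∧ γ t = k := by
  obtain ⟨γ, hγ, k, hk, h1⟩ := exists_neg_of_sum (s := s) (t := -t)
    (fun γ hγ => by
      obtain ⟨k, hk⟩ := hs γ hγ
      exact ⟨-k, by rw [map_neg, hk]; simp⟩) (N := -N) (by omega) (by rw [map_neg, h]; simp)
  exact ⟨γ, hγ, -k, by omega, by rw [map_neg] at h1; push_cast; rw [← h1, neg_neg]⟩

lemma simple_sub_notRoot {β β' : Dual K S.h} (hβ : S.IsSimpleRoot β) (hβ' : S.IsSimpleRoot β') :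
    ¬ IsRootOf K g S.h (β - β') := by
  intro h
  by_cases hp : β - β' ∈ S.pos
  · exact hβ.2 ⟨{β - β', β'}, by simp, by simp [hp, hβ'.1], by simp⟩
  · have := S.neg_mem_pos h hp
    exact hβ'.2 ⟨{-(β - β'), β}, by simp, by simp [hβ.1] at this ⊢; exact this, by simp⟩

lemma simple_lie_eq_zero {β β' : Dual K S.h} (hβ : S.IsSimpleRoot β) (hβ' : S.IsSimpleRoot β')
    (hne : β ≠ β') {x y : g} (hx : x ∈ S.W β) (hy : y ∈ S.W (-β')) : ⁅x, y⁆ = 0 := by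
  by_contra h0
  refine simple_sub_notRoot hβ hβ' (S.isRoot_of_mem (sub_ne_zero.2 hne) ?_ h0)
  rw [sub_eq_add_neg]
  exact S.lie_mem_W hx hy

namespace IsDynkin

variable (hD : S.IsDynkin)
include hD

/-- A nonempty sum of positive roots is nonzero. -/
theorem sum_ne_zero {s : Multiset (Dual K S.h)} (hs : ∀ γ ∈ s, γ ∈ S.pos) (h0 : s ≠ 0) :
    s.sum ≠ 0 := by
  induction hn : Multiset.card s using Nat.strong_induction_on generalizing s with
  | _ n ih =>
  intro hsum
  obtain ⟨α, hα⟩ := Multiset.exists_mem_of_ne_zero h0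
  obtain ⟨s', rfl⟩ := Multiset.exists_cons_of_mem hα
  have hαp := hs α (Multiset.mem_cons_self _ _)
  have hs' : ∀ γ ∈ s', γ ∈ S.pos := fun γ hγ => hs γ (Multiset.mem_cons_of_mem hγ)
  obtain ⟨x, y, t, hT⟩ := hD.exists_triple_of_isRoot (S.pos_root α hαp)
  obtain ⟨γ, hγ, k, hk, hγt⟩ := exists_neg_of_sum (s := s') (t := t) (fun γ hγ => by
      obtain ⟨x', y', t', hT'⟩ := hD.exists_triple_of_isRoot (S.pos_root γ (hs' γ hγ))
      exact hD.exists_int hT' hT) (N := -2) (by omega) (by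
      have := LinearMap.congr_fun hsum t
      rw [Multiset.sum_cons, LinearMap.add_apply, hT.two, LinearMap.zero_apply] at this
      push_cast
      linear_combination this)
  obtain ⟨z, hz, hz0⟩ := (Submodule.ne_bot_iff _).1 (S.pos_root γ (hs' γ hγ)).2
  have hp := pos_add_of_lie hαp (hs' γ hγ) hT.hx hz (hT.lie_ne_zero hz hz0 hk hγt)
  obtain ⟨s'', rfl⟩ := Multiset.exists_cons_of_mem hγ
  refine ih (Multiset.card ((α + γ) ::ₘ s'')) (by simp [← hn]) (s := (α + γ) ::ₘ s'') ?_
    (Multiset.cons_ne_zero) rfl ?_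
  · intro δ hδ
    rcases Multiset.mem_cons.1 hδ with rfl | hδ
    · exact hp
    · exact hs' δ (Multiset.mem_cons_of_mem hδ)
  · simpa [add_assoc] using hsum

/-- Every positive root is a sum of simple roots. -/
theorem exists_simple_sum {α : Dual K S.h} (hα : α ∈ S.pos) :
    ∃ s : Multiset (Dual K S.h), (∀ γ ∈ s, S.IsSimpleRoot γ) ∧ s.sum = α := by
  let A : Set (Dual K S.h) := {α | ∃ s : Multiset (Dual K S.h), (∀ γ ∈ s, S.IsSimpleRoot γ) ∧
    s.sum = α}
  have hA : ∀ α ∈ A, ∀ β ∈ A, ∀ x ∈ S.W α, ∀ y ∈ S.W β, ⁅x, y⁆ ≠ 0 → α + β ∈ A := by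
    rintro _ ⟨s, hs, rfl⟩ _ ⟨s', hs', rfl⟩ - - - - -
    refine ⟨s + s', fun γ hγ => ?_, by simp⟩
    rcases Multiset.mem_add.1 hγ with h | h
    exacts [hs γ h, hs' γ h]
  have hb : S.b ≤ subW A hA := hD.b_le
    (fun x hx => mem_iSup_W (A := A) (α := 0) ⟨0, by simp, by simp⟩ (S.mem_W_zero.2 hx))
    (fun β hβ x hx => mem_iSup_W (A := A) (α := β) ⟨{β}, by simpa using hβ, by simp⟩ hx)
  obtain ⟨x, hx, h0⟩ := (Submodule.ne_bot_iff _).1 (S.pos_root α hα).2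
  exact mem_of_mem_iSup_W (A := A) hx h0 (hb (S.mem_b_of_mem_W hα hx))

omit [IsAlgClosed K] hD in
lemma nonpos_sum {s : Multiset (Dual K S.h)} {t : S.h}
    (hs : ∀ γ ∈ s, ∃ k : ℤ, k ≤ 0 ∧ γ t = k) : ∃ k : ℤ, k ≤ 0 ∧ s.sum t = k := by
  induction s using Multiset.induction_on with
  | empty => exact ⟨0, le_rfl, by simp⟩
  | cons a s ih =>
    obtain ⟨k, hk, h1⟩ := hs a (Multiset.mem_cons_self a s)
    obtain ⟨l, hl, h2⟩ := ih fun γ hγ => hs γ (Multiset.mem_cons_of_mem hγ)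
    exact ⟨k + l, by omega, by rw [Multiset.sum_cons, LinearMap.add_apply, h1, h2]; push_cast; rfl⟩

lemma simple_nonpos {β β' : Dual K S.h} (hβ : S.IsSimpleRoot β) (hβ' : S.IsSimpleRoot β')
    (hne : β ≠ β') {x y : g} {t : S.h} (hT : S.Triple β' x y t) : ∃ k : ℤ, k ≤ 0 ∧ β t = k := by
  obtain ⟨z, hz, hz0⟩ := (Submodule.ne_bot_iff _).1 (S.pos_root β hβ.1).2
  obtain ⟨n, hn⟩ := hT.symm.primitive (μ := -β t)
    (by rw [NegMemClass.coe_neg, neg_lie, hz t, neg_smul]) hz0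
    (by rw [← lie_skew, simple_lie_eq_zero hβ hβ' hne hz hT.hy, neg_zero])
  exact ⟨-n, by omega, by push_cast; rw [← hn, neg_neg]⟩

lemma sum_eq_zero_of_nonpos {s : Multiset (Dual K S.h)} (hs : ∀ γ ∈ s, IsRootOf K g S.h γ)
    (h : ∀ γ ∈ s, ∀ x y t, S.Triple γ x y t → ∃ k : ℤ, k ≤ 0 ∧ s.sum t = k) : s.sum = 0 := by
  have hT : ∀ i : {γ // γ ∈ s}, ∃ x y t, S.Triple i.1 x y t :=
    fun i => hD.exists_triple_of_isRoot (hs i.1 i.2)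
  choose x y t hT using hT
  have hfin : Finite {γ // γ ∈ s} := (Multiset.finite_toSet s).to_subtype
  have h1 := eventually_all.2 fun i => hD.eventually_rootTriple (hT i)
  by_contra h0
  obtain ⟨m, h2, h3⟩ := (h1.and (eventually_ne_res h0)).exists
  choose hx hy ht h2 using h2
  have hsum : (s.attach.map fun i => S.res m i.1).sum = S.res m s.sum := by
    have h4 : (fun i : {γ // γ ∈ s} => S.res m i.1) = (fun γ => S.res m γ) ∘ Subtype.val := rfl
    rw [h4, ← Multiset.map_map, Multiset.attach_map_val]
    let φ : Dual K S.h →+ Dual K (S.torus m) :=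
      { toFun := S.res m, map_zero' := rfl, map_add' := fun _ _ => rfl }
    exact (map_multiset_sum φ s).symm
  refine h3 ?_
  rw [← hsum]
  refine (S.maxToral m).sum_eq_zero (S.F_reductive m) _ _ _ _ s.attach (fun i _ => h2 i)
    fun i _ => ?_
  rw [hsum]
  exact h i.1 i.2 _ _ _ (hT i)

/-- The simple roots are linearly independent over the natural numbers. -/
theorem simple_sum_injective {s s' : Multiset (Dual K S.h)} (hs : ∀ γ ∈ s, S.IsSimpleRoot γ)
    (hs' : ∀ γ ∈ s', S.IsSimpleRoot γ) (h : s.sum = s'.sum) : s = s' := by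
  classical
  have key : ∀ s s' : Multiset (Dual K S.h), (∀ γ ∈ s, S.IsSimpleRoot γ) →
      (∀ γ ∈ s', S.IsSimpleRoot γ) → s.sum = s'.sum → s ∩ s' = 0 → s.sum = 0 := by
    intro s s' hs hs' h hd
    refine hD.sum_eq_zero_of_nonpos (fun γ hγ => S.pos_root γ (hs γ hγ).1) fun γ hγ x y t hT => ?_
    rw [h]
    refine nonpos_sum fun δ hδ => hD.simple_nonpos (hs' δ hδ) (hs γ hγ) ?_ hT
    rintro rfl
    have : δ ∈ s ∩ s' := Multiset.mem_inter.2 ⟨hγ, hδ⟩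
    rw [hd] at this
    exact Multiset.notMem_zero _ this
  have h1 : s - s' + s ∩ s' = s := Multiset.sub_add_inter s s'
  have h2 : s' - s + s ∩ s' = s' := by rw [Multiset.inter_comm]; exact Multiset.sub_add_inter s' s
  have h3 : (s - s').sum = (s' - s).sum := add_right_cancel (b := (s ∩ s').sum) (by
    rw [← Multiset.sum_add, ← Multiset.sum_add, h1, h2, h])
  have h4 : (s - s') ∩ (s' - s) = 0 := by
    ext γ
    rw [Multiset.count_inter, Multiset.count_sub, Multiset.count_sub, Multiset.count_zero]
    omega
  have hss : ∀ γ ∈ s - s', S.IsSimpleRoot γ := fun γ hγ =>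
    hs γ (Multiset.mem_of_le (Multiset.sub_le_self _ _) hγ)
  have hss' : ∀ γ ∈ s' - s, S.IsSimpleRoot γ := fun γ hγ =>
    hs' γ (Multiset.mem_of_le (Multiset.sub_le_self _ _) hγ)
  have h5 := key _ _ hss hss' h3 h4
  have h6 : s - s' = 0 := by
    by_contra h0
    exact hD.sum_ne_zero (fun γ hγ => (hss γ hγ).1) h0 h5
  have h7 : s' - s = 0 := by
    by_contra h0
    exact hD.sum_ne_zero (fun γ hγ => (hss' γ hγ).1) h0 (h3 ▸ h5)
  rw [h6, zero_add] at h1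
  rw [h7, zero_add] at h2
  rw [← h1, h2]

end IsDynkin

end Setup

end Paper

namespace Paper

namespace Setup

open Module LieAlgebra LieAux Filter

variable {K : Type} [Field K] [IsAlgClosed K] [CharZero K]
variable {g : Type} [LieRing g] [LieAlgebra K g]
variable {S : Setup K g}

namespace IsDynkin

variable (hD : S.IsDynkin)
include hD

lemma reflect {α β : Dual K S.h} {x y : g} {t : S.h} (h : S.Triple β x y t) {z : g}
    (hα : α ≠ 0) (hz : z ∈ S.W α) (h0 : z ≠ 0) :
    ∃ k : ℕ, (α t = k ∧ ((ad K g y) ^ k) z ≠ 0) ∨ (α t = -k ∧ ((ad K g x) ^ k) z ≠ 0) := by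
  obtain ⟨k, hk⟩ := h.exists_reflect (hz t) h0
  refine ⟨k, hk.imp (And.imp_right ?_) (And.imp_right ?_)⟩ <;> rintro ⟨q, hq⟩ h1 <;> apply hq
  · obtain ⟨c, hc⟩ := hD.exists_smul (x' := ((ad K g y) ^ q) (((ad K g x) ^ q) z)) hα hz h0 (by
      convert pow_mem_W h.hy (pow_mem_W h.hx hz q) q using 1
      congr 1
      simp)
    rw [add_comm, pow_add, Module.End.mul_apply, hc, map_smul, h1, smul_zero]
  · obtain ⟨c, hc⟩ := hD.exists_smul (x' := ((ad K g x) ^ q) (((ad K g y) ^ q) z)) hα hz h0 (by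
      convert pow_mem_W h.hx (pow_mem_W h.hy hz q) q using 1
      congr 1
      simp)
    rw [add_comm, pow_add, Module.End.mul_apply, hc, map_smul, h1, smul_zero]

lemma eq_of_smul {α β : Dual K S.h} (hα : α ∈ S.pos) (hβ : β ∈ S.pos) {c : K} (h : α = c • β) :
    α = β := by
  obtain ⟨x, y, t, hT⟩ := hD.exists_triple_of_isRoot (S.pos_root α hα)
  obtain ⟨x', y', t', hT'⟩ := hD.exists_triple_of_isRoot (S.pos_root β hβ)
  rcases hD.eq_or_eq_neg_of_smul hT' hT h with h1 | h1
  · exact h1.symm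
  · exact absurd (h1 ▸ hβ) (S.neg_notMem_pos hα)

lemma add_nsmul_pos {α β : Dual K S.h} (hα : α ∈ S.pos) (hβ : β ∈ S.pos) {m : ℕ}
    (h : IsRootOf K g S.h (α + m • β)) : α + m • β ∈ S.pos := by
  by_contra hn
  refine hD.sum_ne_zero (s := -(α + m • β) ::ₘ α ::ₘ Multiset.replicate m β) ?_
    Multiset.cons_ne_zero ?_
  · intro γ hγ
    simp only [Multiset.mem_cons, Multiset.mem_replicate] at hγ
    rcases hγ with rfl | rfl | ⟨-, rfl⟩
    exacts [S.neg_mem_pos h hn, hα, hβ]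
  · simp

lemma sub_nsmul_pos {α β : Dual K S.h} (hα : α ∈ S.pos) (hβ : S.IsSimpleRoot β) (hne : α ≠ β)
    {m : ℕ} (h : IsRootOf K g S.h (α - m • β)) : α - m • β ∈ S.pos := by
  by_contra hn
  obtain ⟨s, hs, h1⟩ := hD.exists_simple_sum hα
  obtain ⟨s', hs', h2⟩ := hD.exists_simple_sum (S.neg_mem_pos h hn)
  have h3 := hD.simple_sum_injective (s := s + s') (s' := Multiset.replicate m β)
    (fun γ hγ => (Multiset.mem_add.1 hγ).elim (hs γ) (hs' γ))
    (fun γ hγ => by rw [Multiset.eq_of_mem_replicate hγ]; exact hβ)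
    (by rw [Multiset.sum_add, h1, h2, Multiset.sum_replicate]; abel)
  have h4 : s = Multiset.replicate (Multiset.card s) β :=
    Multiset.eq_replicate_card.2 fun γ hγ => by
      have : γ ∈ s + s' := Multiset.mem_add.2 (Or.inl hγ)
      rw [h3] at this
      exact Multiset.eq_of_mem_replicate this
  refine hne (hD.eq_of_smul hα hβ.1 (c := Multiset.card s) ?_)
  rw [← h1]
  nth_rewrite 1 [h4]
  rw [Multiset.sum_replicate, Nat.cast_smul_eq_nsmul]

/-- The coroot of `α - β` lies in the span of the coroots of `α` and `β`. -/
lemma coroot_sub_mem_span {α β : Dual K S.h} {x y w w' u v : g} {t τ τ' : S.h}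
    (h : S.Triple β x y t) (hw : S.Triple α w w' τ) (hu : S.Triple (α - β) u v τ')
    (huw : u = ⁅y, w⁆) : ∃ a b : K, τ' = a • τ + b • t := by
  obtain ⟨d, hd⟩ := hD.exists_smul (x' := ⁅w, v⁆) h.ne_zero h.hx h.x_ne_zero (by
    convert S.lie_mem_W hw.hx hu.hy using 1
    congr 1
    abel)
  obtain ⟨e, he⟩ := hD.exists_smul (x' := ⁅y, v⁆) hw.symm.ne_zero hw.symm.hx hw.symm.x_ne_zero (by
    convert S.lie_mem_W h.hy hu.hy using 1
    congr 1
    abel)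
  refine ⟨-e, -d, Subtype.ext ?_⟩
  have h1 : ⁅y, x⁆ = -(t : g) := by rw [← lie_skew, h.lie]
  rw [← hu.lie, huw, lie_lie, hd, he, lie_smul, lie_smul, h1, hw.lie]
  change _ = (-e) • (τ : g) + (-d) • (t : g)
  module

theorem exists_reduce {α : Dual K S.h} (hα : α ∈ S.pos) (hns : ¬ S.IsSimpleRoot α) {x y : g}
    {t : S.h} (hT : S.Triple α x y t) : ∃ β, S.IsSimpleRoot β ∧ ∃ m : ℕ, 0 < m ∧
      α - m • β ∈ S.pos ∧ ∀ x' y' t', S.Triple β x' y' t' → α t' = m ∧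
        ∀ x'' y'' t'', S.Triple (α - m • β) x'' y'' t'' → t'' = t - β t • t' := by
  obtain ⟨s, hs, h1⟩ := hD.exists_simple_sum hα
  obtain ⟨β, hβs, k, hk, hβt⟩ := exists_pos_of_sum (s := s) (t := t) (fun γ hγ => by
    obtain ⟨x', y', t', hT'⟩ := hD.exists_triple_of_isRoot (S.pos_root γ (hs γ hγ).1)
    exact hD.exists_int hT' hT) (N := 2) (by omega) (by rw [h1, hT.two]; simp)
  have hβ := hs β hβs
  have hne : α ≠ β := fun h => hns (h ▸ hβ)
  have hne' : α ≠ -β := fun h => S.neg_notMem_pos hβ.1 (h ▸ hα)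
  obtain ⟨x', y', t', hT'⟩ := hD.exists_triple_of_isRoot (S.pos_root β hβ.1)
  obtain ⟨l, hl, hαt⟩ := hD.pos_symm hT' hT hk hβt
  obtain ⟨m, hm⟩ := hD.reflect hT' hT.ne_zero hT.hx hT.x_ne_zero
  have hneg : ¬ (α t' = -m) := by
    intro h
    rw [hαt] at h
    have : l = -(m : ℤ) := by exact_mod_cast h
    omega
  obtain ⟨hαm, hm0⟩ := hm.resolve_right fun h => hneg h.1
  have hm1 : 0 < m := by
    rw [hαt] at hαm
    have : l = (m : ℤ) := by exact_mod_cast hαm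
    omega
  have hW : ∀ k, ((ad K g y') ^ k) x ∈ S.W (α - k • β) := fun k => by
    rw [show α - k • β = α + k • -β by module]
    exact pow_mem_W hT'.hy hT.hx k
  have hne0 : ∀ k : ℕ, α - k • β ≠ 0 := fun k h => hne (hD.eq_of_smul hα hβ.1 (c := k) (by
    rw [Nat.cast_smul_eq_nsmul]; exact sub_eq_zero.1 h))
  have hx0 : ∀ k ≤ m, ((ad K g y') ^ k) x ≠ 0 := fun k hk h => hm0 (by
    obtain ⟨j, rfl⟩ := Nat.exists_eq_add_of_le hk
    rw [add_comm, pow_add, Module.End.mul_apply, h, map_zero])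
  have hspan : ∀ k ≤ m, ∃ v τ, S.Triple (α - k • β) (((ad K g y') ^ k) x) v τ ∧
      ∃ a b : K, τ = a • t + b • t' := by
    intro k hk
    induction k with
    | zero =>
      exact ⟨y, t, by simpa using hT, 1, 0, by simp⟩
    | succ k ih =>
      obtain ⟨v, τ, hv, a, b, hab⟩ := ih (by omega)
      obtain ⟨v', τ', hv'⟩ := hD.exists_triple (hne0 (k + 1)) (hW (k + 1)) (hx0 (k + 1) hk)
      refine ⟨v', τ', hv', ?_⟩
      have heq : α - (k + 1) • β = α - k • β - β := by rw [succ_nsmul]; abel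
      obtain ⟨a', b', hab'⟩ := hD.coroot_sub_mem_span hT' hv (heq ▸ hv') (by
        rw [pow_succ', Module.End.mul_apply, ad_apply])
      exact ⟨a' * a, a' * b + b', by rw [hab', hab]; module⟩
  obtain ⟨v, τ, hv, a, b, hab⟩ := hspan m le_rfl
  refine ⟨β, hβ, m, hm1, hD.sub_nsmul_pos hα hβ hne hv.isRoot, fun x₁ y₁ t₁ h₁ => ?_⟩
  obtain rfl := hD.coroot_unique hT' h₁
  refine ⟨hαm, fun x'' y'' t'' h₂ => ?_⟩
  obtain rfl := hD.coroot_unique hv h₂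
  exact hD.coroot_reflection hT hT' hv hne hne'
    (by rw [hαm, Nat.cast_smul_eq_nsmul]) hab

end IsDynkin

end Setup

end Paper

namespace Paper

namespace Setup

open Module LieAlgebra LieAux Filter

variable {K : Type} [Field K] [IsAlgClosed K] [CharZero K]
variable {g : Type} [LieRing g] [LieAlgebra K g]

section proj

variable (S : Setup K g)

open Classical in
lemma isInternal_W : DirectSum.IsInternal S.W :=
  DirectSum.isInternal_submodule_of_iSupIndep_of_iSup_eq_top S.h_indep S.h_span

open Classical in
/-- The decomposition of `g` into weight spaces. -/
noncomputable def decomp : (DirectSum (Dual K S.h) fun α => S.W α) ≃ₗ[K] g :=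
  LinearEquiv.ofBijective (DirectSum.coeLinearMap S.W) S.isInternal_W

open Classical in
/-- The projection onto a weight space. -/
noncomputable def proj (α : Dual K S.h) : g →ₗ[K] g :=
  (S.W α).subtype ∘ₗ DirectSum.component K _ _ α ∘ₗ S.decomp.symm.toLinearMap

lemma proj_mem (α : Dual K S.h) (z : g) : S.proj α z ∈ S.W α := Subtype.prop _

open Classical in
lemma decomp_symm {α : Dual K S.h} {x : g} (hx : x ∈ S.W α) :
    S.decomp.symm x = DirectSum.lof K _ (fun α => S.W α) α ⟨x, hx⟩ := by
  rw [LinearEquiv.symm_apply_eq]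
  exact (DirectSum.coeLinearMap_lof S.W α ⟨x, hx⟩).symm

lemma proj_self {α : Dual K S.h} {x : g} (hx : x ∈ S.W α) : S.proj α x = x := by
  simp only [proj, LinearMap.comp_apply, LinearEquiv.coe_coe, S.decomp_symm hx]
  rw [DirectSum.component.lof_self]
  rfl

lemma proj_ne {α β : Dual K S.h} {x : g} (hx : x ∈ S.W α) (h : β ≠ α) : S.proj β x = 0 := by
  simp only [proj, LinearMap.comp_apply, LinearEquiv.coe_coe, S.decomp_symm hx]
  rw [DirectSum.component.of, dif_neg h.symm, map_zero]

lemma proj_shift {f : g →ₗ[K] g} {δ : Dual K S.h} (hf : ∀ α, ∀ x ∈ S.W α, f x ∈ S.W (α + δ))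
    (α : Dual K S.h) (z : g) : S.proj (α + δ) (f z) = f (S.proj α z) := by
  refine S.induction_W (Q := fun z => S.proj (α + δ) (f z) = f (S.proj α z)) (by simp) ?_ ?_ z
  · intro a b ha hb
    simp only [map_add, ha, hb]
  · intro β x hx
    by_cases h : α = β
    · subst h
      rw [S.proj_self hx, S.proj_self (hf _ x hx)]
    · rw [S.proj_ne hx h, S.proj_ne (hf _ x hx) fun h1 => h (add_right_cancel h1), map_zero]

lemma proj_lie (H : S.h) (α : Dual K S.h) (z : g) :
    S.proj α ⁅(H : g), z⁆ = α H • S.proj α z := by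
  refine S.induction_W (Q := fun z => S.proj α ⁅(H : g), z⁆ = α H • S.proj α z) (by simp) ?_ ?_ z
  · intro a b ha hb
    simp only [map_add, lie_add, ha, hb, smul_add]
  · intro β x hx
    rw [hx H, map_smul]
    by_cases h : α = β
    · rw [h]
    · rw [S.proj_ne hx h, smul_zero, smul_zero]

lemma proj_eq_zero_of_mem_b {α : Dual K S.h} (h0 : α ≠ 0) (hα : α ∉ S.pos) {z : g}
    (hz : z ∈ S.b) : S.proj α z = 0 := by
  suffices h : S.b.toSubmodule ≤ LinearMap.ker (S.proj α) from h hz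
  rw [S.b_eq]
  refine sup_le (fun x hx => S.proj_ne (S.mem_W_zero.2 hx) h0) (iSup₂_le fun β hβ x hx => ?_)
  exact S.proj_ne hx fun h => hα (h ▸ hβ)

lemma mem_b_of_proj {z : g} (h : ∀ α, α ≠ 0 → α ∉ S.pos → S.proj α z = 0) : z ∈ S.b := by
  classical
  have h1 : z = S.decomp (S.decomp.symm z) := (S.decomp.apply_symm_apply z).symm
  rw [h1]
  change DirectSum.coeLinearMap S.W _ ∈ S.b
  rw [DirectSum.coeLinearMap_eq_dfinsuppSum]
  refine Submodule.sum_mem S.b.toSubmodule fun α _ => ?_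
  by_cases h0 : α = 0
  · subst h0
    exact S.mem_b_of_mem_h (S.mem_W_zero.1 (Subtype.prop _))
  by_cases hα : α ∈ S.pos
  · exact S.mem_b_of_mem_W hα (Subtype.prop _)
  · have := h α h0 hα
    change ((S.decomp.symm z α : S.W α) : g) = 0 at this
    change ((S.decomp.symm z α : S.W α) : g) ∈ S.b.toSubmodule
    rw [this]
    exact zero_mem _

end proj

variable {S : Setup K g}

lemma pow_mem_adWeightSpace {H : LieSubalgebra K g} {α γ : Dual K H} {x z : g}
    (hx : x ∈ adWeightSpace K g H α) (hz : z ∈ adWeightSpace K g H γ) (n : ℕ) :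
    ((ad K g x) ^ n) z ∈ adWeightSpace K g H (γ + n • α) := by
  induction n with
  | zero => simpa using hz
  | succ n ih =>
    rw [pow_succ', Module.End.mul_apply, ad_apply]
    convert lie_mem_wsp (T := H.toSubmodule) (V := g) hx ih using 1
    rw [succ_nsmul]
    change adWeightSpace K g H _ = adWeightSpace K g H _
    congr 1
    abel

lemma mem_res_of_mem_W {n : ℕ} {α : Dual K S.h} {x : g} (hx : x ∈ S.W α) :
    x ∈ adWeightSpace K g (S.hn n) (S.resDual n α) := fun H => hx ⟨H, H.2.1⟩

lemma resDual_eq_of_proj {n : ℕ} {α : Dual K S.h} {δ : Dual K (S.hn n)} {z : g}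
    (hz : z ∈ adWeightSpace K g (S.hn n) δ) (h : S.proj α z ≠ 0) : S.resDual n α = δ := by
  refine LinearMap.ext fun H => ?_
  have h1 := S.proj_lie ⟨H, H.2.1⟩ α z
  have h2 : ⁅(H : g), z⁆ = δ H • z := hz H
  change S.proj α ⁅(H : g), z⁆ = _ at h1
  rw [h2, map_smul] at h1
  exact (smul_left_injective K h h1).symm

lemma rootSpaceN_finite (n : ℕ) : {γ : Dual K (S.hn n) | S.rootSpaceN n γ ≠ ⊥}.Finite := by
  let e : S.torus n →ₗ[K] S.hn n :=
    ((S.F n).toSubmodule.subtype.comp (S.torus n).toSubmodule.subtype).codRestrict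
      (S.hn n).toSubmodule fun τ => ⟨τ.2, τ.1.2⟩
  have hinj : Function.Injective fun γ : Dual K (S.hn n) => γ.comp e := fun γ δ h =>
    LinearMap.ext fun H => LinearMap.congr_fun h ⟨⟨H, H.2.2⟩, H.2.1⟩
  have h1 := WellFoundedGT.finite_ne_bot_of_iSupIndep
    (iSupIndep_wsp (T := (S.torus n).toSubmodule) (V := S.F n))
  refine (h1.preimage hinj.injOn).subset fun γ hγ => ?_
  obtain ⟨z, hz, h0⟩ := (Submodule.ne_bot_iff _).1 hγ
  refine (Submodule.ne_bot_iff _).2 ⟨⟨z, hz.1⟩, fun τ => ?_, fun h => h0 (congrArg Subtype.val h)⟩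
  exact Subtype.ext (hz.2 ⟨τ, τ.2, τ.1.2⟩)

namespace IsDynkin

variable (hD : S.IsDynkin)
include hD

lemma ne_smul {α β : Dual K S.h} (hα : α ∈ S.pos) (hβ : β ∈ S.pos) (h : α ≠ β) (c : K) :
    α - c • β ≠ 0 := fun h1 => h (hD.eq_of_smul hα hβ (sub_eq_zero.1 h1))

lemma reflect_mem_b_of_nonneg {β : Dual K S.h} (hβ : S.IsSimpleRoot β) {x y : g} {t : S.h}
    (h : S.Triple β x y t) {n : ℕ} (ht : (t : g) ∈ S.F n) {γ : Dual K (S.hn n)} {k : ℕ}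
    (hγ : γ ⟨t, t.2, ht⟩ = k) (hne : γ ≠ S.resDual n β) {z : g}
    (hz : z ∈ adWeightSpace K g (S.hn n) (γ - k • S.resDual n β))
    (hb : ((ad K g x) ^ k) z ∈ S.b) : z ∈ S.b := by
  refine S.mem_b_of_proj fun α h0 hα => by_contra fun hp => ?_
  have hres := resDual_eq_of_proj hz hp
  have hαt : α t = -k := by
    have h1 := LinearMap.congr_fun hres ⟨t, t.2, ht⟩
    change α t = γ ⟨t, t.2, ht⟩ - k • β t at h1
    rw [h1, hγ, h.two, nsmul_eq_mul]
    ring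
  have hαr := S.isRoot_of_mem h0 (S.proj_mem α z) hp
  have hnα : -α ≠ β := by
    intro h1
    have h2 : k = 2 := by
      rw [← neg_eq_iff_eq_neg, ← LinearMap.neg_apply, h1, h.two] at hαt
      exact_mod_cast hαt.symm
    have h3 : α = -β := by rw [← h1, neg_neg]
    rw [h3, h2] at hres
    refine hne ?_
    have h4 : S.resDual n (-β) = -S.resDual n β := rfl
    rw [h4, eq_sub_iff_add_eq, two_nsmul] at hres
    rw [← hres]
    abel
  have hx0 : ((ad K g x) ^ k) (S.proj α z) ≠ 0 := by
    obtain ⟨k', hk' | hk'⟩ := hD.reflect h h0 (S.proj_mem α z) hp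
    · have h1 : k = 0 := by
        have h2 := hk'.1
        rw [hαt, neg_eq_iff_add_eq_zero] at h2
        have : k + k' = 0 := by exact_mod_cast h2
        omega
      rw [h1]
      exact hp
    · have h1 : k = k' := by
        have h2 := hk'.1
        rw [hαt, neg_inj] at h2
        exact_mod_cast h2
      rw [h1]
      exact hk'.2
  have hshift := S.proj_shift (f := (ad K g x) ^ k) (δ := k • β)
    (fun α v hv => pow_mem_W h.hx hv k) α z
  have hnp := S.neg_mem_pos hαr hα
  have hne0 := hD.ne_smul hnp hβ.1 hnα k
  rw [Nat.cast_smul_eq_nsmul] at hne0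
  have hne1 : α + k • β ≠ 0 := fun h => hne0 (by rw [← neg_eq_zero, ← h]; abel)
  have hr := hD.neg_isRoot (S.isRoot_of_mem hne1 (pow_mem_W h.hx (S.proj_mem α z) k) hx0)
  have heq : -(α + k • β) = -α - k • β := by abel
  have hp2 := hD.sub_nsmul_pos hnp hβ hnα (heq ▸ hr)
  rw [← heq] at hp2
  refine hx0 ?_
  rw [← hshift]
  exact S.proj_eq_zero_of_mem_b hne1 (fun h => S.neg_notMem_pos h hp2) hb

lemma reflect_mem_b_of_nonpos {β : Dual K S.h} (hβ : S.IsSimpleRoot β) {x y : g} {t : S.h}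
    (h : S.Triple β x y t) {n : ℕ} (ht : (t : g) ∈ S.F n) {γ : Dual K (S.hn n)} {k : ℕ}
    (hγ : γ ⟨t, t.2, ht⟩ = -k) {z : g}
    (hz : z ∈ adWeightSpace K g (S.hn n) (γ + k • S.resDual n β))
    (hb : ((ad K g y) ^ k) z ∈ S.b) : z ∈ S.b := by
  refine S.mem_b_of_proj fun α h0 hα => by_contra fun hp => ?_
  have hres := resDual_eq_of_proj hz hp
  have hαt : α t = k := by
    have h1 := LinearMap.congr_fun hres ⟨t, t.2, ht⟩
    change α t = γ ⟨t, t.2, ht⟩ + k • β t at h1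
    rw [h1, hγ, h.two, nsmul_eq_mul]
    ring
  have hαr := S.isRoot_of_mem h0 (S.proj_mem α z) hp
  have hnα : -α ≠ β := by
    intro h1
    have h2 := h.two
    rw [← h1, LinearMap.neg_apply, hαt, neg_eq_iff_add_eq_zero] at h2
    have : k + 2 = 0 := by exact_mod_cast h2
    omega
  have hy0 : ((ad K g y) ^ k) (S.proj α z) ≠ 0 := by
    obtain ⟨k', hk' | hk'⟩ := hD.reflect h h0 (S.proj_mem α z) hp
    · have h1 : k = k' := by
        have h2 := hk'.1
        rw [hαt] at h2
        exact_mod_cast h2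
      rw [h1]
      exact hk'.2
    · have h1 : k = 0 := by
        have h2 := hk'.1
        rw [hαt, eq_neg_iff_add_eq_zero] at h2
        have : k + k' = 0 := by exact_mod_cast h2
        omega
      rw [h1]
      exact hp
  have hshift := S.proj_shift (f := (ad K g y) ^ k) (δ := k • -β)
    (fun α v hv => pow_mem_W h.hy hv k) α z
  have hnp := S.neg_mem_pos hαr hα
  have hne0 := hD.ne_smul hnp hβ.1 hnα (-k)
  have heq : -(α + k • -β) = -α + k • β := by module
  have hne1 : α + k • -β ≠ 0 := fun h => hne0 (by
    rw [← neg_zero, ← h, ← Nat.cast_smul_eq_nsmul K]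
    module)
  have hr := hD.neg_isRoot (S.isRoot_of_mem hne1 (pow_mem_W h.hy (S.proj_mem α z) k) hy0)
  have hp2 := hD.add_nsmul_pos hnp hβ.1 (heq ▸ hr)
  rw [← heq] at hp2
  refine hy0 ?_
  rw [← hshift]
  exact S.proj_eq_zero_of_mem_b hne1 (fun h => S.neg_notMem_pos h hp2) hb

/-- A simple reflection permutes the positive roots of `g_n` other than the simple root. -/
lemma reflect_mem_posRootsN {β : Dual K S.h} (hβ : S.IsSimpleRoot β) {x y : g} {t : S.h}
    (h : S.Triple β x y t) {n : ℕ} (hx : x ∈ S.F n) (hy : y ∈ S.F n) (ht : (t : g) ∈ S.F n)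
    {γ : Dual K (S.hn n)} (hγ : γ ∈ S.posRootsN n) (hne : γ ≠ S.resDual n β) :
    γ - γ ⟨t, t.2, ht⟩ • S.resDual n β ∈ S.posRootsN n ∧
      γ - γ ⟨t, t.2, ht⟩ • S.resDual n β ≠ S.resDual n β := by
  set T : S.hn n := ⟨t, t.2, ht⟩ with hT
  have hβT : S.resDual n β T = 2 := h.two
  obtain ⟨hγ0, hγb, hγle⟩ := hγ
  obtain ⟨z, hz, hz0⟩ := (Submodule.ne_bot_iff _).1 hγb
  have hx' : x ∈ adWeightSpace K g (S.hn n) (S.resDual n β) := mem_res_of_mem_W h.hx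
  have hy' : y ∈ adWeightSpace K g (S.hn n) (-S.resDual n β) :=
    mem_res_of_mem_W (α := -β) h.hy
  have hsT : (γ - γ T • S.resDual n β) T = - γ T := by
    rw [LinearMap.sub_apply, LinearMap.smul_apply, hβT, smul_eq_mul]
    ring
  refine ⟨⟨fun h0 => ?_, ?_, ?_⟩, fun h0 => ?_⟩
  · rw [h0, LinearMap.zero_apply, eq_comm, neg_eq_zero] at hsT
    rw [hsT, zero_smul, sub_zero] at h0
    exact hγ0 h0
  · obtain ⟨k, ⟨hk, q, hq⟩ | ⟨hk, q, hq⟩⟩ := h.exists_reflect (μ := γ T) (hz.2 T) hz0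
    · refine (Submodule.ne_bot_iff _).2 ⟨_, ⟨pow_mem_F hy (pow_mem_F hx hz.1 q) (q + k), ?_⟩, hq⟩
      have h1 : γ - γ T • S.resDual n β =
          γ + q • S.resDual n β + (q + k) • -S.resDual n β := by
        rw [hk]
        module
      rw [h1]
      exact pow_mem_adWeightSpace hy' (pow_mem_adWeightSpace hx' hz.2 q) (q + k)
    · refine (Submodule.ne_bot_iff _).2 ⟨_, ⟨pow_mem_F hx (pow_mem_F hy hz.1 q) (q + k), ?_⟩, hq⟩
      have h1 : γ - γ T • S.resDual n β =
          γ + q • -S.resDual n β + (q + k) • S.resDual n β := by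
        rw [hk]
        module
      rw [h1]
      exact pow_mem_adWeightSpace hx' (pow_mem_adWeightSpace hy' hz.2 q) (q + k)
  · intro w hw
    obtain ⟨k, ⟨hk, -⟩ | ⟨hk, -⟩⟩ := h.exists_reflect (μ := γ T) (hz.2 T) hz0
    · have h1 : γ - γ T • S.resDual n β = γ - k • S.resDual n β := by
        rw [hk]
        module
      have h2 : γ = γ - k • S.resDual n β + k • S.resDual n β := by abel
      rw [h1] at hw
      refine hD.reflect_mem_b_of_nonneg hβ h ht hk hne hw.2 (hγle ⟨pow_mem_F hx hw.1 k, ?_⟩)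
      rw [h2]
      exact pow_mem_adWeightSpace hx' hw.2 k
    · have h1 : γ - γ T • S.resDual n β = γ + k • S.resDual n β := by
        rw [hk]
        module
      have h2 : γ = γ + k • S.resDual n β + k • -S.resDual n β := by module
      rw [h1] at hw
      refine hD.reflect_mem_b_of_nonpos hβ h ht hk hw.2 (hγle ⟨pow_mem_F hy hw.1 k, ?_⟩)
      rw [h2]
      exact pow_mem_adWeightSpace hy' hw.2 k
  · rw [h0, hβT, eq_comm, neg_eq_iff_eq_neg] at hsT
    have hγβ : γ = -S.resDual n β := by
      rw [hsT] at h0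
      rw [← sub_eq_zero, ← sub_eq_zero.2 h0]
      module
    have hyb : y ∈ S.b := hγle ⟨hy, by rw [hγβ]; exact hy'⟩
    have := S.proj_eq_zero_of_mem_b h.symm.ne_zero (S.neg_notMem_pos hβ.1) hyb
    rw [S.proj_self h.hy] at this
    exact h.symm.x_ne_zero this

theorem rho_eq_one {ρ : Dual K S.h} (hρ : S.IsGlobalRho ρ) {β : Dual K S.h}
    (hβ : S.IsSimpleRoot β) {x y : g} {t : S.h} (h : S.Triple β x y t) : ρ t = 1 := by
  classical
  obtain ⟨n, ⟨hx, -, hdim, -⟩, hy, ht⟩ := ((hD.eventually_partner h.ne_zero h.hx h.x_ne_zero).and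
    ((S.eventually_mem y).and (S.eventually_mem (t : g)))).exists
  let T : S.hn n := ⟨t, t.2, ht⟩
  have hβT : S.resDual n β T = 2 := h.two
  have hfin : (S.posRootsN n).Finite := (S.rootSpaceN_finite n).subset fun γ hγ => hγ.2.1
  have hmem : S.resDual n β ∈ S.posRootsN n := by
    refine ⟨fun h0 => ?_, (Submodule.ne_bot_iff _).2
      ⟨x, ⟨hx, mem_res_of_mem_W h.hx⟩, h.x_ne_zero⟩, fun z hz => ?_⟩
    · rw [h0, LinearMap.zero_apply] at hβT
      exact two_ne_zero hβT.symm
    · obtain ⟨c, hc⟩ := hdim ⟨z, hz.1⟩ fun τ => Subtype.ext (hz.2 ⟨τ, τ.2, τ.1.2⟩)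
      have hzc : z = c • x := congrArg Subtype.val hc
      rw [hzc]
      exact S.b.smul_mem c (S.mem_b_of_mem_W hβ.1 h.hx)
  have h1 : ρ t = S.rhoN n T := LinearMap.congr_fun (hρ n) T
  have hz : ∑ γ ∈ hfin.toFinset.erase (S.resDual n β), γ T = 0 := by
    have hT2 : ∀ γ : Dual K (S.hn n), (γ - γ T • S.resDual n β) T = - γ T := fun γ => by
      rw [LinearMap.sub_apply, LinearMap.smul_apply, hβT, smul_eq_mul]
      ring
    refine Finset.sum_involution (fun γ _ => γ - γ T • S.resDual n β) (fun γ _ => ?_)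
      (fun γ _ hγ h0 => hγ ?_) (fun γ hγ => ?_) (fun γ _ => ?_)
    · rw [hT2, add_neg_cancel]
    · have := hT2 γ
      rw [h0] at this
      exact self_eq_neg.1 this
    · rw [Finset.mem_erase, Set.Finite.mem_toFinset] at hγ ⊢
      exact (hD.reflect_mem_posRootsN hβ h hx hy ht hγ.2 hγ.1).symm
    · rw [hT2]
      module
  rw [h1, rhoN, LinearMap.smul_apply, finsum_mem_eq_finite_toFinset_sum _ hfin,
    LinearMap.sum_apply, ← Finset.add_sum_erase _ _ (hfin.mem_toFinset.2 hmem), hz, hβT]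
  simp

end IsDynkin

end Setup

end Paper

namespace Paper

namespace Setup

open Module LieAlgebra LieAux VermaTheory

variable {K : Type} [Field K] [IsAlgClosed K] [CharZero K]
variable {g : Type} [LieRing g] [LieAlgebra K g]
variable {S : Setup K g}

lemma pos_ne_neg (i j : S.pos) : (i : Dual K S.h) ≠ -j :=
  fun h => S.neg_notMem_pos j.2 (h ▸ i.2)

lemma pos_ne_zero (i : S.pos) : (i : Dual K S.h) ≠ 0 := (S.pos_root i i.2).1

/-- A choice of a triple for each positive root. -/
structure Triples (S : Setup K g) where
  /-- the positive root vectors -/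
  x : S.pos → g
  /-- the negative root vectors -/
  y : S.pos → g
  /-- the coroots -/
  t : S.pos → S.h
  triple : ∀ i : S.pos, S.Triple (i : Dual K S.h) (x i) (y i) (t i)

lemma IsDynkin.nonempty_triples (hD : S.IsDynkin) : Nonempty S.Triples := by
  choose x y t h using fun i : S.pos => hD.exists_triple_of_isRoot (S.pos_root i i.2)
  exact ⟨⟨x, y, t, h⟩⟩

lemma isLieAbelian_h {H x : g} (hH : H ∈ S.h) (hx : x ∈ S.h) : ⁅H, x⁆ = 0 := by
  rw [S.mem_W_zero.2 hx ⟨H, hH⟩, LinearMap.zero_apply, zero_smul]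

namespace Triples

variable {κ : Type} (C : S.Triples) (hb : Basis κ K S.h)

/-- The weight of a letter. -/
def wt : Letter S.pos κ → Dual K S.h := lwt Subtype.val

/-- The basis vector of a letter. -/
noncomputable def vec : Letter S.pos κ → g
  | .f i => C.y i
  | .H k => hb k
  | .e i => C.x i

lemma vec_mem_W (l : Letter S.pos κ) : C.vec hb l ∈ S.W (wt l) := by
  cases l with
  | f i => exact (C.triple i).hy
  | H k => exact S.mem_W_zero.2 (hb k).2
  | e i => exact (C.triple i).hx

lemma exists_dual {α : Dual K S.h} {x : g} (hx : x ∈ S.W α) (h0 : x ≠ 0) :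
    ∃ f : Dual K g, f x = 1 ∧ ∀ β, β ≠ α → ∀ y ∈ S.W β, f y = 0 := by
  obtain ⟨f, hf⟩ := exists_dual_forall_apply_eq_one
    (LinearIndepOn.singleton (R := K) (v := id) h0)
  refine ⟨f ∘ₗ S.proj α, ?_, fun β hβ y hy => ?_⟩
  · rw [LinearMap.comp_apply, S.proj_self hx]
    exact hf x rfl
  · rw [LinearMap.comp_apply, S.proj_ne hy hβ.symm, map_zero]

lemma exists_dual_vec (l : Letter S.pos κ) :
    ∃ f : Dual K g, f (C.vec hb l) = 1 ∧ ∀ m, m ≠ l → f (C.vec hb m) = 0 := by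
  cases l with
  | f i =>
    obtain ⟨f, h1, h2⟩ := exists_dual (C.triple i).hy (C.triple i).symm.x_ne_zero
    refine ⟨f, h1, fun m hm => h2 _ ?_ _ (C.vec_mem_W hb m)⟩
    cases m with
    | f j => exact fun h => hm (by rw [Subtype.ext (neg_injective h)])
    | H k => exact fun h => pos_ne_zero i (neg_eq_zero.1 h.symm)
    | e j => exact fun h => pos_ne_neg j i h
  | H k =>
    refine ⟨hb.coord k ∘ₗ (S.proj 0).codRestrict S.h.toSubmodule
      (fun z => S.mem_W_zero.1 (S.proj_mem 0 z)), ?_, fun m hm => ?_⟩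
    · have h1 : (S.proj 0).codRestrict S.h.toSubmodule
          (fun z => S.mem_W_zero.1 (S.proj_mem 0 z)) (hb k) = hb k :=
        Subtype.ext (S.proj_self (S.mem_W_zero.2 (hb k).2))
      rw [vec, LinearMap.comp_apply, h1]
      simp
    · cases m with
      | H j =>
        have h1 : (S.proj 0).codRestrict S.h.toSubmodule
            (fun z => S.mem_W_zero.1 (S.proj_mem 0 z)) (hb j) = hb j :=
          Subtype.ext (S.proj_self (S.mem_W_zero.2 (hb j).2))
        rw [vec, LinearMap.comp_apply, h1]
        have h2 : j ≠ k := fun h => hm (by rw [h])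
        simp [h2]
      | f j =>
        have h1 : (S.proj 0).codRestrict S.h.toSubmodule
            (fun z => S.mem_W_zero.1 (S.proj_mem 0 z)) (C.vec hb (.f j)) = 0 :=
          Subtype.ext (S.proj_ne (C.triple j).hy fun h => pos_ne_zero j (neg_eq_zero.1 h.symm))
        rw [LinearMap.comp_apply, h1, map_zero]
      | e j =>
        have h1 : (S.proj 0).codRestrict S.h.toSubmodule
            (fun z => S.mem_W_zero.1 (S.proj_mem 0 z)) (C.vec hb (.e j)) = 0 :=
          Subtype.ext (S.proj_ne (C.triple j).hx fun h => pos_ne_zero j h.symm)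
        rw [LinearMap.comp_apply, h1, map_zero]
  | e i =>
    obtain ⟨f, h1, h2⟩ := exists_dual (C.triple i).hx (C.triple i).x_ne_zero
    refine ⟨f, h1, fun m hm => h2 _ ?_ _ (C.vec_mem_W hb m)⟩
    cases m with
    | f j => exact fun h => pos_ne_neg i j h.symm
    | H k => exact fun h => pos_ne_zero i h.symm
    | e j => exact fun h => hm (by rw [Subtype.ext h])

lemma linearIndependent_vec : LinearIndependent K (C.vec hb) := by
  choose f h1 h2 using C.exists_dual_vec hb
  exact LinearIndependent.of_pairwise_dual_eq_zero_one _ f (fun l m h => h2 l m h.symm) h1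

variable (hD : S.IsDynkin)
include hD

lemma span_vec : ⊤ ≤ Submodule.span K (Set.range (C.vec hb)) := by
  intro z _
  refine S.induction_W (Q := fun z => z ∈ Submodule.span K (Set.range (C.vec hb)))
    (zero_mem _) (fun _ _ => add_mem) (fun α z hz => ?_) z
  have hl : ∀ l, C.vec hb l ∈ Submodule.span K (Set.range (C.vec hb)) :=
    fun l => Submodule.subset_span ⟨l, rfl⟩
  by_cases hz0 : z = 0
  · rw [hz0]
    exact zero_mem _
  by_cases h0 : α = 0
  · subst h0
    rw [S.mem_W_zero] at hz
    have h1 : (⊤ : Submodule K S.h) ≤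
        (Submodule.span K (Set.range (C.vec hb))).comap S.h.toSubmodule.subtype := by
      rw [← hb.span_eq, Submodule.span_le]
      rintro _ ⟨k, rfl⟩
      exact hl (.H k)
    exact h1 (x := ⟨z, hz⟩) trivial
  by_cases hα : α ∈ S.pos
  · have h := C.triple ⟨α, hα⟩
    obtain ⟨c, rfl⟩ := hD.exists_smul h0 h.hx h.x_ne_zero hz
    exact Submodule.smul_mem _ _ (hl (.e ⟨α, hα⟩))
  · have hn := S.neg_mem_pos (S.isRoot_of_mem h0 hz hz0) hα
    have h := (C.triple ⟨-α, hn⟩).symm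
    obtain ⟨c, rfl⟩ := hD.exists_smul h.ne_zero h.hx h.x_ne_zero (x' := z)
      (by rwa [show -((⟨-α, hn⟩ : S.pos) : Dual K S.h) = α from neg_neg α])
    exact Submodule.smul_mem _ _ (hl (.f ⟨-α, hn⟩))

/-- The triangular basis of `g` given by root vectors and a basis of `h`. -/
noncomputable def tri : Tri K g S.pos κ where
  h := S.h
  hb := hb
  b := Basis.mk (C.linearIndependent_vec hb) (C.span_vec hb hD)
  b_H k := by rw [Basis.mk_apply]; rfl
  wt := Subtype.val
  lie_b H l := by
    rw [Basis.mk_apply]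
    exact C.vec_mem_W hb l H
  wt_inj := Subtype.val_injective
  wt_sum_ne s hs := hD.sum_ne_zero (by simp +contextual) (by simpa using hs)
  t := C.t
  lie_ef i := by
    rw [Basis.mk_apply, Basis.mk_apply]
    exact (C.triple i).lie
  wt_t i := (C.triple i).two

lemma tri_b (l : Letter S.pos κ) : (C.tri hb hD).b l = C.vec hb l := Basis.mk_apply _ (C.span_vec hb hD) _

lemma finite_sum_eq (η : Dual K S.h) :
    {s : Multiset S.pos | (s.map Subtype.val).sum = η}.Finite := by
  classical
  choose q hq hsum using fun i : S.pos => hD.exists_simple_sum i.2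
  have hbind : ∀ s : Multiset S.pos, (∀ γ ∈ s.bind q, S.IsSimpleRoot γ) ∧
      (s.bind q).sum = (s.map Subtype.val).sum := fun s => by
    refine ⟨fun γ hγ => ?_, ?_⟩
    · obtain ⟨i, -, hi⟩ := Multiset.mem_bind.1 hγ
      exact hq i γ hi
    · rw [Multiset.sum_bind]
      simp only [hsum]
  rcases Set.eq_empty_or_nonempty {s : Multiset S.pos | (s.map Subtype.val).sum = η} with h | h
  · rw [h]
    exact Set.finite_empty
  obtain ⟨s₀, hs₀⟩ := h
  have hM : ∀ s : Multiset S.pos, (s.map Subtype.val).sum = η → s.bind q = s₀.bind q :=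
    fun s hs => hD.simple_sum_injective (hbind s).1 (hbind s₀).1
      (by rw [(hbind s).2, (hbind s₀).2, hs]; exact hs₀.symm)
  have hA : {i : S.pos | q i ≤ s₀.bind q}.Finite := by
    refine (Set.finite_Iic (s₀.bind q)).preimage (fun i _ j _ hij => Subtype.ext ?_)
    rw [← hsum i, ← hsum j, hij]
  refine (Set.finite_Iic (Multiset.card (s₀.bind q) • hA.toFinset.val)).subset fun s hs => ?_
  have hcard : Multiset.card s ≤ Multiset.card (s₀.bind q) := by
    rw [← hM s hs, Multiset.card_bind]
    have h1 : ∀ c ∈ s.map (Multiset.card ∘ q), 1 ≤ c := by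
      intro c hc
      obtain ⟨i, -, rfl⟩ := Multiset.mem_map.1 hc
      refine Multiset.card_pos.2 fun h0 => pos_ne_zero i ?_
      rw [← hsum i, h0, Multiset.sum_zero]
    simpa using Multiset.card_nsmul_le_sum h1
  refine Multiset.le_iff_count.2 fun i => ?_
  by_cases hi : i ∈ s
  · have h1 : i ∈ hA.toFinset := by
      rw [Set.Finite.mem_toFinset, Set.mem_ofPred_eq, ← hM s hs]
      exact Multiset.le_bind s hi
    rw [Multiset.count_nsmul, Multiset.count_eq_one_of_mem hA.toFinset.nodup h1, mul_one]
    exact (Multiset.count_le_card i s).trans hcard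
  · rw [Multiset.count_eq_zero_of_notMem hi]
    exact Nat.zero_le _

lemma x_mem_lieSpan (i : S.pos) :
    C.x i ∈ LieSubalgebra.lieSpan K g (C.x '' {j | S.IsSimpleRoot j}) := by
  set M := LieSubalgebra.lieSpan K g (C.x '' {j | S.IsSimpleRoot j}) with hM
  have hsub : ∀ j : S.pos, S.IsSimpleRoot j → C.x j ∈ M :=
    fun j hj => LieSubalgebra.subset_lieSpan ⟨j, hj, rfl⟩
  have hMpos : M ≤ subW S.pos fun α hα β hβ x hx y hy h => pos_add_of_lie hα hβ hx hy h := by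
    rw [hM, LieSubalgebra.lieSpan_le]
    rintro _ ⟨j, -, rfl⟩
    exact mem_iSup_W j.2 (C.triple j).hx
  have hlie : ∀ H ∈ S.h, ∀ m ∈ M, ⁅H, m⁆ ∈ M := by
    intro H hH m hm
    induction hm using LieSubalgebra.lieSpan_induction with
    | mem m hm =>
      obtain ⟨j, hj, rfl⟩ := hm
      rw [(C.triple j).hx ⟨H, hH⟩]
      exact M.smul_mem _ (hsub j hj)
    | zero => rw [lie_zero]; exact M.zero_mem
    | add a b _ _ ha hb => rw [lie_add]; exact M.add_mem ha hb
    | smul c a _ ha => rw [lie_smul]; exact M.smul_mem c ha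
    | lie a b ha' hb' ha hb =>
      rw [leibniz_lie]
      exact M.add_mem (M.lie_mem ha hb') (M.lie_mem ha' hb)
  let N : LieSubalgebra K g :=
    { S.h.toSubmodule ⊔ M.toSubmodule with
      lie_mem' := fun {a b} ha hb => by
        obtain ⟨H, hH, m, hm, rfl⟩ := Submodule.mem_sup.1 ha
        obtain ⟨H', hH', m', hm', rfl⟩ := Submodule.mem_sup.1 hb
        refine Submodule.mem_sup_right ?_
        rw [add_lie, lie_add, lie_add, isLieAbelian_h hH hH', zero_add]
        refine M.add_mem (hlie H hH m' hm') (M.add_mem ?_ (M.lie_mem hm hm'))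
        rw [← lie_skew]
        exact M.neg_mem (hlie H' hH' m hm) }
  have hN : S.b ≤ N := by
    refine hD.b_le (fun H hH => Submodule.mem_sup_left hH) fun α hα z hz => ?_
    have h := C.triple ⟨α, hα.1⟩
    obtain ⟨c, rfl⟩ := hD.exists_smul h.ne_zero h.hx h.x_ne_zero hz
    exact Submodule.mem_sup_right (M.smul_mem c (hsub ⟨α, hα.1⟩ hα))
  obtain ⟨H, hH, m, hm, h1⟩ :=
    Submodule.mem_sup.1 (hN (S.mem_b_of_mem_W i.2 (C.triple i).hx))
  have h2 : H = 0 := by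
    refine S.eq_zero_of_mem_h S.zero_notMem_pos ?_ hH
    rw [eq_sub_of_add_eq h1]
    exact sub_mem (mem_iSup_W i.2 (C.triple i).hx) (hMpos hm)
  rw [← h1, h2, zero_add]
  exact hm

theorem exists_isDynkin {ρ : Dual K S.h} (hρ : S.IsGlobalRho ρ) :
    ∃ ht, (C.tri hb hD).IsDynkin {j : S.pos | S.IsSimpleRoot j} ht ρ := by
  choose q hq hsum using fun i : S.pos => hD.exists_simple_sum i.2
  refine ⟨fun i => Multiset.card (q i), ?_⟩
  constructor
  · exact finite_sum_eq hD
  · simp only [tri_b]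
    exact C.x_mem_lieSpan hD
  · intro i hi j hj hij
    rw [tri_b, tri_b]
    exact simple_lie_eq_zero hi hj (Subtype.val_injective.ne hij) (C.triple i).hx (C.triple j).hy
  · intro i _ z
    rw [tri_b]
    exact (C.triple i).nilpotent_y z
  · intro i hi
    obtain ⟨β, hβ, m, hm, hp, h⟩ := hD.exists_reduce i.2 hi (C.triple i)
    obtain ⟨h1, h2⟩ := h _ _ _ (C.triple ⟨β, hβ.1⟩)
    refine ⟨⟨β, hβ.1⟩, hβ, ⟨_, hp⟩, m, hm, (sub_add_cancel _ _).symm, h1,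
      h2 _ _ _ (C.triple ⟨_, hp⟩), ?_⟩
    have h3 : q i = q ⟨_, hp⟩ + m • {β} := by
      refine hD.simple_sum_injective (hq i) (fun γ hγ => ?_) ?_
      · rcases Multiset.mem_add.1 hγ with h | h
        · exact hq _ γ h
        · rw [Multiset.mem_singleton.1 (Multiset.mem_of_mem_nsmul h)]
          exact hβ
      · rw [Multiset.sum_add, Multiset.sum_nsmul, Multiset.sum_singleton, hsum, hsum]
        exact (sub_add_cancel _ _).symm
    rw [h3]
    simpa using hm
  · intro i j hij
    exact hD.linearIndependent_coroot (C.triple i) (C.triple j) (Subtype.val_injective.ne hij)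
      (pos_ne_neg i j)
  · intro i hi
    exact hD.rho_eq_one hρ hi (C.triple i)

section

attribute [local instance] LieRing.ofAssociativeRing

lemma vermaIdeal_eq_vIdeal (lam : Dual K S.h) :
    S.vermaIdeal lam = (C.tri hb hD).vIdeal lam := by
  refine le_antisymm (Submodule.span_le.2 (Set.union_subset ?_ ?_))
    (Submodule.span_le.2 (Set.union_subset ?_ ?_))
  · rintro _ ⟨z, hz, rfl⟩
    suffices h : S.nplus ≤ (((C.tri hb hD).vIdeal lam).restrictScalars K).comap
        (UniversalEnvelopingAlgebra.ι K : g →ₗ⁅K⁆ Env K g).toLinearMap from h hz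
    refine iSup₂_le fun α hα z hz => ?_
    have h := C.triple ⟨α, hα⟩
    obtain ⟨c, rfl⟩ := hD.exists_smul h.ne_zero h.hx h.x_ne_zero hz
    refine Submodule.smul_mem _ c (Submodule.subset_span (Or.inl ⟨⟨α, hα⟩, ?_⟩))
    exact congrArg _ (C.tri_b hb hD (.e ⟨α, hα⟩))
  · rintro _ ⟨H, rfl⟩
    exact Submodule.subset_span (Or.inr ⟨H, rfl⟩)
  · rintro _ ⟨i, rfl⟩
    refine Submodule.subset_span (Or.inl ⟨C.x i, mem_iSup_W i.2 (C.triple i).hx, ?_⟩)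
    exact congrArg _ (C.tri_b hb hD (.e i)).symm
  · rintro _ ⟨H, rfl⟩
    exact Submodule.subset_span (Or.inr ⟨H, rfl⟩)

end

lemma isAntidominant_iff {ρ lam : Dual K S.h} :
    S.IsAntidominant ρ lam ↔ ∀ i : S.pos, ∀ k : ℕ, 0 < k → (lam + ρ) (C.t i) ≠ k := by
  constructor
  · intro h i k hk h1
    have hT := C.triple i
    exact h i i.2 (C.t i) ⟨hT.two, _, hT.hx, _, hT.hy, hT.lie.symm⟩ ⟨k, hk, h1⟩
  · rintro h α hα H ⟨h2, x, hx, y, hy, hxy⟩ ⟨k, hk, h1⟩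
    have hT : S.Triple α x y H := ⟨hx, hy, hxy.symm, h2⟩
    rw [hD.coroot_unique hT (C.triple ⟨α, hα⟩)] at h1
    exact h ⟨α, hα⟩ k hk h1

end Triples

end Setup

/-- For `lam ∈ h^*`, the Verma module `M(lam)` is simple if and only if
`lam` is antidominant. -/
theorem verma_simple_iff_antidominant
    (K : Type) [Field K] [IsAlgClosed K] [CharZero K]
    (g : Type) [LieRing g] [LieAlgebra K g] (S : Setup K g) (hDynkin : S.IsDynkin)
    (ρ : Module.Dual K S.h) (hρ : S.IsGlobalRho ρ) (lam : Module.Dual K S.h) :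
    IsSimpleModule (Env K g) (S.Verma lam) ↔ S.IsAntidominant ρ lam := by
  obtain ⟨C⟩ := hDynkin.nonempty_triples
  let hb := Module.Basis.ofVectorSpace K S.h
  obtain ⟨ht, hT⟩ := C.exists_isDynkin hb hDynkin hρ
  let _ : LinearOrder S.pos := IsWellOrder.linearOrder WellOrderingRel
  let _ : LinearOrder (Module.Basis.ofVectorSpaceIndex K S.h) :=
    IsWellOrder.linearOrder WellOrderingRel
  rw [isSimpleModule_iff_isCoatom, C.vermaIdeal_eq_vIdeal hb hDynkin, C.isAntidominant_iff hDynkin]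
  exact hT.isCoatom_vIdeal_iff lam

end Paper
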